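/- Let R be a reduced elliptic root system of rank l ≥ 2 with fundamental-set Π ∪ {a} and associated maps k, g, where the affine root system W_Π·Π is of type D_{l+1}^{(2)}, k(α) = 1 for all α ∈ Π, g(α₀) = 2ℤ+1, and g(α) = ∅ for α ∈ Π ∖ {α₀}. Let 𝔤 = 𝔤(Π,k,g,ω₁) be the elliptic Lie algebra with trivial tuning. Then for all p, z ∈ ℤ: dim 𝔤_{pδ+za} = l+1 if p ≡ 0 (mod 4) and (p,z) ≠ (0,0); dim 𝔤_{pδ+za} = 1 if p is odd; dim 𝔤_{pδ+za} = l if p ≡ 2 (mod 4) and z is even; dim 𝔤_{pδ+za} = l+1 if p ≡ 2 (mod 4) and z is odd. -/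

import Mathlib

/- ## Preliminaries: extended affine root systems (Saito) -/

noncomputable section

open Set

/-- The reflection `s_v : z ↦ z - (v^∨, z) v = z - (2 (v,z)/(v,v)) v` associated to a
bilinear form `B` and a vector `v`.  (When `B v v = 0` this is the identity, by the
`division by zero = 0` convention; reflections are only ever used at non-isotropic `v`.) -/
def srefl {V : Type*} [AddCommGroup V] [Module ℝ V]
    (B : LinearMap.BilinForm ℝ V) (v : V) : Module.End ℝ V :=
  LinearMap.id - (((2 * (B v v)⁻¹) • (B v)).smulRight v)

/-- The Weyl group `W_S` generated by the reflections in the elements of `S`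
(realized as the multiplicative closure; each generator is an involution, so this
agrees with the generated group). -/
def weyl {V : Type*} [AddCommGroup V] [Module ℝ V]
    (B : LinearMap.BilinForm ℝ V) (S : Set V) : Submonoid (Module.End ℝ V) :=
  Submonoid.closure (srefl B '' S)

/-- The orbit `W_S · α`. -/
def worbit {V : Type*} [AddCommGroup V] [Module ℝ V]
    (B : LinearMap.BilinForm ℝ V) (S : Set V) (α : V) : Set V :=
  {v | ∃ w ∈ weyl B S, w α = v}

/-- `V⁰`, the set of isotropic vectors. -/
def nullSet {V : Type*} [AddCommGroup V] [Module ℝ V]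
    (B : LinearMap.BilinForm ℝ V) : Set V := {v | B v v = 0}

/-- `ℤR`, the subgroup of `V` generated by `R`. -/
def zspan {V : Type*} [AddCommGroup V] (R : Set V) : AddSubgroup V :=
  AddSubgroup.closure R

/-- `ℤ≥0 Π`, the set of nonnegative-integer linear combinations of elements of `Π`. -/
def nnspan {V : Type*} [AddCommMonoid V] (P : Set V) : Set V :=
  (AddSubmonoid.closure P : Set V)

/-- `(R, V)` is an `n`-extended affine root system of rank `l` (K. Saito). -/
structure IsEARS {V : Type*} [AddCommGroup V] [Module ℝ V]
    (B : LinearMap.BilinForm ℝ V) (R : Set V) (l n : ℕ) : Prop where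
  rank_pos : 1 ≤ l
  findim : FiniteDimensional ℝ V
  symm : ∀ u v, B u v = B v u
  posSemidef : ∀ v, 0 ≤ B v v
  dim_eq : Module.finrank ℝ V = l + n
  null_eq : nullSet B = (LinearMap.ker B : Set V)
  dim_null : Module.finrank ℝ (LinearMap.ker B) = n
  /-- (AX1), first half -/
  root_nonisotropic : ∀ α ∈ R, B α α ≠ 0
  /-- (AX1), second half -/
  span_eq_top : Submodule.span ℝ R = ⊤
  /-- (AX2) -/
  free : Module.Free ℤ (zspan R)
  /-- (AX2) -/
  rank_eq : Module.finrank ℤ (zspan R) = l + n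
  /-- (AX3): `(α^∨, β) ∈ ℤ` -/
  integral : ∀ α ∈ R, ∀ β ∈ R, ∃ m : ℤ, 2 * B α β = (m : ℝ) * B α α
  /-- (AX4) -/
  reflect : ∀ α ∈ R, srefl B α '' R = R
  /-- (AX5) -/
  connected : ∀ S' ⊆ R, S'.Nonempty → S' ≠ R → ∃ x ∈ S', ∃ y ∈ R \ S', B x y ≠ 0

/-- `R` is reduced, i.e. `R ∩ 2R = ∅`. -/
def IsReducedRS {V : Type*} [AddCommGroup V] [Module ℝ V] (R : Set V) : Prop :=
  ∀ α ∈ R, (2 : ℤ) • α ∉ R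

/-- `Π₀` is a base (with `m` elements) of the root system `R₀`:
`Π₀ ⊆ R₀`, `Π₀` consists of `m` linearly independent elements, and
`R₀ = (R₀ ∩ ℤ≥0 Π₀) ∪ (R₀ ∩ ℤ≤0 Π₀)`. -/
def IsBaseSet {M : Type*} [AddCommGroup M] [Module ℝ M] (R₀ P₀ : Set M) (m : ℕ) : Prop :=
  P₀ ⊆ R₀ ∧ P₀.Finite ∧ P₀.ncard = m ∧
  LinearIndependent ℝ ((↑) : P₀ → M) ∧
  R₀ = (R₀ ∩ nnspan P₀) ∪ (R₀ ∩ (-(nnspan P₀)))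

/-- The bilinear form induced on a quotient `V ⧸ W` by a form vanishing on `W`. -/
def quotForm {V : Type*} [AddCommGroup V] [Module ℝ V]
    (W : Submodule ℝ V) (B : LinearMap.BilinForm ℝ V)
    (h1 : ∀ w ∈ W, B w = 0) (h2 : ∀ v : V, ∀ w ∈ W, B v w = 0) :
    LinearMap.BilinForm ℝ (V ⧸ W) :=
  Submodule.liftQ W
    { toFun := fun v => Submodule.liftQ W (B v) (fun w hw => LinearMap.mem_ker.mpr (h2 v w hw))
      map_add' := fun u v => by
        ext x
        simp
      map_smul' := fun c v => by
        ext x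
        simp }
    (fun w hw => by
      simp only [LinearMap.mem_ker]
      ext x
      simp [h1 w hw])

end

/-- A fundamental-set `Π ∪ {a}` of a reduced elliptic root system `R` of rank `l`:
(FS1) `a ∈ (ℤR)⁰` and `(ℤR)⁰ = ℤa ⊕ ℤb` for some `b`;
(FS2) `|Π| = l+1`, `Π ⊆ R` and `π_a(Π)` is a base of the affine root system `π_a(R)`. -/
def IsFundamentalSet {V : Type*} [AddCommGroup V] [Module ℝ V]
    (B : LinearMap.BilinForm ℝ V) (R : Set V) (l : ℕ) (P : Set V) (a : V) : Prop :=
  a ∈ zspan R ∧ B a a = 0 ∧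
  (∃ b : V, b ∈ zspan R ∧ B b b = 0 ∧
    ((zspan R : Set V) ∩ nullSet B = {v | ∃ m n : ℤ, v = m • a + n • b}) ∧
    (∀ m n : ℤ, m • a + n • b = 0 → m = 0 ∧ n = 0)) ∧
  P ⊆ R ∧ P.Finite ∧ P.ncard = l + 1 ∧
  IsBaseSet ((Submodule.span ℝ {a}).mkQ '' R) ((Submodule.span ℝ {a}).mkQ '' P) (l + 1)

/-- The subset `⋃_{ε=±1} ((εα + ℤ kα a) ∪ (2εα + gα·kα a))` of the plane `ℝα ⊕ ℝa`;
here `gα : Bool`, with `false` encoding `g(α) = ∅` and `true` encoding `g(α) = 2ℤ+1`. -/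
def kgLine {V : Type*} [AddCommGroup V] (a α : V) (kα : ℕ) (gα : Bool) : Set V :=
  {v | ∃ ε m : ℤ, (ε = 1 ∨ ε = -1) ∧ v = ε • α + (m * kα) • a} ∪
  {v | gα = true ∧ ∃ ε m : ℤ, (ε = 1 ∨ ε = -1) ∧ Odd m ∧ v = (2 * ε) • α + (m * kα) • a}

/-- `k : Π → ℕ` and `g : Π → {∅, 2ℤ+1}` are the maps associated to the fundamental-set
`Π ∪ {a}`, i.e. `R ∩ (ℝα ⊕ ℝa) = ⋃_{ε=±1} ((εα + ℤ k(α) a) ∪ (2εα + g(α)k(α)a))`. -/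
def IsKG {V : Type*} [AddCommGroup V] [Module ℝ V]
    (R : Set V) (a : V) (P : Set V) (k : V → ℕ) (g : V → Bool) : Prop :=
  ∀ α ∈ P, 0 < k α ∧
    R ∩ (Submodule.span ℝ {α, a} : Set V) = kgLine a α (k α) (g α)

/-- `c(α) = 1` if `g(α) = ∅`, `c(α) = 2` if `g(α) = 2ℤ+1`. -/
def cMap {V : Type*} (g : V → Bool) (α : V) : ℕ := if g α then 2 else 1

/-- `α* := c(α)·α + k(α)·a`. -/
def starMap {V : Type*} [AddCommGroup V] (a : V) (k : V → ℕ) (g : V → Bool) (α : V) : V :=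
  (cMap g α : ℤ) • α + (k α : ℤ) • a

/-- `B₊ := {α, α* | α ∈ Π}`. -/
def bplus {V : Type*} [AddCommGroup V] (a : V) (P : Set V) (k : V → ℕ) (g : V → Bool) :
    Set V :=
  P ∪ (starMap a k g '' P)

/-- `B := B₊ ∪ (−B₊)`. -/
def bfull {V : Type*} [AddCommGroup V] (a : V) (P : Set V) (k : V → ℕ) (g : V → Bool) :
    Set V :=
  bplus a P k g ∪ (-(bplus a P k g))

/-- The set `R(Π,k,g) = ⋃_{w ∈ W_Π} ⋃_{α ∈ Π} ((w(α) + ℤk(α)a) ∪ (w(2α) + g(α)k(α)a))`. -/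
def kgUnion {V : Type*} [AddCommGroup V] [Module ℝ V]
    (B : LinearMap.BilinForm ℝ V) (P : Set V) (a : V) (k : V → ℕ) (g : V → Bool) :
    Set V :=
  {v | ∃ w ∈ weyl B P, ∃ α ∈ P,
    (∃ m : ℤ, v = w α + (m * k α) • a) ∨
    (g α = true ∧ ∃ m : ℤ, Odd m ∧ v = w ((2 : ℤ) • α) + (m * k α) • a)}

noncomputable section

/-- `ω : 𝒜 → ℂ^×` is a tuning: it is nonzero on
`𝒜 = {(α,β) : (α,β^∨) = -1}` and `ω(α,β)ω(β,α) = 1` whenever also `(α^∨,β) = -1`. -/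
def IsTuning {V : Type*} [AddCommGroup V] [Module ℝ V]
    (B : LinearMap.BilinForm ℝ V) (P : Set V) (ω : V → V → ℂ) : Prop :=
  ∀ α ∈ P, ∀ β ∈ P,
    (2 * B α β = -(B β β) → ω α β ≠ 0) ∧
    (2 * B α β = -(B β β) → 2 * B α β = -(B α α) → ω α β * ω β α = 1)

/-- `δ = δ(Π)`: a positive-integer combination of the elements of `Π` with
`ℤδ = (ℤΠ)⁰`. -/
def IsDelta {V : Type*} [AddCommGroup V] [Module ℝ V]
    (B : LinearMap.BilinForm ℝ V) (P : Set V) (δ : V) : Prop :=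
  (∃ s : Finset V, (s : Set V) = P ∧
    ∃ c : V → ℕ, (∀ α ∈ s, 0 < c α) ∧ δ = ∑ α ∈ s, (c α : ℤ) • α) ∧
  (AddSubgroup.closure {δ} : Set V) = (AddSubgroup.closure P : Set V) ∩ nullSet B

end

/-- The affine root system `W_Π·Π` is of type `D_{l+1}^{(2)}`, realized (after rescaling
the form) by an enumeration `αf : Fin (l+1) → V` of `Π = {α₀, α₁, …, α_l}` with the
prescribed Gram matrix: `(α₀,α₀) = (α₁,α₁) = 1`, `(α_j,α_j) = 2` for `2 ≤ j ≤ l`,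
`(α₁,α₂) = −1`, `(α_j,α_{j+1}) = −1` for `2 ≤ j ≤ l−1`, `(α_l,α₀) = −1`, and all other
off-diagonal entries `0`. -/
def IsTypeDTwo {V : Type*} [AddCommGroup V] [Module ℝ V]
    (B : LinearMap.BilinForm ℝ V) (P : Set V) (l : ℕ) (αf : Fin (l + 1) → V) : Prop :=
  Function.Injective αf ∧ Set.range αf = P ∧
  B (αf 0) (αf 0) = 1 ∧ B (αf 1) (αf 1) = 1 ∧
  (∀ j : Fin (l + 1), 2 ≤ (j : ℕ) → B (αf j) (αf j) = 2) ∧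
  B (αf 1) (αf 2) = -1 ∧
  (∀ j : ℕ, ∀ _h2 : 2 ≤ j, ∀ _h3 : j + 1 ≤ l,
    B (αf ⟨j, by omega⟩) (αf ⟨j + 1, by omega⟩) = -1) ∧
  B (αf (Fin.last l)) (αf 0) = -1 ∧
  (∀ i j : Fin (l + 1), i ≠ j →
    ¬(({(i : ℕ), (j : ℕ)} : Finset ℕ) = {1, 2} ∨
      (∃ m : ℕ, 2 ≤ m ∧ m + 1 ≤ l ∧ ({(i : ℕ), (j : ℕ)} : Finset ℕ) = {m, m + 1}) ∨
      ({(i : ℕ), (j : ℕ)} : Finset ℕ) = {l, 0}) →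
    B (αf i) (αf j) = 0)

noncomputable section

/- ## The elliptic Lie algebra `𝔤(Π, k, g, ω)` presented by (SR1)–(SR9) -/

open TensorProduct

/-- The complexification `V^ℂ = ℂ ⊗_ℝ V`. -/
abbrev Vc (V : Type*) [AddCommGroup V] [Module ℝ V] : Type _ := ℂ ⊗[ℝ] V

/-- `v^∨ := 2v/(v,v)`. -/
def vee {V : Type*} [AddCommGroup V] [Module ℝ V]
    (B : LinearMap.BilinForm ℝ V) (v : V) : V := (2 / B v v) • v

/-- The exponent `x_{μ,ν} = 1 - ((μ^∨,ν) - |(μ^∨,ν)|)/2` (a positive integer since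
`(μ^∨,ν) ∈ ℤ`). -/
def xExp {V : Type*} [AddCommGroup V] [Module ℝ V]
    (B : LinearMap.BilinForm ℝ V) (μ ν : V) : ℕ :=
  1 + ⌈-(2 * B μ ν / B μ μ)⌉₊

/-- The type of generators of the presented elliptic Lie algebra:
`h_σ` for `σ ∈ V^ℂ` and `E_μ` for `μ ∈ B = B₊ ∪ (−B₊)`. -/
def EllGen {V : Type*} [AddCommGroup V] [Module ℝ V]
    (a : V) (P : Set V) (k : V → ℕ) (g : V → Bool) : Type _ :=
  Vc V ⊕ ↥(bfull a P k g)

/-- The generator `h_σ` inside the free Lie algebra. -/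
def hFree {V : Type*} [AddCommGroup V] [Module ℝ V]
    (a : V) (P : Set V) (k : V → ℕ) (g : V → Bool) (σ : Vc V) :
    FreeLieAlgebra ℂ (EllGen a P k g) :=
  FreeLieAlgebra.of ℂ (Sum.inl σ)

open scoped Classical in
/-- The generator `E_μ` inside the free Lie algebra (`0` if `μ ∉ B`; the relations only
ever use it at points of `B`). -/
def eFree {V : Type*} [AddCommGroup V] [Module ℝ V]
    (a : V) (P : Set V) (k : V → ℕ) (g : V → Bool) (μ : V) :
    FreeLieAlgebra ℂ (EllGen a P k g) :=
  if h : μ ∈ bfull a P k g then FreeLieAlgebra.of ℂ (Sum.inr ⟨μ, h⟩) else 0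

/-- The relations (SR1)–(SR9) of Definition 5.2, as elements of the free Lie algebra. -/
def ellRels {V : Type*} [AddCommGroup V] [Module ℝ V]
    (B : LinearMap.BilinForm ℝ V) (a : V) (P : Set V) (k : V → ℕ) (g : V → Bool)
    (ω : V → V → ℂ) : Set (FreeLieAlgebra ℂ (EllGen a P k g)) :=
  -- (SR1)
  {z | ∃ (x y : ℂ) (σ τ : Vc V),
    z = x • hFree a P k g σ + y • hFree a P k g τ - hFree a P k g (x • σ + y • τ)} ∪
  -- (SR2)
  {z | ∃ σ τ : Vc V, z = ⁅hFree a P k g σ, hFree a P k g τ⁆} ∪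
  -- (SR3)
  {z | ∃ σ : Vc V, ∃ μ ∈ bfull a P k g,
    z = ⁅hFree a P k g σ, eFree a P k g μ⁆
      - (LinearMap.BilinForm.baseChange ℂ B σ ((1 : ℂ) ⊗ₜ[ℝ] μ)) • eFree a P k g μ} ∪
  -- (SR4)
  {z | ∃ μ ∈ bplus a P k g,
    z = ⁅eFree a P k g μ, eFree a P k g (-μ)⁆
      - hFree a P k g ((1 : ℂ) ⊗ₜ[ℝ] vee B μ)} ∪
  -- (SR5)
  {z | ∃ μ ∈ bfull a P k g, ∃ ν ∈ bfull a P k g, μ ≠ ν ∧ ν ≠ -μ ∧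
    z = ((LieAlgebra.ad ℂ _ (eFree a P k g μ)) ^ xExp B μ ν) (eFree a P k g ν)} ∪
  -- (SR6)
  {z | ∃ α ∈ P, ∃ β ∈ P, 2 * B α β = -(B β β) ∧
    z = (cMap g α : ℂ) •
          ((LieAlgebra.ad ℂ _ (eFree a P k g (starMap a k g α))) ^ (k β / k α))
            (eFree a P k g β)
      - ω α β •
          ((LieAlgebra.ad ℂ _ (eFree a P k g α)) ^ (cMap g α * (k β / k α)))
            (eFree a P k g (starMap a k g β))} ∪
  -- (SR7)
  {z | ∃ α ∈ P, ∃ β ∈ P, 2 * B α β = -(B β β) ∧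
    z = ((-1 : ℂ) ^ (cMap g α + 1) * (cMap g α : ℂ)) •
          ((LieAlgebra.ad ℂ _ (eFree a P k g (-(starMap a k g α)))) ^ (k β / k α))
            (eFree a P k g (-β))
      - (ω α β)⁻¹ •
          ((LieAlgebra.ad ℂ _ (eFree a P k g (-α))) ^ (cMap g α * (k β / k α)))
            (eFree a P k g (-(starMap a k g β)))} ∪
  -- (SR8)
  {z | ∃ α ∈ P, ∃ β ∈ P, 2 * B α β = -(B β β) ∧ ∃ i : ℕ, 1 ≤ i ∧ i ≤ k β / k α - 1 ∧
    z = ((LieAlgebra.ad ℂ _ (eFree a P k g α)) ^ i)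
          (((LieAlgebra.ad ℂ _ (eFree a P k g (starMap a k g α))) ^ (k β / k α - i))
            (eFree a P k g β))} ∪
  -- (SR9)
  {z | ∃ α ∈ P, ∃ β ∈ P, 2 * B α β = -(B β β) ∧ ∃ i : ℕ, 1 ≤ i ∧ i ≤ k β / k α - 1 ∧
    z = ((LieAlgebra.ad ℂ _ (eFree a P k g (-α))) ^ i)
          (((LieAlgebra.ad ℂ _ (eFree a P k g (-(starMap a k g α)))) ^ (k β / k α - i))
            (eFree a P k g (-β)))}

/-- The Lie ideal generated by the relations (SR1)–(SR9). -/
def ellIdeal {V : Type*} [AddCommGroup V] [Module ℝ V]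
    (B : LinearMap.BilinForm ℝ V) (a : V) (P : Set V) (k : V → ℕ) (g : V → Bool)
    (ω : V → V → ℂ) : LieIdeal ℂ (FreeLieAlgebra ℂ (EllGen a P k g)) :=
  LieSubmodule.lieSpan ℂ _ (ellRels B a P k g ω)

/-- The elliptic Lie algebra `𝔤(Π,k,g,ω)`, presented by generators and the relations
(SR1)–(SR9). -/
abbrev EllipticLieAlg {V : Type*} [AddCommGroup V] [Module ℝ V]
    (B : LinearMap.BilinForm ℝ V) (a : V) (P : Set V) (k : V → ℕ) (g : V → Bool)
    (ω : V → V → ℂ) : Type _ :=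
  FreeLieAlgebra ℂ (EllGen a P k g) ⧸ ellIdeal B a P k g ω

/-- The element `h_σ` of the elliptic Lie algebra. -/
def hbar {V : Type*} [AddCommGroup V] [Module ℝ V]
    (B : LinearMap.BilinForm ℝ V) (a : V) (P : Set V) (k : V → ℕ) (g : V → Bool)
    (ω : V → V → ℂ) (σ : Vc V) : EllipticLieAlg B a P k g ω :=
  LieSubmodule.Quotient.mk (N := ellIdeal B a P k g ω) (hFree a P k g σ)

/-- The element `E_μ` of the elliptic Lie algebra. -/
def ebar {V : Type*} [AddCommGroup V] [Module ℝ V]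
    (B : LinearMap.BilinForm ℝ V) (a : V) (P : Set V) (k : V → ℕ) (g : V → Bool)
    (ω : V → V → ℂ) (μ : V) : EllipticLieAlg B a P k g ω :=
  LieSubmodule.Quotient.mk (N := ellIdeal B a P k g ω) (eFree a P k g μ)

open scoped Classical in
/-- `gr` is the `ℤR`-grading `𝔤 = ⊕_{σ ∈ ℤR} 𝔤_σ` of the elliptic Lie algebra
(indexed by `V`, supported on `ℤR`), with `E_μ ∈ 𝔤_μ` and `h_σ ∈ 𝔤_0`. -/
def IsEllGrading {V : Type*} [AddCommGroup V] [Module ℝ V]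
    (B : LinearMap.BilinForm ℝ V) (R : Set V) (a : V) (P : Set V) (k : V → ℕ)
    (g : V → Bool) (ω : V → V → ℂ)
    (gr : V → Submodule ℂ (EllipticLieAlg B a P k g ω)) : Prop :=
  DirectSum.IsInternal gr ∧
  (∀ σ τ : V, ∀ x ∈ gr σ, ∀ y ∈ gr τ, ⁅x, y⁆ ∈ gr (σ + τ)) ∧
  (∀ σ : V, gr σ ≠ ⊥ → σ ∈ zspan R) ∧
  (∀ σ : Vc V, hbar B a P k g ω σ ∈ gr 0) ∧
  (∀ μ ∈ bfull a P k g, ebar B a P k g ω μ ∈ gr μ)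

end

set_option linter.all false

namespace Ell
noncomputable section
open LieAlgebra

section sl2
variable {L : Type*} [LieRing L] [LieAlgebra ℂ L]

lemma sl2_comm {e f h v : L} (hef : ⁅e, f⁆ = h) (hhf : ⁅h, f⁆ = (-2 : ℂ) • f) {n : ℂ}
    (hv : ⁅h, v⁆ = n • v) (k : ℕ) :
    ⁅h, (ad ℂ L f ^ k) v⁆ = (n - 2 * k) • (ad ℂ L f ^ k) v ∧
    ⁅e, (ad ℂ L f ^ (k + 1)) v⁆ = (ad ℂ L f ^ (k + 1)) ⁅e, v⁆
      + ((k + 1) * (n - k)) • (ad ℂ L f ^ k) v := by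
  have hw : ∀ k : ℕ, ⁅h, (ad ℂ L f ^ k) v⁆ = (n - 2 * k) • (ad ℂ L f ^ k) v := by
    intro k
    induction k with
    | zero => simp [hv]
    | succ k ih =>
      rw [pow_succ', Module.End.mul_apply, ad_apply, leibniz_lie, hhf, ih, smul_lie, lie_smul,
        ← add_smul]
      push_cast; congr 1; ring
  refine ⟨hw k, ?_⟩
  induction k with
  | zero => simp [leibniz_lie e f v, hef, hv, add_comm]
  | succ k ih =>
    rw [pow_succ' _ (k + 1), Module.End.mul_apply, ad_apply, leibniz_lie, hef, ih, lie_add,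
      lie_smul, hw (k + 1)]
    rw [Module.End.mul_apply, ad_apply]
    have : ⁅f, (ad ℂ L f ^ k) v⁆ = (ad ℂ L f ^ (k + 1)) v := by
      rw [pow_succ', Module.End.mul_apply, ad_apply]
    rw [this]
    push_cast
    module

lemma sl2_A {e f h : L} (hef : ⁅e, f⁆ = h) (hhe : ⁅h, e⁆ = (2 : ℂ) • e)
    (hhf : ⁅h, f⁆ = (-2 : ℂ) • f) (m : ℕ) : ∀ (n : ℕ) (v : L), 1 ≤ n →
    ⁅h, v⁆ = (n : ℂ) • v → (ad ℂ L f ^ n) v = 0 → (ad ℂ L e ^ m) v = 0 → v = 0 := by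
  induction m with
  | zero => intro n v _ _ _ h; simpa using h
  | succ m ih =>
    intro n v hn hv hf hm
    have hf1 : (ad ℂ L f ^ (n + 1)) v = 0 := by
      rw [pow_succ', Module.End.mul_apply, hf, map_zero]
    have hf2 : (ad ℂ L f ^ (n + 2)) v = 0 := by
      rw [pow_succ', Module.End.mul_apply, hf1, map_zero]
    have he : ⁅e, v⁆ = 0 := by
      apply ih (n + 2) ⁅e, v⁆ (by omega)
      · rw [leibniz_lie, hhe, hv, smul_lie, lie_smul, ← add_smul]; push_cast; congr 1; ring
      · have := (sl2_comm hef hhf hv (n + 1)).2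
        rw [hf2, hf1] at this
        simpa using this.symm
      · simpa [pow_succ] using hm
    have : ∀ j ≤ n, (ad ℂ L f ^ (n - j)) v = 0 := by
      intro j
      induction j with
      | zero => simpa using hf
      | succ j ihj =>
        intro hj
        have h1 := (sl2_comm hef hhf hv (n - (j + 1))).2
        rw [show n - (j + 1) + 1 = n - j by omega, ihj (by omega), he] at h1
        simp only [map_zero, lie_zero, zero_add] at h1
        have h2 : (((n - (j + 1) : ℕ) : ℂ) + 1) * ((n : ℂ) - (n - (j + 1) : ℕ)) ≠ 0 := by
          apply mul_ne_zero
          · exact Nat.cast_add_one_ne_zero _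
          · rw [sub_ne_zero]; intro h; have : n = n - (j + 1) := by exact_mod_cast h
            omega
        exact (smul_eq_zero.mp h1.symm).resolve_left h2
    simpa using this n le_rfl

lemma sl2_C {e f h v : L} (hef : ⁅e, f⁆ = h)
    (hhf : ⁅h, f⁆ = (-2 : ℂ) • f) (n : ℕ)
    (hv : ⁅h, v⁆ = (n : ℂ) • v) (he : ⁅e, v⁆ = 0) (hN : ∃ N, (ad ℂ L f ^ N) v = 0) :
    (ad ℂ L f ^ (n + 1)) v = 0 := by
  classical
  have h0 := Nat.find_spec hN
  have hmin := fun k => Nat.find_min hN (m := k)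
  set N := Nat.find hN
  rcases hN' : N with _ | k
  · rw [hN'] at h0
    have : v = 0 := by simpa using h0
    simp [this]
  · have h1 := (sl2_comm hef hhf hv k).2
    rw [hN'] at h0
    rw [h0, he] at h1
    simp only [map_zero, lie_zero, zero_add] at h1
    rcases smul_eq_zero.mp h1.symm with h2 | h2
    · rcases mul_eq_zero.mp h2 with h3 | h3
      · exact absurd h3 (Nat.cast_add_one_ne_zero _)
      · have : n = k := by exact_mod_cast sub_eq_zero.mp h3
        rw [this]; exact h0
    · exact absurd h2 (hmin k (by omega))

end sl2

/-- coordinate vector -/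
abbrev sg (t : ℕ) (m : ℤ) : ℕ → ℤ := Pi.single t m

/-- pairing with the coroot of node `t` -/
def pr (l t : ℕ) (n : ℕ → ℤ) : ℤ :=
  if t = 0 then 2 * n 0 - 2 * n 1
  else if t = l then 2 * n l - 2 * n (l - 1)
  else 2 * n t - n (t - 1) - n (t + 1)

def prs (l t : ℕ) (n : ℕ → ℤ) : ℤ :=
  if t = l then n l - n (l - 1) else pr l t n

lemma pr_add (l t : ℕ) (n m : ℕ → ℤ) : pr l t (n + m) = pr l t n + pr l t m := by
  unfold pr; split_ifs <;> simp <;> ring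
lemma pr_neg (l t : ℕ) (n : ℕ → ℤ) : pr l t (-n) = -pr l t n := by
  unfold pr; split_ifs <;> simp <;> ring
lemma prs_neg (l t : ℕ) (n : ℕ → ℤ) : prs l t (-n) = -prs l t n := by
  unfold prs; split_ifs <;> simp [pr_neg]; ring
lemma prs_add (l t : ℕ) (n m : ℕ → ℤ) : prs l t (n + m) = prs l t n + prs l t m := by
  unfold prs; split_ifs <;> simp [pr_add]; ring

/-- degree of the starred generator -/
def stc (l t : ℕ) : ℤ := if t = l then 2 else 1

structure Sys (l : ℕ) (L : Type*) [LieRing L] [LieAlgebra ℂ L] where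
  hl : 2 ≤ l
  e : ℕ → L
  f : ℕ → L
  es : ℕ → L
  fs : ℕ → L
  h : ℕ → L
  hs : ℕ → L
  Hs : Set L
  Gr : (ℕ → ℤ) → ℤ → Submodule ℂ L
  indep : iSupIndep (fun p : (ℕ → ℤ) × ℤ => Gr p.1 p.2)
  top : ⨆ p : (ℕ → ℤ) × ℤ, Gr p.1 p.2 = ⊤
  mul : ∀ n z m y u v, u ∈ Gr n z → v ∈ Gr m y → ⁅u, v⁆ ∈ Gr (n + m) (z + y)
  he : ∀ t ≤ l, e t ∈ Gr (sg t 1) 0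
  hf : ∀ t ≤ l, f t ∈ Gr (sg t (-1)) 0
  hes : ∀ t ≤ l, es t ∈ Gr (sg t (stc l t)) 1
  hfs : ∀ t ≤ l, fs t ∈ Gr (sg t (-stc l t)) (-1)
  wt : ∀ t ≤ l, ∀ n z, ∀ v ∈ Gr n z, ⁅h t, v⁆ = (pr l t n : ℂ) • v
  wts : ∀ t ≤ l, ∀ n z, ∀ v ∈ Gr n z, ⁅hs t, v⁆ = (prs l t n : ℂ) • v
  wtH : ∀ u ∈ Hs, ∀ n z, ∃ c : ℂ, ∀ v ∈ Gr n z, ⁅u, v⁆ = c • v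
  H0 : ∀ u ∈ Hs, u ∈ Gr 0 0
  ef : ∀ t ≤ l, ⁅e t, f t⁆ = h t
  esfs : ∀ t ≤ l, ⁅es t, fs t⁆ = hs t
  ees : ∀ t ≤ l, ⁅e t, es t⁆ = 0
  ffs : ∀ t ≤ l, ⁅f t, fs t⁆ = 0
  cross : ∀ t ≤ l, ∀ u ≤ l, t ≠ u → ⁅e t, f u⁆ = 0 ∧ ⁅e t, fs u⁆ = 0 ∧ ⁅es t, f u⁆ = 0 ∧
    ⁅es t, fs u⁆ = 0
  far : ∀ t ≤ l, ∀ u ≤ l, t + 1 < u → ⁅e t, e u⁆ = 0 ∧ ⁅e t, es u⁆ = 0 ∧ ⁅es t, e u⁆ = 0 ∧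
    ⁅f t, f u⁆ = 0 ∧ ⁅f t, fs u⁆ = 0 ∧ ⁅fs t, f u⁆ = 0
  sr6 : ∀ t, t + 1 < l → ⁅es t, e (t + 1)⁆ = ⁅e t, es (t + 1)⁆
  sr7 : ∀ t, t + 1 < l → ⁅fs t, f (t + 1)⁆ = ⁅f t, fs (t + 1)⁆
  sr6l : (2 : ℂ) • ⁅es l, e (l - 1)⁆ = ⁅e l, ⁅e l, es (l - 1)⁆⁆
  sr7l : (-2 : ℂ) • ⁅fs l, f (l - 1)⁆ = ⁅f l, ⁅f l, fs (l - 1)⁆⁆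
  nile : ∀ t ≤ l, ∀ v, ∃ n, (ad ℂ L (e t) ^ n) v = 0
  nilf : ∀ t ≤ l, ∀ v, ∃ n, (ad ℂ L (f t) ^ n) v = 0
  niles : ∀ t ≤ l, ∀ v, ∃ n, (ad ℂ L (es t) ^ n) v = 0
  nilfs : ∀ t ≤ l, ∀ v, ∃ n, (ad ℂ L (fs t) ^ n) v = 0
  gen : ∀ A : LieSubalgebra ℂ L, Hs ⊆ A → (∀ t ≤ l, e t ∈ A ∧ f t ∈ A ∧ es t ∈ A ∧ fs t ∈ A) →
    A = ⊤

namespace Sys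
variable {l : ℕ} {L : Type*} [LieRing L] [LieAlgebra ℂ L] (S : Sys l L)

/-- sign used in duality at the last node -/
def sgn (l t : ℕ) : ℂ := if t = l then -1 else 1

lemma sgn_sq (l t : ℕ) : sgn l t * sgn l t = 1 := by unfold sgn; split_ifs <;> norm_num
lemma sgn_ne (l t : ℕ) : sgn l t ≠ 0 := by unfold sgn; split_ifs <;> norm_num
lemma sgn_l (l : ℕ) : sgn l l = -1 := by simp [sgn]
lemma sgn_lt {l t : ℕ} (h : t < l) : sgn l t = 1 := by simp [sgn, h.ne]

lemma mem_smul_iff' {A : LieSubalgebra ℂ L} {c : ℂ} (hc : c ≠ 0) {x : L} (h : c • x ∈ A) : x ∈ A := by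
  have := A.smul_mem c⁻¹ h
  rwa [smul_smul, inv_mul_cancel₀ hc, one_smul] at this

lemma nil_smul {x : L} (c : ℂ) {v : L} (h : ∃ n, (ad ℂ L x ^ n) v = 0) :
    ∃ n, (ad ℂ L (c • x) ^ n) v = 0 := by
  obtain ⟨n, hn⟩ := h
  refine ⟨n, ?_⟩
  rw [map_smul, smul_pow]; simp [hn]

def dual : Sys l L where
  hl := S.hl
  e := S.f
  f := S.e
  es t := sgn l t • S.fs t
  fs t := sgn l t • S.es t
  h t := - S.h t
  hs t := - S.hs t
  Hs := S.Hs
  Gr n z := S.Gr (-n) (-z)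
  indep := by
    have := S.indep.comp (f := fun p : (ℕ → ℤ) × ℤ => (-p.1, -p.2)) (by
      rintro ⟨a, b⟩ ⟨c, d⟩ h; simpa using h)
    exact this
  top := by
    rw [← S.top]
    exact Equiv.iSup_comp (g := fun p : (ℕ → ℤ) × ℤ => S.Gr p.1 p.2) (Equiv.neg ((ℕ → ℤ) × ℤ))
  mul n z m y u v hu hv := by
    have := S.mul _ _ _ _ _ _ hu hv
    rwa [neg_add, neg_add]
  he t ht := by rw [← Pi.single_neg, neg_zero]; exact S.hf t ht
  hf t ht := by rw [← Pi.single_neg, neg_zero]; simpa using S.he t ht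
  hes t ht := by rw [← Pi.single_neg]; exact Submodule.smul_mem _ _ (S.hfs t ht)
  hfs t ht := by rw [← Pi.single_neg, neg_neg, neg_neg]; exact Submodule.smul_mem _ _ (S.hes t ht)
  wt t ht n z v hv := by rw [neg_lie, S.wt t ht _ _ v hv, pr_neg]; push_cast; module
  wts t ht n z v hv := by rw [neg_lie, S.wts t ht _ _ v hv, prs_neg]; push_cast; module
  wtH u hu n z := S.wtH u hu _ _
  H0 u hu := by simpa using S.H0 u hu
  ef t ht := by rw [← lie_skew, S.ef t ht]
  esfs t ht := by
    rw [smul_lie, lie_smul, smul_smul, sgn_sq, ← lie_skew, S.esfs t ht, one_smul]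
  ees t ht := by rw [lie_smul, S.ffs t ht, smul_zero]
  ffs t ht := by rw [lie_smul, S.ees t ht, smul_zero]
  cross t ht u hu htu := by
    obtain ⟨h1, h2, h3, h4⟩ := S.cross u hu t ht htu.symm
    refine ⟨?_, ?_, ?_, ?_⟩
    · rw [← lie_skew, h1, neg_zero]
    · rw [lie_smul, ← lie_skew, h3]; simp
    · rw [smul_lie, ← lie_skew, h2]; simp
    · rw [smul_lie, lie_smul, ← lie_skew, h4]; simp
  far t ht u hu htu := by
    obtain ⟨h1, h2, h3, h4, h5, h6⟩ := S.far t ht u hu htu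
    simp [h1, h2, h3, h4, h5, h6]
  sr6 t ht := by
    rw [sgn_lt ht, sgn_lt (show t < l by omega), one_smul, one_smul, S.sr7 t ht]
  sr7 t ht := by
    rw [sgn_lt ht, sgn_lt (show t < l by omega), one_smul, one_smul, S.sr6 t ht]
  sr6l := by
    have := S.hl
    rw [sgn_l, sgn_lt (show l - 1 < l by omega), one_smul, ← S.sr7l, smul_lie]; module
  sr7l := by
    have := S.hl
    rw [sgn_l, sgn_lt (show l - 1 < l by omega), one_smul, ← S.sr6l, smul_lie]; module
  nile := S.nilf
  nilf := S.nile
  niles t ht v := nil_smul _ (S.nilfs t ht v)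
  nilfs t ht v := nil_smul _ (S.niles t ht v)
  gen A hH hA := by
    apply S.gen A hH
    intro t ht
    obtain ⟨h1, h2, h3, h4⟩ := hA t ht
    exact ⟨h2, h1, mem_smul_iff' (sgn_ne l t) h4, mem_smul_iff' (sgn_ne l t) h3⟩

/-- elements of trivial weight are central -/
lemma central_of {c : L} (hc : ∀ n z, ∀ v ∈ S.Gr n z, ⁅c, v⁆ = 0) (v : L) : ⁅c, v⁆ = 0 := by
  have : (⊤ : Submodule ℂ L) ≤ LinearMap.ker (ad ℂ L c) := by
    rw [← S.top]
    refine iSup_le fun p v hv => ?_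
    simpa using hc _ _ v hv
  simpa using this (Submodule.mem_top (x := v))

end Sys
end
end Ell

namespace Ell
noncomputable section
open LieAlgebra
namespace Sys
variable {l : ℕ} {L : Type*} [LieRing L] [LieAlgebra ℂ L] (S : Sys l L)

def x1 (t : ℕ) : L := if t = l then ⁅S.f t, S.es t⁆ else S.es t
def ym (t : ℕ) : L := if t = l then ⁅S.fs t, S.e t⁆ else S.fs t
def T (t : ℕ) : L := ⁅S.x1 t, S.f t⁆
def Tm (t : ℕ) : L := ⁅S.e t, S.ym t⁆

end Sys
def kap (l t : ℕ) : ℂ := if t = l then 6 else 2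
def KK (l t u : ℕ) : ℂ := if t = u then kap l t else (pr l t (sg u 1) : ℂ)
lemma kap_ne (l t : ℕ) : kap l t ≠ 0 := by unfold kap; split_ifs <;> norm_num
namespace Sys
variable {l : ℕ} {L : Type*} [LieRing L] [LieAlgebra ℂ L] (S : Sys l L)

lemma dual_x1 (t : ℕ) : S.dual.x1 t = S.ym t := by
  unfold x1 ym
  split_ifs with h
  · simp [dual, sgn, h]
  · simp [dual, sgn, h]
lemma dual_ym (t : ℕ) : S.dual.ym t = S.x1 t := by
  unfold x1 ym
  split_ifs with h
  · simp [dual, sgn, h]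
  · simp [dual, sgn, h]
lemma dual_T (t : ℕ) : S.dual.T t = - S.Tm t := by
  unfold T Tm; rw [dual_x1, lie_skew]; rfl
lemma dual_Tm (t : ℕ) : S.dual.Tm t = - S.T t := by
  unfold T Tm; rw [dual_ym, lie_skew]; rfl

lemma pr_self {l : ℕ} (hl : 2 ≤ l) {t : ℕ} (_ht : t ≤ l) (m : ℤ) : pr l t (sg t m) = 2 * m := by
  unfold pr
  split_ifs with h1 h2
  · subst h1; simp
  · subst h2; simp [Pi.single_apply, show t - 1 ≠ t by omega]
  · simp [Pi.single_apply, show t - 1 ≠ t by omega]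
lemma prs_self_l {l : ℕ} (hl : 2 ≤ l) (m : ℤ) : prs l l (sg l m) = m := by
  unfold prs
  simp [Pi.single_apply, show l - 1 ≠ l by omega]
lemma prs_lt {l t : ℕ} (h : t < l) (n) : prs l t n = pr l t n := by
  unfold prs; simp [h.ne]
lemma pr_l_l1 {l : ℕ} (hl : 2 ≤ l) (m : ℤ) : pr l l (sg (l-1) m) = -2 * m := by
  unfold pr
  rw [if_neg (by omega), if_pos rfl]
  simp [Pi.single_apply, show l ≠ l - 1 by omega]
lemma prs_l_l1 {l : ℕ} (hl : 2 ≤ l) (m : ℤ) : prs l l (sg (l-1) m) = - m := by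
  unfold prs
  rw [if_pos rfl]
  simp [Pi.single_apply, show l ≠ l - 1 by omega]
lemma pr_l1_l {l : ℕ} (hl : 2 ≤ l) (m : ℤ) : pr l (l-1) (sg l m) = - m := by
  unfold pr
  rw [if_neg (by omega), if_neg (by omega)]
  simp [Pi.single_apply, show l - 1 ≠ l by omega, show l - 1 + 1 = l by omega,
    show l - 1 - 1 ≠ l by omega]
lemma pr_far {l t u : ℕ} (_ht : t ≤ l) (_hu : u ≤ l) (hl : 2 ≤ l) (h : t + 1 < u ∨ u + 1 < t) (m : ℤ) :
    pr l t (sg u m) = 0 := by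
  unfold pr
  split_ifs with h1 h2
  · simp [Pi.single_apply, show 0 ≠ u by omega, show 1 ≠ u by omega]
  · simp [Pi.single_apply, show l ≠ u by omega, show l - 1 ≠ u by omega]
  · simp [Pi.single_apply, show t ≠ u by omega, show t - 1 ≠ u by omega,
      show t + 1 ≠ u by omega]

/-- same-node relations -/
lemma he2 {t : ℕ} (ht : t ≤ l) : ⁅S.h t, S.e t⁆ = (2 : ℂ) • S.e t := by
  rw [S.wt t ht _ _ _ (S.he t ht), pr_self S.hl ht]; norm_num
lemma hf2 {t : ℕ} (ht : t ≤ l) : ⁅S.h t, S.f t⁆ = (-2 : ℂ) • S.f t := by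
  rw [S.wt t ht _ _ _ (S.hf t ht), pr_self S.hl ht]; norm_num
lemma hes2 {t : ℕ} (ht : t ≤ l) : ⁅S.hs t, S.es t⁆ = (2 : ℂ) • S.es t := by
  rw [S.wts t ht _ _ _ (S.hes t ht)]
  rcases eq_or_ne t l with rfl | h
  · rw [prs_self_l S.hl]; simp [stc]
  · rw [prs_lt (by omega), pr_self S.hl ht]; simp [stc, h]
lemma hfs2 {t : ℕ} (ht : t ≤ l) : ⁅S.hs t, S.fs t⁆ = (-2 : ℂ) • S.fs t := by
  rw [S.wts t ht _ _ _ (S.hfs t ht)]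
  rcases eq_or_ne t l with rfl | h
  · rw [prs_self_l S.hl]; simp [stc]
  · rw [prs_lt (by omega), pr_self S.hl ht]; simp [stc, h]

lemma lemA {t : ℕ} (ht : t ≤ l) (n : ℕ) (hn : 1 ≤ n) (v : L)
    (hv : ⁅S.h t, v⁆ = (n : ℂ) • v) (h : (ad ℂ L (S.f t) ^ n) v = 0) : v = 0 := by
  obtain ⟨m, hm⟩ := S.nile t ht v
  exact sl2_A (S.ef t ht) (S.he2 ht) (S.hf2 ht) m n v hn hv h hm
lemma lemAs {t : ℕ} (ht : t ≤ l) (n : ℕ) (hn : 1 ≤ n) (v : L)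
    (hv : ⁅S.hs t, v⁆ = (n : ℂ) • v) (h : (ad ℂ L (S.fs t) ^ n) v = 0) : v = 0 := by
  obtain ⟨m, hm⟩ := S.niles t ht v
  exact sl2_A (S.esfs t ht) (S.hes2 ht) (S.hfs2 ht) m n v hn hv h hm
lemma lemC {t : ℕ} (ht : t ≤ l) (n : ℕ) (v : L)
    (hv : ⁅S.h t, v⁆ = (n : ℂ) • v) (h : ⁅S.e t, v⁆ = 0) : (ad ℂ L (S.f t) ^ (n + 1)) v = 0 :=
  sl2_C (S.ef t ht) (S.hf2 ht) n hv h (S.nilf t ht v)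
lemma lemCs {t : ℕ} (ht : t ≤ l) (n : ℕ) (v : L)
    (hv : ⁅S.hs t, v⁆ = (n : ℂ) • v) (h : ⁅S.es t, v⁆ = 0) : (ad ℂ L (S.fs t) ^ (n + 1)) v = 0 :=
  sl2_C (S.esfs t ht) (S.hfs2 ht) n hv h (S.nilfs t ht v)

lemma pr_zero (l t : ℕ) : pr l t 0 = 0 := by simp [pr]
lemma prs_zero (l t : ℕ) : prs l t 0 = 0 := by simp [prs, pr_zero]

/-- degree zero vectors killed by e are killed by f, etc. -/
lemma kill_f {t : ℕ} (ht : t ≤ l) {v : L} {z : ℤ} (hv : v ∈ S.Gr 0 z) (h : ⁅S.e t, v⁆ = 0) :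
    ⁅S.f t, v⁆ = 0 := by
  have := S.lemC ht 0 v (by rw [S.wt t ht _ _ _ hv, pr_zero]; simp) h
  simpa using this
lemma kill_es {t : ℕ} (ht : t ≤ l) {v : L} {z : ℤ} (hv : v ∈ S.Gr 0 z) (h : ⁅S.fs t, v⁆ = 0) :
    ⁅S.es t, v⁆ = 0 := by
  have := S.dual.lemCs ht 0 v (by
    rw [S.dual.wts t ht 0 (-z) v (by simpa [dual] using hv), prs_zero]; simp) (by
      change ⁅sgn l t • S.fs t, v⁆ = 0
      rw [smul_lie, h, smul_zero])
  have h2 : ⁅sgn l t • S.es t, v⁆ = 0 := by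
    simp only [zero_add, pow_one, ad_apply] at this; exact this
  rw [smul_lie] at h2
  exact (smul_eq_zero.mp h2).resolve_left (sgn_ne l t)

lemma x1_mem {t : ℕ} (ht : t ≤ l) : S.x1 t ∈ S.Gr (sg t 1) 1 := by
  unfold x1
  split_ifs with h
  · have := S.mul _ _ _ _ _ _ (S.hf t ht) (S.hes t ht)
    rwa [← Pi.single_add, stc, if_pos h, zero_add] at this
  · have := S.hes t ht
    rwa [stc, if_neg h] at this
lemma ym_mem {t : ℕ} (ht : t ≤ l) : S.ym t ∈ S.Gr (sg t (-1)) (-1) := by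
  have := S.dual.x1_mem ht
  rw [dual_x1] at this
  have e : sg t (-1) = - sg t 1 := Pi.single_neg _ _
  rw [e]; exact this
lemma T_mem {t : ℕ} (ht : t ≤ l) : S.T t ∈ S.Gr 0 1 := by
  have := S.mul _ _ _ _ _ _ (S.x1_mem ht) (S.hf t ht)
  rw [← Pi.single_add] at this
  simpa [T] using this
lemma Tm_mem {t : ℕ} (ht : t ≤ l) : S.Tm t ∈ S.Gr 0 (-1) := by
  have := S.mul _ _ _ _ _ _ (S.he t ht) (S.ym_mem ht)
  rw [← Pi.single_add] at this
  simpa [Tm] using this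

/-- last-node auxiliary computations -/
lemma e_x1_l : ⁅S.e l, S.x1 l⁆ = (4 : ℂ) • S.es l := by
  have ht := le_refl l
  simp only [x1, if_true]
  rw [leibniz_lie, S.ef l ht, S.ees l ht, lie_zero, add_zero, S.wt l ht _ _ _ (S.hes l ht),
    pr_self S.hl ht]
  norm_num [stc]
lemma hsf_l : ⁅S.hs l, S.f l⁆ = - S.f l := by
  rw [S.wts l le_rfl _ _ _ (S.hf l le_rfl), prs_self_l S.hl]; simp
lemma hse_l : ⁅S.hs l, S.e l⁆ = S.e l := by
  rw [S.wts l le_rfl _ _ _ (S.he l le_rfl), prs_self_l S.hl]; simp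
lemma fs_x1_l : ⁅S.fs l, S.x1 l⁆ = - S.f l := by
  have ht := le_refl l
  simp only [x1, if_true]
  rw [leibniz_lie, ← lie_skew (S.fs l) (S.f l), S.ffs l ht, neg_zero, zero_lie, zero_add,
    ← lie_skew (S.fs l), S.esfs l ht, lie_neg, lie_skew, hsf_l]
lemma ym_x1_l : ⁅S.ym l, S.x1 l⁆ = S.h l - (4 : ℂ) • S.hs l := by
  have ht := le_refl l
  have h1 : ⁅S.ym l, S.f l⁆ = (4 : ℂ) • S.fs l := by
    have := S.dual.e_x1_l
    rw [dual_x1] at this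
    change ⁅S.f l, S.ym l⁆ = (4 : ℂ) • sgn l l • S.fs l at this
    rw [← lie_skew, this, sgn_l]; module
  have h2 : ⁅S.ym l, S.es l⁆ = - S.e l := by
    have := S.dual.fs_x1_l
    rw [dual_x1] at this
    change ⁅sgn l l • S.es l, S.ym l⁆ = - S.e l at this
    rw [sgn_l, smul_lie] at this
    rw [← lie_skew, ← this]; module
  conv_lhs => rw [x1, if_pos rfl, leibniz_lie, h1, h2, smul_lie, lie_neg]
  rw [← lie_skew (S.fs l), S.esfs l ht, ← lie_skew (S.f l), S.ef l ht]; module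

lemma T_e {t : ℕ} (ht : t ≤ l) : ⁅S.T t, S.e t⁆ = kap l t • S.x1 t := by
  rw [T, lie_lie, ← lie_skew (S.f t) (S.e t), S.ef t ht, lie_neg, lie_skew,
    S.wt t ht _ _ _ (S.x1_mem ht), pr_self S.hl ht]
  rcases eq_or_ne t l with rfl | h
  · rw [← lie_skew (S.x1 t), e_x1_l]
    simp only [kap, if_true, lie_neg, lie_smul]
    have : ⁅S.f t, S.es t⁆ = S.x1 t := by simp [x1]
    rw [this]; push_cast; module
  · have : ⁅S.x1 t, S.e t⁆ = 0 := by rw [x1, if_neg h, ← lie_skew, S.ees t ht, neg_zero]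
    rw [this]; simp [kap, h]
lemma T_fs {t : ℕ} (ht : t ≤ l) : ⁅S.T t, S.fs t⁆ = if t = l then 0 else (-2 : ℂ) • S.f t := by
  rw [T, lie_lie, S.ffs t ht, lie_zero, zero_sub]
  split_ifs with h
  · subst h; rw [← lie_skew (S.x1 t), fs_x1_l]; simp
  · rw [x1, if_neg h, S.esfs t ht, lie_skew, S.wts t ht _ _ _ (S.hf t ht), prs_lt (by omega),
      pr_self S.hl ht]; norm_num
lemma Tm_f {t : ℕ} (ht : t ≤ l) : ⁅S.Tm t, S.f t⁆ = - kap l t • S.ym t := by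
  have := S.dual.T_e ht
  rw [dual_T, dual_x1, neg_lie] at this
  rw [neg_smul, ← this, neg_neg]; rfl
lemma Tm_x1 {t : ℕ} (ht : t ≤ l) : ⁅S.Tm t, S.x1 t⁆ = kap l t • S.e t := by
  rcases eq_or_ne t l with rfl | h
  · rw [Tm, lie_lie, ym_x1_l, e_x1_l, lie_sub, lie_smul, lie_smul]
    rw [← lie_skew _ (S.h t), ← lie_skew _ (S.hs t), S.he2 ht, hse_l, ]
    have h2 : ⁅S.ym t, S.es t⁆ = - S.e t := by
      have := S.dual.fs_x1_l
      rw [dual_x1] at this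
      change ⁅sgn t t • S.es t, S.ym t⁆ = - S.e t at this
      rw [sgn_l, smul_lie] at this
      rw [← lie_skew, ← this]; module
    rw [h2, kap, if_pos rfl]; module
  · simp only [Tm, x1, ym, if_neg h, kap]
    rw [lie_lie, ← lie_skew (S.fs t), S.esfs t ht, S.ees t ht, lie_neg, lie_skew, lie_zero,
      sub_zero, S.wts t ht _ _ _ (S.he t ht), prs_lt (by omega), pr_self S.hl ht]; norm_num
lemma T_ym {t : ℕ} (ht : t ≤ l) : ⁅S.T t, S.ym t⁆ = - kap l t • S.f t := by
  have := S.dual.Tm_x1 ht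
  rw [dual_Tm, dual_x1, neg_lie] at this
  rw [neg_smul, ← neg_eq_iff_eq_neg, this]; rfl

lemma T_Tm_central {t : ℕ} (ht : t ≤ l) (v : L) : ⁅⁅S.T t, S.Tm t⁆, v⁆ = 0 := by
  have h1 : ⁅S.T t, S.Tm t⁆ = kap l t • (⁅S.x1 t, S.ym t⁆ - S.h t) := by
    rw [Tm, leibniz_lie, T_e S ht, T_ym S ht, smul_lie, lie_smul, S.ef t ht]; module
  apply S.central_of
  intro n z v hv
  rw [h1, smul_lie, sub_lie]
  rcases eq_or_ne t l with rfl | h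
  · rw [← lie_skew (S.x1 t), ym_x1_l]
    simp only [neg_sub, sub_lie, smul_lie]
    rw [S.wt t ht _ _ _ hv, S.wts t ht _ _ _ hv]
    have : pr t t n = 2 * prs t t n := by
      have := S.hl
      simp only [pr, prs]
      split_ifs
      · omega
      · ring
    rw [this]; push_cast; module
  · simp only [x1, ym, if_neg h]
    rw [S.esfs t ht, S.wt t ht _ _ _ hv, S.wts t ht _ _ _ hv, prs_lt (by omega)]; simp

end Sys
end
end Ell

namespace Ell
noncomputable section
open LieAlgebra
namespace Sys
variable {l : ℕ} {L : Type*} [LieRing L] [LieAlgebra ℂ L] (S : Sys l L)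

lemma sg_neg (t : ℕ) (m : ℤ) : sg t (-m) = - sg t m := Pi.single_neg _ _

lemma prs_l_eq (hl : 2 ≤ l) (t : ℕ) (n) (h : pr l t n = 0) : prs l t n = 0 := by
  unfold prs
  split_ifs with h1
  · subst h1
    unfold pr at h
    rw [if_neg (by omega), if_pos rfl] at h
    omega
  · exact h

/-- the cross statement: `T t - (K/κ) T u` kills `e u` and `fs u`. -/
def CrossOK (t u : ℕ) : Prop :=
  ⁅S.T t, S.e u⁆ = (KK l t u) • S.x1 u ∧
  ⁅S.T t, S.fs u⁆ = (KK l t u / kap l u) • ⁅S.T u, S.fs u⁆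

/-- adjacency below `l` -/
lemma sr6' {t u : ℕ} (ht : t < l) (hu : u < l) (h : t + 1 = u ∨ u + 1 = t) :
    ⁅S.es t, S.e u⁆ = ⁅S.e t, S.es u⁆ := by
  rcases h with rfl | rfl
  · exact S.sr6 t hu
  · rw [← lie_skew, ← S.sr6 u ht, lie_skew]

lemma sr7' {t u : ℕ} (ht : t < l) (hu : u < l) (h : t + 1 = u ∨ u + 1 = t) :
    ⁅S.fs t, S.f u⁆ = ⁅S.f t, S.fs u⁆ := by
  rcases h with rfl | rfl
  · exact S.sr7 t hu
  · rw [← lie_skew, ← S.sr7 u ht, lie_skew]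

lemma cross_adj {t u : ℕ} (ht : t < l) (hu : u < l) (h : t + 1 = u ∨ u + 1 = t) :
    S.CrossOK t u := by
  have htu : t ≠ u := by omega
  have hT : S.T t = ⁅S.es t, S.f t⁆ := by rw [T, x1, if_neg ht.ne]
  have hK : KK l t u = (pr l t (sg u 1) : ℂ) := by rw [KK, if_neg htu]
  obtain ⟨c1, c2, c3, c4⟩ := S.cross u hu.le t ht.le htu.symm
  obtain ⟨d1, d2, d3, d4⟩ := S.cross t ht.le u hu.le htu
  constructor
  · rw [hT, hK, lie_lie, ← lie_skew (S.f t) (S.e u), c1, neg_zero, lie_zero, zero_sub,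
      S.sr6' ht hu h, leibniz_lie, ← lie_skew (S.f t) (S.e t), S.ef t ht.le,
      ← lie_skew (S.f t) (S.es u), c3]
    rw [neg_zero, lie_zero, add_zero, neg_lie, neg_neg]
    rw [S.wt t ht.le _ _ _ (S.hes u hu.le), x1, if_neg hu.ne, stc, if_neg hu.ne]
  · rw [S.T_fs hu.le, if_neg hu.ne, hT, hK, lie_lie, d4, lie_zero, sub_zero, ← S.sr7' ht hu h,
      leibniz_lie, S.esfs t ht.le, d3, lie_zero, add_zero, S.wts t ht.le _ _ _ (S.hf u hu.le),
      prs_lt ht, kap, if_neg hu.ne, sg_neg, pr_neg]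
    push_cast; module

lemma far_comm {t u : ℕ} (ht : t ≤ l) (hu : u ≤ l) (h : t + 1 < u ∨ u + 1 < t) :
    ⁅S.e t, S.e u⁆ = 0 ∧ ⁅S.e t, S.es u⁆ = 0 ∧ ⁅S.es t, S.e u⁆ = 0 ∧
    ⁅S.f t, S.f u⁆ = 0 ∧ ⁅S.f t, S.fs u⁆ = 0 ∧ ⁅S.fs t, S.f u⁆ = 0 := by
  rcases h with h | h
  · exact S.far t ht u hu h
  · obtain ⟨h1, h2, h3, h4, h5, h6⟩ := S.far u hu t ht h
    refine ⟨?_, ?_, ?_, ?_, ?_, ?_⟩ <;> rw [← lie_skew] <;> simp [*]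

lemma lie2_zero {a b c : L} (h1 : ⁅a, c⁆ = 0) (h2 : ⁅b, c⁆ = 0) : ⁅⁅a, b⁆, c⁆ = 0 := by
  rw [lie_lie, h1, h2]; simp

lemma x1_comm {t : ℕ} {v : L} (h1 : ⁅S.es t, v⁆ = 0) (h2 : ⁅S.f t, v⁆ = 0) : ⁅S.x1 t, v⁆ = 0 := by
  unfold x1; split_ifs
  · exact lie2_zero h2 h1
  · exact h1

lemma ym_comm {t : ℕ} {v : L} (h1 : ⁅S.fs t, v⁆ = 0) (h2 : ⁅S.e t, v⁆ = 0) : ⁅S.ym t, v⁆ = 0 := by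
  unfold ym; split_ifs
  · exact lie2_zero h1 h2
  · exact h1

lemma cross_far {t u : ℕ} (ht : t ≤ l) (hu : u ≤ l) (h : t + 1 < u ∨ u + 1 < t) :
    S.CrossOK t u := by
  have htu : t ≠ u := by omega
  obtain ⟨c1, c2, c3, c4⟩ := S.cross u hu t ht htu.symm
  obtain ⟨d1, d2, d3, d4⟩ := S.cross t ht u hu htu
  obtain ⟨h1, h2, h3, h4, h5, h6⟩ := S.far_comm ht hu h
  have hK : KK l t u = 0 := by rw [KK, if_neg htu, pr_far ht hu S.hl h]; simp
  have fe : ⁅S.f t, S.e u⁆ = 0 := by rw [← lie_skew, c1, neg_zero]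
  constructor
  · rw [hK, zero_smul]; exact lie2_zero (S.x1_comm h3 fe) fe
  · rw [hK, zero_div, zero_smul]; exact lie2_zero (S.x1_comm d4 h5) h5

/-- the last two nodes -/
lemma x1_e' : ⁅S.x1 l, S.e (l-1)⁆ = ⁅S.e l, S.es (l-1)⁆ ∧
    ⁅S.f l, ⁅S.e l, S.es (l-1)⁆⁆ = (2 : ℂ) • S.es (l-1) := by
  have hl := S.hl
  obtain ⟨c1, c2, c3, c4⟩ := S.cross (l-1) (by omega) l le_rfl (by omega)
  have fe : ⁅S.f l, S.e l⁆ = - S.h l := by rw [← lie_skew, S.ef l le_rfl]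
  have h1 : ⁅S.f l, S.e (l-1)⁆ = 0 := by rw [← lie_skew, c1, neg_zero]
  have h2 : ⁅S.f l, S.es (l-1)⁆ = 0 := by rw [← lie_skew, c3, neg_zero]
  have h3 : ⁅S.h l, S.es (l-1)⁆ = (-2 : ℂ) • S.es (l-1) := by
    rw [S.wt l le_rfl _ _ _ (S.hes _ (by omega)), pr_l_l1 hl, stc, if_neg (by omega)]; norm_num
  have h4 : ⁅S.f l, ⁅S.e l, S.es (l-1)⁆⁆ = (2 : ℂ) • S.es (l-1) := by
    rw [leibniz_lie, fe, h2, neg_lie, h3]; simp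
  refine ⟨?_, h4⟩
  have h5 : ⁅S.es l, S.e (l-1)⁆ = (1/2 : ℂ) • ⁅S.e l, ⁅S.e l, S.es (l-1)⁆⁆ := by
    rw [← S.sr6l]; module
  rw [x1, if_pos rfl, lie_lie, h1, lie_zero, sub_zero, h5, lie_smul, leibniz_lie, fe, h4, neg_lie,
    leibniz_lie (S.h l), h3, S.he2 le_rfl, lie_smul, smul_lie, lie_smul]
  module

lemma q_zero : ⁅S.x1 l, S.f (l-1)⁆ = 0 := by
  have hl := S.hl
  obtain ⟨c1, c2, c3, c4⟩ := S.cross l le_rfl (l-1) (by omega) (by omega)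
  have k1 : ⁅S.fs l, S.f (l-1)⁆ = (-1/2 : ℂ) • ⁅S.f l, ⁅S.f l, S.fs (l-1)⁆⁆ := by
    rw [← S.sr7l]; module
  have fsf : ⁅S.fs l, S.f l⁆ = 0 := by rw [← lie_skew, S.ffs l le_rfl, neg_zero]
  have cub : ⁅S.f l, ⁅S.f l, ⁅S.f l, S.fs (l-1)⁆⁆⁆ = 0 := by
    have := S.lemC le_rfl 2 (S.fs (l-1)) (by
      rw [S.wt l le_rfl _ _ _ (S.hfs _ (by omega)), pr_l_l1 hl, stc, if_neg (by omega)]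
      norm_num) c2
    simpa [pow_succ] using this
  have sq : ⁅S.fs l, ⁅S.fs l, S.f (l-1)⁆⁆ = 0 := by
    have := S.lemCs le_rfl 1 (S.f (l-1)) (by
      rw [S.wts l le_rfl _ _ _ (S.hf _ (by omega)), prs_l_l1 hl]
      norm_num) c3
    simpa [pow_succ] using this
  refine S.lemAs le_rfl 2 (by norm_num) _ ?_ ?_
  · have := S.mul _ _ _ _ _ _ (S.x1_mem le_rfl) (S.hf (l-1) (by omega))
    rw [S.wts l le_rfl _ _ _ this, prs_add, prs_self_l hl, prs_l_l1 hl]; norm_num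
  · have : ⁅S.fs l, ⁅S.fs l, ⁅S.x1 l, S.f (l-1)⁆⁆⁆ = 0 := by
      rw [leibniz_lie (S.fs l) (S.x1 l), fs_x1_l, lie_add, neg_lie, lie_neg,
        leibniz_lie (S.fs l) (S.f l), fsf, zero_lie, zero_add, leibniz_lie (S.fs l) (S.x1 l),
        fs_x1_l, sq, lie_zero, add_zero, neg_lie, k1, lie_smul, cub]
      simp
    simpa [pow_succ] using this

lemma cross_l1_l : S.CrossOK (l-1) l := by
  have hl := S.hl
  obtain ⟨c1, c2, c3, c4⟩ := S.cross l le_rfl (l-1) (by omega) (by omega)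
  obtain ⟨d1, d2, d3, d4⟩ := S.cross (l-1) (by omega) l le_rfl (by omega)
  have hT : S.T (l-1) = ⁅S.es (l-1), S.f (l-1)⁆ := by rw [T, x1, if_neg (by omega)]
  have hK : KK l (l-1) l = -1 := by rw [KK, if_neg (by omega), pr_l1_l hl]; norm_num
  have h1 : ⁅S.T (l-1), S.e l⁆ = - S.x1 l := by
    have h2 : ⁅S.e (l-1), ⁅S.x1 l, S.f (l-1)⁆⁆ = 0 := by rw [q_zero, lie_zero]
    rw [leibniz_lie, ← lie_skew (S.e (l-1)), (S.x1_e').1, neg_lie, lie_lie, ← hT, c1, lie_zero,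
      S.ef (l-1) (by omega), ← lie_skew (S.x1 l), S.wt (l-1) (by omega) _ _ _ (S.x1_mem le_rfl),
      pr_l1_l hl, sub_zero, lie_skew] at h2
    rw [eq_neg_iff_add_eq_zero, ← h2]; simp
  constructor
  · rw [h1, hK]; module
  · rw [S.T_fs le_rfl, if_pos rfl, smul_zero, hT, lie_lie, d4, lie_zero, sub_zero]
    have k1 : ⁅S.f (l-1), S.fs l⁆ = (1/2 : ℂ) • ⁅S.f l, ⁅S.f l, S.fs (l-1)⁆⁆ := by
      rw [← S.sr7l, ← lie_skew]; module
    rw [k1, lie_smul, leibniz_lie, d3, zero_lie, zero_add, leibniz_lie (S.es (l-1)), d3, zero_lie,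
      zero_add, S.esfs _ (by omega), ← lie_skew (S.f l) (S.hs _),
      S.wts (l-1) (by omega) _ _ _ (S.hf l le_rfl)]
    simp

/-- consequences of `CrossOK` : the difference commutes with the whole node algebra. -/
lemma cross_kill {t u : ℕ} (ht : t ≤ l) (hu : u ≤ l) (h : S.CrossOK t u) :
    ∀ v : L, (v = S.e u ∨ v = S.f u ∨ v = S.es u ∨ v = S.fs u ∨ v = S.x1 u ∨ v = S.ym u ∨ v = S.T u
      ∨ v = S.Tm u) → ⁅S.T t, v⁆ = (KK l t u / kap l u) • ⁅S.T u, v⁆ := by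
  have hk := kap_ne l u
  set D := S.T t - (KK l t u / kap l u) • S.T u with hD
  have hm : D ∈ S.Gr 0 1 := Submodule.sub_mem _ (S.T_mem ht) (Submodule.smul_mem _ _ (S.T_mem hu))
  have key : ∀ v : L, ⁅v, D⁆ = 0 → ⁅S.T t, v⁆ = (KK l t u / kap l u) • ⁅S.T u, v⁆ := by
    intro v hv
    rw [← lie_skew, neg_eq_zero, hD, sub_lie, smul_lie, sub_eq_zero] at hv
    exact hv
  have h1 : ⁅S.e u, D⁆ = 0 := by
    rw [← lie_skew, neg_eq_zero, hD, sub_lie, smul_lie, h.1, S.T_e hu, smul_smul,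
      div_mul_cancel₀ _ hk, sub_self]
  have h2 : ⁅S.fs u, D⁆ = 0 := by
    rw [← lie_skew, neg_eq_zero, hD, sub_lie, smul_lie, h.2, sub_self]
  have h3 := S.kill_f hu hm h1
  have h4 := S.kill_es hu hm h2
  have h5 := S.x1_comm h4 h3
  have h6 := S.ym_comm h2 h1
  rintro v (rfl | rfl | rfl | rfl | rfl | rfl | rfl | rfl) <;> apply key
  · exact h1
  · exact h3
  · exact h4
  · exact h2
  · exact h5
  · exact h6
  · exact lie2_zero h5 h3
  · exact lie2_zero h1 h6

lemma x1_fs'_l : ⁅S.x1 l, S.fs (l-1)⁆ = 0 := by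
  have hl := S.hl
  have h1 := S.dual.cross_kill (by omega) le_rfl S.dual.cross_l1_l (S.x1 l) (by
    right; right; right; right; right; left; rw [dual_ym])
  rw [dual_T, dual_T, neg_lie, neg_lie, S.Tm_x1 le_rfl] at h1
  have hK : KK l (l-1) l = -1 := by rw [KK, if_neg (by omega), pr_l1_l hl]; norm_num
  have h2 : ⁅S.Tm (l-1), S.x1 l⁆ = - S.e l := by
    rw [hK, kap, if_pos rfl] at h1
    rw [neg_eq_iff_eq_neg] at h1
    rw [h1]; module
  have h3 : ⁅S.Tm (l-1), ⁅S.x1 l, S.f (l-1)⁆⁆ = 0 := by rw [q_zero, lie_zero]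
  rw [leibniz_lie, h2, S.Tm_f (by omega), ym, if_neg (show l - 1 ≠ l by omega), neg_lie,
    (S.cross l le_rfl (l-1) (by omega) (by omega)).1, neg_zero, zero_add, lie_smul] at h3
  exact (smul_eq_zero.mp h3).resolve_left (by simpa using kap_ne l (l-1))

lemma cross_l_l1 : S.CrossOK l (l-1) := by
  have hl := S.hl
  obtain ⟨c1, c2, c3, c4⟩ := S.cross l le_rfl (l-1) (by omega) (by omega)
  obtain ⟨d1, d2, d3, d4⟩ := S.cross (l-1) (by omega) l le_rfl (by omega)
  have hK : KK l l (l-1) = -2 := by rw [KK, if_neg (by omega), pr_l_l1 hl]; norm_num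
  have hne : l - 1 ≠ l := by omega
  constructor
  · rw [T, lie_lie, ← lie_skew (S.f l) (S.e (l-1)), d1, neg_zero, lie_zero, zero_sub, (S.x1_e').1,
      (S.x1_e').2, hK, x1, if_neg hne]; module
  · rw [S.T_fs (by omega), if_neg hne, T, lie_lie, x1_fs'_l, lie_zero, sub_zero]
    have h0 : ⁅S.es l, ⁅S.f l, S.fs (l-1)⁆⁆ = 0 := by
      have := S.x1_fs'_l
      rw [x1, if_pos rfl, lie_lie, c4, lie_zero, zero_sub, neg_eq_zero] at this
      exact this
    conv_lhs => rw [x1, if_pos rfl, lie_lie, h0, lie_zero, ← S.sr7l, lie_smul, leibniz_lie,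
      S.esfs l le_rfl, c3, lie_zero, add_zero, S.wts l le_rfl _ _ _ (S.hf _ (by omega)), prs_l_l1 hl]
    rw [hK, kap, if_neg hne]; push_cast; module

lemma crossOK {t u : ℕ} (ht : t ≤ l) (hu : u ≤ l) (htu : t ≠ u) : S.CrossOK t u := by
  have hl := S.hl
  by_cases h : t + 1 < u ∨ u + 1 < t
  · exact S.cross_far ht hu h
  · rcases eq_or_ne t l with rfl | h1
    · have : u = t - 1 := by omega
      subst this; exact S.cross_l_l1
    · rcases eq_or_ne u l with rfl | h2
      · have : t = u - 1 := by omega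
        subst this; exact S.cross_l1_l
      · exact S.cross_adj (by omega) (by omega) (by omega)

end Sys
end
end Ell

namespace Ell
noncomputable section
open LieAlgebra

structure Sys2 (l : ℕ) (L : Type*) [LieRing L] [LieAlgebra ℂ L] where
  hl : 2 ≤ l
  x : ℕ → ℤ → L
  y : ℕ → ℤ → L
  T : ℕ → L
  Tm : ℕ → L
  h : ℕ → L
  Hs : Set L
  Gr : (ℕ → ℤ) → ℤ → Submodule ℂ L
  indep : iSupIndep (fun p : (ℕ → ℤ) × ℤ => Gr p.1 p.2)
  mul : ∀ n z m y u v, u ∈ Gr n z → v ∈ Gr m y → ⁅u, v⁆ ∈ Gr (n + m) (z + y)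
  hx : ∀ t ≤ l, ∀ n, x t n ∈ Gr (sg t 1) n
  hy : ∀ t ≤ l, ∀ n, y t n ∈ Gr (-sg t 1) n
  hT : ∀ t ≤ l, T t ∈ Gr 0 1
  hTm : ∀ t ≤ l, Tm t ∈ Gr 0 (-1)
  Tx : ∀ t ≤ l, ∀ u ≤ l, ∀ n, ⁅T t, x u n⁆ = KK l t u • x u (n + 1)
  Ty : ∀ t ≤ l, ∀ u ≤ l, ∀ n, ⁅T t, y u n⁆ = - KK l t u • y u (n + 1)
  Tmx : ∀ t ≤ l, ∀ u ≤ l, ∀ n, ⁅Tm t, x u n⁆ = KK l t u • x u (n - 1)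
  Tmy : ∀ t ≤ l, ∀ u ≤ l, ∀ n, ⁅Tm t, y u n⁆ = - KK l t u • y u (n - 1)
  wt : ∀ t ≤ l, ∀ n z, ∀ v ∈ Gr n z, ⁅h t, v⁆ = (pr l t n : ℂ) • v
  wtH : ∀ u ∈ Hs, ∀ n z, ∃ c : ℂ, ∀ v ∈ Gr n z, ⁅u, v⁆ = c • v
  H0 : ∀ u ∈ Hs, u ∈ Gr 0 0
  xy : ∀ t ≤ l, ⁅x t 0, y t 0⁆ = h t
  xyu : ∀ t ≤ l, ∀ u ≤ l, t ≠ u → ⁅x t 0, y u 0⁆ = 0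
  xadj : ∀ t ≤ l, ∀ u ≤ l, (t + 1 = u ∨ u + 1 = t) → ⁅x t 1, x u 0⁆ = ⁅x t 0, x u 1⁆
  yadj : ∀ t ≤ l, ∀ u ≤ l, (t + 1 = u ∨ u + 1 = t) → ⁅y t (-1), y u 0⁆ = ⁅y t 0, y u (-1)⁆
  xfar : ∀ t ≤ l, ∀ u ≤ l, (t + 1 < u ∨ u + 1 < t) → ⁅x t 0, x u 0⁆ = 0
  yfar : ∀ t ≤ l, ∀ u ≤ l, (t + 1 < u ∨ u + 1 < t) → ⁅y t 0, y u 0⁆ = 0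
  xself : ∀ t < l, ⁅x t 1, x t 0⁆ = 0
  yself : ∀ t < l, ⁅y t (-1), y t 0⁆ = 0
  xl2 : ⁅x l 2, x l 0⁆ = 0
  yl2 : ⁅y l (-2), y l 0⁆ = 0
  xl3 : ⁅⁅x l 1, x l 0⁆, x l 0⁆ = 0
  yl3 : ⁅⁅y l (-1), y l 0⁆, y l 0⁆ = 0
  xly : ⁅⁅x l 1, x l 0⁆, y l 0⁆ = (4 : ℂ) • x l 1
  ylx : ⁅⁅y l (-1), y l 0⁆, x l 0⁆ = (4 : ℂ) • y l (-1)
  nilx : ∀ t ≤ l, ∀ v, ∃ n, (ad ℂ L (x t 0) ^ n) v = 0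
  nily : ∀ t ≤ l, ∀ v, ∃ n, (ad ℂ L (y t 0) ^ n) v = 0
  gen : ∀ A : LieSubalgebra ℂ L, Hs ⊆ A → (∀ t ≤ l, x t 0 ∈ A ∧ y t 0 ∈ A ∧ x t 1 ∈ A ∧
    y t (-1) ∈ A) → A = ⊤

namespace Sys2
variable {l : ℕ} {L : Type*} [LieRing L] [LieAlgebra ℂ L] (S : Sys2 l L)

def dual : Sys2 l L where
  hl := S.hl
  x t n := S.y t (-n)
  y t n := S.x t (-n)
  T t := - S.Tm t
  Tm t := - S.T t
  h t := - S.h t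
  Hs := S.Hs
  Gr n z := S.Gr (-n) (-z)
  indep := by
    have := S.indep.comp (f := fun p : (ℕ → ℤ) × ℤ => (-p.1, -p.2)) (by
      rintro ⟨a, b⟩ ⟨c, d⟩ h; simpa using h)
    exact this
  mul n z m y u v hu hv := by
    have := S.mul _ _ _ _ _ _ hu hv
    rwa [neg_add, neg_add]
  hx t ht n := S.hy t ht _
  hy t ht n := by simpa using S.hx t ht (-n)
  hT t ht := by simpa using S.hTm t ht
  hTm t ht := by simpa using S.hT t ht
  Tx t ht u hu n := by
    rw [neg_lie, S.Tmy t ht u hu, neg_add]; simp [sub_eq_add_neg]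
  Ty t ht u hu n := by
    rw [neg_lie, S.Tmx t ht u hu, neg_add]; simp [sub_eq_add_neg]
  Tmx t ht u hu n := by
    rw [neg_lie, S.Ty t ht u hu, neg_sub]; simp [sub_eq_add_neg, add_comm]
  Tmy t ht u hu n := by
    rw [neg_lie, S.Tx t ht u hu, neg_sub]; simp [sub_eq_add_neg, add_comm]
  wt t ht n z v hv := by rw [neg_lie, S.wt t ht _ _ v hv, pr_neg]; push_cast; module
  wtH u hu n z := S.wtH u hu _ _
  H0 u hu := by simpa using S.H0 u hu
  xy t ht := by rw [← lie_skew, neg_zero, S.xy t ht]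
  xyu t ht u hu htu := by rw [← lie_skew, neg_zero, S.xyu u hu t ht htu.symm, neg_zero]
  xadj := by simpa using S.yadj
  yadj := by simpa using S.xadj
  xfar := by simpa using S.yfar
  yfar := by simpa using S.xfar
  xself := by
    simp only [neg_neg, neg_zero]
    exact S.yself
  yself := by
    simp only [neg_neg, neg_zero]
    exact S.xself
  xl2 := by
    simp only [neg_neg, neg_zero]
    exact S.yl2
  yl2 := by
    simp only [neg_neg, neg_zero]
    exact S.xl2
  xl3 := by
    simp only [neg_neg, neg_zero]
    exact S.yl3
  yl3 := by
    simp only [neg_neg, neg_zero]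
    exact S.xl3
  xly := by
    simp only [neg_neg, neg_zero]
    exact S.ylx
  ylx := by
    simp only [neg_neg, neg_zero]
    exact S.xly
  nilx := by simpa using S.nily
  nily := by simpa using S.nilx
  gen A hH hA := by
    apply S.gen A hH
    intro t ht
    obtain ⟨h1, h2, h3, h4⟩ := hA t ht
    refine ⟨?_, ?_, ?_, ?_⟩ <;> simpa using ‹_›

end Sys2

namespace Sys
variable {l : ℕ} {L : Type*} [LieRing L] [LieAlgebra ℂ L] (S : Sys l L)

def xx (t : ℕ) : ℤ → L
  | Int.ofNat n => (((kap l t)⁻¹ • ad ℂ L (S.T t)) ^ n) (S.e t)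
  | Int.negSucc n => (((kap l t)⁻¹ • ad ℂ L (S.Tm t)) ^ (n + 1)) (S.e t)

def yy (t : ℕ) (n : ℤ) : L := S.dual.xx t (-n)

lemma xx_zero (t : ℕ) : S.xx t 0 = S.e t := rfl
lemma xx_one {t : ℕ} (ht : t ≤ l) : S.xx t 1 = S.x1 t := by
  change (((kap l t)⁻¹ • ad ℂ L (S.T t)) ^ 1) (S.e t) = _
  simp [S.T_e ht, smul_smul, kap_ne]

lemma seq_step {M : Type*} [AddCommGroup M] [Module ℂ M] (P Q : Module.End ℂ M) (v : M)
    (hc : Commute P Q) (h : Q (P v) = v) (X : ℤ → M)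
    (h1 : ∀ n : ℕ, X (Int.ofNat n) = (P ^ n) v) (h2 : ∀ n : ℕ, X (Int.negSucc n) = (Q ^ (n + 1)) v)
    (n : ℤ) : P (X n) = X (n + 1) ∧ Q (X n) = X (n - 1) := by
  have h' : P (Q v) = v := by
    rw [← Module.End.mul_apply, hc.eq, Module.End.mul_apply, h]
  rcases n with n | n
  · constructor
    · rw [h1, show Int.ofNat n + 1 = Int.ofNat (n + 1) from rfl, h1, pow_succ', Module.End.mul_apply]
    · rw [h1]
      rcases n with _ | n
      · rw [show Int.ofNat 0 - 1 = Int.negSucc 0 from rfl, h2]; simp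
      · rw [show Int.ofNat (n+1) - 1 = Int.ofNat n by simp, h1, ← Module.End.mul_apply,
          (hc.symm.pow_right (n+1)).eq, pow_succ, Module.End.mul_apply, Module.End.mul_apply,
          ← Module.End.mul_apply P Q, hc.eq, Module.End.mul_apply, h]
  · constructor
    · rw [h2]
      rcases n with _ | n
      · rw [show Int.negSucc 0 + 1 = Int.ofNat 0 from rfl, h1]; simpa using h'
      · rw [show Int.negSucc (n+1) + 1 = Int.negSucc n from rfl, h2, ← Module.End.mul_apply,
          (hc.pow_right (n+1+1)).eq, pow_succ, Module.End.mul_apply, Module.End.mul_apply, 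
          ← Module.End.mul_apply Q P, hc.symm.eq, Module.End.mul_apply, h']
    · rw [h2, show Int.negSucc n - 1 = Int.negSucc (n + 1) from rfl, h2, pow_succ' _ (n + 1),
        Module.End.mul_apply]

lemma xx_step {t : ℕ} (ht : t ≤ l) (n : ℤ) :
    ⁅S.T t, S.xx t n⁆ = kap l t • S.xx t (n + 1) ∧ ⁅S.Tm t, S.xx t n⁆ = kap l t • S.xx t (n - 1) := by
  have hk := kap_ne l t
  obtain ⟨h1, h2⟩ := seq_step ((kap l t)⁻¹ • ad ℂ L (S.T t)) ((kap l t)⁻¹ • ad ℂ L (S.Tm t)) (S.e t)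
    (by
      refine ((Commute.smul_left ?_ _).smul_right _)
      refine LinearMap.ext fun v => ?_
      have h0 := S.T_Tm_central ht v
      rw [lie_lie, sub_eq_zero] at h0
      exact h0)
    (by simp [S.T_e ht, S.Tm_x1 ht, smul_smul, hk]) (S.xx t) (fun _ => rfl) (fun _ => rfl) n
  constructor
  · rw [← h1]; simp [smul_smul, hk]
  · rw [← h2]; simp [smul_smul, hk]

lemma xx_kill {D : L} {u : ℕ} (hu : u ≤ l) (h1 : ⁅D, S.e u⁆ = 0) (h2 : ⁅D, S.T u⁆ = 0)
    (h3 : ⁅D, S.Tm u⁆ = 0) (n : ℤ) : ⁅D, S.xx u n⁆ = 0 := by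
  have hk := kap_ne l u
  induction n using Int.induction_on with
  | zero => exact h1
  | succ n ih =>
    have : ⁅D, ⁅S.T u, S.xx u n⁆⁆ = 0 := by rw [leibniz_lie, h2, ih]; simp
    rw [(S.xx_step hu n).1, lie_smul] at this
    exact (smul_eq_zero.mp this).resolve_left hk
  | pred n ih =>
    have : ⁅D, ⁅S.Tm u, S.xx u (-n)⁆⁆ = 0 := by rw [leibniz_lie, h3, ih]; simp
    rw [(S.xx_step hu (-n)).2, lie_smul] at this
    exact (smul_eq_zero.mp this).resolve_left hk

lemma T_xx {t u : ℕ} (ht : t ≤ l) (hu : u ≤ l) (n : ℤ) :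
    ⁅S.T t, S.xx u n⁆ = KK l t u • S.xx u (n + 1) ∧ ⁅S.Tm t, S.xx u n⁆ = KK l t u • S.xx u (n - 1) := by
  rcases eq_or_ne t u with rfl | htu
  · rw [KK, if_pos rfl]; exact S.xx_step ht n
  have hk := kap_ne l u
  have k1 := S.cross_kill ht hu (S.crossOK ht hu htu)
  have k2 := S.dual.cross_kill ht hu (S.dual.crossOK ht hu htu)
  have k2' : ∀ v : L, (v = S.e u ∨ v = S.T u ∨ v = S.Tm u) →
      ⁅S.Tm t, v⁆ = (KK l t u / kap l u) • ⁅S.Tm u, v⁆ := by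
    intro v hv
    have : ∀ v' : L, (v' = v ∨ v' = -v) → (v' = S.dual.f u ∨ v' = S.dual.T u ∨ v' = S.dual.Tm u) →
      ⁅S.Tm t, v⁆ = (KK l t u / kap l u) • ⁅S.Tm u, v⁆ := by
      intro v' h1 h2
      have := k2 v' (by tauto)
      rw [dual_T, dual_T] at this
      rcases h1 with rfl | rfl
      · rw [neg_lie, neg_lie, smul_neg, neg_inj] at this; exact this
      · rw [neg_lie, neg_lie, smul_neg, neg_inj, lie_neg, lie_neg, smul_neg, neg_inj] at this
        exact this
    rcases hv with rfl | rfl | rfl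
    · exact this _ (Or.inl rfl) (Or.inl rfl)
    · exact this _ (Or.inr rfl) (Or.inr (Or.inr (S.dual_Tm u).symm))
    · exact this _ (Or.inr rfl) (Or.inr (Or.inl (S.dual_T u).symm))
  constructor
  · have := S.xx_kill (D := S.T t - (KK l t u / kap l u) • S.T u) hu
      (by rw [sub_lie, smul_lie, sub_eq_zero]; exact k1 _ (by tauto))
      (by rw [sub_lie, smul_lie, sub_eq_zero]; exact k1 _ (by tauto))
      (by rw [sub_lie, smul_lie, sub_eq_zero]; exact k1 _ (by tauto)) n
    rw [sub_lie, smul_lie, sub_eq_zero] at this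
    rw [this, (S.xx_step hu n).1, smul_smul, div_mul_cancel₀ _ hk]
  · have := S.xx_kill (D := S.Tm t - (KK l t u / kap l u) • S.Tm u) hu
      (by rw [sub_lie, smul_lie, sub_eq_zero]; exact k2' _ (by tauto))
      (by rw [sub_lie, smul_lie, sub_eq_zero]; exact k2' _ (by tauto))
      (by rw [sub_lie, smul_lie, sub_eq_zero]; exact k2' _ (by tauto)) n
    rw [sub_lie, smul_lie, sub_eq_zero] at this
    rw [this, (S.xx_step hu n).2, smul_smul, div_mul_cancel₀ _ hk]

lemma xx_mem {t : ℕ} (ht : t ≤ l) (n : ℤ) : S.xx t n ∈ S.Gr (sg t 1) n := by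
  have hk := kap_ne l t
  induction n using Int.induction_on with
  | zero => exact S.he t ht
  | succ n ih =>
    have := S.mul _ _ _ _ _ _ (S.T_mem ht) ih
    rw [(S.xx_step ht n).1, zero_add, add_comm] at this
    exact (Submodule.smul_mem_iff _ hk).mp this
  | pred n ih =>
    have := S.mul _ _ _ _ _ _ (S.Tm_mem ht) ih
    rw [(S.xx_step ht _).2, zero_add, add_comm, ← sub_eq_add_neg] at this
    exact (Submodule.smul_mem_iff _ hk).mp this

lemma xx_adj (t : ℕ) (ht : t ≤ l) (u : ℕ) (hu : u ≤ l) (h : t + 1 = u ∨ u + 1 = t) :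
    ⁅S.xx t 1, S.xx u 0⁆ = ⁅S.xx t 0, S.xx u 1⁆ := by
  have hl := S.hl
  rw [S.xx_one ht, S.xx_one hu, xx_zero, xx_zero]
  rcases eq_or_ne t l with rfl | h1
  · have : u = t - 1 := by omega
    subst this
    rw [(S.x1_e').1]; conv_rhs => rw [x1, if_neg (by omega)]
  · rcases eq_or_ne u l with rfl | h2
    · have : t = u - 1 := by omega
      subst this
      rw [← lie_skew (S.e _), (S.x1_e').1, lie_skew]
      rw [x1, if_neg (by omega)]
    · rw [x1, x1, if_neg h1, if_neg h2]
      exact S.sr6' (by omega) (by omega) h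

lemma x1_e_l : ⁅S.x1 l, S.e l⁆ = (-4 : ℂ) • S.es l := by
  rw [← lie_skew, e_x1_l]; module

lemma T_es_l : ⁅S.T l, S.es l⁆ = 0 := by
  have := S.kill_es le_rfl (S.T_mem le_rfl) (by rw [← lie_skew, S.T_fs le_rfl]; simp)
  rw [← lie_skew, this, neg_zero]

lemma xx_l2 : ⁅S.xx l 2, S.xx l 0⁆ = 0 := by
  have h1 : ⁅S.T l, ⁅S.xx l 1, S.xx l 0⁆⁆ = 0 := by
    rw [S.xx_one le_rfl, xx_zero, x1_e_l, lie_smul, T_es_l, smul_zero]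
  rw [leibniz_lie, (S.xx_step le_rfl 1).1, (S.xx_step le_rfl 0).1] at h1
  norm_num at h1
  exact h1.resolve_left (kap_ne l l)

lemma xx_l3 : ⁅⁅S.xx l 1, S.xx l 0⁆, S.xx l 0⁆ = 0 := by
  rw [S.xx_one le_rfl, xx_zero, x1_e_l, smul_lie, ← lie_skew, S.ees l le_rfl]; simp

lemma xx_ly : ⁅⁅S.xx l 1, S.xx l 0⁆, S.f l⁆ = (4 : ℂ) • S.xx l 1 := by
  rw [S.xx_one le_rfl, xx_zero, x1_e_l, smul_lie, ← lie_skew, x1, if_pos rfl]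
  module

def toSys2 : Sys2 l L where
  hl := S.hl
  x := S.xx
  y := S.yy
  T := S.T
  Tm := S.Tm
  h := S.h
  Hs := S.Hs
  Gr := S.Gr
  indep := S.indep
  mul := S.mul
  hx t ht n := S.xx_mem ht n
  hy t ht n := by
    have := S.dual.xx_mem ht (-n)
    change _ ∈ S.Gr (-sg t 1) (-(-n)) at this
    rw [neg_neg] at this; exact this
  hT t ht := S.T_mem ht
  hTm t ht := S.Tm_mem ht
  Tx t ht u hu n := (S.T_xx ht hu n).1
  Tmx t ht u hu n := (S.T_xx ht hu n).2
  Ty t ht u hu n := by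
    have := (S.dual.T_xx ht hu (-n)).2
    rw [dual_Tm, neg_lie] at this
    rw [yy, yy, neg_smul, neg_add, ← sub_eq_add_neg, ← this, neg_neg]
  Tmy t ht u hu n := by
    have := (S.dual.T_xx ht hu (-n)).1
    rw [dual_T, neg_lie] at this
    rw [yy, yy, neg_smul, neg_sub', sub_neg_eq_add, ← this, neg_neg]
  wt := S.wt
  wtH := S.wtH
  H0 := S.H0
  xy t ht := S.ef t ht
  xyu t ht u hu htu := (S.cross t ht u hu htu).1
  xadj := S.xx_adj
  yadj := by simpa [yy] using S.dual.xx_adj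
  xfar t ht u hu h := (S.far_comm ht hu h).1
  yfar t ht u hu h := (S.far_comm ht hu h).2.2.2.1
  xself t ht := by
    rw [S.xx_one ht.le, x1, if_neg ht.ne, ← lie_skew, xx_zero, S.ees t ht.le, neg_zero]
  yself t ht := by
    simp only [yy, neg_neg, neg_zero]
    rw [S.dual.xx_one ht.le, x1, if_neg ht.ne, ← lie_skew, xx_zero, S.dual.ees t ht.le, neg_zero]
  xl2 := S.xx_l2
  yl2 := by simpa [yy] using S.dual.xx_l2
  xl3 := S.xx_l3
  yl3 := by
    simp only [yy, neg_neg, neg_zero]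
    exact S.dual.xx_l3
  xly := S.xx_ly
  ylx := by
    simp only [yy, neg_neg, neg_zero]
    exact S.dual.xx_ly
  nilx := S.nile
  nily := S.nilf
  gen A hH hA := by
    apply S.gen A hH
    intro t ht
    obtain ⟨h1, h2, h3, h4⟩ := hA t ht
    rw [S.xx_one ht] at h3
    rw [yy, neg_neg, S.dual.xx_one ht, S.dual_x1] at h4
    have h1' : S.e t ∈ A := h1
    have h2' : S.f t ∈ A := h2
    refine ⟨h1', h2', ?_, ?_⟩
    · rcases eq_or_ne t l with rfl | h
      · have := A.lie_mem h3 h1'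
        rw [x1_e_l] at this
        exact mem_smul_iff' (by norm_num) this
      · rwa [x1, if_neg h] at h3
    · rcases eq_or_ne t l with rfl | h
      · have := A.lie_mem h4 h2'
        have e := S.dual.x1_e_l
        rw [dual_x1] at e
        change ⁅S.ym t, S.f t⁆ = (-4 : ℂ) • (sgn t t • S.fs t) at e
        rw [e, smul_smul] at this
        exact mem_smul_iff' (mul_ne_zero (by norm_num) (sgn_ne _ _)) this
      · rwa [ym, if_neg h] at h4

end Sys
end
end Ell

namespace Ell
noncomputable section
open LieAlgebra

lemma pr_adj_val {l t u : ℕ} (hl : 2 ≤ l) (ht : t ≤ l) (hu : u ≤ l) (h : t + 1 = u ∨ u + 1 = t) (m : ℤ) :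
    pr l t (sg u m) = if t = 0 ∨ t = l then -2 * m else -m := by
  unfold pr
  rcases h with rfl | rfl
  · by_cases h0 : t = 0
    · subst h0; simp
    · rw [if_neg h0, if_neg (by omega), if_neg (by omega)]
      simp [Pi.single_apply, show t - 1 ≠ t + 1 by omega]
  · by_cases h0 : u + 1 = l
    · subst h0; simp
    · rw [if_neg (by omega), if_neg h0, if_neg (by omega)]
      simp [Pi.single_apply, show u + 1 + 1 ≠ u by omega]

lemma KK_det {l t u : ℕ} (hl : 2 ≤ l) (ht : t ≤ l) (hu : u ≤ l) (htu : t ≠ u) :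
    KK l t t * KK l u u - KK l t u * KK l u t ≠ 0 := by
  unfold KK
  rw [if_pos rfl, if_pos rfl, if_neg htu, if_neg htu.symm]
  by_cases hf : t + 1 < u ∨ u + 1 < t
  · rw [Sys.pr_far ht hu hl hf]
    simp [kap_ne]
  · have ha : t + 1 = u ∨ u + 1 = t := by omega
    rw [pr_adj_val hl ht hu ha, pr_adj_val hl hu ht (by tauto)]
    unfold kap
    split_ifs <;> first | omega | norm_num

lemma step_zero {M : Type*} [AddCommGroup M] [Module ℂ M] (G : ℤ → ℤ → M) (T U Tm Um : M →ₗ[ℂ] M)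
    (a b c d : ℂ) (hdet : a * d - b * c ≠ 0)
    (hT : ∀ n m, T (G n m) = a • G (n+1) m + b • G n (m+1))
    (hU : ∀ n m, U (G n m) = c • G (n+1) m + d • G n (m+1))
    (hTm : ∀ n m, Tm (G n m) = a • G (n-1) m + b • G n (m-1))
    (hUm : ∀ n m, Um (G n m) = c • G (n-1) m + d • G n (m-1))
    (h0 : G 0 0 = 0) (n m : ℤ) : G n m = 0 := by
  have key : ∀ p q : M, a • p + b • q = 0 → c • p + d • q = 0 → p = 0 ∧ q = 0 := by
    intro p q h1 h2
    constructor
    · have : (a * d - b * c) • p = d • (a • p + b • q) - b • (c • p + d • q) := by module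
      rw [h1, h2, smul_zero, smul_zero, sub_zero] at this
      exact (smul_eq_zero.mp this).resolve_left hdet
    · have : (a * d - b * c) • q = a • (c • p + d • q) - c • (a • p + b • q) := by module
      rw [h1, h2, smul_zero, smul_zero, sub_zero] at this
      exact (smul_eq_zero.mp this).resolve_left hdet
  have k1 : ∀ n m, G n m = 0 → G (n+1) m = 0 ∧ G n (m+1) = 0 := fun n m h =>
    key _ _ (by rw [← hT, h, map_zero]) (by rw [← hU, h, map_zero])
  have k2 : ∀ n m, G n m = 0 → G (n-1) m = 0 ∧ G n (m-1) = 0 := fun n m h =>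
    key _ _ (by rw [← hTm, h, map_zero]) (by rw [← hUm, h, map_zero])
  have h1 : G n 0 = 0 := by
    induction n using Int.induction_on with
    | zero => exact h0
    | succ n ih => exact (k1 _ _ ih).1
    | pred n ih => exact (k2 _ _ ih).1
  induction m using Int.induction_on with
  | zero => exact h1
  | succ n ih => exact (k1 _ _ ih).2
  | pred n ih => exact (k2 _ _ ih).2

namespace Sys2
variable {l : ℕ} {L : Type*} [LieRing L] [LieAlgebra ℂ L] (S : Sys2 l L)

lemma xy_zero {t u : ℕ} (ht : t ≤ l) (hu : u ≤ l) (htu : t ≠ u) (n m : ℤ) : ⁅S.x t n, S.y u m⁆ = 0 := by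
  refine step_zero (fun n m => ⁅S.x t n, S.y u m⁆) (ad ℂ L (S.T t)) (ad ℂ L (S.T u)) (ad ℂ L (S.Tm t))
    (ad ℂ L (S.Tm u)) (KK l t t) (-KK l t u) (KK l u t) (-KK l u u) ?_ ?_ ?_ ?_ ?_ (S.xyu t ht u hu htu) n m
  · have := KK_det S.hl ht hu htu
    intro h; apply this; linear_combination -h
  · intro n m; rw [ad_apply, leibniz_lie, S.Tx t ht t ht, S.Ty t ht u hu, smul_lie, lie_smul]
  · intro n m; rw [ad_apply, leibniz_lie, S.Tx u hu t ht, S.Ty u hu u hu, smul_lie, lie_smul]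
  · intro n m; rw [ad_apply, leibniz_lie, S.Tmx t ht t ht, S.Tmy t ht u hu, smul_lie, lie_smul]
  · intro n m; rw [ad_apply, leibniz_lie, S.Tmx u hu t ht, S.Tmy u hu u hu, smul_lie, lie_smul]

lemma xx_far {t u : ℕ} (ht : t ≤ l) (hu : u ≤ l) (h : t + 1 < u ∨ u + 1 < t) (n m : ℤ) :
    ⁅S.x t n, S.x u m⁆ = 0 := by
  refine step_zero (fun n m => ⁅S.x t n, S.x u m⁆) (ad ℂ L (S.T t)) (ad ℂ L (S.T u)) (ad ℂ L (S.Tm t))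
    (ad ℂ L (S.Tm u)) (KK l t t) (KK l t u) (KK l u t) (KK l u u) ?_ ?_ ?_ ?_ ?_ (S.xfar t ht u hu h) n m
  · exact KK_det S.hl ht hu (by omega)
  · intro n m; rw [ad_apply, leibniz_lie, S.Tx t ht t ht, S.Tx t ht u hu, smul_lie, lie_smul]
  · intro n m; rw [ad_apply, leibniz_lie, S.Tx u hu t ht, S.Tx u hu u hu, smul_lie, lie_smul]
  · intro n m; rw [ad_apply, leibniz_lie, S.Tmx t ht t ht, S.Tmx t ht u hu, smul_lie, lie_smul]
  · intro n m; rw [ad_apply, leibniz_lie, S.Tmx u hu t ht, S.Tmx u hu u hu, smul_lie, lie_smul]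

lemma xx_adj1 {t u : ℕ} (ht : t ≤ l) (hu : u ≤ l) (h : t + 1 = u ∨ u + 1 = t) (n m : ℤ) :
    ⁅S.x t (n+1), S.x u m⁆ = ⁅S.x t n, S.x u (m+1)⁆ := by
  rw [← sub_eq_zero]
  refine step_zero (fun n m => ⁅S.x t (n+1), S.x u m⁆ - ⁅S.x t n, S.x u (m+1)⁆)
    (ad ℂ L (S.T t)) (ad ℂ L (S.T u)) (ad ℂ L (S.Tm t))
    (ad ℂ L (S.Tm u)) (KK l t t) (KK l t u) (KK l u t) (KK l u u) ?_ ?_ ?_ ?_ ?_ ?_ n m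
  · exact KK_det S.hl ht hu (by omega)
  · intro n m
    rw [ad_apply, lie_sub, leibniz_lie _ (S.x t (n+1)), leibniz_lie _ (S.x t n), S.Tx t ht t ht, S.Tx t ht t ht, S.Tx t ht u hu, S.Tx t ht u hu]
    simp only [smul_lie, lie_smul]; module
  · intro n m
    rw [ad_apply, lie_sub, leibniz_lie _ (S.x t (n+1)), leibniz_lie _ (S.x t n), S.Tx u hu t ht, S.Tx u hu t ht, S.Tx u hu u hu, S.Tx u hu u hu]
    simp only [smul_lie, lie_smul]; module
  · intro n m
    rw [ad_apply, lie_sub, leibniz_lie _ (S.x t (n+1)), leibniz_lie _ (S.x t n), S.Tmx t ht t ht, S.Tmx t ht t ht, S.Tmx t ht u hu, S.Tmx t ht u hu]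
    simp only [smul_lie, lie_smul, add_sub_right_comm]; module
  · intro n m
    rw [ad_apply, lie_sub, leibniz_lie _ (S.x t (n+1)), leibniz_lie _ (S.x t n), S.Tmx u hu t ht, S.Tmx u hu t ht, S.Tmx u hu u hu, S.Tmx u hu u hu]
    simp only [smul_lie, lie_smul, add_sub_right_comm]; module
  · rw [zero_add, sub_eq_zero]; exact S.xadj t ht u hu h

lemma shift_seq {M : Type*} (F : ℤ → ℤ → M) (h : ∀ n m, F (n+1) m = F n (m+1)) (k n m : ℤ) :
    F (n + k) m = F n (m + k) := by
  induction k using Int.induction_on generalizing n m with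
  | zero => simp
  | succ k ih => rw [← add_assoc, h, ih]; congr 1; ring
  | pred k ih =>
    have := h (n - k - 1) m
    rw [show n + (-(k:ℤ) - 1) = n - k - 1 by ring]
    have h2 := ih n (m - 1)
    rw [show n + -(k:ℤ) = n - k - 1 + 1 by ring, h, sub_add_cancel] at h2
    rw [h2]; congr 1; ring

lemma xx_adj {t u : ℕ} (ht : t ≤ l) (hu : u ≤ l) (h : t + 1 = u ∨ u + 1 = t) (n m : ℤ) :
    ⁅S.x t n, S.x u m⁆ = ⁅S.x t 0, S.x u (n + m)⁆ := by
  have := shift_seq (fun n m => ⁅S.x t n, S.x u m⁆) (S.xx_adj1 ht hu h) n 0 m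
  rw [zero_add] at this
  rw [this, add_comm]

/-- structure constant -/
lemma Jy {s u : ℕ} (hs : s ≤ l) (hu : u ≤ l) (h : s + 1 = u ∨ u + 1 = s) (k p m : ℤ) :
    ⁅S.x s k, ⁅S.y s p, S.y u m⁆⁆ = -(pr l s (sg u 1) : ℂ) • S.y u (k + p + m) := by
  have hsu : s ≠ u := by omega
  have hz : ∀ p m, ⁅S.y s p, S.y u m⁆ = ⁅S.y s 0, S.y u (p + m)⁆ := by
    intro p m
    have := S.dual.xx_adj hs hu h (-p) (-m)
    change ⁅S.y s (- -p), S.y u (- -m)⁆ = ⁅S.y s (-0), S.y u (-(-p + -m))⁆ at this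
    rwa [neg_neg, neg_neg, neg_zero, neg_add, neg_neg, neg_neg] at this
  have hk := kap_ne l s
  have hss : KK l s s = kap l s := by simp [KK]
  have hKu : KK l s u = (pr l s (sg u 1) : ℂ) := by simp [KK, hsu]
  have key : ∀ k m, ⁅S.x s k, ⁅S.y s 0, S.y u m⁆⁆ = -(pr l s (sg u 1) : ℂ) • S.y u (k + m) := by
    intro k
    induction k using Int.induction_on with
    | zero =>
      intro m
      rw [leibniz_lie, S.xy s hs, S.xy_zero hs hu hsu, lie_zero, add_zero, S.wt s hs _ _ _ (S.hy u hu m),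
        pr_neg, zero_add]; push_cast; rfl
    | succ k ih =>
      intro m
      have h1 : ⁅S.T s, ⁅S.x s k, ⁅S.y s 0, S.y u m⁆⁆⁆ =
          (kap l s) • ⁅S.x s (k+1), ⁅S.y s 0, S.y u m⁆⁆ -
            (kap l s + KK l s u) • ⁅S.x s k, ⁅S.y s 0, S.y u (m+1)⁆⁆ := by
        rw [leibniz_lie, leibniz_lie (S.T s) (S.y s 0), S.Tx s hs s hs, S.Ty s hs s hs, S.Ty s hs u hu, hss,
          smul_lie, smul_lie, lie_smul, hz (0+1) m, show 0 + 1 + m = m + 1 by ring, lie_add, lie_smul, lie_smul]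
        module
      rw [ih, ih, lie_smul, S.Ty s hs u hu, hKu] at h1
      rw [← smul_right_inj hk]
      rw [show (k:ℤ) + 1 + m = k + m + 1 by ring]
      rw [← add_assoc] at h1
      linear_combination (norm := module) -h1
    | pred k ih =>
      intro m
      have h1 : ⁅S.Tm s, ⁅S.x s (-k), ⁅S.y s 0, S.y u m⁆⁆⁆ =
          (kap l s) • ⁅S.x s (-k-1), ⁅S.y s 0, S.y u m⁆⁆ -
            (kap l s + KK l s u) • ⁅S.x s (-k), ⁅S.y s 0, S.y u (m-1)⁆⁆ := by
        rw [leibniz_lie, leibniz_lie (S.Tm s) (S.y s 0), S.Tmx s hs s hs, S.Tmy s hs s hs, S.Tmy s hs u hu, hss,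
          smul_lie, smul_lie, lie_smul, hz (0-1) m, show 0 - 1 + m = m - 1 by ring, lie_add, lie_smul, lie_smul]
        module
      rw [ih, ih, lie_smul, S.Tmy s hs u hu, hKu] at h1
      rw [← smul_right_inj hk]
      rw [show -(k:ℤ) - 1 + m = -k + m - 1 by ring]
      rw [← add_sub_assoc] at h1
      linear_combination (norm := module) -h1
  rw [hz, key, add_assoc]

lemma Jx {s u : ℕ} (hs : s ≤ l) (hu : u ≤ l) (h : s + 1 = u ∨ u + 1 = s) (k p m : ℤ) :
    ⁅S.y s k, ⁅S.x s p, S.x u m⁆⁆ = -(pr l s (sg u 1) : ℂ) • S.x u (k + p + m) := by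
  have := S.dual.Jy hs hu h (-k) (-p) (-m)
  change ⁅S.y s (- -k), ⁅S.x s (- -p), S.x u (- -m)⁆⁆ = _ • S.x u (-(-k + -p + -m)) at this
  rwa [neg_neg, neg_neg, neg_neg, show -(-k + -p + -m) = k + p + m by ring] at this

lemma Gx {s u : ℕ} (hs : s ≤ l) (hu : u ≤ l) (h : s + 1 = u ∨ u + 1 = s) (k p m : ℤ) :
    ⁅⁅S.x s k, S.y s p⁆, S.x u m⁆ = (pr l s (sg u 1) : ℂ) • S.x u (k + p + m) := by
  rw [lie_lie, ← lie_skew (S.y s p) (S.x u m), S.xy_zero hu hs (by omega), S.Jx hs hu h, add_comm p k]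
  simp

lemma Gy {s u : ℕ} (hs : s ≤ l) (hu : u ≤ l) (h : s + 1 = u ∨ u + 1 = s) (k p m : ℤ) :
    ⁅⁅S.x s k, S.y s p⁆, S.y u m⁆ = -(pr l s (sg u 1) : ℂ) • S.y u (k + p + m) := by
  rw [lie_lie, S.xy_zero hs hu (by omega), S.Jy hs hu h]
  simp

lemma exU {u : ℕ} (hu : u ≤ l) (k : ℤ) : ∃ U ∈ S.Gr 0 k, (∀ m, ⁅U, S.x u m⁆ = S.x u (m + k)) ∧
    (∀ m, ⁅U, S.y u m⁆ = - S.y u (m + k)) := by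
  have hl := S.hl
  obtain ⟨s, hs, h⟩ : ∃ s, s ≤ l ∧ (s + 1 = u ∨ u + 1 = s) := by
    rcases Nat.eq_zero_or_pos u with h | h
    · exact ⟨1, by omega, by omega⟩
    · exact ⟨u - 1, by omega, by omega⟩
  have hA : (pr l s (sg u 1) : ℂ) ≠ 0 := by
    rw [pr_adj_val hl hs hu h]; split_ifs <;> norm_num
  refine ⟨(pr l s (sg u 1) : ℂ)⁻¹ • ⁅S.x s k, S.y s 0⁆, ?_, ?_, ?_⟩
  · apply Submodule.smul_mem
    have := S.mul _ _ _ _ _ _ (S.hx s hs k) (S.hy s hs 0)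
    rwa [add_neg_cancel, add_zero] at this
  · intro m
    rw [smul_lie, S.Gx hs hu h, smul_smul, inv_mul_cancel₀ hA, one_smul]; congr 1; ring
  · intro m
    rw [smul_lie, S.Gy hs hu h, neg_smul, smul_neg, smul_smul, inv_mul_cancel₀ hA, one_smul]
    congr 2; ring

end Sys2
end
end Ell

namespace Ell
noncomputable section
open LieAlgebra

namespace Sys2
variable {l : ℕ} {L : Type*} [LieRing L] [LieAlgebra ℂ L] (S : Sys2 l L)

lemma self_zero {v : L} (h : v = -v) : v = 0 := by
  have : (2 : ℂ) • v = 0 := by rw [two_smul]; nth_rewrite 1 [h]; simp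
  exact (smul_eq_zero.mp this).resolve_left two_ne_zero

/-- the spanning line at node `t` and level `n` -/
def X (t : ℕ) (n : ℤ) : Submodule ℂ L := Submodule.span ℂ {S.x t n}

lemma x_mem_X (t : ℕ) (n : ℤ) : S.x t n ∈ S.X t n := Submodule.mem_span_singleton_self _

lemma U_X {u : ℕ} {U v : L} {k m : ℤ} (hU : ∀ m, ⁅U, S.x u m⁆ = S.x u (m + k)) (hv : v ∈ S.X u m) :
    ⁅U, v⁆ ∈ S.X u (m + k) := by
  obtain ⟨c, rfl⟩ := Submodule.mem_span_singleton.mp hv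
  rw [lie_smul, hU]
  exact Submodule.smul_mem _ _ (S.x_mem_X _ _)

lemma R1 {u : ℕ} (hu : u < l) (n m : ℤ) : ⁅S.x u n, S.x u m⁆ = 0 := by
  have h1 : ∀ k, ⁅S.x u (k+1), S.x u 0⁆ = ⁅S.x u k, S.x u 1⁆ := by
    intro k
    obtain ⟨U, _, hU, _⟩ := S.exU hu.le k
    have h : ⁅U, ⁅S.x u 1, S.x u 0⁆⁆ = 0 := by rw [S.xself u hu, lie_zero]
    rw [leibniz_lie, hU, hU, zero_add, ← lie_skew (S.x u 1) (S.x u k), add_comm 1 k] at h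
    rwa [← sub_eq_add_neg, sub_eq_zero] at h
  have h2 : ∀ k m, ⁅S.x u (k+1), S.x u m⁆ = ⁅S.x u k, S.x u (m+1)⁆ := by
    intro k m
    obtain ⟨U, _, hU, _⟩ := S.exU hu.le m
    have h : ⁅U, ⁅S.x u (k+1), S.x u 0⁆⁆ = ⁅U, ⁅S.x u k, S.x u 1⁆⁆ := by rw [h1]
    rw [leibniz_lie, leibniz_lie U (S.x u k), hU, hU, hU, hU, zero_add, add_right_comm, h1, add_comm 1 m] at h
    exact add_left_cancel h
  have h3 := shift_seq (fun n m => ⁅S.x u n, S.x u m⁆) h2 (n - m) m m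
  rw [add_sub_cancel] at h3
  apply self_zero
  rw [h3, lie_skew]
  exact h3.symm

/-- brackets at the last node -/
lemma F2 (k n m : ℤ) : ⁅S.x l (n + 2 * k), S.x l m⁆ = ⁅S.x l n, S.x l (m + 2 * k)⁆ := by
  have h1 : ∀ k, ⁅S.x l (k+2), S.x l 0⁆ = ⁅S.x l k, S.x l 2⁆ := by
    intro k
    obtain ⟨U, _, hU, _⟩ := S.exU le_rfl k
    have h : ⁅U, ⁅S.x l 2, S.x l 0⁆⁆ = 0 := by rw [S.xl2, lie_zero]
    rw [leibniz_lie, hU, hU, zero_add, ← lie_skew (S.x l 2) (S.x l k), add_comm 2 k] at h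
    rwa [← sub_eq_add_neg, sub_eq_zero] at h
  have h2 : ∀ k m, ⁅S.x l (k+2), S.x l m⁆ = ⁅S.x l k, S.x l (m+2)⁆ := by
    intro k m
    obtain ⟨U, _, hU, _⟩ := S.exU le_rfl m
    have h : ⁅U, ⁅S.x l (k+2), S.x l 0⁆⁆ = ⁅U, ⁅S.x l k, S.x l 2⁆⁆ := by rw [h1]
    rw [leibniz_lie, leibniz_lie U (S.x l k), hU, hU, hU, hU, zero_add, add_right_comm, h1, add_comm 2 m] at h
    exact add_left_cancel h
  have h3 := shift_seq (fun a b => ⁅S.x l (n + 2 * a), S.x l (m + 2 * b)⁆) (fun a b => by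
    have := h2 (n + 2 * a) (m + 2 * b)
    rwa [show n + 2 * a + 2 = n + 2 * (a + 1) by ring, show m + 2 * b + 2 = m + 2 * (b + 1) by ring] at this) k 0 0
  simpa only [mul_zero, add_zero, zero_add] using h3

lemma F_even {n m : ℤ} (h : Even (n + m)) : ⁅S.x l n, S.x l m⁆ = 0 := by
  obtain ⟨r, hr⟩ := h
  have h3 := S.F2 (r - m) m m
  rw [show m + 2 * (r - m) = n by omega] at h3
  apply self_zero
  rw [h3, lie_skew]
  exact h3.symm

lemma F_odd1 {n m : ℤ} (h : Even m) : ⁅S.x l n, S.x l m⁆ = ⁅S.x l (n + m), S.x l 0⁆ := by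
  obtain ⟨r, hr⟩ := h
  have h3 := S.F2 r n 0
  rw [zero_add, show 2 * r = m by omega] at h3
  exact h3.symm

/-- any bracket at the last node is a multiple of `w`. -/
lemma F_w (n m : ℤ) : ∃ c : ℂ, ⁅S.x l n, S.x l m⁆ = c • ⁅S.x l (n + m), S.x l 0⁆ := by
  rcases Int.even_or_odd m with hm | hm
  · exact ⟨1, by rw [S.F_odd1 hm, one_smul]⟩
  · rcases Int.even_or_odd n with hn | hn
    · refine ⟨-1, ?_⟩
      rw [← lie_skew, S.F_odd1 hn, add_comm m n]; simp
    · exact ⟨0, by rw [S.F_even (hn.add_odd hm), zero_smul]⟩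

lemma U_w_even {U : L} {N k : ℤ} (hU : ∀ m, ⁅U, S.x l m⁆ = S.x l (m + k)) (hk : Even k) :
    ⁅U, ⁅S.x l N, S.x l 0⁆⁆ = (2 : ℂ) • ⁅S.x l (N + k), S.x l 0⁆ := by
  rw [leibniz_lie, hU, hU, zero_add, S.F_odd1 hk, two_smul]

lemma U_w_odd {U : L} {N k : ℤ} (hU : ∀ m, ⁅U, S.x l m⁆ = S.x l (m + k)) (hk : Odd k) (hN : Odd N) :
    ⁅U, ⁅S.x l N, S.x l 0⁆⁆ = 0 := by
  rw [leibniz_lie, hU, hU, zero_add, S.F_even (hN.add_odd hk), S.F_even (by rw [add_zero]; exact hN.add_odd hk), add_zero]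

lemma w_x (N m : ℤ) : ⁅⁅S.x l N, S.x l 0⁆, S.x l m⁆ = 0 := by
  rcases Int.even_or_odd N with hN | hN
  · rw [S.F_even (by simpa using hN), zero_lie]
  have h1 : ∀ m k, Odd k → ⁅⁅S.x l 1, S.x l 0⁆, S.x l m⁆ = 0 → ⁅⁅S.x l 1, S.x l 0⁆, S.x l (m+k)⁆ = 0 := by
    intro m k hk h
    obtain ⟨U, _, hU, _⟩ := S.exU le_rfl k
    have h' : ⁅U, ⁅⁅S.x l 1, S.x l 0⁆, S.x l m⁆⁆ = 0 := by rw [h, lie_zero]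
    rwa [leibniz_lie, S.U_w_odd hU hk odd_one, zero_lie, zero_add, hU] at h'
  have h2 : ∀ m, ⁅⁅S.x l 1, S.x l 0⁆, S.x l m⁆ = 0 := by
    intro m
    rcases Int.even_or_odd m with hm | hm
    · have := h1 _ (m - 1) (by exact hm.sub_odd odd_one) (h1 0 1 odd_one S.xl3)
      rwa [show 0 + 1 + (m - 1) = m by ring] at this
    · have := h1 0 m hm S.xl3
      rwa [zero_add] at this
  obtain ⟨U, _, hU, _⟩ := S.exU le_rfl (N - 1)
  have hk : Even (N - 1) := hN.sub_odd odd_one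
  have h' : ⁅U, ⁅⁅S.x l 1, S.x l 0⁆, S.x l m⁆⁆ = 0 := by rw [h2, lie_zero]
  rw [leibniz_lie, S.U_w_even hU hk, hU, h2, add_zero, add_sub_cancel, smul_lie] at h'
  exact (smul_eq_zero.mp h').resolve_left two_ne_zero

lemma w_y (N m : ℤ) : ⁅⁅S.x l N, S.x l 0⁆, S.y l m⁆ ∈ S.X l (N + m) := by
  rcases Int.even_or_odd N with hN | hN
  · rw [S.F_even (by simpa using hN), zero_lie]; exact Submodule.zero_mem _
  have h1 : ∀ m k, Odd k → ⁅⁅S.x l 1, S.x l 0⁆, S.y l m⁆ ∈ S.X l (1 + m) →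
      ⁅⁅S.x l 1, S.x l 0⁆, S.y l (m+k)⁆ ∈ S.X l (1 + m + k) := by
    intro m k hk h
    obtain ⟨U, _, hU, hU'⟩ := S.exU le_rfl k
    have h' := S.U_X hU h
    rw [leibniz_lie, S.U_w_odd hU hk odd_one, zero_lie, zero_add, hU', lie_neg] at h'
    exact (Submodule.neg_mem_iff _).mp h'
  have h0 : ⁅⁅S.x l 1, S.x l 0⁆, S.y l 0⁆ ∈ S.X l (1 + 0) := by
    rw [S.xly, add_zero]; exact Submodule.smul_mem _ _ (S.x_mem_X _ _)
  have h2 : ∀ m, ⁅⁅S.x l 1, S.x l 0⁆, S.y l m⁆ ∈ S.X l (1 + m) := by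
    intro m
    rcases Int.even_or_odd m with hm | hm
    · have := h1 _ (m - 1) (by exact hm.sub_odd odd_one) (h1 0 1 odd_one h0)
      rwa [show 1 + (m - 1) = m by ring, show 1 + 1 + (m - 1) = 1 + m by ring] at this
    · have := h1 0 m hm h0
      rwa [zero_add, add_zero] at this
  obtain ⟨U, _, hU, hU'⟩ := S.exU le_rfl (N - 1)
  have hk : Even (N - 1) := hN.sub_odd odd_one
  have h' := S.U_X hU (h2 m)
  rw [leibniz_lie, S.U_w_even hU hk, hU', add_sub_cancel, smul_lie, lie_neg] at h'
  have h3 := h2 (m + (N - 1))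
  have h4 := Submodule.add_mem _ h' (by rw [show 1 + m + (N-1) = 1 + (m + (N - 1)) by ring]; exact h3)
  rw [neg_add_cancel_right] at h4
  rw [show N + m = 1 + m + (N - 1) by ring]
  exact (Submodule.smul_mem_iff _ two_ne_zero).mp h4

lemma F_y {u : ℕ} (hu : u ≤ l) (n m p : ℤ) : ⁅⁅S.x u n, S.x u m⁆, S.y u p⁆ ∈ S.X u (n + m + p) := by
  rcases hu.lt_or_eq with h | rfl
  · rw [S.R1 h, zero_lie]; exact Submodule.zero_mem _
  · obtain ⟨c, hc⟩ := S.F_w n m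
    rw [hc, smul_lie]
    exact Submodule.smul_mem _ _ (S.w_y _ _)

lemma R2 {u : ℕ} (hu : u ≤ l) (n p m : ℤ) : ⁅⁅S.x u n, S.y u p⁆, S.x u m⁆ ∈ S.X u (n + p + m) := by
  have g1 : ∀ k, ⁅S.x u k, S.y u 0⁆ = ⁅S.x u 0, S.y u k⁆ := by
    intro k
    obtain ⟨U, hm, hU, hU'⟩ := S.exU hu k
    have h : ⁅U, ⁅S.x u 0, S.y u 0⁆⁆ = 0 := by
      rw [S.xy u hu, ← lie_skew, S.wt u hu _ _ _ hm, Sys.pr_zero]; simp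
    rw [leibniz_lie, hU, hU', zero_add, lie_neg, ← sub_eq_add_neg, sub_eq_zero] at h
    exact h
  have g2 : ∀ k p, (2 : ℂ) • ⁅S.x u (k + p), S.y u 0⁆ = ⁅S.x u k, S.y u p⁆ + ⁅S.x u p, S.y u k⁆ := by
    intro k p
    obtain ⟨U, hm, hU, hU'⟩ := S.exU hu p
    have h : ⁅U, ⁅S.x u k, S.y u 0⁆⁆ = ⁅U, ⁅S.x u 0, S.y u k⁆⁆ := by rw [g1]
    rw [leibniz_lie, leibniz_lie U (S.x u 0), hU, hU, hU', hU', zero_add, lie_neg, lie_neg, ← g1 (k + p)] at h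
    rw [two_smul]
    linear_combination (norm := module) h
  have sw : ∀ n p m, ⁅⁅S.x u n, S.y u p⁆, S.x u m⁆ ∈ S.X u (n + p + m) ↔
      ⁅⁅S.x u m, S.y u p⁆, S.x u n⁆ ∈ S.X u (m + p + n) := by
    intro n p m
    have h : ⁅⁅S.x u n, S.y u p⁆, S.x u m⁆ = ⁅⁅S.x u m, S.y u p⁆, S.x u n⁆ + ⁅⁅S.x u n, S.x u m⁆, S.y u p⁆ := by
      rw [lie_lie (S.x u n) (S.x u m), ← lie_skew (S.x u n) ⁅S.x u m, S.y u p⁆,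
          ← lie_skew (S.x u m) ⁅S.x u n, S.y u p⁆]; abel
    have h3 := S.F_y hu n m p
    rw [show n + m + p = n + p + m by ring] at h3
    rw [h, show m + p + n = n + p + m by ring]
    constructor
    · intro h; simpa using Submodule.sub_mem _ h h3
    · intro h; exact Submodule.add_mem _ h h3
  -- level (k,0,0)
  have a0 : ∀ k, ⁅⁅S.x u k, S.y u 0⁆, S.x u 0⁆ ∈ S.X u (k + 0 + 0) := by
    intro k
    rw [sw, S.xy u hu, S.wt u hu _ _ _ (S.hx u hu k), zero_add, zero_add]
    exact Submodule.smul_mem _ _ (S.x_mem_X _ _)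
  -- symmetric difference
  have a1 : ∀ k p, ⁅⁅S.x u k, S.y u 0⁆, S.x u p⁆ ∈ S.X u (k + p) := by
    intro k p
    -- all four membership statements are equivalent modulo differences
    have e : ∀ n p m, ⁅⁅S.x u n, S.y u p⁆, S.x u m⁆ - ⁅⁅S.x u m, S.y u p⁆, S.x u n⁆ ∈ S.X u (n + m + p) := by
      intro n p m
      have h : ⁅⁅S.x u n, S.y u p⁆, S.x u m⁆ = ⁅⁅S.x u m, S.y u p⁆, S.x u n⁆ + ⁅⁅S.x u n, S.x u m⁆, S.y u p⁆ := by
        rw [lie_lie (S.x u n) (S.x u m), ← lie_skew (S.x u n) ⁅S.x u m, S.y u p⁆,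
          ← lie_skew (S.x u m) ⁅S.x u n, S.y u p⁆]; abel
      rw [h, add_sub_cancel_left]; exact S.F_y hu n m p
    have b1 := e k p 0
    have b2 := e p 0 k
    have b3 := e p k 0
    rw [← g1 p] at b1
    rw [← g1 k] at b3
    have b4 := a0 (k + p)
    have b5 := congrArg (fun v => ⁅v, S.x u 0⁆) (g2 k p)
    simp only [smul_lie, add_lie] at b5
    rw [add_zero, show k + p = p + k by ring] at b1
    rw [add_zero] at b2 b3
    rw [add_zero, add_zero, show k + p = p + k by ring] at b4
    rw [show k + p = p + k by ring] at b5 ⊢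
    have : (2 : ℂ) • ⁅⁅S.x u k, S.y u 0⁆, S.x u p⁆ ∈ S.X u (p + k) := by
      have h := Submodule.sub_mem _ (Submodule.sub_mem _ (Submodule.sub_mem _ (Submodule.smul_mem _ (2:ℂ) b4) b1) b3) b2
      rw [b5] at h
      convert h using 1
      rw [show ∀ v : L, (2:ℂ) • v = v + v from fun v => two_smul _ _]; abel
    exact (Submodule.smul_mem_iff _ two_ne_zero).mp this
  obtain ⟨U, hm, hU, hU'⟩ := S.exU hu p
  have h := S.U_X hU (a1 n m)
  rw [leibniz_lie, leibniz_lie U (S.x u n), hU, hU', hU, zero_add] at h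
  have c1 := a1 (n + p) m
  have c2 := a1 n (m + p)
  rw [show n + p + m = n + m + p by ring] at c1 ⊢
  rw [show n + (m + p) = n + m + p by ring] at c2
  have h := Submodule.sub_mem _ (Submodule.add_mem _ c1 c2) h
  convert h using 1
  rw [lie_neg, add_lie, neg_lie]; abel

end Sys2
end
end Ell

namespace Ell
noncomputable section
open LieAlgebra

lemma eq_of_indep {ι M : Type*} [AddCommGroup M] [Module ℂ M] {A G : ι → Submodule ℂ M}
    (hG : iSupIndep G) (hA : ∀ i, A i ≤ G i) (ht : ⨆ i, A i = ⊤) (i : ι) : G i ≤ A i := by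
  intro v hv
  have h1 : v ∈ A i ⊔ ⨆ (j) (_ : j ≠ i), A j := by rw [← iSup_split_single, ht]; trivial
  obtain ⟨a, ha, b, hb, rfl⟩ := Submodule.mem_sup.mp h1
  have hb1 : b ∈ G i := by simpa using Submodule.sub_mem _ hv (hA i ha)
  have hb2 : b ∈ ⨆ (j) (_ : j ≠ i), G j := (iSup₂_mono fun j _ => hA j) hb
  have : b = 0 := (Submodule.disjoint_def.mp (hG i)) b hb1 hb2
  rw [this, add_zero]; exact ha

namespace Sys2
variable {l : ℕ} {L : Type*} [LieRing L] [LieAlgebra ℂ L] (S : Sys2 l L)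

/-- the full line of node `t` -/
def Xt (t : ℕ) : Submodule ℂ L := Submodule.span ℂ (Set.range (S.x t))
def Yt (t : ℕ) : Submodule ℂ L := Submodule.span ℂ (Set.range (S.y t))

lemma X_le (t : ℕ) (n : ℤ) : S.X t n ≤ S.Xt t := Submodule.span_mono (by rintro _ rfl; exact ⟨n, rfl⟩)
lemma x_Xt (t : ℕ) (n : ℤ) : S.x t n ∈ S.Xt t := Submodule.subset_span ⟨n, rfl⟩
lemma y_Yt (t : ℕ) (n : ℤ) : S.y t n ∈ S.Yt t := Submodule.subset_span ⟨n, rfl⟩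

lemma dual_Xt (t : ℕ) : S.dual.Xt t = S.Yt t := by
  unfold Xt Yt; congr 1; ext v; constructor
  · rintro ⟨n, rfl⟩; exact ⟨-n, rfl⟩
  · rintro ⟨n, rfl⟩; exact ⟨-n, by change S.y t (- -n) = _; rw [neg_neg]⟩
lemma dual_Yt (t : ℕ) : S.dual.Yt t = S.Xt t := by
  unfold Xt Yt; congr 1; ext v; constructor
  · rintro ⟨n, rfl⟩; exact ⟨-n, rfl⟩
  · rintro ⟨n, rfl⟩; exact ⟨-n, by change S.x t (- -n) = _; rw [neg_neg]⟩

def Np : Submodule ℂ L :=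
  sInf {p | (∀ t ≤ l, ∀ n, S.x t n ∈ p) ∧ ∀ t ≤ l, ∀ n, ∀ v ∈ p, ⁅S.x t n, v⁆ ∈ p}

lemma x_Np {t : ℕ} (ht : t ≤ l) (n : ℤ) : S.x t n ∈ S.Np :=
  Submodule.mem_sInf.mpr fun _ hp => hp.1 t ht n
lemma lie_Np {t : ℕ} (ht : t ≤ l) (n : ℤ) {v : L} (hv : v ∈ S.Np) : ⁅S.x t n, v⁆ ∈ S.Np :=
  Submodule.mem_sInf.mpr fun p hp => hp.2 t ht n v (Submodule.mem_sInf.mp hv p hp)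
lemma Np_le {p : Submodule ℂ L} (h1 : ∀ t ≤ l, ∀ n, S.x t n ∈ p)
    (h2 : ∀ t ≤ l, ∀ n, ∀ v ∈ p, ⁅S.x t n, v⁆ ∈ p) : S.Np ≤ p := sInf_le ⟨h1, h2⟩
lemma Np_ind {P : L → Prop} (h0 : P 0) (ha : ∀ u v, P u → P v → P (u + v)) (hs : ∀ (c : ℂ) v, P v → P (c • v))
    (h1 : ∀ t ≤ l, ∀ n, P (S.x t n)) (h2 : ∀ t ≤ l, ∀ n, ∀ v ∈ S.Np, P v → P ⁅S.x t n, v⁆) :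
    ∀ v ∈ S.Np, P v := by
  let p : Submodule ℂ L :=
    { carrier := {v | v ∈ S.Np ∧ P v}
      add_mem' := fun hu hv => ⟨Submodule.add_mem _ hu.1 hv.1, ha _ _ hu.2 hv.2⟩
      zero_mem' := ⟨Submodule.zero_mem _, h0⟩
      smul_mem' := fun c v hv => ⟨Submodule.smul_mem _ c hv.1, hs c v hv.2⟩ }
  intro v hv
  exact (S.Np_le (p := p) (fun t ht n => ⟨S.x_Np ht n, h1 t ht n⟩)
    (fun t ht n v hv => ⟨S.lie_Np ht n hv.1, h2 t ht n v hv.1 hv.2⟩) hv).2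

lemma Xt_Np {t : ℕ} (ht : t ≤ l) : S.Xt t ≤ S.Np := Submodule.span_le.mpr (by rintro _ ⟨n, rfl⟩; exact S.x_Np ht n)
lemma lie_Xt_Np {t : ℕ} (ht : t ≤ l) {u v : L} (hu : u ∈ S.Xt t) (hv : v ∈ S.Np) : ⁅u, v⁆ ∈ S.Np := by
  induction hu using Submodule.span_induction with
  | mem x h => obtain ⟨n, rfl⟩ := h; exact S.lie_Np ht n hv
  | zero => rw [zero_lie]; exact Submodule.zero_mem _
  | add x y _ _ h1 h2 => rw [add_lie]; exact Submodule.add_mem _ h1 h2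
  | smul c x _ h => rw [smul_lie]; exact Submodule.smul_mem _ _ h

def N0 : Submodule ℂ L where
  carrier := {u | u ∈ (⨆ z, S.Gr 0 z) ∧ ∀ t ≤ l, ∀ n, ⁅u, S.x t n⁆ ∈ S.Xt t ∧ ⁅u, S.y t n⁆ ∈ S.Yt t}
  add_mem' := by
    rintro u v ⟨h1, h2⟩ ⟨h3, h4⟩
    refine ⟨Submodule.add_mem _ h1 h3, fun t ht n => ?_⟩
    rw [add_lie, add_lie]
    exact ⟨Submodule.add_mem _ (h2 t ht n).1 (h4 t ht n).1, Submodule.add_mem _ (h2 t ht n).2 (h4 t ht n).2⟩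
  zero_mem' := ⟨Submodule.zero_mem _, fun t ht n => by
    rw [zero_lie, zero_lie]; exact ⟨Submodule.zero_mem _, Submodule.zero_mem _⟩⟩
  smul_mem' := by
    rintro c v ⟨h3, h4⟩
    refine ⟨Submodule.smul_mem _ _ h3, fun t ht n => ?_⟩
    rw [smul_lie, smul_lie]
    exact ⟨Submodule.smul_mem _ _ (h4 t ht n).1, Submodule.smul_mem _ _ (h4 t ht n).2⟩

lemma dual_N0 : S.dual.N0 = S.N0 := by
  ext u
  change (u ∈ (⨆ z, S.Gr (-0) (-z)) ∧ ∀ t ≤ l, ∀ n, ⁅u, S.y t (-n)⁆ ∈ S.dual.Xt t ∧ ⁅u, S.x t (-n)⁆ ∈ S.dual.Yt t) ↔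
    (u ∈ (⨆ z, S.Gr 0 z) ∧ ∀ t ≤ l, ∀ n, ⁅u, S.x t n⁆ ∈ S.Xt t ∧ ⁅u, S.y t n⁆ ∈ S.Yt t)
  have : (⨆ z, S.Gr (-0) (-z)) = ⨆ z, S.Gr 0 z := by
    rw [neg_zero]
    exact Equiv.iSup_comp (g := fun z => S.Gr 0 z) (Equiv.neg ℤ)
  rw [this]
  simp only [dual_Xt, dual_Yt]
  refine and_congr_right fun _ => ⟨fun h t ht n => ?_, fun h t ht n => ?_⟩
  · have := h t ht (-n); rw [neg_neg] at this; exact this.symm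
  · exact (h t ht (-n)).symm

lemma xy_N0_half {s : ℕ} (hs : s ≤ l) (k p : ℤ) (t : ℕ) (ht : t ≤ l) (n : ℤ) :
    ⁅⁅S.x s k, S.y s p⁆, S.x t n⁆ ∈ S.Xt t := by
  rcases eq_or_ne s t with rfl | h
  · exact S.X_le _ _ (S.R2 hs k p n)
  by_cases ha : s + 1 = t ∨ t + 1 = s
  · rw [S.Gx hs ht ha]; exact Submodule.smul_mem _ _ (S.x_Xt _ _)
  · rw [lie_lie, S.xx_far hs ht (by omega), ← lie_skew (S.y s p), S.xy_zero ht hs h.symm]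
    simp

lemma xy_N0 {s : ℕ} (hs : s ≤ l) (k p : ℤ) : ⁅S.x s k, S.y s p⁆ ∈ S.N0 := by
  refine ⟨?_, fun t ht n => ⟨S.xy_N0_half hs k p t ht n, ?_⟩⟩
  · have := S.mul _ _ _ _ _ _ (S.hx s hs k) (S.hy s hs p)
    rw [add_neg_cancel] at this
    exact (le_iSup (fun z => S.Gr 0 z) (k + p)) this
  · have := S.dual.xy_N0_half hs (-p) (-k) t ht (-n)
    rw [dual_Xt] at this
    change ⁅⁅S.y s (- -p), S.x s (- -k)⁆, S.y t (- -n)⁆ ∈ _ at this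
    rw [neg_neg, neg_neg, neg_neg, ← lie_skew (S.y s p), neg_lie] at this
    exact (Submodule.neg_mem_iff _).mp this

lemma xy_N0' {s t : ℕ} (hs : s ≤ l) (ht : t ≤ l) (k p : ℤ) : ⁅S.x s k, S.y t p⁆ ∈ S.N0 := by
  rcases eq_or_ne s t with rfl | h
  · exact S.xy_N0 hs k p
  · rw [S.xy_zero hs ht h]; exact Submodule.zero_mem _

lemma x_N0 {t : ℕ} (ht : t ≤ l) (n : ℤ) {u : L} (hu : u ∈ S.N0) : ⁅S.x t n, u⁆ ∈ S.Np := by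
  rw [← lie_skew]; exact Submodule.neg_mem _ (S.Xt_Np ht (hu.2 t ht n).1)

lemma N0_Np {u v : L} (hu : u ∈ S.N0) (hv : v ∈ S.Np) : ⁅u, v⁆ ∈ S.Np := by
  refine S.Np_ind (P := fun v => ⁅u, v⁆ ∈ S.Np) ?_ ?_ ?_ ?_ ?_ v hv
  · show ⁅u, (0:L)⁆ ∈ S.Np; rw [lie_zero]; exact Submodule.zero_mem _
  · intro a b h1 h2; beta_reduce at *; rw [lie_add]; exact Submodule.add_mem _ h1 h2
  · intro a b h1; beta_reduce at *; rw [lie_smul]; exact Submodule.smul_mem _ _ h1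
  · intro t ht n; exact S.Xt_Np ht (hu.2 t ht n).1
  · intro t ht n v hv h; beta_reduce at *
    rw [leibniz_lie]
    exact Submodule.add_mem _ (S.lie_Xt_Np ht (hu.2 t ht n).1 hv) (S.lie_Np ht n h)

lemma y_Np {t : ℕ} (ht : t ≤ l) (n : ℤ) {v : L} (hv : v ∈ S.Np) : ⁅S.y t n, v⁆ ∈ S.Np ⊔ S.N0 := by
  refine S.Np_ind (P := fun v => ⁅S.y t n, v⁆ ∈ S.Np ⊔ S.N0) ?_ ?_ ?_ ?_ ?_ v hv
  · show ⁅S.y t n, (0:L)⁆ ∈ S.Np ⊔ S.N0; rw [lie_zero]; exact Submodule.zero_mem _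
  · intro a b h1 h2; beta_reduce at *; rw [lie_add]; exact Submodule.add_mem _ h1 h2
  · intro a b h1; beta_reduce at *; rw [lie_smul]; exact Submodule.smul_mem _ _ h1
  · intro u hu m; beta_reduce
    rw [← lie_skew]
    exact Submodule.neg_mem _ (Submodule.mem_sup_right (S.xy_N0' hu ht m n))
  · intro u hu m v hv h; beta_reduce at *
    rw [leibniz_lie]
    apply Submodule.mem_sup_left
    refine Submodule.add_mem _ (S.N0_Np ?_ hv) ?_
    · rw [← lie_skew]; exact Submodule.neg_mem _ (S.xy_N0' hu ht m n)
    · obtain ⟨a, ha, b, hb, h⟩ := Submodule.mem_sup.mp h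
      rw [← h, lie_add]
      exact Submodule.add_mem _ (S.lie_Np hu m ha) (S.x_N0 hu m hb)

def CC : Submodule ℂ L := S.dual.Np ⊔ S.N0 ⊔ S.Np
lemma dual_dual_x (t n) : S.dual.dual.x t n = S.x t n := by change S.x t (- -n) = _; rw [neg_neg]
lemma dual_dual_Np : S.dual.dual.Np = S.Np := by
  unfold Np; simp only [dual_dual_x]
lemma dual_CC : S.dual.CC = S.CC := by
  unfold CC; rw [dual_N0, dual_dual_Np, sup_right_comm, sup_comm S.Np, sup_right_comm]

lemma x_CC {t : ℕ} (ht : t ≤ l) (n : ℤ) {v : L} (hv : v ∈ S.CC) : ⁅S.x t n, v⁆ ∈ S.CC := by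
  obtain ⟨ab, hab, c, hc, rfl⟩ := Submodule.mem_sup.mp hv
  obtain ⟨a, ha, b, hb, rfl⟩ := Submodule.mem_sup.mp hab
  rw [lie_add, lie_add]
  refine Submodule.add_mem _ (Submodule.add_mem _ ?_ ?_) ?_
  · have := S.dual.y_Np ht (-n) ha
    change ⁅S.x t (- -n), a⁆ ∈ _ at this
    rw [neg_neg, dual_N0] at this
    exact Submodule.mem_sup_left this
  · exact Submodule.mem_sup_right (S.x_N0 ht n hb)
  · exact Submodule.mem_sup_right (S.lie_Np ht n hc)

lemma y_CC {t : ℕ} (ht : t ≤ l) (n : ℤ) {v : L} (hv : v ∈ S.CC) : ⁅S.y t n, v⁆ ∈ S.CC := by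
  have := S.dual.x_CC ht (-n) (v := v) (by rwa [dual_CC])
  rw [dual_CC] at this
  change ⁅S.y t (- -n), v⁆ ∈ _ at this
  rwa [neg_neg] at this

lemma Hs_N0 {u : L} (hu : u ∈ S.Hs) : u ∈ S.N0 := by
  refine ⟨(le_iSup (fun z => S.Gr 0 z) 0) (S.H0 u hu), fun t ht n => ?_⟩
  obtain ⟨c, hc⟩ := S.wtH u hu (sg t 1) n
  obtain ⟨d, hd⟩ := S.wtH u hu (-sg t 1) n
  rw [hc _ (S.hx t ht n), hd _ (S.hy t ht n)]
  exact ⟨Submodule.smul_mem _ _ (S.x_Xt _ _), Submodule.smul_mem _ _ (S.y_Yt _ _)⟩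

lemma Hs_Xt {u : L} (hu : u ∈ S.Hs) {t : ℕ} (ht : t ≤ l) {v : L} (hv : v ∈ S.Xt t) : ⁅u, v⁆ ∈ S.Xt t := by
  induction hv using Submodule.span_induction with
  | mem x h => obtain ⟨n, rfl⟩ := h; exact ((S.Hs_N0 hu).2 t ht n).1
  | zero => rw [lie_zero]; exact Submodule.zero_mem _
  | add x y _ _ h1 h2 => rw [lie_add]; exact Submodule.add_mem _ h1 h2
  | smul c x _ h => rw [lie_smul]; exact Submodule.smul_mem _ _ h
lemma Hs_Yt {u : L} (hu : u ∈ S.Hs) {t : ℕ} (ht : t ≤ l) {v : L} (hv : v ∈ S.Yt t) : ⁅u, v⁆ ∈ S.Yt t := by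
  rw [← dual_Xt] at hv ⊢
  exact S.dual.Hs_Xt hu ht hv

lemma N0_Xt {u : L} (hu : u ∈ S.N0) {t : ℕ} (ht : t ≤ l) {v : L} (hv : v ∈ S.Xt t) : ⁅u, v⁆ ∈ S.Xt t := by
  induction hv using Submodule.span_induction with
  | mem x h => obtain ⟨n, rfl⟩ := h; exact (hu.2 t ht n).1
  | zero => rw [lie_zero]; exact Submodule.zero_mem _
  | add x y _ _ h1 h2 => rw [lie_add]; exact Submodule.add_mem _ h1 h2
  | smul c x _ h => rw [lie_smul]; exact Submodule.smul_mem _ _ h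

lemma Hs_N0_N0 {u v : L} (hu : u ∈ S.Hs) (hv : v ∈ S.N0) : ⁅u, v⁆ ∈ S.N0 := by
  have hv' : v ∈ S.dual.N0 := by rwa [dual_N0]
  refine ⟨?_, fun t ht n => ⟨?_, ?_⟩⟩
  · have h : (⨆ z, S.Gr 0 z) ≤ (⨆ z, S.Gr 0 z).comap (ad ℂ L u) := by
      refine iSup_le fun z w hw => ?_
      obtain ⟨c, hc⟩ := S.wtH u hu 0 z
      change ⁅u, w⁆ ∈ (⨆ z, S.Gr 0 z)
      rw [hc w hw]
      exact Submodule.smul_mem _ _ ((le_iSup (fun z => S.Gr 0 z) z) hw)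
    exact h hv.1
  · rw [lie_lie]
    exact Submodule.sub_mem _ (S.Hs_Xt hu ht (hv.2 t ht n).1) (S.N0_Xt hv ht ((S.Hs_N0 hu).2 t ht n).1)
  · rw [lie_lie]
    refine Submodule.sub_mem _ (S.Hs_Yt hu ht (hv.2 t ht n).2) ?_
    rw [← dual_Xt]
    exact S.dual.N0_Xt hv' ht (by rw [dual_Xt]; exact ((S.Hs_N0 hu).2 t ht n).2)

lemma Hs_CC {u v : L} (hu : u ∈ S.Hs) (hv : v ∈ S.CC) : ⁅u, v⁆ ∈ S.CC := by
  obtain ⟨ab, hab, c, hc, rfl⟩ := Submodule.mem_sup.mp hv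
  obtain ⟨a, ha, b, hb, rfl⟩ := Submodule.mem_sup.mp hab
  rw [lie_add, lie_add]
  refine Submodule.add_mem _ (Submodule.add_mem _ ?_ ?_) ?_
  · exact Submodule.mem_sup_left (Submodule.mem_sup_left (S.dual.N0_Np (S.dual.Hs_N0 hu) ha))
  · exact Submodule.mem_sup_left (Submodule.mem_sup_right (S.Hs_N0_N0 hu hb))
  · exact Submodule.mem_sup_right (S.N0_Np (S.Hs_N0 hu) hc)

lemma CC_top : S.CC = ⊤ := by
  let A : LieSubalgebra ℂ L :=
    { carrier := {u | ∀ v ∈ S.CC, ⁅u, v⁆ ∈ S.CC}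
      add_mem' := fun h1 h2 v hv => by rw [add_lie]; exact Submodule.add_mem _ (h1 v hv) (h2 v hv)
      zero_mem' := fun v hv => by rw [zero_lie]; exact Submodule.zero_mem _
      smul_mem' := fun c u h v hv => by rw [smul_lie]; exact Submodule.smul_mem _ _ (h v hv)
      lie_mem' := fun {a b} h1 h2 v hv => by
        rw [lie_lie]; exact Submodule.sub_mem _ (h1 _ (h2 v hv)) (h2 _ (h1 v hv)) }
  have hA : A = ⊤ := S.gen A (fun u hu v hv => S.Hs_CC hu hv) fun t ht =>
    ⟨fun v hv => S.x_CC ht 0 hv, fun v hv => S.y_CC ht 0 hv, fun v hv => S.x_CC ht 1 hv,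
      fun v hv => S.y_CC ht (-1) hv⟩
  have hA' : ∀ u : L, ∀ v ∈ S.CC, ⁅u, v⁆ ∈ S.CC := by
    intro u
    have : u ∈ A := by rw [hA]; trivial
    exact this
  let C : LieSubalgebra ℂ L := { S.CC with lie_mem' := fun {a b} _ h2 => hA' a b h2 }
  have hx : ∀ t ≤ l, ∀ n, S.x t n ∈ S.CC := fun t ht n => Submodule.mem_sup_right (S.x_Np ht n)
  have hy : ∀ t ≤ l, ∀ n, S.y t n ∈ S.CC := fun t ht n =>
    Submodule.mem_sup_left (Submodule.mem_sup_left (by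
      have := S.dual.x_Np ht (-n)
      change S.y t (- -n) ∈ _ at this
      rwa [neg_neg] at this))
  have hC : C = ⊤ := S.gen C (fun u hu => Submodule.mem_sup_left (Submodule.mem_sup_right (S.Hs_N0 hu)))
    fun t ht => ⟨hx t ht _, hy t ht _, hx t ht _, hy t ht _⟩
  rw [eq_top_iff]
  intro v _
  have : v ∈ C := by rw [hC]; trivial
  exact this

end Sys2
end
end Ell

namespace Ell
noncomputable section
open LieAlgebra

lemma sg_apply (t : ℕ) (m : ℤ) (u : ℕ) : sg t m u = if u = t then m else 0 := Pi.single_apply _ _ _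
lemma sg_same (t : ℕ) (m : ℤ) : sg t m t = m := by simp

def Dim1 {M : Type*} [AddCommGroup M] [Module ℂ M] (p : Submodule ℂ M) : Prop :=
  ∀ x ∈ p, ∀ y ∈ p, x ≠ 0 → ∃ c : ℂ, y = c • x

lemma Dim1_of_le_span {M : Type*} [AddCommGroup M] [Module ℂ M] {p : Submodule ℂ M} {v : M}
    (h : p ≤ Submodule.span ℂ {v}) : Dim1 p := by
  intro x hx y hy hne
  obtain ⟨c, rfl⟩ := Submodule.mem_span_singleton.mp (h hx)
  obtain ⟨d, rfl⟩ := Submodule.mem_span_singleton.mp (h hy)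
  have hc : c ≠ 0 := by rintro rfl; simp at hne
  exact ⟨d / c, by rw [smul_smul, div_mul_cancel₀ _ hc]⟩

lemma Dim1_bot {M : Type*} [AddCommGroup M] [Module ℂ M] {p : Submodule ℂ M} (h : p = ⊥) : Dim1 p := by
  intro x hx y hy hne; rw [h] at hx; exact absurd ((Submodule.mem_bot ℂ).mp hx) hne

namespace Sys2
variable {l : ℕ} {L : Type*} [LieRing L] [LieAlgebra ℂ L] (S : Sys2 l L)

def IsPos (n : ℕ → ℤ) (z : ℤ) (v : L) : Prop :=
  (∃ t ≤ l, n = sg t 1 ∧ v = S.x t z) ∨ (n = sg l 2 ∧ v = ⁅S.x l z, S.x l 0⁆) ∨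
  (0 ≤ n ∧ (∀ t > l, n t = 0) ∧ (∃ s ≤ l, ∃ t ≤ l, s ≠ t ∧ 0 < n s ∧ 0 < n t) ∧ v ∈ S.Gr n z)

lemma IsPos.nonneg {n z v} (h : S.IsPos n z v) : 0 ≤ n ∧ ∀ t > l, n t = 0 := by
  rcases h with ⟨t, ht, rfl, _⟩ | ⟨rfl, _⟩ | ⟨h1, h2, _⟩
  · refine ⟨Pi.single_nonneg.mpr (by norm_num), fun u hu => ?_⟩
    rw [sg_apply, if_neg (by omega)]
  · refine ⟨Pi.single_nonneg.mpr (by norm_num), fun u hu => ?_⟩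
    rw [sg_apply, if_neg (by omega)]
  · exact ⟨h1, h2⟩

lemma IsPos.mem {n z v} (h : S.IsPos n z v) : v ∈ S.Gr n z := by
  rcases h with ⟨t, ht, rfl, rfl⟩ | ⟨rfl, rfl⟩ | ⟨h1, h2, _, h⟩
  · exact S.hx t ht z
  · have := S.mul _ _ _ _ _ _ (S.hx l le_rfl z) (S.hx l le_rfl 0)
    rwa [add_zero, ← Pi.single_add] at this
  · exact h

def Ap (n : ℕ → ℤ) (z : ℤ) : Submodule ℂ L := Submodule.span ℂ {v | S.IsPos n z v}

lemma Ap_le (n z) : S.Ap n z ≤ S.Gr n z := Submodule.span_le.mpr fun v hv => IsPos.mem S hv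

lemma lie_IsPos {t : ℕ} (ht : t ≤ l) (k : ℤ) {n z v} (h : S.IsPos n z v) :
    ⁅S.x t k, v⁆ ∈ S.Ap (sg t 1 + n) (k + z) := by
  have hm := S.mul _ _ _ _ _ _ (S.hx t ht k) (IsPos.mem S h)
  have hmix : ∀ s ≤ l, s ≠ t → 0 < n s → ⁅S.x t k, v⁆ ∈ S.Ap (sg t 1 + n) (k + z) := by
    intro s hs hst hp
    obtain ⟨h1, h2⟩ := IsPos.nonneg S h
    refine Submodule.subset_span (Or.inr (Or.inr ⟨?_, ?_, ⟨s, hs, t, ht, hst, ?_, ?_⟩, hm⟩))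
    · exact add_nonneg (Pi.single_nonneg.mpr (by norm_num)) h1
    · intro u hu; rw [Pi.add_apply, h2 u hu, sg_apply, if_neg (by omega), add_zero]
    · rw [Pi.add_apply, sg_apply, if_neg hst, zero_add]; exact hp
    · have := h1 t
      rw [Pi.add_apply, sg_same]; simp only [Pi.zero_apply] at this; omega
  rcases h with ⟨s, hs, rfl, rfl⟩ | ⟨rfl, rfl⟩ | ⟨h1, h2, ⟨s, hs, u, hu, hsu, h3, h4⟩, h⟩
  · rcases eq_or_ne s t with rfl | hst
    · rcases hs.lt_or_eq with h | rfl
      · rw [S.R1 h]; exact Submodule.zero_mem _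
      · obtain ⟨c, hc⟩ := S.F_w k z
        rw [hc]
        refine Submodule.smul_mem _ _ (Submodule.subset_span (Or.inr (Or.inl ⟨?_, rfl⟩)))
        rw [← Pi.single_add]; norm_num
    · exact hmix s hs hst (by simp)
  · rcases eq_or_ne l t with rfl | hst
    · rw [← lie_skew, S.w_x, neg_zero]; exact Submodule.zero_mem _
    · exact hmix l le_rfl hst (by simp)
  · rcases eq_or_ne s t with rfl | hst
    · exact hmix u hu hsu.symm h4
    · exact hmix s hs hst h3

def ApT : Submodule ℂ L := ⨆ p : (ℕ → ℤ) × ℤ, S.Ap p.1 p.2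

lemma lie_Ap {t : ℕ} (ht : t ≤ l) (k : ℤ) {n z v} (h : v ∈ S.Ap n z) :
    ⁅S.x t k, v⁆ ∈ S.Ap (sg t 1 + n) (k + z) := by
  induction h using Submodule.span_induction with
  | mem x h => exact S.lie_IsPos ht k h
  | zero => rw [lie_zero]; exact Submodule.zero_mem _
  | add x y _ _ h1 h2 => rw [lie_add]; exact Submodule.add_mem _ h1 h2
  | smul c x _ h => rw [lie_smul]; exact Submodule.smul_mem _ _ h

lemma Np_ApT : S.Np ≤ S.ApT := by
  apply S.Np_le
  · intro t ht n
    exact (le_iSup (fun p : (ℕ → ℤ) × ℤ => S.Ap p.1 p.2) (sg t 1, n))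
      (Submodule.subset_span (Or.inl ⟨t, ht, rfl, rfl⟩))
  · intro t ht n v hv
    have h : S.ApT ≤ S.ApT.comap (ad ℂ L (S.x t n)) := by
      refine iSup_le fun p w hw => ?_
      change ⁅S.x t n, w⁆ ∈ S.ApT
      exact (le_iSup (fun p : (ℕ → ℤ) × ℤ => S.Ap p.1 p.2) (sg t 1 + p.1, n + p.2)) (S.lie_Ap ht n hw)
    exact h hv

open scoped Classical in
def AA (p : (ℕ → ℤ) × ℤ) : Submodule ℂ L :=
  S.Ap p.1 p.2 ⊔ S.dual.Ap (-p.1) (-p.2) ⊔ (if p.1 = 0 then S.Gr 0 p.2 else ⊥)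

lemma AA_le (p) : S.AA p ≤ S.Gr p.1 p.2 := by
  refine sup_le (sup_le (S.Ap_le _ _) ?_) ?_
  · have := S.dual.Ap_le (-p.1) (-p.2)
    change _ ≤ S.Gr (- -p.1) (- -p.2) at this
    rwa [neg_neg, neg_neg] at this
  · split_ifs with h
    · rw [h]
    · exact bot_le

lemma AA_top : ⨆ p, S.AA p = ⊤ := by
  rw [eq_top_iff, ← S.CC_top]
  refine sup_le (sup_le ?_ ?_) ?_
  · refine S.dual.Np_ApT.trans (iSup_le fun p => ?_)
    refine le_trans ?_ (le_iSup _ (-p.1, -p.2))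
    refine le_trans ?_ (le_sup_of_le_left le_sup_right)
    simp only [neg_neg]; exact le_rfl
  · intro u hu
    have h : (⨆ z, S.Gr 0 z) ≤ ⨆ p, S.AA p := by
      refine iSup_le fun z => ?_
      refine le_trans ?_ (le_iSup _ ((0 : ℕ → ℤ), z))
      refine le_trans ?_ le_sup_right
      rw [if_pos rfl]
    exact h hu.1
  · refine S.Np_ApT.trans (iSup_le fun p => ?_)
    have h1 : S.Ap p.1 p.2 ≤ S.AA p := le_sup_of_le_left le_sup_left
    exact h1.trans (le_iSup S.AA p)

lemma Ap_bot {n : ℕ → ℤ} (z : ℤ) (h : ¬ (0 ≤ n ∧ ∀ t > l, n t = 0)) : S.Ap n z = ⊥ := by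
  unfold Ap
  rw [Submodule.span_eq_bot]
  intro v hv; exact absurd (IsPos.nonneg S hv) h

lemma Gr_pos {n : ℕ → ℤ} {s : ℕ} (hs : 0 < n s) (z : ℤ) : S.Gr n z ≤ S.Ap n z := by
  have h := eq_of_indep S.indep S.AA_le S.AA_top (n, z)
  refine le_trans h ?_
  unfold AA
  rw [S.dual.Ap_bot, if_neg, sup_bot_eq, sup_bot_eq]
  · rintro h0; simp only at h0; rw [h0] at hs; simp at hs
  · rintro ⟨h1, _⟩; have := h1 s; simp at this; omega

lemma S1 {n : ℕ → ℤ} {s : ℕ} (hs : 0 < n s) {z : ℤ} (h : ¬ (0 ≤ n ∧ ∀ t > l, n t = 0)) : S.Gr n z = ⊥ := by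
  have := S.Gr_pos hs z
  rwa [S.Ap_bot z h, le_bot_iff] at this

lemma S1' {n : ℕ → ℤ} {s : ℕ} (hs : n s < 0) {z : ℤ} (h : ¬ (n ≤ 0 ∧ ∀ t > l, n t = 0)) : S.Gr n z = ⊥ := by
  have := S.dual.S1 (n := -n) (s := s) (by simpa using hs) (z := -z) (by simpa using h)
  change S.Gr (- -n) (- -z) = ⊥ at this
  rwa [neg_neg, neg_neg] at this

lemma S2 {t : ℕ} (ht : t ≤ l) {m : ℤ} (hm : 1 ≤ m) (z : ℤ) :
    (∃ v, S.Gr (sg t m) z ≤ Submodule.span ℂ {v}) ∧ (¬ (m = 1 ∨ (m = 2 ∧ t = l)) → S.Gr (sg t m) z = ⊥) := by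
  have h0 := S.Gr_pos (n := sg t m) (s := t) (by rw [sg_same]; omega) z
  have hcase : ∀ v, S.IsPos (sg t m) z v → (m = 1 ∧ v = S.x t z) ∨ (m = 2 ∧ t = l ∧ v = ⁅S.x l z, S.x l 0⁆) := by
    rintro v (⟨s, hs, h1, rfl⟩ | ⟨h1, rfl⟩ | ⟨_, _, ⟨s, hs, u, hu, hsu, h3, h4⟩, _⟩)
    · have e1 := congrFun h1 t
      rw [sg_same, sg_apply] at e1
      split_ifs at e1 with h
      · exact Or.inl ⟨e1, by rw [h]⟩
      · omega
    · have e1 := congrFun h1 t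
      rw [sg_same, sg_apply] at e1
      split_ifs at e1 with h
      · exact Or.inr ⟨e1, h, rfl⟩
      · omega
    · rw [sg_apply] at h3 h4
      split_ifs at h3 h4 with h5 h6
      · omega
      · omega
      · omega
      · omega
  constructor
  · by_cases hm1 : m = 1
    · refine ⟨S.x t z, h0.trans (Submodule.span_mono ?_)⟩
      intro v hv
      rcases hcase v hv with ⟨_, h⟩ | ⟨h, _⟩
      · exact h
      · omega
    · refine ⟨⁅S.x l z, S.x l 0⁆, h0.trans (Submodule.span_mono ?_)⟩
      intro v hv
      rcases hcase v hv with ⟨h, _⟩ | ⟨_, _, h⟩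
      · omega
      · exact h
  · intro h
    rw [← le_bot_iff]
    refine h0.trans (Submodule.span_le.mpr fun v hv => ?_)
    rcases hcase v hv with ⟨h', _⟩ | ⟨h1, h2, _⟩
    · exact absurd (Or.inl h') h
    · exact absurd (Or.inr ⟨h1, h2⟩) h

lemma lemA {t : ℕ} (ht : t ≤ l) (n : ℕ) (hn : 1 ≤ n) (v : L)
    (hv : ⁅S.h t, v⁆ = (n : ℂ) • v) (h : (ad ℂ L (S.y t 0) ^ n) v = 0) : v = 0 := by
  obtain ⟨m, hm⟩ := S.nilx t ht v
  refine sl2_A (S.xy t ht) ?_ ?_ m n v hn hv h hm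
  · rw [S.wt t ht _ _ _ (S.hx t ht 0), Sys.pr_self S.hl ht]; norm_num
  · rw [S.wt t ht _ _ _ (S.hy t ht 0), pr_neg, Sys.pr_self S.hl ht]; norm_num

lemma pow_y_mem {t : ℕ} (ht : t ≤ l) {n z} {v : L} (hv : v ∈ S.Gr n z) (k : ℕ) :
    (ad ℂ L (S.y t 0) ^ k) v ∈ S.Gr (n - (k : ℤ) • sg t 1) z := by
  induction k with
  | zero => simpa using hv
  | succ k ih =>
    rw [pow_succ', Module.End.mul_apply, ad_apply]
    have := S.mul _ _ _ _ _ _ (S.hy t ht 0) ih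
    rw [zero_add] at this
    convert this using 2
    push_cast; module

lemma reflect {t : ℕ} (ht : t ≤ l) {n : ℕ → ℤ} (h : 0 < pr l t n) (z : ℤ) :
    (Dim1 (S.Gr (n - pr l t n • sg t 1) z) → Dim1 (S.Gr n z)) ∧
    (S.Gr (n - pr l t n • sg t 1) z = ⊥ → S.Gr n z = ⊥) := by
  obtain ⟨k, hk⟩ : ∃ k : ℕ, pr l t n = k := ⟨(pr l t n).toNat, by omega⟩
  have hinj : ∀ v ∈ S.Gr n z, (ad ℂ L (S.y t 0) ^ k) v = 0 → v = 0 := by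
    intro v hv h0
    refine S.lemA ht k (by omega) v ?_ h0
    rw [S.wt t ht _ _ _ hv, hk]; norm_cast
  rw [hk]
  constructor
  · intro hd x hx y hy hne
    obtain ⟨c, hc⟩ := hd _ (S.pow_y_mem ht hx k) _ (S.pow_y_mem ht hy k) (fun h0 => hne (hinj x hx h0))
    refine ⟨c, sub_eq_zero.mp (hinj _ (Submodule.sub_mem _ hy (Submodule.smul_mem _ c hx)) ?_)⟩
    rw [map_sub, map_smul, hc, sub_self]
  · intro hb
    rw [eq_bot_iff]
    intro v hv
    refine hinj v hv ?_
    have := S.pow_y_mem ht hv k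
    rw [hb] at this; exact this

end Sys2

def qf (l : ℕ) (n : ℕ → ℤ) : ℤ := ∑ i ∈ Finset.range l, (n i - n (i + 1)) ^ 2

lemma qf_neg (l n) : qf l (-n) = qf l n := by
  unfold qf; refine Finset.sum_congr rfl fun i _ => ?_
  simp only [Pi.neg_apply]; ring

lemma qf_reflect {l : ℕ} (hl : 2 ≤ l) {t : ℕ} (ht : t ≤ l) (n : ℕ → ℤ) :
    qf l (n - pr l t n • sg t 1) = qf l n := by
  generalize hc : pr l t n = c
  have key : qf l (n - c • sg t 1) - qf l n = ∑ i ∈ Finset.range l,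
      ((if i = t then -2 * c * (n t - n (t + 1)) + c ^ 2 else 0) +
        (if i = t - 1 then (if 0 < t then 2 * c * (n (t - 1) - n t) + c ^ 2 else 0) else 0)) := by
    unfold qf
    rw [← Finset.sum_sub_distrib]
    refine Finset.sum_congr rfl fun i _ => ?_
    simp only [Pi.sub_apply, Pi.smul_apply, sg_apply, smul_eq_mul]
    by_cases h1 : i = t
    · subst h1
      by_cases h0 : 0 < i
      · rw [if_pos rfl, if_neg (by omega), if_pos rfl, if_neg (by omega)]; ring
      · rw [if_pos rfl, if_neg (by omega), if_pos rfl, if_neg h0, ite_self]; ring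
    · by_cases h2 : i + 1 = t
      · subst h2
        rw [if_neg h1, if_pos rfl, if_neg h1, if_pos (by omega), if_pos (by omega)]
        simp only [Nat.add_sub_cancel]; ring
      · rw [if_neg h1, if_neg h2, if_neg h1]
        by_cases h3 : i = t - 1
        · rw [if_pos h3, if_neg (by omega)]; ring
        · rw [if_neg h3]; ring
  rw [Finset.sum_add_distrib, Finset.sum_ite_eq', Finset.sum_ite_eq'] at key
  simp only [Finset.mem_range] at key
  rw [← sub_eq_zero, key]
  unfold pr at hc
  split_ifs at hc with h1 h2
  · subst h1
    rw [if_pos (by omega), if_neg (lt_irrefl 0), ite_self, ← hc]; simp only [zero_add]; ring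
  · subst h2
    rw [if_neg (by omega), if_pos (by omega), if_pos (by omega), ← hc]; ring
  · rw [if_pos (by omega), if_pos (by omega), if_pos (by omega), ← hc]; ring

lemma exists_pr_pos {l : ℕ} (hl : 2 ≤ l) {n : ℕ → ℤ} (h : ∃ s ≤ l, ∃ t ≤ l, n s ≠ n t) :
    ∃ t ≤ l, 0 < pr l t n := by
  by_contra! hcon
  have h1 : ∀ t < l, n t ≤ n (t + 1) := by
    intro t
    induction t with
    | zero => intro _; have := hcon 0 (by omega); simp [pr] at this; simpa using this
    | succ t ih =>
      intro ht
      have := hcon (t + 1) ht.le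
      unfold pr at this
      rw [if_neg (by omega), if_neg (by omega)] at this
      simp only [Nat.add_sub_cancel] at this
      have := ih (by omega)
      omega
  have h2 : ∀ t < l, n (t + 1) - n t ≤ 0 := by
    intro t ht
    obtain ⟨k, hk⟩ : ∃ k, l - 1 - t = k := ⟨_, rfl⟩
    induction k generalizing t with
    | zero =>
      have := hcon l le_rfl
      unfold pr at this
      rw [if_neg (by omega), if_pos rfl] at this
      rw [show t = l - 1 by omega, show l - 1 + 1 = l by omega]; omega
    | succ k ih =>
      have h3 := ih (t + 1) (by omega) (by omega)
      have := hcon (t + 1) (by omega)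
      unfold pr at this
      rw [if_neg (by omega), if_neg (by omega)] at this
      simp only [Nat.add_sub_cancel] at this
      omega
  have h3 : ∀ t ≤ l, n t = n 0 := by
    intro t
    induction t with
    | zero => intro _; rfl
    | succ t ih => intro ht; have := ih (by omega); have := h1 t (by omega); have := h2 t (by omega); omega
  obtain ⟨s, hs, t, ht, hne⟩ := h
  exact hne (by rw [h3 s hs, h3 t ht])

namespace Sys2
variable {l : ℕ} {L : Type*} [LieRing L] [LieAlgebra ℂ L] (S : Sys2 l L)

def Clm (n : ℕ → ℤ) : Prop := ∀ z, Dim1 (S.Gr n z) ∧ (Odd (n l) → qf l n ≠ 1 → S.Gr n z = ⊥)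

lemma Clm_bot {n} (h : ∀ z, S.Gr n z = ⊥) : S.Clm n := fun z => ⟨Dim1_bot (h z), fun _ _ => h z⟩

lemma descent_pos (N : ℕ) : ∀ n : ℕ → ℤ, 0 ≤ n → (∀ t > l, n t = 0) → (∃ s ≤ l, ∃ t ≤ l, n s ≠ n t) →
    ∑ t ∈ Finset.range (l + 1), n t = N → S.Clm n := by
  induction N using Nat.strong_induction_on with
  | _ N ih =>
  intro n hn hsup hnc hN
  obtain ⟨t, ht, hpos⟩ := exists_pr_pos S.hl hnc
  by_cases hsing : ∀ s ≤ l, s ≠ t → n s = 0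
  · have hnt : n = sg t (n t) := by
      funext s
      rw [sg_apply]
      split_ifs with h
      · rw [h]
      · by_cases hs : s ≤ l
        · exact hsing s hs h
        · exact hsup s (by omega)
    have h1 : 1 ≤ n t := by
      rw [hnt, Sys.pr_self S.hl ht] at hpos; omega
    intro z
    generalize n t = m at *
    subst hnt
    obtain ⟨⟨v, hv⟩, hb⟩ := S.S2 ht h1 z
    refine ⟨Dim1_of_le_span hv, fun ho hq => hb ?_⟩
    rintro (rfl | ⟨rfl, rfl⟩)
    · rw [sg_apply] at ho
      split_ifs at ho with h
      · subst h
        apply hq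
        unfold qf
        rw [Finset.sum_eq_single (l - 1)]
        · rw [sg_apply, sg_apply, if_neg (by have := S.hl; omega), if_pos (by have := S.hl; omega)]; norm_num
        · intro i hi hne
          rw [Finset.mem_range] at hi
          rw [sg_apply, sg_apply, if_neg (by omega), if_neg (by omega)]; norm_num
        · intro h; exact absurd (Finset.mem_range.mpr (by have := S.hl; omega)) h
      · simp at ho
    · rw [sg_same] at ho; revert ho; decide
  · push Not at hsing
    obtain ⟨s, hs, hst, hs0⟩ := hsing
    have hsp : 0 < n s := lt_of_le_of_ne (hn s) (Ne.symm hs0)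
    set n' := n - pr l t n • sg t 1 with hn'
    have hn's : n' s = n s := by
      simp [hn', sg_apply, hst]
    have hn't : n' t = n t - pr l t n := by simp [hn']
    have hC : S.Clm n' := by
      by_cases h0 : 0 ≤ n'
      · have hsum : ∑ i ∈ Finset.range (l + 1), n' i = N - pr l t n := by
          simp only [hn', Pi.sub_apply, Finset.sum_sub_distrib, hN, Pi.smul_apply, smul_eq_mul]
          simp only [sg_apply]
          rw [← Finset.mul_sum, Finset.sum_ite_eq', if_pos (by simp; omega), mul_one]
        have hnn : 0 ≤ ∑ i ∈ Finset.range (l + 1), n' i := Finset.sum_nonneg fun i _ => h0 i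
        refine ih ((N : ℤ) - pr l t n).toNat (by omega) n' h0 ?_ ?_ (by omega)
        · intro u hu
          simp [hn', sg_apply, hsup u hu]; omega
        · by_contra! hconst
          have h1 : pr l t n' = - pr l t n := by
            rw [hn', sub_eq_add_neg, pr_add, pr_neg]
            have : pr l t n • sg t 1 = sg t (pr l t n) := by
              rw [← Pi.single_smul]; simp
            rw [this, Sys.pr_self S.hl ht]; ring
          have h2 : pr l t n' = 0 := by
            have hl := S.hl
            unfold pr
            split_ifs with h3 h4
            · rw [hconst 0 (by omega) 1 (by omega)]; ring
            · rw [hconst l (by omega) (l-1) (by omega)]; ring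
            · rw [hconst (t-1) (by omega) t (by omega), hconst (t+1) (by omega) t (by omega)]; ring
          omega
      · exact S.Clm_bot fun z => S.S1 (s := s) (by omega) (fun h => h0 h.1)
    intro z
    obtain ⟨r1, r2⟩ := S.reflect ht hpos z
    refine ⟨r1 (hC z).1, fun ho hq => r2 ((hC z).2 ?_ ?_)⟩
    · rcases eq_or_ne t l with rfl | h
      · rw [hn't]
        have : Even (pr t t n) := by
          unfold pr; rw [if_neg (by have := S.hl; omega), if_pos rfl]; exact ⟨n t - n (t-1), by ring⟩
        exact ho.sub_even this
      · have : n' l = n l := by simp [hn', sg_apply, h.symm]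
        rwa [this]
    · rw [hn', qf_reflect S.hl ht]; exact hq

lemma descent_pos' {n : ℕ → ℤ} (hnc : ∃ s ≤ l, ∃ t ≤ l, n s ≠ n t) (h0 : ∃ s, 0 < n s) : S.Clm n := by
  obtain ⟨s, hs⟩ := h0
  by_cases h : 0 ≤ n ∧ ∀ t > l, n t = 0
  · exact S.descent_pos (∑ t ∈ Finset.range (l + 1), n t).toNat n h.1 h.2 hnc (by
      have : 0 ≤ ∑ t ∈ Finset.range (l + 1), n t := Finset.sum_nonneg fun i _ => h.1 i
      omega)
  · exact S.Clm_bot fun z => S.S1 hs h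

theorem descent {n : ℕ → ℤ} (hnc : ∃ s ≤ l, ∃ t ≤ l, n s ≠ n t) : S.Clm n := by
  by_cases h : ∃ s, 0 < n s
  · exact S.descent_pos' hnc h
  · push Not at h
    have h2 : ∃ s, 0 < (-n) s := by
      by_contra! h'
      obtain ⟨s, _, t, _, hne⟩ := hnc
      have h1 := h' s; have h2 := h' t; have h3 := h s; have h4 := h t
      simp only [Pi.neg_apply] at h1 h2
      omega
    have := S.dual.descent_pos' (n := -n) (by
      obtain ⟨s, hs, t, ht, hne⟩ := hnc
      exact ⟨s, hs, t, ht, by simpa using hne⟩) h2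
    intro z
    have := this (-z)
    change Dim1 (S.Gr (- -n) (- -z)) ∧ (Odd ((-n) l) → qf l (-n) ≠ 1 → S.Gr (- -n) (- -z) = ⊥) at this
    rw [neg_neg, neg_neg, qf_neg, Pi.neg_apply, odd_neg] at this
    exact this

end Sys2
end
end Ell

namespace Ell
noncomputable section
open LieAlgebra

/-- data for a one-dimensional central extension of an associative algebra with derivation and trace -/
structure Coc (A : Type*) [Ring A] [Algebra ℂ A] where
  D : A →ₗ[ℂ] A
  t : A →ₗ[ℂ] ℂ
  D_mul : ∀ a b, D (a * b) = D a * b + a * D b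
  t_comm : ∀ a b, t (a * b) = t (b * a)
  t_D : ∀ a, t (D a) = 0

variable {A : Type*} [Ring A] [Algebra ℂ A]

def Coc.Ext (c : Coc A) : Type _ := A × ℂ

namespace Coc
variable (c : Coc A)
instance : AddCommGroup c.Ext := inferInstanceAs (AddCommGroup (A × ℂ))
instance : Module ℂ c.Ext := inferInstanceAs (Module ℂ (A × ℂ))

def psi (a b : A) : ℂ := c.t (c.D a * b)

lemma psi_add_left (a b d : A) : c.psi (a + b) d = c.psi a d + c.psi b d := by
  simp [psi, add_mul]
lemma psi_add_right (a b d : A) : c.psi a (b + d) = c.psi a b + c.psi a d := by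
  simp [psi, mul_add]
lemma psi_sub_left (a b d : A) : c.psi (a - b) d = c.psi a d - c.psi b d := by
  simp [psi, sub_mul]
lemma psi_sub_right (a b d : A) : c.psi a (b - d) = c.psi a b - c.psi a d := by
  simp [psi, mul_sub]
lemma psi_smul_left (x : ℂ) (a d : A) : c.psi (x • a) d = x * c.psi a d := by
  simp [psi]
lemma psi_smul_right (x : ℂ) (a d : A) : c.psi a (x • d) = x * c.psi a d := by
  simp [psi]
lemma psi_skew (a b : A) : c.psi a b = - c.psi b a := by
  have := c.t_D (a * b)
  rw [c.D_mul, map_add, c.t_comm a] at this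
  unfold psi
  linear_combination this
lemma psi_self (a : A) : c.psi a a = 0 := by
  have := c.psi_skew a a
  linear_combination (1/2 : ℂ) * this

instance : Bracket c.Ext c.Ext := ⟨fun u v => (u.1 * v.1 - v.1 * u.1, c.psi u.1 v.1)⟩

lemma lie_def (u v : c.Ext) : ⁅u, v⁆ = ((u.1 * v.1 - v.1 * u.1, c.psi u.1 v.1) : A × ℂ) := rfl

instance : LieRing c.Ext where
  add_lie u v w := by
    refine Prod.ext ?_ ?_
    · change (u.1 + v.1) * w.1 - w.1 * (u.1 + v.1) = (u.1 * w.1 - w.1 * u.1) + (v.1 * w.1 - w.1 * v.1)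
      noncomm_ring
    · exact c.psi_add_left _ _ _
  lie_add u v w := by
    refine Prod.ext ?_ ?_
    · change u.1 * (v.1 + w.1) - (v.1 + w.1) * u.1 = (u.1 * v.1 - v.1 * u.1) + (u.1 * w.1 - w.1 * u.1)
      noncomm_ring
    · exact c.psi_add_right _ _ _
  lie_self u := by
    refine Prod.ext ?_ ?_
    · exact sub_self _
    · exact c.psi_self _
  leibniz_lie u v w := by
    refine Prod.ext ?_ ?_
    · change u.1 * (v.1 * w.1 - w.1 * v.1) - (v.1 * w.1 - w.1 * v.1) * u.1 =
        ((u.1 * v.1 - v.1 * u.1) * w.1 - w.1 * (u.1 * v.1 - v.1 * u.1)) +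
        (v.1 * (u.1 * w.1 - w.1 * u.1) - (u.1 * w.1 - w.1 * u.1) * v.1)
      noncomm_ring
    · change c.psi u.1 (v.1 * w.1 - w.1 * v.1) =
        c.psi (u.1 * v.1 - v.1 * u.1) w.1 + c.psi v.1 (u.1 * w.1 - w.1 * u.1)
      unfold psi
      simp only [map_sub, c.D_mul, sub_mul, mul_sub, add_mul, map_add, ← mul_assoc]
      have h1 := c.t_comm (c.D u.1 * w.1) v.1
      have h2 := c.t_comm u.1 (c.D v.1 * w.1)
      simp only [← mul_assoc] at h1 h2
      linear_combination - h1 - h2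

instance : LieAlgebra ℂ c.Ext where
  lie_smul x u v := by
    refine Prod.ext ?_ ?_
    · change u.1 * (x • v.1) - (x • v.1) * u.1 = x • (u.1 * v.1 - v.1 * u.1)
      simp [smul_sub]
    · exact c.psi_smul_right _ _ _

def of (a : A) : c.Ext := ((a, 0) : A × ℂ)

lemma of_smul (x : ℂ) (a : A) : c.of (x • a) = x • c.of a := by
  refine Prod.ext rfl ?_; change (0:ℂ) = x • 0; simp
lemma of_add (a b : A) : c.of (a + b) = c.of a + c.of b := by
  refine Prod.ext rfl ?_; change (0:ℂ) = 0 + 0; simp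
lemma of_sub (a b : A) : c.of (a - b) = c.of a - c.of b := by
  refine Prod.ext rfl ?_; change (0:ℂ) = 0 - 0; simp
lemma of_zero : c.of 0 = 0 := rfl

lemma lie_of (a b : A) (h : c.psi a b = 0) : ⁅c.of a, c.of b⁆ = c.of (a * b - b * a) := by
  refine Prod.ext rfl ?_; exact h

lemma nil_of {a : A} {N : ℕ} (h : a ^ N = 0) (v : c.Ext) : ∃ n, (ad ℂ c.Ext (c.of a) ^ n) v = 0 := by
  have h1 : ∀ (k : ℕ) (w : c.Ext), ((ad ℂ c.Ext (c.of a) ^ k) w).1 =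
      ((LinearMap.mulLeft ℂ a - LinearMap.mulRight ℂ a) ^ k) w.1 := by
    intro k
    induction k with
    | zero => intro w; rfl
    | succ k ih => intro w; rw [pow_succ, pow_succ]; exact ih _
  have h2 : IsNilpotent (LinearMap.mulLeft ℂ a - LinearMap.mulRight ℂ a) := by
    apply Commute.isNilpotent_sub
    · exact LinearMap.commute_mulLeft_right ..
    · exact ⟨N, by rw [LinearMap.pow_mulLeft, h]; ext; simp⟩
    · exact ⟨N, by rw [LinearMap.pow_mulRight, h]; ext; simp⟩
  obtain ⟨k, hk⟩ := h2
  refine ⟨k + 1, ?_⟩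
  rw [pow_succ', Module.End.mul_apply, ad_apply, lie_def]
  have := h1 k v
  rw [hk] at this
  rw [this]
  refine Prod.ext ?_ ?_
  · simp; rfl
  · simp [psi]; rfl

end Coc
end
end Ell

namespace Ell
noncomputable section
open LieAlgebra

section loop
variable (I : Type) [Fintype I] [DecidableEq I]
abbrev LM : Type := AddMonoidAlgebra (Matrix I I ℂ) (ℤ × ℤ)

variable {I}
/-- homogeneous element -/
def mo (g : ℤ × ℤ) (M : Matrix I I ℂ) : LM I := AddMonoidAlgebra.single g M

lemma mo_mul (g h : ℤ × ℤ) (M M' : Matrix I I ℂ) : mo g M * mo h M' = mo (g + h) (M * M') :=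
  AddMonoidAlgebra.single_mul_single ..
lemma mo_smul (c : ℂ) (g : ℤ × ℤ) (M : Matrix I I ℂ) : mo g (c • M) = c • mo g M :=
  (AddMonoidAlgebra.smul_single ..).symm
lemma mo_add (g : ℤ × ℤ) (M M' : Matrix I I ℂ) : mo g (M + M') = mo g M + mo g M' :=
  AddMonoidAlgebra.single_add ..
lemma mo_zero (g : ℤ × ℤ) : mo g (0 : Matrix I I ℂ) = 0 :=
  AddMonoidAlgebra.single_zero ..
lemma mo_sub (g : ℤ × ℤ) (M M' : Matrix I I ℂ) : mo g (M - M') = mo g M - mo g M' := by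
  rw [eq_sub_iff_add_eq, ← mo_add, sub_add_cancel]

/-- coefficient -/
def cf (g : ℤ × ℤ) : LM I →ₗ[ℂ] Matrix I I ℂ where
  toFun x := x.coeff g
  map_add' x y := by simp
  map_smul' x y := by simp

lemma cf_mo (g h : ℤ × ℤ) (M : Matrix I I ℂ) : cf g (mo h M) = if h = g then M else 0 := by
  change (AddMonoidAlgebra.single h M).coeff g = _
  rw [AddMonoidAlgebra.coeff_single, Finsupp.single_apply]
lemma cf_mo_same (g : ℤ × ℤ) (M : Matrix I I ℂ) : cf g (mo g M) = M := by
  rw [cf_mo, if_pos rfl]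

lemma LM_ind {p : LM I → Prop} (x : LM I) (h0 : p 0) (ha : ∀ x y, p x → p y → p (x + y))
    (hm : ∀ g M, p (mo g M)) : p x :=
  AddMonoidAlgebra.induction_linear x h0 ha hm

def chi (P z : ℤ) (g : ℤ × ℤ) : ℂ := z * g.1 - P * g.2

def dD (P z : ℤ) : LM I →ₗ[ℂ] LM I where
  toFun x := AddMonoidAlgebra.ofCoeff (Finsupp.onFinset x.coeff.support
    (fun g => chi P z g • x.coeff g) (by
      intro g hg
      rw [Finsupp.mem_support_iff]
      intro h
      apply hg
      rw [h, smul_zero]))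
  map_add' x y := by
    ext g : 2
    simp [Finsupp.onFinset_apply]
  map_smul' c x := by
    ext g : 2
    simp [Finsupp.onFinset_apply, smul_comm c]

lemma cf_dD (P z : ℤ) (g : ℤ × ℤ) (x : LM I) : cf g (dD P z x) = chi P z g • cf g x := rfl

lemma cf_ext {x y : LM I} (h : ∀ g, cf g x = cf g y) : x = y := by
  ext g : 2
  exact h g

lemma dD_mo (P z : ℤ) (g : ℤ × ℤ) (M : Matrix I I ℂ) : dD P z (mo g M) = chi P z g • mo g M := by
  apply cf_ext
  intro h
  rw [cf_dD, map_smul, cf_mo]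
  split_ifs with h1
  · rw [h1]
  · rw [smul_zero, smul_zero]

def tT (P z : ℤ) : LM I →ₗ[ℂ] ℂ := (Matrix.traceLinearMap I ℂ ℂ) ∘ₗ cf (P, z)

lemma tT_mo (P z : ℤ) (g : ℤ × ℤ) (M : Matrix I I ℂ) :
    tT P z (mo g M) = if g = (P, z) then M.trace else 0 := by
  unfold tT
  rw [LinearMap.comp_apply, cf_mo]
  split_ifs
  · rfl
  · rw [map_zero]

def coc (I : Type) [Fintype I] [DecidableEq I] (P z : ℤ) : Coc (LM I) where
  D := dD P z
  t := tT P z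
  D_mul a b := by
    refine LM_ind (p := fun a => dD P z (a * b) = dD P z a * b + a * dD P z b) a ?_ ?_ ?_
    · simp
    · intro x y hx hy
      rw [add_mul, map_add, hx, hy, map_add]; noncomm_ring
    intro g M
    refine LM_ind (p := fun b => dD P z (mo g M * b) = dD P z (mo g M) * b + mo g M * dD P z b) b ?_ ?_ ?_
    · simp
    · intro x y hx hy
      rw [mul_add, map_add, hx, hy, map_add]; noncomm_ring
    intro h M'
    rw [mo_mul, dD_mo, dD_mo, dD_mo, smul_mul_assoc, mul_smul_comm, mo_mul, ← add_smul]
    congr 1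
    unfold chi
    push_cast [Prod.fst_add, Prod.snd_add]
    ring
  t_comm a b := by
    refine LM_ind (p := fun a => tT P z (a * b) = tT P z (b * a)) a ?_ ?_ ?_
    · simp
    · intro x y hx hy
      rw [add_mul, map_add, hx, hy, mul_add, map_add]
    intro g M
    refine LM_ind (p := fun b => tT P z (mo g M * b) = tT P z (b * mo g M)) b ?_ ?_ ?_
    · simp
    · intro x y hx hy
      rw [mul_add, map_add, hx, hy, add_mul, map_add]
    intro h M'
    rw [mo_mul, mo_mul, tT_mo, tT_mo, add_comm h g, Matrix.trace_mul_comm]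
  t_D a := by
    unfold tT
    rw [LinearMap.comp_apply, cf_dD]
    have : chi P z (P, z) = 0 := by unfold chi; ring
    rw [this, zero_smul, map_zero]

end loop
end
end Ell

namespace Ell
noncomputable section
open LieAlgebra

/-- the sign `(-1)^n` -/
def sn (n : ℤ) : ℂ := (-1 : ℂ) ^ n
lemma sn_add (n m : ℤ) : sn (n + m) = sn n * sn m := zpow_add₀ (by norm_num) _ _
lemma sn_zero : sn 0 = 1 := zpow_zero _
lemma sn_one : sn 1 = -1 := zpow_one _
lemma sn_even {n : ℤ} (h : Even n) : sn n = 1 := h.neg_one_zpow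
lemma sn_odd {n : ℤ} (h : Odd n) : sn n = -1 := h.neg_one_zpow
lemma sn_sq (n : ℤ) : sn n * sn n = 1 := by rw [← sn_add]; exact sn_even ⟨n, rfl⟩
lemma sn_neg (n : ℤ) : sn (-n) = sn n := by
  rcases Int.even_or_odd n with h | h
  · rw [sn_even h, sn_even h.neg]
  · rw [sn_odd h, sn_odd h.neg]
lemma sn_sub (n m : ℤ) : sn (n - m) = sn n * sn m := by rw [sub_eq_add_neg, sn_add, sn_neg]
lemma sn_congr {n m : ℤ} (h : Even (n - m)) : sn n = sn m := by
  have := sn_even h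
  rw [sn_sub] at this
  calc sn n = sn n * (sn m * sn m) := by rw [sn_sq, mul_one]
    _ = sn m := by rw [← mul_assoc, this, one_mul]

abbrev Nn (l : ℕ) : ℤ := 2 * (l : ℤ) + 2

lemma ndvd {N x : ℤ} (h : (0 < x ∧ x < N) ∨ (-N < x ∧ x < 0) ∨ (N < x ∧ x < 2 * N)) : ¬ N ∣ x := by
  intro hd
  rcases h with ⟨h1, h2⟩ | ⟨h1, h2⟩ | ⟨h1, h2⟩
  · exact absurd (Int.le_of_dvd h1 hd) (by omega)
  · exact absurd (Int.le_of_dvd (by omega : 0 < -x) ((dvd_neg).2 hd)) (by omega)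
  · exact absurd (Int.le_of_dvd (by omega : 0 < x - N) (dvd_sub hd dvd_rfl)) (by omega)

abbrev ZZ (l : ℕ) : Type := ZMod (4 * l + 4)
instance (l : ℕ) : NeZero (4 * l + 4) := ⟨by omega⟩

lemma zz_eq (l : ℕ) (i j : ℤ) : ((i : ZZ l) = (j : ZZ l)) ↔ 2 * Nn l ∣ i - j := by
  rw [eq_comm, ZMod.intCast_eq_intCast_iff_dvd_sub]
  have : ((4 * l + 4 : ℕ) : ℤ) = 2 * Nn l := by push_cast; unfold Nn; ring
  rw [this]

variable {l : ℕ}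
abbrev sg1 (i j : ℤ) : Matrix (ZZ l) (ZZ l) ℂ := Matrix.single (i : ZZ l) (j : ZZ l) (1:ℂ)

lemma sg1_mul (i j k : ℤ) : (sg1 i j * sg1 j k : Matrix (ZZ l) (ZZ l) ℂ) = sg1 i k := by
  unfold sg1; rw [Matrix.single_mul_single_same, one_mul]
lemma sg1_mul_ne {i j j' k : ℤ} (h : ¬ 2 * Nn l ∣ j - j') :
    (sg1 i j * sg1 j' k : Matrix (ZZ l) (ZZ l) ℂ) = 0 := by
  unfold sg1; rw [Matrix.single_mul_single_of_ne]; rw [Ne, zz_eq]; exact h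

def mx (l : ℕ) (i j n : ℤ) : Matrix (ZZ l) (ZZ l) ℂ :=
  sg1 i j + sn n • sg1 (i + Nn l) (j + Nn l)

lemma two_nd : ¬ 2 * Nn l ∣ Nn l := by
  apply ndvd; left; unfold Nn; omega

lemma mx_mul (i j k n q : ℤ) : mx l i j n * mx l j k q = mx l i k (n + q) := by
  unfold mx
  have h1 : ¬ 2 * Nn l ∣ j - (j + Nn l) := by
    rw [sub_add_cancel_left, dvd_neg]; exact two_nd
  have h2 : ¬ 2 * Nn l ∣ (j + Nn l) - j := by
    rw [add_sub_cancel_left]; exact two_nd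
  rw [add_mul, mul_add, mul_add, sg1_mul, mul_smul_comm, sg1_mul_ne h1, smul_mul_assoc, sg1_mul_ne h2,
    smul_mul_assoc, mul_smul_comm, sg1_mul, smul_smul, ← sn_add]
  simp

lemma mx_mul_ne {i j j' k n q : ℤ} (h : ¬ Nn l ∣ j - j') : mx l i j n * mx l j' k q = 0 := by
  unfold mx
  have h0 : ∀ x : ℤ, Nn l ∣ x - (j - j') → ¬ 2 * Nn l ∣ x := by
    intro x hx hd
    exact h ((dvd_sub_right ((dvd_mul_left _ _).trans hd)).1 hx)
  rw [add_mul, mul_add, mul_add, sg1_mul_ne (h0 _ (by simp)), mul_smul_comm,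
    sg1_mul_ne (h0 _ (by rw [show j - (j' + Nn l) - (j - j') = - Nn l by ring]; exact (dvd_neg).2 dvd_rfl)),
    smul_mul_assoc, sg1_mul_ne (h0 _ (by rw [show j + Nn l - j' - (j - j') = Nn l by ring])),
    smul_mul_assoc, mul_smul_comm, sg1_mul_ne (h0 _ (by simp))]
  simp

lemma mx_shift (i j n : ℤ) : mx l (i + Nn l) (j + Nn l) n = sn n • mx l i j n := by
  unfold mx
  have : ∀ i : ℤ, ((i + Nn l + Nn l : ℤ) : ZZ l) = (i : ZZ l) := by
    intro i; rw [zz_eq]; exact ⟨1, by ring⟩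
  unfold sg1
  rw [this, this, smul_add, smul_smul, sn_sq, one_smul, add_comm]

lemma mx_trace (i j n : ℤ) : (mx l i j n).trace = if 2 * Nn l ∣ i - j then 1 + sn n else 0 := by
  unfold mx sg1
  rw [Matrix.trace_add, Matrix.trace_smul]
  have h2 : (2 * Nn l ∣ i + Nn l - (j + Nn l)) ↔ (2 * Nn l ∣ i - j) := by
    rw [show i + Nn l - (j + Nn l) = i - j by ring]
  split_ifs with h
  · have h' := (zz_eq l i j).2 h
    have h2' := (zz_eq l _ _).2 (h2.2 h)
    rw [h', h2', Matrix.trace_single_eq_same, Matrix.trace_single_eq_same]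
    simp
  · rw [Matrix.trace_single_eq_of_ne, Matrix.trace_single_eq_of_ne]
    · simp
    · rw [Ne, zz_eq, h2]; exact h
    · rw [Ne, zz_eq]; exact h

/-- the basic elements of the loop algebra -/
def ee (l : ℕ) (i j n : ℤ) : LM (ZZ l) := mo (i - j, n) (mx l i j n)

lemma ee_mul (i j k n q : ℤ) : ee l i j n * ee l j k q = ee l i k (n + q) := by
  unfold ee
  rw [mo_mul, mx_mul]
  congr 1
  simp
lemma ee_mul_ne {i j j' k n q : ℤ} (h : ¬ Nn l ∣ j - j') : ee l i j n * ee l j' k q = 0 := by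
  unfold ee
  rw [mo_mul, mx_mul_ne h, mo_zero]
lemma ee_shift (i j n : ℤ) : ee l (i + Nn l) (j + Nn l) n = sn n • ee l i j n := by
  unfold ee
  rw [mx_shift, mo_smul, show i + Nn l - (j + Nn l) = i - j by ring]
lemma ee_shiftr (i j n r : ℤ) : ee l (i + Nn l * r) (j + Nn l * r) n = sn (n * r) • ee l i j n := by
  induction r using Int.induction_on with
  | zero => simp [sn_zero]
  | succ r ih =>
    rw [show i + Nn l * (r + 1) = i + Nn l * r + Nn l by ring, show j + Nn l * (r + 1) = j + Nn l * r + Nn l by ring, ee_shift, ih, smul_smul, mul_add, mul_one, sn_add, mul_comm (sn n)]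
  | pred r ih =>
    have := ee_shift (l := l) (i + Nn l * (-r - 1)) (j + Nn l * (-r - 1)) n
    rw [show i + Nn l * (-r - 1) + Nn l = i + Nn l * (-r) by ring,
      show j + Nn l * (-r - 1) + Nn l = j + Nn l * (-r) by ring, ih] at this
    have h2 := congrArg (fun v => sn n • v) this
    simp only [smul_smul, sn_sq, one_smul] at h2
    rw [← h2, ← sn_add]
    congr 1
    apply sn_congr
    exact ⟨n, by ring⟩

lemma D_ee (P z i j n : ℤ) : dD P z (ee l i j n) = chi P z (i - j, n) • ee l i j n := dD_mo ..
lemma t_ee (P z i j n : ℤ) : tT P z (ee l i j n) =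
    if (i - j, n) = (P, z) then (if 2 * Nn l ∣ i - j then 1 + sn n else 0) else 0 := by
  unfold ee; rw [tT_mo, mx_trace]
lemma t_ee_nd (P z : ℤ) {i j n : ℤ} (h : ¬ Nn l ∣ i - j) : tT P z (ee l i j n) = 0 := by
  rw [t_ee, if_neg (c := 2 * Nn l ∣ i - j), ite_self]
  intro hd; exact h ((dvd_mul_left _ _).trans hd)
lemma t_ee_self {P z : ℤ} (h : ¬ (P = 0 ∧ z = 0)) (i : ℤ) : tT P z (ee l i i 0) = 0 := by
  rw [t_ee, if_neg]
  rw [Prod.mk.injEq]; rintro ⟨h1, h2⟩; exact h ⟨by omega, by omega⟩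

lemma ee_ne (i j n : ℤ) : ee l i j n ≠ 0 := by
  intro h
  have h1 := congrArg (cf (i - j, n)) h
  unfold ee at h1
  rw [cf_mo_same, map_zero] at h1
  have h2 := congrFun (congrFun h1 (i : ZZ l)) (j : ZZ l)
  unfold mx sg1 at h2
  rw [Matrix.add_apply, Matrix.smul_apply, Matrix.single_apply_same, Matrix.single_apply_of_row_ne] at h2
  · simp at h2
  · rw [Ne, zz_eq, add_sub_cancel_left]; exact two_nd

def me (l : ℕ) (i j n : ℤ) : LM (ZZ l) := ee l i j n - ee l (-j) (-i) n

lemma me_refl (i j n : ℤ) : me l (-j) (-i) n = - me l i j n := by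
  unfold me; rw [neg_neg, neg_neg, neg_sub]
lemma me_shiftr (i j n r : ℤ) : me l (i + Nn l * r) (j + Nn l * r) n = sn (n * r) • me l i j n := by
  unfold me
  rw [smul_sub, ee_shiftr, show -(j + Nn l * r) = -j + Nn l * (-r) by ring,
    show -(i + Nn l * r) = -i + Nn l * (-r) by ring, ee_shiftr, mul_neg, sn_neg]

abbrev cc (l : ℕ) (P z : ℤ) : Coc (LM (ZZ l)) := coc (ZZ l) P z

lemma psi_ee (P z i j n : ℤ) (y : LM (ZZ l)) : (cc l P z).psi (ee l i j n) y = chi P z (i - j, n) * tT P z (ee l i j n * y) := by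
  unfold Coc.psi
  change tT P z (dD P z _ * y) = _
  rw [D_ee, smul_mul_assoc, map_smul, smul_eq_mul]
lemma psi_me (P z i j n : ℤ) (y : LM (ZZ l)) : (cc l P z).psi (me l i j n) y = chi P z (i - j, n) * tT P z (me l i j n * y) := by
  unfold me
  rw [Coc.psi_sub_left, psi_ee, psi_ee, sub_mul, map_sub, show -j - -i = i - j by ring]
  ring

/-- lift of `me` to the central extension -/
def mb (l : ℕ) (P z i j n : ℤ) : (cc l P z).Ext := (cc l P z).of (me l i j n)

lemma mb_refl (P z i j n : ℤ) : mb l P z (-j) (-i) n = - mb l P z i j n := by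
  unfold mb
  rw [me_refl, ← neg_one_smul ℂ (me l i j n), Coc.of_smul, neg_one_smul]
lemma mb_shiftr (P z i j n r : ℤ) : mb l P z (i + Nn l * r) (j + Nn l * r) n = sn (n * r) • mb l P z i j n := by
  unfold mb
  rw [me_shiftr, Coc.of_smul]

lemma mb_comm {P z i j n i' j' n' : ℤ} (h1 : ¬ Nn l ∣ j - i') (h2 : ¬ Nn l ∣ j + j')
    (h3 : ¬ Nn l ∣ i + i') (h4 : ¬ Nn l ∣ i - j') : ⁅mb l P z i j n, mb l P z i' j' n'⁆ = 0 := by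
  have a1 : me l i j n * me l i' j' n' = 0 := by
    unfold me
    rw [sub_mul, mul_sub, mul_sub, ee_mul_ne h1, ee_mul_ne (by simpa using h2), ee_mul_ne, ee_mul_ne]
    · simp
    · rw [show -i - -j' = -(i - j') by ring, dvd_neg]; exact h4
    · rw [show -i - i' = -(i + i') by ring, dvd_neg]; exact h3
  have a2 : me l i' j' n' * me l i j n = 0 := by
    unfold me
    rw [sub_mul, mul_sub, mul_sub, ee_mul_ne, ee_mul_ne, ee_mul_ne, ee_mul_ne]
    · simp
    · rw [show -i' - -j = (j - i') by ring]; exact h1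
    · rw [show -i' - i = -(i + i') by ring, dvd_neg]; exact h3
    · rw [show j' - -j = j + j' by ring]; exact h2
    · rw [show j' - i = -(i - j') by ring, dvd_neg]; exact h4
  unfold mb
  rw [Coc.lie_of, a1, a2, sub_zero, Coc.of_zero]
  rw [psi_me, a1, map_zero, mul_zero]

lemma mb_steinberg {P z i j k n q : ℤ} (h1 : ¬ Nn l ∣ i - k) (h2 : ¬ Nn l ∣ j + k)
    (h3 : ¬ Nn l ∣ i + j) : ⁅mb l P z i j n, mb l P z j k q⁆ = mb l P z i k (n + q) := by
  have a1 : me l i j n * me l j k q = ee l i k (n + q) := by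
    unfold me
    rw [sub_mul, mul_sub, mul_sub, ee_mul, ee_mul_ne (by simpa using h2), ee_mul_ne, ee_mul_ne]
    · simp
    · rw [show -i - -k = -(i - k) by ring, dvd_neg]; exact h1
    · rw [show -i - j = -(i + j) by ring, dvd_neg]; exact h3
  have a2 : me l j k q * me l i j n = ee l (-k) (-i) (n + q) := by
    unfold me
    rw [sub_mul, mul_sub, mul_sub, ee_mul, ee_mul_ne, ee_mul_ne, ee_mul_ne]
    · simp [add_comm]
    · rw [show -j - i = -(i + j) by ring, dvd_neg]; exact h3
    · rw [show k - -j = j + k by ring]; exact h2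
    · rw [show k - i = -(i - k) by ring, dvd_neg]; exact h1
  unfold mb
  rw [Coc.lie_of, a1, a2]
  · rfl
  · rw [psi_me, a1, t_ee_nd _ _ h1, mul_zero]

end
end Ell

namespace Ell
noncomputable section
open LieAlgebra

variable {l : ℕ}

def dg (l : ℕ) (d : ℤ → ℂ) : LM (ZZ l) := mo (0, 0) (Matrix.diagonal fun x : ZZ l => d (x.val : ℤ))

def Per (l : ℕ) (d : ℤ → ℂ) : Prop := ∀ k, d (k + Nn l) = d k
lemma Per.mul {d : ℤ → ℂ} (h : Per l d) (k r : ℤ) : d (k + Nn l * r) = d k := by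
  induction r using Int.induction_on with
  | zero => simp
  | succ r ih => rw [show k + Nn l * (r + 1) = k + Nn l * r + Nn l by ring, h, ih]
  | pred r ih => rw [← h, show k + Nn l * (-r - 1) + Nn l = k + Nn l * (-r) by ring, ih]
lemma Per.val {d : ℤ → ℂ} (h : Per l d) (i : ℤ) : d (((i : ZZ l).val : ℤ)) = d i := by
  rw [ZMod.val_intCast]
  have h1 : ((4 * l + 4 : ℕ) : ℤ) = Nn l * 2 := by push_cast; unfold Nn; ring
  rw [h1]
  have h2 := Int.emod_add_mul_ediv i (Nn l * 2)
  rw [← h.mul (i % (Nn l * 2)) (2 * (i / (Nn l * 2))), ← mul_assoc, h2]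

lemma diag_sg1 (f : ZZ l → ℂ) (i j : ℤ) : Matrix.diagonal f * sg1 i j = f i • sg1 i j := by
  unfold sg1
  ext x y
  rw [Matrix.diagonal_mul, Matrix.smul_apply, Matrix.single_apply, smul_eq_mul]
  split_ifs with h
  · rw [h.1]
  · simp
lemma sg1_diag (f : ZZ l → ℂ) (i j : ℤ) : sg1 i j * Matrix.diagonal f = f j • sg1 i j := by
  unfold sg1
  ext x y
  rw [Matrix.mul_diagonal, Matrix.smul_apply, Matrix.single_apply, smul_eq_mul]
  split_ifs with h
  · rw [h.2, mul_comm]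
  · simp

lemma dg_ee {d : ℤ → ℂ} (h : Per l d) (i j n : ℤ) : dg l d * ee l i j n = d i • ee l i j n := by
  unfold dg ee
  rw [mo_mul, ← mo_smul, show ((0, 0) + (i - j, n) : ℤ × ℤ) = (i - j, n) by simp]
  unfold mx
  rw [mul_add, mul_smul_comm, diag_sg1, diag_sg1, h.val, h.val, h, smul_add, smul_comm]
lemma ee_dg {d : ℤ → ℂ} (h : Per l d) (i j n : ℤ) : ee l i j n * dg l d = d j • ee l i j n := by
  unfold dg ee
  rw [mo_mul, ← mo_smul, show ((i - j, n) + (0, 0) : ℤ × ℤ) = (i - j, n) by simp]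
  unfold mx
  rw [add_mul, smul_mul_assoc, sg1_diag, sg1_diag, h.val, h.val, h, smul_add, smul_comm]

lemma psi_dg (P z : ℤ) (d : ℤ → ℂ) (y : LM (ZZ l)) : (cc l P z).psi (dg l d) y = 0 := by
  unfold Coc.psi
  change tT P z (dD P z (mo (0, 0) _) * y) = _
  rw [dD_mo]
  simp [chi]

def hb (l : ℕ) (P z : ℤ) (d : ℤ → ℂ) : (cc l P z).Ext := (cc l P z).of (dg l d)

lemma dg_add (d d' : ℤ → ℂ) : dg l (d + d') = dg l d + dg l d' := by
  unfold dg; rw [← mo_add, Matrix.diagonal_add]; rfl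
lemma dg_smul (c : ℂ) (d : ℤ → ℂ) : dg l (c • d) = c • dg l d := by
  unfold dg; rw [← mo_smul, ← Matrix.diagonal_smul]; rfl
lemma hb_add (P z : ℤ) (d d' : ℤ → ℂ) : hb l P z (d + d') = hb l P z d + hb l P z d' := by
  unfold hb; rw [dg_add, Coc.of_add]
lemma hb_smul (P z : ℤ) (c : ℂ) (d : ℤ → ℂ) : hb l P z (c • d) = c • hb l P z d := by
  unfold hb; rw [dg_smul, Coc.of_smul]
lemma hb_hb (P z : ℤ) (d d' : ℤ → ℂ) : ⁅hb l P z d, hb l P z d'⁆ = 0 := by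
  unfold hb
  rw [Coc.lie_of _ _ _ (psi_dg _ _ _ _)]
  unfold dg
  rw [mo_mul, mo_mul, Matrix.diagonal_mul_diagonal, Matrix.diagonal_mul_diagonal]
  simp only [mul_comm]
  rw [sub_self, Coc.of_zero]
lemma hb_mb {P z : ℤ} {d : ℤ → ℂ} (h : Per l d) (ho : ∀ k, d (-k) = - d k) (i j n : ℤ) :
    ⁅hb l P z d, mb l P z i j n⁆ = (d i - d j) • mb l P z i j n := by
  unfold hb mb
  rw [Coc.lie_of _ _ _ (psi_dg _ _ _ _), ← Coc.of_smul]
  congr 1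
  unfold me
  rw [mul_sub, sub_mul, dg_ee h, dg_ee h, ee_dg h, ee_dg h, ho, ho]
  module

def ind (l : ℕ) (i : ℤ) : ℤ → ℂ := fun k => if Nn l ∣ k - i then 1 else 0

lemma per_ind (i : ℤ) : Per l (ind l i) := by
  intro k
  unfold ind
  have : Nn l ∣ k + Nn l - i ↔ Nn l ∣ k - i := by
    rw [show k + Nn l - i = k - i + Nn l by ring]; exact dvd_add_self_right
  simp only [this]
lemma ind_congr {i j : ℤ} (h : Nn l ∣ i - j) : ind l i = ind l j := by
  funext k
  unfold ind
  have : Nn l ∣ k - i ↔ Nn l ∣ k - j := by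
    rw [show k - j = k - i + (i - j) by ring]; exact (dvd_add_left h).symm
  simp only [this]

lemma Nn_dvd_two {x : ℤ} (h : Nn l ∣ x) : 2 * Nn l ∣ x ∨ 2 * Nn l ∣ x - Nn l := by
  obtain ⟨c, rfl⟩ := h
  rcases Int.even_or_odd' c with ⟨m, rfl | rfl⟩
  · left; exact ⟨m, by ring⟩
  · right; exact ⟨m, by ring⟩

lemma ee_ind (i : ℤ) : ee l i i 0 = dg l (ind l i) := by
  unfold ee dg
  rw [sub_self]
  congr 1
  ext x y
  obtain ⟨x, rfl⟩ := ZMod.intCast_surjective x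
  obtain ⟨y, rfl⟩ := ZMod.intCast_surjective y
  rw [Matrix.diagonal_apply, (per_ind i).val]
  unfold mx sg1 ind
  rw [Matrix.add_apply, Matrix.smul_apply, sn_zero, one_smul, Matrix.single_apply, Matrix.single_apply]
  simp only [zz_eq]
  by_cases h : 2 * Nn l ∣ x - y
  · rw [if_pos h]
    have e1 : 2 * Nn l ∣ i - y ↔ 2 * Nn l ∣ i - x := by
      rw [show i - y = i - x + (x - y) by ring]; exact dvd_add_left h
    have e2 : 2 * Nn l ∣ i + Nn l - y ↔ 2 * Nn l ∣ i + Nn l - x := by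
      rw [show i + Nn l - y = i + Nn l - x + (x - y) by ring]; exact dvd_add_left h
    simp only [e1, e2, and_self]
    by_cases h3 : 2 * Nn l ∣ i - x
    · have h4 : ¬ 2 * Nn l ∣ i + Nn l - x := by
        intro h4
        have := dvd_sub h4 h3
        rw [show i + Nn l - x - (i - x) = Nn l by ring] at this
        exact two_nd this
      have h5 : Nn l ∣ x - i := by
        rw [← dvd_neg, neg_sub]; exact (dvd_mul_left _ _).trans h3
      rw [if_pos h3, if_neg h4, if_pos h5, add_zero]
    · rw [if_neg h3, zero_add]
      congr 1
      apply propext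
      constructor
      · intro h4
        have := (dvd_mul_left (Nn l) 2).trans h4
        rw [show x - i = - (i + Nn l - x) + Nn l by ring]
        exact dvd_add ((dvd_neg).2 this) dvd_rfl
      · intro h4
        rcases Nn_dvd_two h4 with h5 | h5
        · exact absurd (by rw [← dvd_neg, neg_sub]; exact h5) h3
        · rw [← dvd_neg, show -(i + Nn l - x) = x - i - Nn l by ring]; exact h5
  · rw [if_neg h, if_neg, if_neg, add_zero]
    · rintro ⟨h1, h2⟩
      apply h
      have := dvd_sub h2 h1
      rwa [show i + Nn l - y - (i + Nn l - x) = x - y by ring] at this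
    · rintro ⟨h1, h2⟩
      apply h
      have := dvd_sub h2 h1
      rwa [show i - y - (i - x) = x - y by ring] at this

lemma mb_sl2 {P z i j : ℤ} (h0 : ¬ (P = 0 ∧ z = 0)) (h : ¬ Nn l ∣ i + j) (n : ℤ) :
    ⁅mb l P z i j n, mb l P z j i (-n)⁆ = hb l P z (ind l i - ind l j + ind l (-j) - ind l (-i)) := by
  have a1 : me l i j n * me l j i (-n) = ee l i i 0 + ee l (-j) (-j) 0 := by
    unfold me
    rw [sub_mul, mul_sub, mul_sub, ee_mul, ee_mul, ee_mul_ne, ee_mul_ne]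
    · simp
    · rw [show -i - j = -(i + j) by ring, dvd_neg]; exact h
    · rw [show j - -i = (i + j) by ring]; exact h
  have a2 : me l j i (-n) * me l i j n = ee l j j 0 + ee l (-i) (-i) 0 := by
    unfold me
    rw [sub_mul, mul_sub, mul_sub, ee_mul, ee_mul, ee_mul_ne, ee_mul_ne]
    · simp
    · rw [show -j - i = -(i + j) by ring, dvd_neg]; exact h
    · rw [show i - -j = (i + j) by ring]; exact h
  unfold mb hb
  rw [Coc.lie_of, a1, a2]
  · congr 1
    simp only [ee_ind, sub_eq_add_neg]
    simp only [← neg_one_smul ℂ (ind l _), dg_add, dg_smul]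
    module
  · rw [psi_me, a1, map_add, t_ee_self h0, t_ee_self h0]; simp

lemma mb_nil (P z : ℤ) {i j : ℤ} (n : ℤ) (c : ℂ) (h1 : ¬ Nn l ∣ i - j) (h2 : ¬ Nn l ∣ 2 * i ∨ ¬ Nn l ∣ 2 * j)
    (v : (cc l P z).Ext) : ∃ k, (ad ℂ _ (c • mb l P z i j n) ^ k) v = 0 := by
  unfold mb
  rw [← Coc.of_smul]
  apply Coc.nil_of (N := 3)
  rw [smul_pow]
  have : me l i j n ^ 3 = 0 := by
    have q1 : ee l i j n * ee l i j n = 0 := ee_mul_ne (by rw [← dvd_neg, neg_sub]; exact h1)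
    have q2 : ee l (-j) (-i) n * ee l (-j) (-i) n = 0 := ee_mul_ne (by rw [show -i - -j = -(i - j) by ring, dvd_neg]; exact h1)
    unfold me
    rcases h2 with h2 | h2
    · have q3 : ee l (-j) (-i) n * ee l i j n = 0 := ee_mul_ne (by rw [show -i - i = -(2 * i) by ring, dvd_neg]; exact h2)
      simp only [pow_succ, pow_zero, one_mul, sub_mul, mul_sub, mul_assoc, q1, q2, q3]
      simp
    · have q3 : ee l i j n * ee l (-j) (-i) n = 0 := ee_mul_ne (by rw [show j - -j = (2 * j) by ring]; exact h2)
      simp only [pow_succ, pow_zero, one_mul, sub_mul, mul_sub, mul_assoc, q1, q2, q3]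
      simp
  rw [this, smul_zero]

end
end Ell

namespace Ell
noncomputable section
open LieAlgebra

variable {l : ℕ}
def tp (l t : ℕ) (s : Bool) : ℤ := if t = l ∧ s = true then (t : ℤ) + 2 else t + 1
def lv (s : Bool) : ℤ := if s then 1 else 0
def kp (l t : ℕ) (s : Bool) : ℂ := if t = l ∧ s = true then -(1/4) else 1
def ct (l t : ℕ) : ℂ := if t = 0 ∨ t = l then 2 else 1
def kn (l t : ℕ) (s : Bool) : ℂ := if t = l ∧ s = true then -1 else ct l t
def cs (l t : ℕ) (s : Bool) : ℂ := if t = l ∧ s = true then 1 else ct l t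
/-- model generators -/
def gE (l : ℕ) (P z : ℤ) (t : ℕ) (s pos : Bool) : (cc l P z).Ext :=
  if pos then kp l t s • mb l P z (tp l t s) t (lv s) else kn l t s • mb l P z t (tp l t s) (- lv s)

lemma tp_cases (l t : ℕ) (s : Bool) : (t = l ∧ s = true ∧ tp l t s = t + 2) ∨ (¬ (t = l ∧ s = true) ∧ tp l t s = t + 1) := by
  unfold tp
  split_ifs with h
  · left; exact ⟨h.1, h.2, rfl⟩
  · right; exact ⟨h, rfl⟩

lemma gE_nil (hl : 2 ≤ l) (P z : ℤ) {t : ℕ} (ht : t ≤ l) (s pos : Bool) (v : (cc l P z).Ext) :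
    ∃ k, (ad ℂ _ (gE l P z t s pos) ^ k) v = 0 := by
  have key : (¬ Nn l ∣ 2 * (t : ℤ) ∨ ¬ Nn l ∣ 2 * tp l t s) := by
    by_cases h0 : t = 0
    · right
      apply ndvd; left
      rcases tp_cases l t s with ⟨h1, h2, h3⟩ | ⟨h2, h3⟩ <;> rw [h3] <;> unfold Nn <;> omega
    · left
      apply ndvd; left; unfold Nn; omega
  have k2 : ¬ Nn l ∣ tp l t s - t := by
    apply ndvd; left
    rcases tp_cases l t s with ⟨h1, h2, h3⟩ | ⟨h2, h3⟩ <;> rw [h3] <;> unfold Nn <;> omega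
  unfold gE
  split_ifs
  · exact mb_nil _ _ _ _ k2 key.symm _
  · exact mb_nil _ _ _ _ (by rw [← dvd_neg, neg_sub]; exact k2) key _

lemma gE_wt {P z : ℤ} {d : ℤ → ℂ} (h : Per l d) (ho : ∀ k, d (-k) = - d k) (t : ℕ) (s pos : Bool) :
    ⁅hb l P z d, gE l P z t s pos⁆ = ((if pos then 1 else -1) * (d (tp l t s) - d t)) • gE l P z t s pos := by
  unfold gE
  cases pos
  · rw [if_neg (by simp), if_neg (by simp), lie_smul, hb_mb h ho]
    module
  · rw [if_pos rfl, if_pos rfl, lie_smul, hb_mb h ho]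
    module

lemma mb_top (P z : ℤ) : mb l P z (l + 2) l 1 = (2 : ℂ) • (cc l P z).of (ee l (l + 2) l 1) := by
  unfold mb me
  rw [← Coc.of_smul]
  congr 1
  have := ee_shift (l := l) (-l) (-(l + 2)) 1
  rw [show -(l:ℤ) + Nn l = l + 2 by unfold Nn; ring, show -((l:ℤ) + 2) + Nn l = l by unfold Nn; ring, sn_one] at this
  rw [two_smul, sub_eq_add_neg]
  congr 1
  rw [this]; module
lemma mb_bot (P z : ℤ) : mb l P z l (l + 2) (-1) = (2 : ℂ) • (cc l P z).of (ee l l (l + 2) (-1)) := by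
  unfold mb me
  rw [← Coc.of_smul]
  congr 1
  have := ee_shift (l := l) (-(l + 2)) (-l) (-1)
  rw [show -(l:ℤ) + Nn l = l + 2 by unfold Nn; ring, show -((l:ℤ) + 2) + Nn l = l by unfold Nn; ring, sn_neg, sn_one] at this
  rw [two_smul, sub_eq_add_neg]
  congr 1
  rw [this]; module

def dcor (l t : ℕ) (s : Bool) : ℤ → ℂ :=
  cs l t s • (ind l (t + 1) - ind l t + ind l (-t) - ind l (-(t + 1)))

lemma gE_sl2 {P z : ℤ} (h0 : ¬ (P = 0 ∧ z = 0)) {t : ℕ} (ht : t ≤ l) (s : Bool) :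
    ⁅gE l P z t s true, gE l P z t s false⁆ = hb l P z (dcor l t s) := by
  unfold gE
  rw [if_pos rfl, if_neg (by simp), smul_lie, lie_smul]
  unfold dcor
  rw [hb_smul]
  rcases tp_cases l t s with ⟨h1, h2, h3⟩ | ⟨h2, h3⟩
  · subst h1; subst h2
    rw [h3]
    have e1 : kp t t true = -(1/4) := by simp [kp]
    have e2 : kn t t true = -1 := by simp [kn]
    have e3 : cs t t true = 1 := by simp [cs]
    rw [e1, e2, e3, one_smul]
    change -(1/4 : ℂ) • (-1 : ℂ) • ⁅mb t P z (t + 2) t 1, mb t P z t (t + 2) (-1)⁆ = _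
    rw [mb_top, mb_bot, smul_lie, lie_smul, Coc.lie_of, ee_mul, ee_mul]
    · have i1 : ind t ((t:ℤ) + 1) = ind t (-(t + 1)) := ind_congr ⟨1, by unfold Nn; ring⟩
      have i2 : ind t ((t:ℤ) + 2) = ind t (-t) := ind_congr ⟨1, by unfold Nn; ring⟩
      rw [i1, show (1:ℤ) + -1 = 0 by ring, show (-1:ℤ) + 1 = 0 by ring, ee_ind, ee_ind, i2]
      unfold hb
      rw [show ind t (-((t:ℤ) + 1)) - ind t t + ind t (-t) - ind t (-((t:ℤ) + 1)) = ind t (-t) + (-1 : ℂ) • ind t t by module,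
        dg_add, dg_smul, sub_eq_add_neg, ← neg_one_smul ℂ (dg t (ind t t))]
      module
    · rw [psi_ee, ee_mul, show (1:ℤ) + -1 = 0 by ring, t_ee_self h0, mul_zero]
  · rw [h3]
    have e1 : kp l t s = 1 := by simp only [kp]; rw [if_neg h2]
    have e2 : kn l t s = ct l t := by simp only [kn]; rw [if_neg h2]
    have e3 : cs l t s = ct l t := by simp only [cs]; rw [if_neg h2]
    rw [e1, e2, e3, one_smul, mb_sl2 h0]
    apply ndvd; left; unfold Nn; omega


lemma gE_cross (hl : 2 ≤ l) {P z : ℤ} {t u : ℕ} (ht : t ≤ l) (hu : u ≤ l) (htu : t ≠ u) (s s' : Bool) :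
    ⁅gE l P z t s true, gE l P z u s' false⁆ = 0 := by
  unfold gE
  rw [if_pos rfl, if_neg (by simp), smul_lie, lie_smul, mb_comm, smul_zero, smul_zero]
  all_goals
    apply ndvd
    rcases tp_cases l t s with ⟨h1, h2, h3⟩ | ⟨h2, h3⟩ <;> rcases tp_cases l u s' with ⟨h1', h2', h3'⟩ | ⟨h2', h3'⟩ <;>
    unfold Nn <;> omega

lemma gE_same (hl : 2 ≤ l) {P z : ℤ} {t : ℕ} (ht : t ≤ l) (pos : Bool) :
    ⁅gE l P z t false pos, gE l P z t true pos⁆ = 0 := by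
  by_cases h0 : t = 0
  · subst h0
    have e : ∀ s, tp l 0 s = 1 := by
      intro s
      rcases tp_cases l 0 s with ⟨h1, h2, h3⟩ | ⟨h2, h3⟩
      · omega
      · rw [h3]; simp
    cases pos
    · unfold gE
      rw [if_neg (by simp), if_neg (by simp), smul_lie, lie_smul, e, e]
      have : ⁅mb l P z 0 1 0, mb l P z 0 1 (-1)⁆ = 0 := by
        have n1 : ¬ Nn l ∣ (1:ℤ) - 0 := ndvd (by unfold Nn; omega)
        have n2 : ¬ Nn l ∣ (1:ℤ) - (-1) := ndvd (by unfold Nn; omega)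
        have n3 : ¬ Nn l ∣ (0:ℤ) - (-1) := ndvd (by unfold Nn; omega)
        have a1 : ∀ n q, me l 0 1 n * me l 0 1 q = - ee l (-1) 1 (n + q) := by
          intro n q
          unfold me
          rw [neg_zero, sub_mul, mul_sub, mul_sub, ee_mul, ee_mul_ne n1, ee_mul_ne n2, ee_mul_ne n3]
          simp
        unfold mb
        rw [Coc.lie_of, a1, a1, add_comm (0:ℤ), sub_self, Coc.of_zero]
        rw [psi_me, a1, map_neg, t_ee_nd, neg_zero, mul_zero]
        exact ndvd (by unfold Nn; omega)
      change _ • _ • ⁅mb l P z ((0:ℕ):ℤ) 1 (-0), mb l P z ((0:ℕ):ℤ) 1 (-1)⁆ = 0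
      rw [Nat.cast_zero, neg_zero, this, smul_zero, smul_zero]
    · unfold gE
      rw [if_pos rfl, if_pos rfl, smul_lie, lie_smul, e, e]
      have : ⁅mb l P z 1 0 0, mb l P z 1 0 1⁆ = 0 := by
        have n1 : ¬ Nn l ∣ (0:ℤ) - 1 := ndvd (by unfold Nn; omega)
        have n2 : ¬ Nn l ∣ (-1:ℤ) - 1 := ndvd (by unfold Nn; omega)
        have n3 : ¬ Nn l ∣ (-1:ℤ) - 0 := ndvd (by unfold Nn; omega)
        have a1 : ∀ n q, me l 1 0 n * me l 1 0 q = - ee l 1 (-1) (n + q) := by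
          intro n q
          unfold me
          rw [neg_zero, sub_mul, mul_sub, mul_sub, ee_mul, ee_mul_ne n1, ee_mul_ne n2, ee_mul_ne n3]
          simp
        unfold mb
        rw [Coc.lie_of, a1, a1, add_comm (0:ℤ), sub_self, Coc.of_zero]
        rw [psi_me, a1, map_neg, t_ee_nd, neg_zero, mul_zero]
        exact ndvd (by unfold Nn; omega)
      change _ • _ • ⁅mb l P z 1 ((0:ℕ):ℤ) 0, mb l P z 1 ((0:ℕ):ℤ) 1⁆ = 0
      rw [Nat.cast_zero, this, smul_zero, smul_zero]
  · unfold gE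
    cases pos
    · rw [if_neg (by simp), if_neg (by simp), smul_lie, lie_smul, mb_comm, smul_zero, smul_zero]
      all_goals
        apply ndvd
        have h3 : tp l t false = t + 1 := by simp [tp]
        have h4 : (t = l ∧ tp l t true = t + 2) ∨ (t ≠ l ∧ tp l t true = t + 1) := by
          unfold tp; split_ifs with h
          · left; exact ⟨h.1, rfl⟩
          · right; exact ⟨fun h' => h ⟨h', rfl⟩, rfl⟩
        rcases h4 with h4 | h4 <;> unfold Nn <;> omega
    · rw [if_pos rfl, if_pos rfl, smul_lie, lie_smul, mb_comm, smul_zero, smul_zero]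
      all_goals
        apply ndvd
        have h3 : tp l t false = t + 1 := by simp [tp]
        have h4 : (t = l ∧ tp l t true = t + 2) ∨ (t ≠ l ∧ tp l t true = t + 1) := by
          unfold tp; split_ifs with h
          · left; exact ⟨h.1, rfl⟩
          · right; exact ⟨fun h' => h ⟨h', rfl⟩, rfl⟩
        rcases h4 with h4 | h4 <;> unfold Nn <;> omega

lemma gE_pos_lt {P z : ℤ} {t : ℕ} (s : Bool) (h : ¬ (t = l ∧ s = true)) : gE l P z t s true = mb l P z (t + 1) t (lv s) := by
  unfold gE tp kp; rw [if_pos rfl, if_neg h, if_neg h, one_smul]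
lemma gE_neg_lt {P z : ℤ} {t : ℕ} (s : Bool) (h : ¬ (t = l ∧ s = true)) : gE l P z t s false = ct l t • mb l P z t (t + 1) (-lv s) := by
  unfold gE tp kn; rw [if_neg (by simp), if_neg h, if_neg h]

lemma mb_adj {P z : ℤ} {t : ℕ} (hl : 2 ≤ l) (ht : t + 1 ≤ l) (n q : ℤ) :
    ⁅mb l P z (t + 1 + 1) (t + 1) n, mb l P z (t + 1) t q⁆ = mb l P z (t + 1 + 1) t (n + q) := by
  apply mb_steinberg <;> apply ndvd <;> unfold Nn <;> omega
lemma mb_adj' {P z : ℤ} {t : ℕ} (hl : 2 ≤ l) (ht : t + 1 ≤ l) (n q : ℤ) :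
    ⁅mb l P z t (t + 1) n, mb l P z (t + 1) (t + 1 + 1) q⁆ = mb l P z t (t + 1 + 1) (n + q) := by
  apply mb_steinberg <;> apply ndvd <;> unfold Nn <;> omega

lemma gE_sr6 (hl : 2 ≤ l) {P z : ℤ} {t : ℕ} (ht : t + 1 < l) :
    ⁅gE l P z t true true, gE l P z (t+1) false true⁆ = ⁅gE l P z t false true, gE l P z (t+1) true true⁆ ∧
    ⁅gE l P z t true false, gE l P z (t+1) false false⁆ = ⁅gE l P z t false false, gE l P z (t+1) true false⁆ := by
  have n1 : ∀ s, ¬ (t = l ∧ s = true) := by rintro s ⟨h, -⟩; omega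
  have n2 : ∀ s, ¬ (t + 1 = l ∧ s = true) := by rintro s ⟨h, -⟩; omega
  simp only [gE_pos_lt _ (n1 _), gE_pos_lt _ (n2 _), gE_neg_lt _ (n1 _), gE_neg_lt _ (n2 _), smul_lie, lie_smul, Nat.cast_add, Nat.cast_one]
  constructor
  · rw [← lie_skew, mb_adj hl ht.le, ← lie_skew, mb_adj hl ht.le]; simp [lv]
  · rw [mb_adj' hl ht.le, mb_adj' hl ht.le]; simp [lv]

lemma top_br (hl : 2 ≤ l) {P z : ℤ} : ⁅mb l P z (l + 2) l 1, mb l P z l (l - 1) 0⁆ = (2 : ℂ) • mb l P z (l + 2) (l - 1) 1 := by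
  rw [mb_top, smul_lie]
  congr 1
  have b1 : ee l (l+2) l 1 * me l l (l - 1) 0 = ee l (l + 2) (l - 1) 1 := by
    unfold me
    rw [mul_sub, ee_mul, ee_mul_ne, sub_zero]; · rfl
    exact ndvd (by unfold Nn; omega)
  have := ee_shift (l := l) (-l) (-(l + 2)) 1
  rw [show -(l:ℤ) + Nn l = l + 2 by unfold Nn; ring, show -((l:ℤ) + 2) + Nn l = l by unfold Nn; ring, sn_one] at this
  have b2 : me l l (l - 1) 0 * ee l (l+2) l 1 = ee l (-(l - 1)) (-(l + 2)) 1 := by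
    rw [this]
    unfold me
    rw [mul_smul_comm, sub_mul, ee_mul_ne, ee_mul]
    · simp
    exact ndvd (by unfold Nn; omega)
  unfold mb
  rw [Coc.lie_of, b1, b2]
  · rfl
  · rw [psi_ee, b1, t_ee_nd, mul_zero]
    exact ndvd (by unfold Nn; omega)
lemma bot_br (hl : 2 ≤ l) {P z : ℤ} : ⁅mb l P z l (l + 2) (-1), mb l P z (l - 1) l 0⁆ = (-2 : ℂ) • mb l P z (l - 1) (l + 2) (-1) := by
  rw [mb_bot, smul_lie, neg_smul, ← smul_neg]
  congr 1
  have b1 : me l (l - 1) l 0 * ee l l (l+2) (-1) = ee l (l - 1) (l + 2) (-1) := by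
    unfold me
    rw [sub_mul, ee_mul, ee_mul_ne, sub_zero]; · rfl
    exact ndvd (by unfold Nn; omega)
  have := ee_shift (l := l) (-(l + 2)) (-l) (-1)
  rw [show -(l:ℤ) + Nn l = l + 2 by unfold Nn; ring, show -((l:ℤ) + 2) + Nn l = l by unfold Nn; ring, sn_neg, sn_one] at this
  have b2 : ee l l (l+2) (-1) * me l (l - 1) l 0 = ee l (-(l + 2)) (-(l - 1)) (-1) := by
    rw [this]
    unfold me
    rw [smul_mul_assoc, mul_sub, ee_mul_ne, ee_mul]
    · simp
    exact ndvd (by unfold Nn; omega)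
  unfold mb
  rw [Coc.lie_of, b1, b2, ← neg_one_smul ℂ (Coc.of _ _), ← Coc.of_smul]
  · congr 1
    unfold me
    module
  · rw [psi_ee, b2, t_ee_nd, mul_zero]
    exact ndvd (by unfold Nn; omega)

lemma gE_sr6l (hl : 2 ≤ l) {P z : ℤ} :
    (2 : ℂ) • ⁅gE l P z l true true, gE l P z (l-1) false true⁆ =
      ⁅gE l P z l false true, ⁅gE l P z l false true, gE l P z (l-1) true true⁆⁆ := by
  obtain ⟨m, rfl⟩ : ∃ m, l = m + 1 := ⟨l - 1, by omega⟩
  rw [show m + 1 - 1 = m by omega]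
  have n1 : ∀ s, ¬ (m = m + 1 ∧ s = true) := by rintro s ⟨h, -⟩; omega
  simp only [gE_pos_lt _ (n1 _), gE_pos_lt false (l := m+1) (t := m + 1) (by simp)]
  have := top_br hl (P := P) (z := z)
  have e1 : gE (m+1) P z (m+1) true true = (-(1/4) : ℂ) • mb (m+1) P z ((m + 1 : ℕ) + 2) (m + 1 : ℕ) 1 := by
    unfold gE; simp [kp, tp, lv]
  rw [e1]
  push_cast at this ⊢
  rw [show (m:ℤ) + 1 - 1 = m by ring] at this
  change (2:ℂ) • ⁅_, mb (m+1) P z (m+1) m 0⁆ = ⁅mb (m+1) P z (m+1+1) (m+1) 0, ⁅mb (m+1) P z (m+1+1) (m+1) 0, mb (m+1) P z (m+1) m 1⁆⁆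
  rw [smul_lie, this, mb_adj hl le_rfl]
  have h1 := mb_refl (l := m+1) P z (m+1+1) (m+1) 0
  have h2 := mb_shiftr (l := m+1) P z (-(m+1)) (-(m+1+1)) 0 1
  rw [zero_mul, sn_zero, one_smul, h1, show -((m:ℤ)+1) + Nn (m+1) * 1 = m + 1 + 2 by unfold Nn; push_cast; ring,
    show -((m:ℤ)+1+1) + Nn (m+1) * 1 = m + 1 + 1 by unfold Nn; push_cast; ring] at h2
  rw [← neg_eq_iff_eq_neg] at h2
  conv_rhs => rw [← h2, neg_lie, mb_steinberg (ndvd (by unfold Nn; omega)) (ndvd (by unfold Nn; omega)) (ndvd (by unfold Nn; omega))]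
  rw [show (0:ℤ) + (0+1) = 1 by ring]
  module

lemma gE_sr7l (hl : 2 ≤ l) {P z : ℤ} :
    (-2 : ℂ) • ⁅gE l P z l true false, gE l P z (l-1) false false⁆ =
      ⁅gE l P z l false false, ⁅gE l P z l false false, gE l P z (l-1) true false⁆⁆ := by
  obtain ⟨m, rfl⟩ : ∃ m, l = m + 1 := ⟨l - 1, by omega⟩
  rw [show m + 1 - 1 = m by omega]
  have n1 : ∀ s, ¬ (m = m + 1 ∧ s = true) := by rintro s ⟨h, -⟩; omega
  simp only [gE_neg_lt _ (n1 _), gE_neg_lt false (l := m+1) (t := m + 1) (by simp)]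
  have := bot_br hl (P := P) (z := z)
  have e1 : gE (m+1) P z (m+1) true false = (-1 : ℂ) • mb (m+1) P z (m + 1 : ℕ) ((m + 1 : ℕ) + 2) (-1) := by
    unfold gE; simp [kn, tp, lv]
  have c1 : ct (m+1) m = 1 := by unfold ct; rw [if_neg]; omega
  have c2 : ct (m+1) (m+1) = 2 := by unfold ct; rw [if_pos]; omega
  rw [e1, c1, c2, one_smul, one_smul]
  push_cast at this ⊢
  rw [show (m:ℤ) + 1 - 1 = m by ring] at this
  change (-2:ℂ) • ⁅_, mb (m+1) P z m (m+1) 0⁆ = ⁅(2:ℂ) • mb (m+1) P z (m+1) (m+1+1) 0, ⁅(2:ℂ) • mb (m+1) P z (m+1) (m+1+1) 0, mb (m+1) P z m (m+1) (-1)⁆⁆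
  rw [smul_lie, this, smul_lie _ _ (mb _ _ _ _ _ (-1)), ← lie_skew (mb (m + 1) P z (↑m + 1) (↑m + 1 + 1) 0) (mb (m + 1) P z (↑m) (↑m + 1) (-1)), mb_adj' hl le_rfl]
  have h1 := mb_refl (l := m+1) P z (m+1) (m+1+1) 0
  have h2 := mb_shiftr (l := m+1) P z (-(m+1+1)) (-(m+1)) 0 1
  rw [zero_mul, sn_zero, one_smul, h1, show -((m:ℤ)+1) + Nn (m+1) * 1 = m + 1 + 2 by unfold Nn; push_cast; ring,
    show -((m:ℤ)+1+1) + Nn (m+1) * 1 = m + 1 + 1 by unfold Nn; push_cast; ring] at h2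
  rw [← neg_eq_iff_eq_neg] at h2
  have h3 : ⁅mb (m+1) P z (m+1) (m+1+1) 0, mb (m+1) P z m (m+1+1) (-1+0)⁆ = mb (m+1) P z m (m+1+2) (-1) := by
    rw [← h2, neg_lie, lie_skew, mb_steinberg (ndvd (by unfold Nn; omega)) (ndvd (by unfold Nn; omega)) (ndvd (by unfold Nn; omega))]
    rfl
  rw [lie_smul, smul_lie, lie_neg, h3]
  module
end
end Ell

namespace Ell
noncomputable section
open LieAlgebra

/-- epsilon weights -/
def eps (l : ℕ) (i : ℤ) : ℕ → ℤ := fun t =>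
  if t ≤ l then -(((t : ℤ) - i) / Nn l) + ((i + t) / Nn l) else 0
def cst (l : ℕ) (p : ℤ) : ℕ → ℤ := fun t => if t ≤ l then p else 0

variable {l : ℕ}

lemma Nn_pos (l : ℕ) : 0 < Nn l := by unfold Nn; omega

lemma eps_neg (i : ℤ) : eps l (-i) = - eps l i := by
  funext t
  simp only [eps, Pi.neg_apply]
  split_ifs
  · rw [sub_neg_eq_add, add_comm (t:ℤ) i, neg_add_eq_sub, neg_add_eq_sub, neg_add_eq_sub]; ring
  · rfl

lemma eps_shift (i r : ℤ) : eps l (i + Nn l * r) = eps l i + cst l (2 * r) := by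
  funext t
  simp only [eps, cst, Pi.add_apply]
  split_ifs
  · have h := (Nn_pos l).ne'
    rw [show (t:ℤ) - (i + Nn l * r) = (t - i) + Nn l * (-r) by ring,
      show (i + Nn l * r + t : ℤ) = (i + t) + Nn l * r by ring, Int.add_mul_ediv_left _ _ h,
      Int.add_mul_ediv_left _ _ h]
    ring
  · rfl

/-- values of eps in the fundamental range -/
lemma eps_val {k t : ℕ} (hk : k ≤ l + 1) (ht : t ≤ l) : eps l k t = if t < k then 1 else 0 := by
  simp only [eps, if_pos ht]
  have hN : Nn l = 2 * (l : ℤ) + 2 := rfl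
  have h2 : ((k : ℤ) + t) / Nn l = 0 := Int.ediv_eq_zero_of_lt (by omega) (by omega)
  rw [h2]
  split_ifs with h
  · have : ((t : ℤ) - k) / Nn l = -1 := by
      rw [Int.ediv_eq_iff_of_pos (Nn_pos l)]; constructor <;> omega
    rw [this]; rfl
  · have : ((t : ℤ) - k) / Nn l = 0 := Int.ediv_eq_zero_of_lt (by omega) (by omega)
    rw [this]; rfl

lemma eps_beyond (i : ℤ) {t : ℕ} (ht : ¬ t ≤ l) : eps l i t = 0 := by
  simp only [eps, if_neg ht]

lemma eps_succ {t : ℕ} (ht : t ≤ l) : eps l (t + 1) - eps l t = sg t 1 := by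
  funext s
  rw [Pi.sub_apply, sg_apply]
  by_cases hs : s ≤ l
  · have := eps_val (l := l) (k := t + 1) (t := s) (by omega) hs
    push_cast at this
    rw [this, eps_val (by omega) hs]
    split_ifs <;> omega
  · rw [eps_beyond _ hs, eps_beyond _ hs]
    rw [if_neg (by omega)]; rfl

lemma eps_zero : eps l 0 = 0 := by
  funext s
  by_cases hs : s ≤ l
  · have := eps_val (l := l) (k := 0) (t := s) (by omega) hs
    push_cast at this
    rw [this]; rfl
  · rw [eps_beyond _ hs]; rfl

lemma eps_half : eps l (l + 1) = cst l 1 := by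
  funext s
  simp only [cst]
  by_cases hs : s ≤ l
  · have := eps_val (l := l) (k := l+1) (t := s) (by omega) hs
    push_cast at this
    rw [this, if_pos hs, if_pos (by omega)]
  · rw [eps_beyond _ hs, if_neg hs]

lemma cst_add (p q : ℤ) : cst l (p + q) = cst l p + cst l q := by
  funext t; simp only [cst, Pi.add_apply]; split_ifs <;> simp
lemma cst_neg (p : ℤ) : cst l (-p) = - cst l p := by
  funext t; simp only [cst, Pi.neg_apply]; split_ifs <;> simp
lemma cst_zero : cst l 0 = 0 := by
  funext t; simp only [cst]; split_ifs <;> simp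

lemma eps_mul (r : ℤ) : eps l ((l + 1) * r) = cst l r := by
  rcases Int.even_or_odd' r with ⟨s, rfl | rfl⟩
  · have := eps_shift (l := l) 0 s
    rw [zero_add, eps_zero, zero_add] at this
    rw [← this]; congr 1; unfold Nn; ring
  · have := eps_shift (l := l) (l + 1) s
    rw [eps_half, ← cst_add] at this
    rw [show (1 + 2 * s : ℤ) = 2 * s + 1 by ring] at this
    rw [← this]; congr 1; unfold Nn; ring

/-- Every integer is, up to sign and shifts, in `[0, l+1]`. -/
lemma orbit_rep (l : ℕ) (i : ℤ) : ∃ k : ℕ, k ≤ l + 1 ∧ ∃ r : ℤ, i = k + Nn l * r ∨ i = -k + Nn l * r := by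
  have h1 := Int.emod_add_mul_ediv i (Nn l)
  have h2 := Int.emod_nonneg i (Nn_pos l).ne'
  have h3 := Int.emod_lt_of_pos i (Nn_pos l)
  have hN : Nn l = 2 * (l : ℤ) + 2 := rfl
  by_cases h : i % Nn l ≤ l + 1
  · refine ⟨(i % Nn l).toNat, by omega, i / Nn l, Or.inl ?_⟩
    rw [Int.toNat_of_nonneg h2]; omega
  · refine ⟨(Nn l - i % Nn l).toNat, by omega, i / Nn l + 1, Or.inr ?_⟩
    rw [Int.toNat_of_nonneg (by omega), mul_add]; omega

def Ok (l : ℕ) (i j : ℤ) : Prop := ¬ Nn l ∣ i - j ∧ ¬ Nn l ∣ i + j ∧ ¬ (((l : ℤ) + 1 ∣ i) ∧ ((l : ℤ) + 1 ∣ j))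

lemma half_dvd (l : ℕ) : ((l : ℤ) + 1) ∣ Nn l := ⟨2, by unfold Nn; ring⟩

lemma Ok.symm {i j : ℤ} (h : Ok l i j) : Ok l j i := by
  refine ⟨fun hd => h.1 ?_, fun hd => h.2.1 (by rwa [add_comm]), fun hd => h.2.2 hd.symm⟩
  rw [← dvd_neg]; rwa [neg_sub]
lemma Ok.neg_right {i j : ℤ} (h : Ok l i j) : Ok l i (-j) := by
  refine ⟨fun hd => h.2.1 (by rwa [sub_neg_eq_add] at hd), fun hd => h.1 (by rwa [← sub_eq_add_neg] at hd), ?_⟩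
  rw [dvd_neg]; exact h.2.2
lemma Ok.shift_right {i j : ℤ} (h : Ok l i j) (r : ℤ) : Ok l i (j + Nn l * r) := by
  refine ⟨fun hd => h.1 ?_, fun hd => h.2.1 ?_, fun hd => h.2.2 ⟨hd.1, ?_⟩⟩
  · have := dvd_add hd (dvd_mul_right (Nn l) r)
    rwa [show i - (j + Nn l * r) + Nn l * r = i - j by ring] at this
  · have := dvd_sub hd (dvd_mul_right (Nn l) r)
    rwa [show i + (j + Nn l * r) - Nn l * r = i + j by ring] at this
  · have := dvd_sub hd.2 ((half_dvd l).mul_right r)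
    rwa [add_sub_cancel_right] at this
lemma Ok.neg_left {i j : ℤ} (h : Ok l i j) : Ok l (-i) j := h.symm.neg_right.symm
lemma Ok.shift_left {i j : ℤ} (h : Ok l i j) (r : ℤ) : Ok l (i + Nn l * r) j := (h.symm.shift_right r).symm
lemma Ok.refl' {i j : ℤ} (h : Ok l i j) : Ok l (-j) (-i) := h.symm.neg_left.neg_right
lemma Ok.shift {i j : ℤ} (h : Ok l i j) (r : ℤ) : Ok l (i + Nn l * r) (j + Nn l * r) := (h.shift_right r).shift_left r

lemma Ok_nat {i j : ℕ} (hi : i ≤ l + 1) (hj : j ≤ l + 1) (hij : i ≠ j) (h : ¬ (i = 0 ∧ j = l + 1) ∧ ¬ (i = l + 1 ∧ j = 0)) : Ok l i j := by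
  have hN : Nn l = 2 * (l : ℤ) + 2 := rfl
  have nh : ∀ k : ℕ, k ≤ l + 1 → ((l : ℤ) + 1 ∣ k) → k = 0 ∨ k = l + 1 := by
    intro k hk hd
    by_contra hc
    have : (0:ℤ) < k := by omega
    exact absurd (Int.le_of_dvd this hd) (by omega)
  refine ⟨ndvd (by omega), ndvd (by omega), ?_⟩
  rintro ⟨h1, h2⟩
  have := nh i hi h1
  have := nh j hj h2
  omega

lemma Ok_succ (hl : 2 ≤ l) {t : ℕ} (ht : t ≤ l) : Ok l (t + 1) t := by
  have := Ok_nat (l := l) (i := t + 1) (j := t) (by omega) (by omega) (by omega) (by omega)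
  push_cast at this; exact this

end
end Ell

namespace Ell
noncomputable section
open LieAlgebra
variable {l : ℕ}

/-- signed orbit representative -/
lemma orbit_rep' (l : ℕ) (i : ℤ) : ∃ k : ℕ, k ≤ l + 1 ∧ ∃ r s : ℤ, (s = 1 ∨ s = -1) ∧ i = s * k + Nn l * r := by
  obtain ⟨k, hk, r, h | h⟩ := orbit_rep l i
  · exact ⟨k, hk, r, 1, Or.inl rfl, by rw [one_mul]; exact h⟩
  · exact ⟨k, hk, r, -1, Or.inr rfl, by rw [neg_one_mul]; exact h⟩

lemma eps_rep {k : ℕ} {r s : ℤ} (hs : s = 1 ∨ s = -1) {t : ℕ} (ht : t ≤ l) :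
    eps l (s * k + Nn l * r) t = s * eps l k t + 2 * r := by
  rw [eps_shift, Pi.add_apply]
  simp only [cst, if_pos ht]
  rcases hs with rfl | rfl
  · rw [one_mul, one_mul]
  · rw [neg_one_mul, neg_one_mul, eps_neg, Pi.neg_apply]

lemma eps_diff {k : ℕ} (hk : k ≤ l + 1) {r s : ℤ} (hs : s = 1 ∨ s = -1) {t : ℕ} (ht : t < l) :
    eps l (s * k + Nn l * r) t - eps l (s * k + Nn l * r) (t + 1) = if t + 1 = k then s else 0 := by
  rw [eps_rep hs (by omega), eps_rep hs (by omega), eps_val hk (by omega), eps_val hk (by omega)]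
  rcases hs with rfl | rfl <;> split_ifs <;> omega

lemma rep_mul {k : ℕ} (hk : k ≤ l + 1) {r s : ℤ} (hs : s = 1 ∨ s = -1) :
    ((l : ℤ) + 1 ∣ s * k + Nn l * r) ↔ (k = 0 ∨ k = l + 1) := by
  rw [dvd_add_left ((half_dvd l).mul_right r)]
  have : ((l : ℤ) + 1 ∣ s * k) ↔ ((l : ℤ) + 1 ∣ k) := by
    rcases hs with rfl | rfl
    · rw [one_mul]
    · rw [neg_one_mul, dvd_neg]
  rw [this]
  constructor
  · intro hd
    by_contra hc
    exact absurd (Int.le_of_dvd (by omega) hd) (by omega)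
  · rintro (rfl | rfl)
    · exact dvd_zero _
    · push_cast; exact dvd_refl _

lemma Ok_rep {k k' : ℕ} {r s r' s' : ℤ} (hs : s = 1 ∨ s = -1) (hs' : s' = 1 ∨ s' = -1)
    (h : Ok l (s * k + Nn l * r) (s' * k' + Nn l * r')) : k ≠ k' := by
  rintro rfl
  rcases hs with rfl | rfl <;> rcases hs' with rfl | rfl
  · exact h.1 ⟨r - r', by ring⟩
  · exact h.2.1 ⟨r + r', by ring⟩
  · exact h.2.1 ⟨r + r', by ring⟩
  · exact h.1 ⟨r - r', by ring⟩

lemma Ok_nc {i j : ℤ} (h : Ok l i j) (p : ℤ) : ∃ s ≤ l, ∃ t ≤ l, (eps l i - eps l j + cst l p) s ≠ (eps l i - eps l j + cst l p) t := by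
  obtain ⟨k, hk, r, s, hs, rfl⟩ := orbit_rep' l i
  obtain ⟨k', hk', r', s', hs', rfl⟩ := orbit_rep' l j
  have hkk := Ok_rep hs hs' h
  have hm := h.2.2
  rw [rep_mul hk hs, rep_mul hk' hs'] at hm
  obtain ⟨t, ht, hne⟩ : ∃ t, t < l ∧ (if t + 1 = k then s else 0) - (if t + 1 = k' then s' else 0) ≠ 0 := by
    by_cases h0 : k = 0 ∨ k = l + 1
    · refine ⟨k' - 1, by omega, ?_⟩
      rw [if_neg (by omega), if_pos (by omega)]; omega
    · refine ⟨k - 1, by omega, ?_⟩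
      rw [if_pos (by omega), if_neg (by omega)]; omega
  refine ⟨t, by omega, t + 1, by omega, ?_⟩
  rw [← eps_diff hk (r := r) hs ht, ← eps_diff hk' (r := r') hs' ht] at hne
  intro he
  simp only [Pi.add_apply, Pi.sub_apply, cst, if_pos (show t ≤ l by omega), if_pos (show t + 1 ≤ l by omega)] at he
  omega

lemma Ok_qf {i j : ℤ} (h : Ok l i j) (hi : ¬ (l : ℤ) + 1 ∣ i) (hj : ¬ (l : ℤ) + 1 ∣ j) (p : ℤ) :
    qf l (eps l i - eps l j + cst l p) = 2 := by
  obtain ⟨k, hk, r, s, hs, rfl⟩ := orbit_rep' l i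
  obtain ⟨k', hk', r', s', hs', rfl⟩ := orbit_rep' l j
  have hkk := Ok_rep hs hs' h
  rw [rep_mul hk hs] at hi
  rw [rep_mul hk' hs'] at hj
  unfold qf
  have : ∀ t ∈ Finset.range l, ((eps l (s * k + Nn l * r) - eps l (s' * k' + Nn l * r') + cst l p) t -
      (eps l (s * k + Nn l * r) - eps l (s' * k' + Nn l * r') + cst l p) (t + 1)) ^ 2 =
      (if t = k - 1 then 1 else 0) + (if t = k' - 1 then 1 else 0) := by
    intro t ht
    have ht := Finset.mem_range.1 ht
    have e1 := eps_diff hk (r := r) hs ht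
    have e2 := eps_diff hk' (r := r') hs' ht
    simp only [Pi.add_apply, Pi.sub_apply, cst, if_pos (show t ≤ l by omega), if_pos (show t + 1 ≤ l by omega)]
    rw [show ∀ a b c d : ℤ, (a - b + p - (c - d + p)) = (a - c) - (b - d) by intros; ring, e1, e2]
    rcases hs with rfl | rfl <;> rcases hs' with rfl | rfl <;> split_ifs <;> first | omega | rfl
  rw [Finset.sum_congr rfl this, Finset.sum_add_distrib, Finset.sum_ite_eq', Finset.sum_ite_eq',
    if_pos (Finset.mem_range.2 (by omega)), if_pos (Finset.mem_range.2 (by omega))]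
  rfl

lemma eps_even {i : ℤ} (hi : ¬ (l : ℤ) + 1 ∣ i) : Even (eps l i l) := by
  obtain ⟨k, hk, r, s, hs, rfl⟩ := orbit_rep' l i
  rw [rep_mul hk hs] at hi
  rw [eps_rep hs le_rfl, eps_val hk le_rfl, if_neg (by omega), mul_zero, zero_add]
  exact even_two_mul r

lemma me_ne {i j : ℤ} (h : ¬ Nn l ∣ i + j) (n : ℤ) : me l i j n ≠ 0 := by
  intro h0
  have h1 : me l i j n * ee l j j 0 = ee l i j n := by
    unfold me
    rw [sub_mul, ee_mul, ee_mul_ne (by rw [← dvd_neg]; rw [show -(-i - j) = i + j by ring]; exact h), sub_zero, add_zero]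
  rw [h0, zero_mul] at h1
  exact ee_ne i j n h1.symm
lemma mb_ne {P z : ℤ} {i j : ℤ} (h : ¬ Nn l ∣ i + j) (n : ℤ) : mb l P z i j n ≠ 0 := by
  intro h0
  exact me_ne h n (congrArg Prod.fst h0)

variable {L : Type*} [LieRing L] [LieAlgebra ℂ L]

/-- compatible representation in the model -/
structure Rep (S : Sys l L) (P z : ℤ) where
  φ : L →ₗ⁅ℂ⁆ (cc l P z).Ext
  pe : ∀ t ≤ l, φ (S.e t) = gE l P z t false true
  pf : ∀ t ≤ l, φ (S.f t) = gE l P z t false false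
  pes : ∀ t ≤ l, φ (S.es t) = gE l P z t true true
  pfs : ∀ t ≤ l, φ (S.fs t) = gE l P z t true false

namespace Rep
variable {S : Sys l L} {P z : ℤ} (ρ : Rep S P z)

def Q (i j n : ℤ) : Prop := ∃ x ∈ S.Gr (eps l i - eps l j) n, ρ.φ x = mb l P z i j n

lemma Q_refl {i j n : ℤ} (h : ρ.Q i j n) : ρ.Q (-j) (-i) n := by
  obtain ⟨x, hx, h⟩ := h
  refine ⟨-x, ?_, ?_⟩
  · rw [eps_neg, eps_neg, neg_sub_neg]; exact Submodule.neg_mem _ hx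
  · rw [map_neg, h, mb_refl]
lemma Q_shift {i j n : ℤ} (h : ρ.Q i j n) (r : ℤ) : ρ.Q (i + Nn l * r) (j + Nn l * r) n := by
  obtain ⟨x, hx, h⟩ := h
  refine ⟨sn (n * r) • x, ?_, ?_⟩
  · rw [eps_shift, eps_shift, add_sub_add_right_eq_sub]; exact Submodule.smul_mem _ _ hx
  · rw [map_smul, h, mb_shiftr]
lemma Q_st {i j k n q : ℤ} (h1 : ρ.Q i j n) (h2 : ρ.Q j k q) (a : ¬ Nn l ∣ i - k) (b : ¬ Nn l ∣ j + k)
    (c : ¬ Nn l ∣ i + j) : ρ.Q i k (n + q) := by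
  obtain ⟨x, hx, h1⟩ := h1
  obtain ⟨y, hy, h2⟩ := h2
  refine ⟨⁅x, y⁆, ?_, ?_⟩
  · have := S.mul _ _ _ _ _ _ hx hy
    rwa [sub_add_sub_cancel] at this
  · rw [LieHom.map_lie, h1, h2, mb_steinberg a b c]

lemma Q_up0 {t : ℕ} (ht : t ≤ l) : ρ.Q (t + 1) t 0 := by
  refine ⟨S.e t, ?_, ?_⟩
  · rw [eps_succ ht]; exact S.he t ht
  · rw [ρ.pe t ht]; simp [gE, kp, tp, lv]
lemma sg_neg (t : ℕ) (m : ℤ) : sg t (-m) = - sg t m := by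
  funext s; rw [Pi.neg_apply, sg_apply, sg_apply]; split_ifs <;> simp
lemma Q_dn0 {t : ℕ} (ht : t ≤ l) : ρ.Q t (t + 1) 0 := by
  have hc : ct l t ≠ 0 := by unfold ct; split_ifs <;> norm_num
  refine ⟨(ct l t)⁻¹ • S.f t, Submodule.smul_mem _ _ ?_, ?_⟩
  · rw [← neg_sub, eps_succ ht, ← sg_neg]; exact S.hf t ht
  · rw [map_smul, ρ.pf t ht]; simp [gE, kn, tp, lv, smul_smul, inv_mul_cancel₀ hc]
lemma Q_up1 {t : ℕ} (ht : t < l) : ρ.Q (t + 1) t 1 := by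
  refine ⟨S.es t, ?_, ?_⟩
  · rw [eps_succ ht.le]
    have := S.hes t ht.le
    rwa [stc, if_neg ht.ne] at this
  · rw [ρ.pes t ht.le]; simp [gE, kp, tp, lv, ht.ne]
lemma Q_dn1 {t : ℕ} (ht : t < l) : ρ.Q t (t + 1) (-1) := by
  have hc : ct l t ≠ 0 := by unfold ct; split_ifs <;> norm_num
  refine ⟨(ct l t)⁻¹ • S.fs t, Submodule.smul_mem _ _ ?_, ?_⟩
  · rw [← neg_sub, eps_succ ht.le, ← sg_neg]
    have := S.hfs t ht.le
    rwa [stc, if_neg ht.ne] at this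
  · rw [map_smul, ρ.pfs t ht.le]; simp [gE, kn, tp, lv, ht.ne, smul_smul, inv_mul_cancel₀ hc]

lemma Q_up (k : ℤ) : ρ.Q (k + 1) k 0 ∧ ρ.Q k (k + 1) 0 := by
  have h1 := Int.emod_add_mul_ediv k (Nn l)
  have h2 := Int.emod_nonneg k (Nn_pos l).ne'
  have h3 := Int.emod_lt_of_pos k (Nn_pos l)
  have hN : Nn l = 2 * (l : ℤ) + 2 := rfl
  by_cases h : k % Nn l ≤ l
  · obtain ⟨t, ht⟩ := Int.eq_ofNat_of_zero_le h2
    have a := ρ.Q_shift (ρ.Q_up0 (t := t) (by omega)) (k / Nn l)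
    have b := ρ.Q_shift (ρ.Q_dn0 (t := t) (by omega)) (k / Nn l)
    have e1 : (t : ℤ) + Nn l * (k / Nn l) = k := by omega
    have e2 : (t : ℤ) + 1 + Nn l * (k / Nn l) = k + 1 := by omega
    rw [e1, e2] at a b
    exact ⟨a, b⟩
  · obtain ⟨t, ht⟩ := Int.eq_ofNat_of_zero_le (show 0 ≤ Nn l - 1 - k % Nn l by omega)
    have a := ρ.Q_shift (ρ.Q_refl (ρ.Q_up0 (t := t) (by omega))) (k / Nn l + 1)
    have b := ρ.Q_shift (ρ.Q_refl (ρ.Q_dn0 (t := t) (by omega))) (k / Nn l + 1)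
    have e1 : -(t : ℤ) + Nn l * (k / Nn l + 1) = k + 1 := by rw [mul_add]; omega
    have e2 : -((t : ℤ) + 1) + Nn l * (k / Nn l + 1) = k := by rw [mul_add]; omega
    rw [e1, e2] at a b
    exact ⟨a, b⟩

lemma nodd (k x : ℤ) (h : x = 2 * k + 1) : ¬ Nn l ∣ x := by
  rintro ⟨c, hc⟩
  rw [hc] at h
  have : Nn l * c = 2 * ((l + 1) * c) := by unfold Nn; ring
  omega

/-- level raising on the pair `(1,0)` -/
lemma Q_10 : ∀ n : ℤ, ρ.Q 1 0 n ∧ ρ.Q 0 1 n := by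
  have hl := S.hl
  have hN : Nn l = 2 * (l : ℤ) + 2 := rfl
  have nd : ∀ x : ℤ, (0 < x ∧ x < 6) ∨ (-6 < x ∧ x < 0) → ¬ Nn l ∣ x := fun x hx => ndvd (by omega)
  have u0 := ρ.Q_up 0
  have u1 := ρ.Q_up 1
  norm_num at u0 u1
  have r0a := ρ.Q_refl u0.1
  have r0b := ρ.Q_refl u0.2
  norm_num at r0a r0b
  have a1 := ρ.Q_up1 (t := 0) (by omega)
  have b1 := ρ.Q_dn1 (t := 0) (by omega)
  norm_num at a1 b1
  have a1' := ρ.Q_refl a1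
  have b1' := ρ.Q_refl b1
  norm_num at a1' b1'
  have h02 : ρ.Q 0 2 0 := ρ.Q_st u0.2 u1.2 (nd _ (by norm_num)) (nd _ (by norm_num)) (nd _ (by norm_num))
  have h20 : ρ.Q 2 0 0 := ρ.Q_st u1.1 u0.1 (nd _ (by norm_num)) (nd _ (by norm_num)) (nd _ (by norm_num))
  have hm12 : ρ.Q (-1) 2 0 := ρ.Q_st r0b h02 (nd _ (by norm_num)) (nd _ (by norm_num)) (nd _ (by norm_num))
  have h2m1 : ρ.Q 2 (-1) 0 := ρ.Q_st h20 r0a (nd _ (by norm_num)) (nd _ (by norm_num)) (nd _ (by norm_num))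
  have h021 : ρ.Q 0 2 1 := ρ.Q_st a1' hm12 (nd _ (by norm_num)) (nd _ (by norm_num)) (nd _ (by norm_num))
  have h20m : ρ.Q 2 0 (-1) := ρ.Q_st h2m1 b1' (nd _ (by norm_num)) (nd _ (by norm_num)) (nd _ (by norm_num))
  have h011 : ρ.Q 0 2 (-1) := ρ.Q_st b1 u1.2 (nd _ (by norm_num)) (nd _ (by norm_num)) (nd _ (by norm_num))
  have h201 : ρ.Q 2 0 1 := ρ.Q_st u1.1 a1 (nd _ (by norm_num)) (nd _ (by norm_num)) (nd _ (by norm_num))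
  have s1 : ∀ n q, ρ.Q 1 0 n → ρ.Q 2 0 q → ρ.Q 1 0 (n + q) := by
    intro n q h1 h2
    have := ρ.Q_st (ρ.Q_st h1 h02 (nd _ (by norm_num)) (nd _ (by norm_num)) (nd _ (by norm_num))) h2 (nd _ (by norm_num)) (nd _ (by norm_num)) (nd _ (by norm_num))
    rwa [add_zero] at this
  have s2 : ∀ n q, ρ.Q 0 1 n → ρ.Q 0 2 q → ρ.Q 0 1 (n + q) := by
    intro n q h1 h2
    have := ρ.Q_st h2 (ρ.Q_st h20 h1 (nd _ (by norm_num)) (nd _ (by norm_num)) (nd _ (by norm_num))) (nd _ (by norm_num)) (nd _ (by norm_num)) (nd _ (by norm_num))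
    rwa [zero_add, add_comm] at this
  intro n
  induction n using Int.induction_on with
  | zero => exact u0
  | succ n ih => exact ⟨s1 _ _ ih.1 h201, s2 _ _ ih.2 h021⟩
  | pred n ih => exact ⟨s1 _ _ ih.1 h20m, s2 _ _ ih.2 h011⟩

lemma Q_i0 (i : ℕ) : ¬ Nn l ∣ (i : ℤ) → ∀ n : ℤ, ρ.Q i 0 n ∧ ρ.Q 0 i n := by
  have hl := S.hl
  have hN : Nn l = 2 * (l : ℤ) + 2 := rfl
  induction i using Nat.strong_induction_on with
  | _ i ih =>
  intro hi n
  have hi0 : i ≠ 0 := by rintro rfl; exact hi (dvd_zero _)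
  by_cases h1 : i = 1
  · subst h1; have := ρ.Q_10 n; push_cast; exact this
  by_cases hd : Nn l ∣ (i : ℤ) - 1
  · have hge := Int.le_of_dvd (by omega) hd
    have sh : ∀ c : ℤ, (0 < c ∧ c < 6) ∨ (-6 < c ∧ c < 0) → ∀ x, x = ((i : ℤ) - 1) + c → ¬ Nn l ∣ x := by
      intro c hc x hx hd'
      rw [hx, dvd_add_right hd] at hd'
      exact ndvd (by omega) hd'
    have c3 : ((i - 3 : ℕ) : ℤ) = (i : ℤ) - 3 := by omega
    have := ih (i - 3) (by omega) (by rw [c3]; exact sh (-2) (by norm_num) _ (by ring)) n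
    rw [c3] at this
    have k0 := ρ.Q_up ((i : ℤ) - 1)
    have k1 := ρ.Q_up ((i : ℤ) - 2)
    have k2 := ρ.Q_up ((i : ℤ) - 3)
    rw [show (i : ℤ) - 1 + 1 = i by ring] at k0
    rw [show (i : ℤ) - 2 + 1 = i - 1 by ring] at k1
    rw [show (i : ℤ) - 3 + 1 = i - 2 by ring] at k2
    have d2 : ¬ Nn l ∣ (2 : ℤ) := ndvd (by omega)
    have d3 : ∀ c : ℤ, (0 < c ∧ c < 6) ∨ (-6 < c ∧ c < 0) → ∀ x, x = 2 * ((i : ℤ) - 1) + c → ¬ Nn l ∣ x := by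
      intro c hc x hx hd'
      rw [hx, dvd_add_right (hd.mul_left 2)] at hd'
      exact ndvd (by omega) hd'
    have e1 : ρ.Q ((i : ℤ) - 1) ((i : ℤ) - 3) 0 := ρ.Q_st k1.1 k2.1 (by rw [show (i : ℤ) - 1 - (i - 3) = 2 by ring]; exact d2)
      (d3 (-3) (by norm_num) _ (by ring)) (d3 (-1) (by norm_num) _ (by ring))
    have e2 : ρ.Q ((i : ℤ) - 3) ((i : ℤ) - 1) 0 := ρ.Q_st k2.2 k1.2 (by rw [show (i : ℤ) - 3 - (i - 1) = -2 by ring, dvd_neg]; exact d2)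
      (d3 (-1) (by norm_num) _ (by ring)) (d3 (-3) (by norm_num) _ (by ring))
    have f1 : ρ.Q i ((i : ℤ) - 3) 0 := ρ.Q_st k0.1 e1 (ndvd (by omega)) (d3 (-2) (by norm_num) _ (by ring)) (d3 1 (by norm_num) _ (by ring))
    have f2 : ρ.Q ((i : ℤ) - 3) i 0 := ρ.Q_st e2 k0.2 (ndvd (by omega)) (d3 1 (by norm_num) _ (by ring)) (d3 (-2) (by norm_num) _ (by ring))
    have g1 := ρ.Q_st f1 this.1 (by rwa [sub_zero]) (sh (-2) (by norm_num) _ (by ring)) (d3 (-1) (by norm_num) _ (by ring))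
    have g2 := ρ.Q_st this.2 f2 (by rwa [zero_sub, dvd_neg]) (d3 (-1) (by norm_num) _ (by ring)) (sh (-2) (by norm_num) _ (by ring))
    rw [zero_add] at g1
    rw [add_zero] at g2
    exact ⟨g1, g2⟩
  · have c1 : ((i - 1 : ℕ) : ℤ) = (i : ℤ) - 1 := by omega
    have := ih (i - 1) (by omega) (by rwa [c1]) n
    rw [c1] at this
    have k0 := ρ.Q_up ((i : ℤ) - 1)
    rw [show (i : ℤ) - 1 + 1 = i by ring] at k0
    have g1 := ρ.Q_st k0.1 this.1 (by rwa [sub_zero]) (by rwa [add_zero]) (nodd (i - 1) _ (by ring))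
    have g2 := ρ.Q_st this.2 k0.2 (by rwa [zero_sub, dvd_neg]) (nodd (i - 1) _ (by ring)) (by rwa [zero_add])
    rw [zero_add] at g1
    rw [add_zero] at g2
    exact ⟨g1, g2⟩

lemma Q_z0 (i : ℤ) (hi : ¬ Nn l ∣ i) (n : ℤ) : ρ.Q i 0 n ∧ ρ.Q 0 i n := by
  rcases le_total 0 i with h | h
  · obtain ⟨k, rfl⟩ := Int.eq_ofNat_of_zero_le h
    exact ρ.Q_i0 k hi n
  · obtain ⟨k, hk⟩ := Int.eq_ofNat_of_zero_le (show 0 ≤ -i by omega)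
    have := ρ.Q_i0 k (by rw [← hk, dvd_neg]; exact hi) n
    rw [← hk] at this
    have a := ρ.Q_refl this.1
    have b := ρ.Q_refl this.2
    rw [neg_neg, neg_zero] at a b
    exact ⟨b, a⟩

lemma Q_all {i j : ℤ} (h : Ok l i j) (n : ℤ) : ρ.Q i j n := by
  by_cases hj : Nn l ∣ j
  · obtain ⟨r, rfl⟩ := hj
    have hi : ¬ Nn l ∣ i - Nn l * r := h.1
    have := ρ.Q_shift (ρ.Q_z0 _ hi n).1 r
    rwa [sub_add_cancel, zero_add] at this
  by_cases hi : Nn l ∣ i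
  · obtain ⟨r, rfl⟩ := hi
    have hi : ¬ Nn l ∣ j - Nn l * r := h.symm.1
    have := ρ.Q_shift (ρ.Q_z0 _ hi n).2 r
    rwa [sub_add_cancel, zero_add] at this
  have := ρ.Q_st (ρ.Q_z0 _ hi n).1 (ρ.Q_z0 _ hj 0).2 h.1 (by rwa [zero_add]) (by rwa [add_zero])
  rwa [add_zero] at this

end Rep
end
end Ell

namespace Ell
noncomputable section
open LieAlgebra
variable {l : ℕ}

/-- the system of real root vectors -/
structure XS (l : ℕ) (L : Type*) [LieRing L] [LieAlgebra ℂ L] where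
  hl : 2 ≤ l
  Gr : (ℕ → ℤ) → ℤ → Submodule ℂ L
  mul : ∀ n z m y u v, u ∈ Gr n z → v ∈ Gr m y → ⁅u, v⁆ ∈ Gr (n + m) (z + y)
  X : ℤ → ℤ → ℤ → L
  mem : ∀ i j, Ok l i j → ∀ n, X i j n ∈ Gr (eps l i - eps l j) n
  refl : ∀ i j, Ok l i j → ∀ n, X (-j) (-i) n = - X i j n
  shift : ∀ i j, Ok l i j → ∀ n r, X (i + Nn l * r) (j + Nn l * r) n = sn (n * r) • X i j n
  st : ∀ i j k, Ok l i j → Ok l j k → Ok l i k → ∀ n q, ⁅X i j n, X j k q⁆ = X i k (n + q)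
  sp : ∀ i j, Ok l i j → ∀ n, ∀ v ∈ Gr (eps l i - eps l j) n, ∃ c : ℂ, v = c • X i j n
  van : ∀ i j, Ok l i j → ¬ (l : ℤ) + 1 ∣ i → ¬ (l : ℤ) + 1 ∣ j → ∀ p, Odd p → ∀ z,
    Gr (eps l i - eps l j + cst l p) z = ⊥
  gen : ∀ p z, ¬ (p = 0 ∧ z = 0) → Gr (cst l p) z ≤ Submodule.span ℂ {w | ∃ t : ℕ, t ≤ l ∧ ∃ q v,
    (v ∈ Gr (eps l t - eps l (t + 1) + cst l p) (z - q) ∧ w = ⁅X (t + 1) t q, v⁆) ∨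
    (v ∈ Gr (eps l (t + 1) - eps l t + cst l p) (z - q) ∧ w = ⁅X t (t + 1) q, v⁆)}

variable {L : Type*} [LieRing L] [LieAlgebra ℂ L]

namespace Sys
variable (S : Sys l L)

/-- the nonzero degree generators -/
def GG : Set L := {g | ∃ t : ℕ, t ≤ l ∧ ∃ q : ℤ, g ∈ S.Gr (sg t 1) q ∨ g ∈ S.Gr (-sg t 1) q}

def M0 : Submodule ℂ L := Submodule.span ℂ {w | ∃ g ∈ S.GG, ∃ v, w = ⁅g, v⁆}

lemma M0_lie {x : L} (hx : x ∈ LieSubalgebra.lieSpan ℂ L S.GG) : ∀ v, ⁅x, v⁆ ∈ S.M0 := by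
  induction hx using LieSubalgebra.lieSpan_induction with
  | mem x h => intro v; exact Submodule.subset_span ⟨x, h, v, rfl⟩
  | zero => intro v; rw [zero_lie]; exact Submodule.zero_mem _
  | smul a x hx h => intro v; rw [smul_lie]; exact Submodule.smul_mem _ _ (h v)
  | add x y hx hy h1 h2 => intro v; rw [add_lie]; exact Submodule.add_mem _ (h1 v) (h2 v)
  | lie x y hx hy h1 h2 => intro v; rw [lie_lie]; exact Submodule.sub_mem _ (h1 _) (h2 _)

lemma J_le {x : L} (hx : x ∈ LieSubalgebra.lieSpan ℂ L S.GG) : x ∈ Submodule.span ℂ S.GG ⊔ S.M0 := by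
  induction hx using LieSubalgebra.lieSpan_induction with
  | mem x h => exact Submodule.mem_sup_left (Submodule.subset_span h)
  | zero => exact Submodule.zero_mem _
  | smul a x hx h => exact Submodule.smul_mem _ _ h
  | add x y hx hy h1 h2 => exact Submodule.add_mem _ h1 h2
  | lie x y hx hy h1 h2 => exact Submodule.mem_sup_right (S.M0_lie hx y)

lemma J_norm {u : L} (hu : u ∈ S.Hs) {x : L} (hx : x ∈ LieSubalgebra.lieSpan ℂ L S.GG) :
    ⁅u, x⁆ ∈ LieSubalgebra.lieSpan ℂ L S.GG := by
  induction hx using LieSubalgebra.lieSpan_induction with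
  | mem x h =>
    have h' := h
    obtain ⟨t, ht, q, h | h⟩ := h
    all_goals
      obtain ⟨c, hc⟩ := S.wtH u hu _ _
      rw [hc x h]
      exact (LieSubalgebra.lieSpan ℂ L S.GG).smul_mem _ (LieSubalgebra.subset_lieSpan h')
  | zero => rw [lie_zero]; exact LieSubalgebra.zero_mem _
  | smul a x hx h => rw [lie_smul]; exact (LieSubalgebra.lieSpan ℂ L S.GG).smul_mem _ h
  | add x y hx hy h1 h2 => rw [lie_add]; exact add_mem h1 h2
  | lie x y hx hy h1 h2 =>
    rw [leibniz_lie]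
    exact add_mem (LieSubalgebra.lie_mem _ h1 hy) (LieSubalgebra.lie_mem _ hx h2)

lemma J_norm' {u : L} (hu : u ∈ Submodule.span ℂ S.Hs) {x : L} (hx : x ∈ LieSubalgebra.lieSpan ℂ L S.GG) :
    ⁅u, x⁆ ∈ LieSubalgebra.lieSpan ℂ L S.GG := by
  induction hu using Submodule.span_induction with
  | mem u h => exact S.J_norm h hx
  | zero => rw [zero_lie]; exact LieSubalgebra.zero_mem _
  | smul a u _ h => rw [smul_lie]; exact (LieSubalgebra.lieSpan ℂ L S.GG).smul_mem _ h
  | add u v _ _ h1 h2 => rw [add_lie]; exact add_mem h1 h2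

lemma H_H {u : L} (hu : u ∈ Submodule.span ℂ S.Hs) {v : L} (hv : v ∈ Submodule.span ℂ S.Hs) : ⁅u, v⁆ ∈ Submodule.span ℂ S.Hs := by
  induction hu using Submodule.span_induction with
  | mem u h =>
    induction hv using Submodule.span_induction with
    | mem v h' =>
      obtain ⟨c, hc⟩ := S.wtH u h 0 0
      rw [hc v (S.H0 v h')]; exact Submodule.smul_mem _ _ (Submodule.subset_span h')
    | zero => rw [lie_zero]; exact Submodule.zero_mem _
    | smul a x hx h => rw [lie_smul]; exact Submodule.smul_mem _ _ h
    | add x y hx hy h1 h2 => rw [lie_add]; exact Submodule.add_mem _ h1 h2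
  | zero => rw [zero_lie]; exact Submodule.zero_mem _
  | smul a x hx h => rw [smul_lie]; exact Submodule.smul_mem _ _ h
  | add x y hx hy h1 h2 => rw [add_lie]; exact Submodule.add_mem _ h1 h2

def HJ : LieSubalgebra ℂ L where
  __ := Submodule.span ℂ S.Hs ⊔ (LieSubalgebra.lieSpan ℂ L S.GG).toSubmodule
  lie_mem' := by
    intro x y hx hy
    obtain ⟨a, ha, b, hb, rfl⟩ := Submodule.mem_sup.1 hx
    obtain ⟨c, hc, d, hd, rfl⟩ := Submodule.mem_sup.1 hy
    change _ ∈ (Submodule.span ℂ S.Hs ⊔ (LieSubalgebra.lieSpan ℂ L S.GG).toSubmodule)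
    rw [add_lie, lie_add, lie_add]
    refine Submodule.add_mem _ (Submodule.add_mem _ ?_ ?_) (Submodule.add_mem _ ?_ ?_)
    · exact Submodule.mem_sup_left (S.H_H ha hc)
    · exact Submodule.mem_sup_right (S.J_norm' ha hd)
    · rw [← lie_skew]; exact Submodule.neg_mem _ (Submodule.mem_sup_right (S.J_norm' hc hb))
    · exact Submodule.mem_sup_right (LieSubalgebra.lie_mem _ hb hd)

lemma HJ_top : S.HJ = ⊤ := by
  have x0 : ∀ t ≤ l, S.toSys2.x t 0 ∈ S.HJ ∧ S.toSys2.y t 0 ∈ S.HJ ∧ S.toSys2.x t 1 ∈ S.HJ ∧ S.toSys2.y t (-1) ∈ S.HJ := by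
    intro t ht
    have k : ∀ g, g ∈ S.GG → g ∈ S.HJ := fun g hg => Submodule.mem_sup_right (LieSubalgebra.subset_lieSpan hg)
    exact ⟨k _ ⟨t, ht, 0, Or.inl (S.toSys2.hx t ht _)⟩, k _ ⟨t, ht, 0, Or.inr (S.toSys2.hy t ht _)⟩,
      k _ ⟨t, ht, 1, Or.inl (S.toSys2.hx t ht _)⟩, k _ ⟨t, ht, -1, Or.inr (S.toSys2.hy t ht _)⟩⟩
  exact S.toSys2.gen S.HJ (fun u hu => Submodule.mem_sup_left (Submodule.subset_span hu)) x0

lemma all_mem (x : L) : x ∈ Submodule.span ℂ S.Hs ⊔ (Submodule.span ℂ S.GG ⊔ S.M0) := by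
  have hx : x ∈ S.HJ := by rw [S.HJ_top]; trivial
  obtain ⟨a, ha, b, hb, rfl⟩ := Submodule.mem_sup.1 (show x ∈ (Submodule.span ℂ S.Hs ⊔ (LieSubalgebra.lieSpan ℂ L S.GG).toSubmodule) from hx)
  exact Submodule.add_mem _ (Submodule.mem_sup_left ha) (Submodule.mem_sup_right (S.J_le hb))

def isNull (l : ℕ) (d : (ℕ → ℤ) × ℤ) : Prop := ∃ p : ℤ, d.1 = cst l p ∧ ¬ (p = 0 ∧ d.2 = 0)

def brk (d : (ℕ → ℤ) × ℤ) : Submodule ℂ L := Submodule.span ℂ {w | ∃ t : ℕ, t ≤ l ∧ ∃ q : ℤ, ∃ g v,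
   (g ∈ S.Gr (sg t 1) q ∧ v ∈ S.Gr (d.1 - sg t 1) (d.2 - q) ∧ w = ⁅g, v⁆) ∨
   (g ∈ S.Gr (-sg t 1) q ∧ v ∈ S.Gr (d.1 + sg t 1) (d.2 - q) ∧ w = ⁅g, v⁆)}

open scoped Classical in
def AA (d : (ℕ → ℤ) × ℤ) : Submodule ℂ L := if isNull l d then S.brk d else S.Gr d.1 d.2

lemma brk_le (d : (ℕ → ℤ) × ℤ) : S.brk d ≤ S.Gr d.1 d.2 := by
  refine Submodule.span_le.2 ?_
  rintro w ⟨t, ht, q, g, v, ⟨hg, hv, rfl⟩ | ⟨hg, hv, rfl⟩⟩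
  · have := S.mul _ _ _ _ _ _ hg hv
    rwa [add_sub_cancel, add_sub_cancel] at this
  · have := S.mul _ _ _ _ _ _ hg hv
    rwa [neg_add_cancel_comm_assoc, add_sub_cancel] at this

lemma AA_le (d : (ℕ → ℤ) × ℤ) : S.AA d ≤ S.Gr d.1 d.2 := by
  unfold AA
  split_ifs
  · exact S.brk_le d
  · exact le_rfl

lemma sg_nc {t : ℕ} (ht : t ≤ l) (hl : 1 ≤ l) (c p : ℤ) (hc : c ≠ 0) : sg t c ≠ cst l p := by
  intro h
  obtain ⟨s, hs, hst⟩ : ∃ s ≤ l, s ≠ t := by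
    by_cases h : t = 0
    · exact ⟨1, hl, by omega⟩
    · exact ⟨0, by omega, by omega⟩
  have h1 := congrFun h t
  have h2 := congrFun h s
  rw [sg_apply] at h1 h2
  simp only [cst, if_pos ht, if_pos hs] at h1 h2
  split_ifs at h1 h2 <;> omega

lemma AA_top : (⨆ d, S.AA d) = ⊤ := by
  rw [eq_top_iff]
  intro x _
  have hx := S.all_mem x
  refine (?_ : Submodule.span ℂ S.Hs ⊔ (Submodule.span ℂ S.GG ⊔ S.M0) ≤ ⨆ d, S.AA d) hx
  have hl := S.hl
  refine sup_le ?_ (sup_le ?_ ?_)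
  · refine Submodule.span_le.2 ?_
    intro u hu
    refine Submodule.mem_iSup_of_mem (0, 0) ?_
    unfold AA
    rw [if_neg]
    · exact S.H0 u hu
    · rintro ⟨p, h1, h2⟩
      have := congrFun h1 0
      simp [cst] at this
      exact h2 ⟨this.symm, rfl⟩
  · refine Submodule.span_le.2 ?_
    rintro g ⟨t, ht, q, h | h⟩
    · refine Submodule.mem_iSup_of_mem (sg t 1, q) ?_
      unfold AA
      rw [if_neg]
      · exact h
      · rintro ⟨p, h1, h2⟩
        exact sg_nc ht (by omega) _ _ (by norm_num) h1
    · refine Submodule.mem_iSup_of_mem (-sg t 1, q) ?_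
      unfold AA
      rw [if_neg]
      · exact h
      · rintro ⟨p, h1, h2⟩
        rw [← Rep.sg_neg] at h1
        exact sg_nc ht (by omega) _ _ (by norm_num) h1
  · refine Submodule.span_le.2 ?_
    rintro w ⟨g, ⟨t, ht, q, hg⟩, v, rfl⟩
    have hv : v ∈ ⨆ p : (ℕ → ℤ) × ℤ, S.Gr p.1 p.2 := by rw [S.top]; trivial
    change _ ∈ ⨆ d, S.AA d
    induction hv using Submodule.iSup_induction' with
    | mem p v hv =>
      rcases hg with hg | hg
      · refine Submodule.mem_iSup_of_mem (sg t 1 + p.1, q + p.2) ?_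
        unfold AA
        split_ifs
        · refine Submodule.subset_span ⟨t, ht, q, g, v, Or.inl ⟨hg, ?_, rfl⟩⟩
          rwa [add_sub_cancel_left, add_sub_cancel_left]
        · exact S.mul _ _ _ _ _ _ hg hv
      · refine Submodule.mem_iSup_of_mem (-sg t 1 + p.1, q + p.2) ?_
        unfold AA
        split_ifs
        · refine Submodule.subset_span ⟨t, ht, q, g, v, Or.inr ⟨hg, ?_, rfl⟩⟩
          rwa [neg_add_cancel_comm, add_sub_cancel_left]
        · exact S.mul _ _ _ _ _ _ hg hv
    | zero => rw [lie_zero]; exact Submodule.zero_mem _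
    | add a b _ _ h1 h2 => rw [lie_add]; exact Submodule.add_mem _ h1 h2

lemma Gr_null (p z : ℤ) (h : ¬ (p = 0 ∧ z = 0)) : S.Gr (cst l p) z ≤ S.brk (cst l p, z) := by
  have := eq_of_indep S.indep S.AA_le S.AA_top (cst l p, z)
  unfold AA at this
  rwa [if_pos ⟨p, rfl, h⟩] at this

end Sys

namespace Rep
variable {S : Sys l L} {P z : ℤ} (ρ : Rep S P z)

open scoped Classical in
def X (i j n : ℤ) : L := if h : Ok l i j then (ρ.Q_all h n).choose else 0
lemma X_mem {i j : ℤ} (h : Ok l i j) (n : ℤ) : ρ.X i j n ∈ S.Gr (eps l i - eps l j) n := by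
  unfold X; rw [dif_pos h]; exact (ρ.Q_all h n).choose_spec.1
lemma X_map {i j : ℤ} (h : Ok l i j) (n : ℤ) : ρ.φ (ρ.X i j n) = mb l P z i j n := by
  unfold X; rw [dif_pos h]; exact (ρ.Q_all h n).choose_spec.2
lemma X_sp {i j : ℤ} (h : Ok l i j) (n : ℤ) {v : L} (hv : v ∈ S.Gr (eps l i - eps l j) n) :
    ∃ c : ℂ, v = c • ρ.X i j n := by
  have hc := Ok_nc h 0
  rw [cst_zero, add_zero] at hc
  refine (S.toSys2.descent hc n).1 _ (ρ.X_mem h n) _ hv ?_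
  intro h0
  have := ρ.X_map h n
  rw [h0, map_zero] at this
  exact mb_ne h.2.1 n this.symm
lemma inj {i j : ℤ} (h : Ok l i j) (n : ℤ) {v w : L} (hv : v ∈ S.Gr (eps l i - eps l j) n)
    (hw : w ∈ S.Gr (eps l i - eps l j) n) (he : ρ.φ v = ρ.φ w) : v = w := by
  obtain ⟨c, rfl⟩ := ρ.X_sp h n hv
  obtain ⟨d, rfl⟩ := ρ.X_sp h n hw
  rw [map_smul, map_smul, ρ.X_map h] at he
  rw [smul_left_injective ℂ (mb_ne h.2.1 n) he]

def toXS : XS l L where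
  hl := S.hl
  Gr := S.Gr
  mul := S.mul
  X := ρ.X
  mem i j h n := ρ.X_mem h n
  refl i j h n := by
    refine ρ.inj h.refl' n (ρ.X_mem h.refl' n) ?_ ?_
    · rw [eps_neg, eps_neg, neg_sub_neg]; exact Submodule.neg_mem _ (ρ.X_mem h n)
    · rw [map_neg, ρ.X_map h, ρ.X_map h.refl', mb_refl]
  shift i j h n r := by
    refine ρ.inj (h.shift r) n (ρ.X_mem (h.shift r) n) ?_ ?_
    · rw [eps_shift, eps_shift, add_sub_add_right_eq_sub]; exact Submodule.smul_mem _ _ (ρ.X_mem h n)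
    · rw [map_smul, ρ.X_map h, ρ.X_map (h.shift r), mb_shiftr]
  st i j k h1 h2 h3 n q := by
    refine ρ.inj h3 (n + q) ?_ (ρ.X_mem h3 _) ?_
    · have := S.mul _ _ _ _ _ _ (ρ.X_mem h1 n) (ρ.X_mem h2 q)
      rwa [sub_add_sub_cancel] at this
    · rw [LieHom.map_lie, ρ.X_map h1, ρ.X_map h2, ρ.X_map h3, mb_steinberg h3.1 h2.2.1 h1.2.1]
  sp i j h n v hv := ρ.X_sp h n hv
  van i j h hi hj p hp z := by
    refine (S.toSys2.descent (Ok_nc h p) z).2 ?_ ?_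
    · rw [Pi.add_apply, Pi.sub_apply]
      simp only [cst, if_pos le_rfl]
      exact ((eps_even hi).sub (eps_even hj)).add_odd hp
    · rw [Ok_qf h hi hj]; norm_num
  gen p z h := by
    refine (S.Gr_null p z h).trans (Submodule.span_le.2 ?_)
    rintro w ⟨t, ht, q, g, v, ⟨hg, hv, rfl⟩ | ⟨hg, hv, rfl⟩⟩
    · rw [← eps_succ ht] at hg hv
      obtain ⟨c, rfl⟩ := ρ.X_sp (Ok_succ S.hl ht) q hg
      rw [smul_lie]
      refine Submodule.smul_mem _ _ (Submodule.subset_span ⟨t, ht, q, v, Or.inl ⟨?_, rfl⟩⟩)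
      rw [add_comm, ← neg_sub (eps l (t + 1)), ← sub_eq_add_neg]; exact hv
    · rw [← eps_succ ht] at hg hv
      rw [neg_sub] at hg
      obtain ⟨c, rfl⟩ := ρ.X_sp (Ok_succ S.hl ht).symm q hg
      rw [smul_lie]
      refine Submodule.smul_mem _ _ (Submodule.subset_span ⟨t, ht, q, v, Or.inr ⟨?_, rfl⟩⟩)
      rw [add_comm]; exact hv

end Rep
end
end Ell

namespace Ell
noncomputable section
open LieAlgebra
variable {l : ℕ} {L : Type*} [LieRing L] [LieAlgebra ℂ L]

lemma sn_mul_congr {a b : ℤ} (h : Even (a - b)) : sn a = sn b := sn_congr h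

namespace XS
variable (D : XS l L)

lemma shift' {i j : ℤ} (h : Ok l i j) (n m : ℤ) : D.X (i - Nn l * m) (j - Nn l * m) n = sn (n * m) • D.X i j n := by
  have := D.shift i j h n (-m)
  rwa [mul_neg, mul_neg, sn_neg, ← sub_eq_add_neg, ← sub_eq_add_neg] at this

lemma _root_.Ell.Ok.sub_right {i j : ℤ} (h : Ok l i j) (m : ℤ) : Ok l i (j - Nn l * m) := by
  have := h.shift_right (-m)
  rwa [mul_neg, ← sub_eq_add_neg] at this
lemma _root_.Ell.Ok.sub_left {i j : ℤ} (h : Ok l i j) (m : ℤ) : Ok l (i - Nn l * m) j := (h.symm.sub_right m).symm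

def T (m z i j n : ℤ) : L := ⁅D.X i j n, D.X j (i - Nn l * m) (z - n)⁆

variable (m z : ℤ)

lemma T_st {i j k : ℤ} (h1 : Ok l i k) (h2 : Ok l k j) (h3 : Ok l i j) (n q : ℤ) :
    D.T m z i j (n + q) = D.T m z i k n + sn (n * m) • D.T m z k j q := by
  unfold T
  rw [← D.st i k j h1 h2 h3 n q, lie_lie, D.st k j (i - Nn l * m) h2 (h3.symm.sub_right m) (h1.symm.sub_right m),
    ← lie_skew (D.X i k n) (D.X j (i - Nn l * m) _), lie_neg, sub_neg_eq_add]
  rw [show q + (z - (n + q)) = z - n by ring]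
  congr 1
  have e := D.shift' h1 n m
  have e2 : D.X i k n = sn (n * m) • D.X (i - Nn l * m) (k - Nn l * m) n := by
    rw [e, smul_smul, sn_sq, one_smul]
  rw [e2, lie_smul, lie_smul, D.st _ _ _ (h3.symm.sub_right m) ((h1.sub_left m).sub_right m) (h2.symm.sub_right m)]
  rw [show z - (n + q) + n = z - q by ring]

lemma T_anti {i j : ℤ} (h : Ok l i j) (n : ℤ) :
    D.T m z i j n = -(sn (n * m) • D.T m z j (i - Nn l * m) (z - n)) := by
  unfold T
  rw [D.shift' h, show z - (z - n) = n by ring, lie_smul, smul_smul, sn_sq, one_smul, lie_skew]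

lemma T_refl {i j : ℤ} (h : Ok l i j) (n : ℤ) :
    D.T m z i j n = sn ((z - n) * m) • D.T m z (-j) (-i) n := by
  unfold T
  have e1 := D.refl i j h n
  have e2 := D.refl j (i - Nn l * m) (h.symm.sub_right m) (z - n)
  have e3 := D.shift' (h.symm.refl'.shift_left m) (z - n) m
  have h4 := D.shift (-i) (-j - Nn l * m) (h.symm.refl'.sub_right m) (z - n) m
  rw [sub_add_cancel, ← sub_eq_neg_add, ← neg_sub] at h4
  rw [e1, show D.X (-i) (-j - Nn l * m) (z - n) = sn ((z - n) * m) • D.X (-(i - Nn l * m)) (-j) (z - n) by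
    rw [h4, smul_smul, sn_sq, one_smul]]
  rw [e2, smul_neg, neg_lie, lie_neg, neg_neg, lie_smul, smul_smul, sn_sq, one_smul]

lemma T_shift {i j : ℤ} (h : Ok l i j) (n r : ℤ) :
    D.T m z (i + Nn l * r) (j + Nn l * r) n = sn (z * r) • D.T m z i j n := by
  unfold T
  have := D.shift j (i - Nn l * m) (h.symm.sub_right m) (z - n) r
  rw [show i - Nn l * m + Nn l * r = i + Nn l * r - Nn l * m by ring] at this
  rw [this, D.shift i j h, smul_lie, lie_smul, smul_smul, ← sn_add]
  congr 2; ring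

/-- `v`-column: indices divisible by `l+1` -/
def Od (l : ℕ) (i : ℤ) : Prop := ¬ (l : ℤ) + 1 ∣ i

lemma _root_.Ell.Ok_od {i v : ℤ} (hi : Od l i) (hv : (l : ℤ) + 1 ∣ v) : Ok l i v := by
  refine ⟨fun hd => hi ?_, fun hd => hi ?_, fun h => hi h.1⟩
  · have := dvd_add ((half_dvd l).trans hd) hv
    rwa [sub_add_cancel] at this
  · have := dvd_sub ((half_dvd l).trans hd) hv
    rwa [add_sub_cancel_right] at this

/-- main identity: elimination through a column `v`. -/
lemma T_col {i j v : ℤ} (hi : Od l i) (hj : Od l j) (h : Ok l i j) (hv : (l : ℤ) + 1 ∣ v) (n c : ℤ) :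
    D.T m z i j c = D.T m z i v n - sn (c * m) • D.T m z j (v - Nn l * m) (z - c + n) := by
  have e := D.T_st m z (Ok_od hi hv) (Ok_od hj hv).symm h n (c - n)
  rw [add_sub_cancel] at e
  rw [e, D.T_anti m z (Ok_od hj hv).symm, smul_neg, smul_smul, ← sn_add, ← sub_eq_add_neg]
  rw [show n * m + (c - n) * m = c * m by ring, show z - (c - n) = z - c + n by ring]

/-- differences in a column -/
lemma T_diff {i j v w : ℤ} (hi : Od l i) (hj : Od l j) (h : Ok l i j) (hv : (l : ℤ) + 1 ∣ v) (hw : (l : ℤ) + 1 ∣ w) (n q c : ℤ) :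
    D.T m z i v n - D.T m z i w q = sn (c * m) • (D.T m z j v (n + c) - D.T m z j w (q + c)) := by
  have a := D.T_col m z hi (j := j - Nn l * m) (by
    unfold Od at *; intro hd; apply hj
    have := dvd_add hd ((half_dvd l).mul_right m); rwa [sub_add_cancel] at this) (h.sub_right m) hv n (z - c)
  have b := D.T_col m z hi (j := j - Nn l * m) (by
    unfold Od at *; intro hd; apply hj
    have := dvd_add hd ((half_dvd l).mul_right m); rwa [sub_add_cancel] at this) (h.sub_right m) hw q (z - c)
  have s1 := D.T_shift m z (Ok_od hj hv) (n + c) (-m)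
  have s2 := D.T_shift m z (Ok_od hj hw) (q + c) (-m)
  rw [mul_neg, mul_neg, sn_neg, ← sub_eq_add_neg, ← sub_eq_add_neg] at s1 s2
  rw [show z - (z - c) + n = n + c by ring, s1, smul_smul] at a
  rw [show z - (z - c) + q = q + c by ring, s2, smul_smul] at b
  have e : sn ((z - c) * m) * sn (z * m) = sn (c * m) := by
    rw [← sn_add]; apply sn_congr; exact ⟨z * m - c * m, by ring⟩
  rw [e] at a b
  rw [a] at b
  linear_combination (norm := module) b

end XS
end
end Ell

namespace Ell
noncomputable section
open LieAlgebra
variable {l : ℕ} {L : Type*} [LieRing L] [LieAlgebra ℂ L]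

lemma Nn_eq (l : ℕ) : (Nn l : ℤ) = 2 * ((l : ℤ) + 1) := by unfold Nn; push_cast; ring

lemma not_dvd_small {N a : ℤ} (h1 : 0 < a) (h2 : a < N) : ¬ N ∣ a := fun h => by
  have := Int.le_of_dvd h1 h; omega

namespace XS
lemma Od_small {i : ℤ} (h1 : 1 ≤ i) (h2 : i ≤ l) : Od l i := not_dvd_small (by omega) (by omega)

lemma Od_one (hl : 2 ≤ l) : Od l 1 := Od_small le_rfl (by omega)
lemma Od_two (hl : 2 ≤ l) : Od l 2 := Od_small (by omega) (by omega)

lemma Od.sub {i : ℤ} (h : Od l i) (m : ℤ) : Od l (Nn l * m - i) := by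
  unfold Od at *; intro hd; apply h
  have := dvd_sub ((half_dvd l).mul_right m) hd
  rwa [sub_sub_cancel] at this

lemma Od.add {i : ℤ} (h : Od l i) (m : ℤ) : Od l (i + Nn l * m) := by
  unfold Od at *; intro hd; apply h
  have := dvd_sub hd ((half_dvd l).mul_right m)
  rwa [add_sub_cancel_right] at this

lemma Ok_of_od {i j : ℤ} (hi : Od l i) (h1 : ¬ (Nn l : ℤ) ∣ i - j) (h2 : ¬ (Nn l : ℤ) ∣ i + j) : Ok l i j :=
  ⟨h1, h2, fun h => hi h.1⟩

lemma exists_third (hl : 2 ≤ l) {i j : ℤ} (hi : Od l i) (hj : Od l j) (h : ¬ Ok l i j) :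
    ∃ k, Od l k ∧ Ok l i k ∧ Ok l k j := by
  have hn : (Nn l : ℤ) ∣ i - j ∨ (Nn l : ℤ) ∣ i + j := by
    by_contra hc; push Not at hc; exact h (Ok_of_od hi hc.1 hc.2)
  have hN := Nn_eq l
  by_cases hk : Ok l i 1
  · refine ⟨1, Od_one hl, hk, (Ok_of_od hj ?_ ?_).symm⟩
    · intro hd
      rcases hn with hn | hn
      · apply hk.1; have := dvd_add hn hd; rwa [sub_add_sub_cancel] at this
      · apply hk.2.1; have := dvd_sub hn hd; rwa [show i + j - (j - 1) = i + 1 by ring] at this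
    · intro hd
      rcases hn with hn | hn
      · apply hk.2.1; have := dvd_add hn hd; rwa [show i - j + (j + 1) = i + 1 by ring] at this
      · apply hk.1; have := dvd_sub hn hd; rwa [show i + j - (j + 1) = i - 1 by ring] at this
  · have hn1 : (Nn l : ℤ) ∣ i - 1 ∨ (Nn l : ℤ) ∣ i + 1 := by
      by_contra hc; push Not at hc; exact hk (Ok_of_od hi hc.1 hc.2)
    have n1 : ¬ (Nn l : ℤ) ∣ 1 := not_dvd_small (by omega) (by omega)
    have n3 : ¬ (Nn l : ℤ) ∣ 3 := not_dvd_small (by omega) (by omega)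
    have hk2 : Ok l i 2 := by
      refine Ok_of_od hi ?_ ?_
      · intro hd
        rcases hn1 with hn | hn
        · apply n1; have := dvd_sub hn hd; rwa [show i - 1 - (i - 2) = 1 by ring] at this
        · apply n3; have := dvd_sub hn hd; rwa [show i + 1 - (i - 2) = 3 by ring] at this
      · intro hd
        rcases hn1 with hn | hn
        · apply n3; have := dvd_sub hd hn; rwa [show i + 2 - (i - 1) = 3 by ring] at this
        · apply n1; have := dvd_sub hd hn; rwa [show i + 2 - (i + 1) = 1 by ring] at this
    refine ⟨2, Od_two hl, hk2, (Ok_of_od hj ?_ ?_).symm⟩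
    · intro hd
      rcases hn with hn | hn
      · apply hk2.1; have := dvd_add hn hd; rwa [sub_add_sub_cancel] at this
      · apply hk2.2.1; have := dvd_sub hn hd; rwa [show i + j - (j - 2) = i + 2 by ring] at this
    · intro hd
      rcases hn with hn | hn
      · apply hk2.2.1; have := dvd_add hn hd; rwa [show i - j + (j + 2) = i + 2 by ring] at this
      · apply hk2.1; have := dvd_sub hn hd; rwa [show i + j - (j + 2) = i - 2 by ring] at this

variable (D : XS l L) (m z : ℤ)

lemma T_diff' {i j v w : ℤ} (hi : Od l i) (hj : Od l j) (hv : (l : ℤ) + 1 ∣ v) (hw : (l : ℤ) + 1 ∣ w) (n q c : ℤ) :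
    D.T m z i v n - D.T m z i w q = sn (c * m) • (D.T m z j v (n + c) - D.T m z j w (q + c)) := by
  by_cases h : Ok l i j
  · exact D.T_diff m z hi hj h hv hw n q c
  · obtain ⟨k, hk, h1, h2⟩ := exists_third D.hl hi hj h
    rw [D.T_diff m z hi hk h1 hv hw n q c, D.T_diff m z hk hj h2 hv hw (n + c) (q + c) 0,
      zero_mul, sn_zero, one_smul, add_zero, add_zero]

def C (i s n : ℤ) : L := D.T m z i (((l : ℤ) + 1) * s) n
def De (s n : ℤ) : L := D.C m z 1 s n - D.C m z 1 0 0

lemma C_diff {i j : ℤ} (hi : Od l i) (hj : Od l j) (s n s' n' c : ℤ) :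
    D.C m z i s n - D.C m z i s' n' = sn (c * m) • (D.C m z j s (n + c) - D.C m z j s' (n' + c)) :=
  D.T_diff' m z hi hj (dvd_mul_right _ _) (dvd_mul_right _ _) _ _ _

lemma C_eq {i : ℤ} (hi : Od l i) (s n : ℤ) : D.C m z i s n = D.C m z i 0 0 + D.De m z s n := by
  have := D.C_diff m z hi (Od_one D.hl) s n 0 0 0
  rw [zero_mul, sn_zero, one_smul, add_zero, add_zero] at this
  unfold De
  rw [← this]; abel

lemma C_diff0 {i : ℤ} (hi : Od l i) (s n s' n' : ℤ) :
    D.C m z i s n - D.C m z i s' n' = D.De m z s n - D.De m z s' n' := by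
  rw [D.C_eq m z hi s n, D.C_eq m z hi s' n']; abel

lemma De_add (s n d : ℤ) : D.De m z s (n + d) = D.De m z 0 d + sn (d * m) • D.De m z s n := by
  have h := D.C_diff m z (Od_one D.hl) (Od_one D.hl) s n 0 0 d
  have e : D.De m z s n = sn (d * m) • (D.De m z s (n + d) - D.De m z 0 d) := by
    have h2 := D.C_diff0 m z (Od_one D.hl) s (n + d) 0 (0 + d)
    rw [h2, zero_add] at h
    exact h
  rw [e, smul_smul, sn_sq, one_smul]; abel

lemma C_shift {i : ℤ} (hi : Od l i) (s n : ℤ) : D.C m z (i + Nn l) (s + 2) n = sn z • D.C m z i s n := by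
  have := D.T_shift m z (Ok_od hi (dvd_mul_right _ s)) n 1
  rw [mul_one, mul_one] at this
  unfold C
  rw [← this]; congr 1
  rw [Nn_eq]; ring

lemma De_shift (s n : ℤ) : D.De m z (s + 2) n = D.De m z 2 0 + sn z • D.De m z s n := by
  have o := Od_one D.hl
  have o' : Od l (1 + Nn l) := by have := o.add 1; rwa [mul_one] at this
  have h := D.C_diff0 m z o' (s + 2) n (0 + 2) 0
  rw [D.C_shift m z o, D.C_shift m z o, ← smul_sub] at h
  have : D.De m z s n = D.C m z 1 s n - D.C m z 1 0 0 := rfl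
  rw [this, h, zero_add]; abel

lemma C_refl {i : ℤ} (hi : Od l i) (s n : ℤ) : D.C m z i s n = - D.C m z (Nn l * m - i) (-s) (z - n) := by
  unfold C
  have h := Ok_od hi (dvd_mul_right _ s)
  rw [D.T_anti m z h, D.T_refl m z (h.symm.sub_right m), smul_smul, sub_sub_cancel, sn_sq, one_smul]
  rw [neg_sub, mul_neg]

lemma De_refl (s n : ℤ) : D.De m z s n + D.De m z (-s) (z - n) = D.De m z 0 z := by
  have o := Od_one D.hl
  have h := D.C_diff0 m z (o.sub m) (-s) (z - n) 0 z
  have e : D.De m z s n = D.C m z 1 s n - D.C m z 1 0 0 := rfl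
  rw [D.C_refl m z o s n, D.C_refl m z o 0 0, neg_zero, sub_zero] at e
  rw [e]
  linear_combination (norm := module) -h

lemma De_zero : D.De m z 0 0 = 0 := sub_self _

lemma c3 : (1 - sn m) • D.De m z 2 0 = (1 - sn z) • D.De m z 0 1 := by
  have h1 := D.De_shift m z 0 1
  have h2 := D.De_add m z 2 0 1
  rw [zero_add] at h1 h2
  rw [h1, one_mul] at h2
  linear_combination (norm := module) h2

lemma De_mem (W : Submodule ℂ L) (h1 : D.De m z 2 0 ∈ W) (h2 : D.De m z 0 1 ∈ W) (h3 : D.De m z 1 0 ∈ W)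
    (s n : ℤ) : D.De m z s n ∈ W := by
  have step : ∀ s n, D.De m z s n ∈ W ↔ D.De m z s (n + 1) ∈ W := by
    intro s n
    rw [D.De_add m z s n 1, Submodule.add_mem_iff_right _ h2, Submodule.smul_mem_iff]
    exact fun h => by have := sn_sq (1 * m); rw [h] at this; norm_num at this
  have step2 : ∀ s n, D.De m z s n ∈ W ↔ D.De m z (s + 2) n ∈ W := by
    intro s n
    rw [D.De_shift m z s n, Submodule.add_mem_iff_right _ h1, Submodule.smul_mem_iff]
    exact fun h => by have := sn_sq z; rw [h] at this; norm_num at this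
  have all : ∀ s, D.De m z s 0 ∈ W → ∀ n, D.De m z s n ∈ W := by
    intro s h n
    induction n using Int.induction_on with
    | zero => exact h
    | succ n ih => exact (step _ _).1 ih
    | pred n ih => rw [step, sub_add_cancel]; exact ih
  apply all
  have ev : ∀ s0 r : ℤ, D.De m z s0 0 ∈ W → D.De m z (s0 + 2 * r) 0 ∈ W := by
    intro s0 r h
    induction r using Int.induction_on with
    | zero => simpa using h
    | succ n ih => have := (step2 _ _).1 ih; rwa [show s0 + 2 * (n : ℤ) + 2 = s0 + 2 * (n + 1) by ring] at this
    | pred n ih => rw [step2, show s0 + 2 * (-(n : ℤ) - 1) + 2 = s0 + 2 * -n by ring]; exact ih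
  rcases Int.even_or_odd' s with ⟨r, rfl | rfl⟩
  · have := ev 0 r (by rw [D.De_zero]; exact W.zero_mem)
    rwa [zero_add] at this
  · have := ev 1 r h3
    rwa [add_comm] at this

/-- value at odd arguments when m is odd -/
lemma De_odd_m (hm : Odd m) (n : ℤ) : D.De m z 0 (n + 2) = D.De m z 0 n := by
  have a := D.De_add m z 0 n 1
  have b := D.De_add m z 0 (n + 1) 1
  rw [one_mul, sn_odd hm] at a b
  rw [show n + 2 = n + 1 + 1 by ring, b, a]; module

lemma De_odd_m' (hm : Odd m) (n r : ℤ) : D.De m z 0 (n + 2 * r) = D.De m z 0 n := by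
  induction r using Int.induction_on with
  | zero => rw [mul_zero, add_zero]
  | succ k ih => rw [show n + 2 * ((k : ℤ) + 1) = n + 2 * k + 2 by ring, D.De_odd_m m z hm, ih]
  | pred k ih =>
    have := D.De_odd_m m z hm (n + 2 * (-(k : ℤ) - 1))
    rw [← this, show n + 2 * (-(k : ℤ) - 1) + 2 = n + 2 * -k by ring, ih]

lemma De_even_m (hm : Even m) (s n : ℤ) : D.De m z s n = (n : ℂ) • D.De m z 0 1 + D.De m z s 0 := by
  have a : ∀ n, D.De m z s (n + 1) = D.De m z 0 1 + D.De m z s n := by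
    intro n
    have := D.De_add m z s n 1
    rwa [one_mul, sn_even hm, one_smul] at this
  induction n using Int.induction_on with
  | zero => rw [Int.cast_zero]; module
  | succ k ih => rw [a, ih]; push_cast; module
  | pred k ih =>
    have := a (-(k : ℤ) - 1)
    rw [sub_add_cancel, ih] at this
    push_cast at this ⊢
    linear_combination (norm := module) -this

lemma De_even_z (hz : Even z) (r n : ℤ) : D.De m z (2 * r) n = (r : ℂ) • D.De m z 2 0 + D.De m z 0 n := by
  have a : ∀ s, D.De m z (s + 2) n = D.De m z 2 0 + D.De m z s n := by
    intro s
    have := D.De_shift m z s n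
    rwa [sn_even hz, one_smul] at this
  induction r using Int.induction_on with
  | zero => rw [Int.cast_zero, mul_zero]; module
  | succ k ih => rw [show 2 * ((k : ℤ) + 1) = 2 * k + 2 by ring, a, ih]; push_cast; module
  | pred k ih =>
    have := a (2 * (-(k : ℤ) - 1))
    rw [show 2 * (-(k : ℤ) - 1) + 2 = 2 * -k by ring, ih] at this
    push_cast at this ⊢
    linear_combination (norm := module) -this

lemma rho_rel : D.De m z 1 0 + sn z • (D.De m z 0 z + sn (z * m) • D.De m z 1 0 - D.De m z 2 0) = D.De m z 0 z := by
  have r := D.De_refl m z 1 0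
  have a := D.De_shift m z (-1) z
  have b := D.De_add m z 1 0 z
  rw [zero_add] at b
  rw [show (-1 : ℤ) + 2 = 1 by norm_num] at a
  rw [← b, a, add_sub_cancel_left, smul_smul, sn_sq, one_smul]
  rw [sub_zero] at r
  exact r

lemma two_cancel {x : L} (h : (2 : ℂ) • x = 0) : x = 0 := (smul_eq_zero.1 h).resolve_left (by norm_num)

lemma case_oe (hm : Odd m) (hz : Even z) :
    D.De m z 2 0 = 0 ∧ D.De m z 0 1 = 0 ∧ D.De m z 1 0 = 0 := by
  have c := D.c3 m z
  rw [sn_odd hm, sn_even hz] at c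
  have g1 : D.De m z 2 0 = 0 := two_cancel (by linear_combination (norm := module) c)
  obtain ⟨r, hr⟩ := hz
  have hz' : Even z := ⟨r, hr⟩
  have d0 : D.De m z 0 z = 0 := by
    rw [← D.De_zero m z, ← D.De_odd_m' m z hm 0 r, zero_add]; congr 1; omega
  have d1 : D.De m z 0 (z - 1) = D.De m z 0 1 := by
    rw [← D.De_odd_m' m z hm 1 (r - 1)]; congr 1; omega
  have R := D.De_refl m z 0 1
  rw [neg_zero, d1, d0] at R
  have rr := D.rho_rel m z
  rw [d0, g1, sn_even hz', sn_even (hz'.mul_right m)] at rr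
  exact ⟨g1, two_cancel (by linear_combination (norm := module) R), two_cancel (by linear_combination (norm := module) rr)⟩

lemma case_eo (hm : Even m) (hz : Odd z) :
    D.De m z 2 0 = 0 ∧ D.De m z 0 1 = 0 := by
  have c := D.c3 m z
  rw [sn_even hm, sn_odd hz] at c
  have g2 : D.De m z 0 1 = 0 := two_cancel (by linear_combination (norm := module) -c)
  have R := D.De_refl m z 2 0
  rw [D.De_even_m m z hm 0 z, D.De_even_m m z hm (-2), g2, D.De_zero] at R
  have s := D.De_shift m z (-2) 0
  rw [sn_odd hz, show (-2 : ℤ) + 2 = 0 by norm_num, D.De_zero] at s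
  exact ⟨two_cancel (by linear_combination (norm := module) R - s), g2⟩

lemma case_oo (hm : Odd m) (hz : Odd z) :
    D.De m z 2 0 = D.De m z 0 1 ∧ D.De m z 1 0 = (1 / 2 : ℂ) • D.De m z 0 1 := by
  have c := D.c3 m z
  rw [sn_odd hm, sn_odd hz] at c
  have g1 : D.De m z 2 0 - D.De m z 0 1 = 0 := two_cancel (by linear_combination (norm := module) c)
  have g1' := sub_eq_zero.1 g1
  obtain ⟨r, hr⟩ := hz
  have hz' : Odd z := ⟨r, hr⟩
  have d0 : D.De m z 0 z = D.De m z 0 1 := by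
    rw [← D.De_odd_m' m z hm 1 r]; congr 1; omega
  have rr := D.rho_rel m z
  rw [d0, g1', sn_odd hz', sn_odd (hz'.mul hm)] at rr
  exact ⟨g1', by linear_combination (norm := module) (1 / 2 : ℂ) • rr⟩

lemma case_ee (hm : Even m) (hz : Even z) :
    D.De m z 1 0 = (1 / 2 : ℂ) • D.De m z 2 0 ∧ (m : ℂ) • D.De m z 2 0 = (z : ℂ) • D.De m z 0 1 := by
  have rr := D.rho_rel m z
  rw [sn_even hz, sn_even (hz.mul_right m)] at rr
  refine ⟨by linear_combination (norm := module) (1 / 2 : ℂ) • rr, ?_⟩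
  have o1 := Od_one D.hl
  have o2 := Od_two D.hl
  have hN := Nn_eq l
  have hl := D.hl
  have h12 : Ok l 2 1 := Ok_of_od o2 (not_dvd_small (by omega) (by omega)) (not_dvd_small (by omega) (by omega))
  have e1 := D.T_col m z o2 o1 h12 (dvd_zero _) 0 0
  have e2 := D.T_st m z h12 (Ok_od o1 (dvd_zero _)) (Ok_od o2 (dvd_zero _)) 0 0
  rw [zero_mul, sn_zero, one_smul] at e1 e2
  have a1 : D.T m z 2 0 0 = D.C m z 2 0 0 := by unfold C; rw [mul_zero]
  have a2 : D.T m z 1 0 0 = D.C m z 1 0 0 := by unfold C; rw [mul_zero]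
  have a3 : D.T m z 1 (0 - Nn l * m) (z - 0 + 0) = D.C m z 1 (2 * -m) z := by
    unfold C; congr 1
    · rw [Nn_eq]; ring
    · ring
  rw [a1, a3, D.C_eq m z o1, D.De_even_z m z hz, D.De_even_m m z hm 0 z, D.De_zero] at e1
  rw [zero_add, a1, a2, e1] at e2
  push_cast at e2
  linear_combination (norm := module) -e2

/-- the spanning statement -/
lemma span_even (W : Submodule ℂ L) (hW : ∀ s n, D.De m z s n ∈ W)
    (hC : ∀ i : ℤ, 1 ≤ i → i ≤ l → D.C m z i 0 0 ∈ W) (h0 : ¬ (m = 0 ∧ z = 0)) :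
    D.Gr (cst l (2 * m)) z ≤ W := by
  have hl := D.hl
  have hCc : ∀ i : ℤ, 1 ≤ i → i ≤ l → ∀ s n, D.C m z i s n ∈ W := by
    intro i h1 h2 s n
    rw [D.C_eq m z (Od_small h1 h2)]
    exact W.add_mem (hC i h1 h2) (hW s n)
  have sh : ∀ i : ℤ, eps l (i - Nn l * m) = eps l i - cst l (2 * m) := by
    intro i
    have := eps_shift (l := l) i (-m)
    rw [mul_neg, ← sub_eq_add_neg] at this
    rw [this, show 2 * -m = -(2 * m) by ring, cst_neg]; abel
  have col : ∀ i v : ℤ, 1 ≤ i → i ≤ l → (l : ℤ) + 1 ∣ v → ∀ n, D.T m z i v n ∈ W := by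
    rintro i v h1 h2 ⟨s, rfl⟩ n
    exact hCc i h1 h2 s n
  have col' : ∀ i v : ℤ, 1 ≤ i → i ≤ l → (l : ℤ) + 1 ∣ v → ∀ n, D.T m z v i n ∈ W := by
    rintro i v h1 h2 hv n
    rw [D.T_anti m z (Ok_od (Od_small h1 h2) hv).symm]
    exact W.neg_mem (W.smul_mem _ (col i _ h1 h2 (dvd_sub hv ((half_dvd l).mul_right m)) _))
  have key : ∀ i j : ℤ, 0 ≤ i → i ≤ l + 1 → 0 ≤ j → j ≤ l + 1 → Ok l i j → ∀ n, D.T m z i j n ∈ W := by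
    intro i j hi hi' hj hj' h n
    by_cases h1 : (l : ℤ) + 1 ∣ i
    · have h2 : ¬ (l : ℤ) + 1 ∣ j := fun h2 => h.2.2 ⟨h1, h2⟩
      have : j ≠ 0 := fun e => h2 (by rw [e]; exact dvd_zero _)
      have : j ≠ l + 1 := fun e => h2 (by rw [e])
      exact col' j i (by omega) (by omega) h1 n
    · have : i ≠ 0 := fun e => h1 (by rw [e]; exact dvd_zero _)
      have : i ≠ l + 1 := fun e => h1 (by rw [e])
      by_cases h2 : (l : ℤ) + 1 ∣ j
      · exact col i j (by omega) (by omega) h2 n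
      · have : j ≠ 0 := fun e => h2 (by rw [e]; exact dvd_zero _)
        have : j ≠ l + 1 := fun e => h2 (by rw [e])
        rw [D.T_col m z h1 h2 h (dvd_zero _) 0 n]
        exact W.sub_mem (col i 0 (by omega) (by omega) (dvd_zero _) _)
          (W.smul_mem _ (col j _ (by omega) (by omega) (dvd_sub (dvd_zero _) ((half_dvd l).mul_right m)) _))
  refine (D.gen (2 * m) z (by omega)).trans (Submodule.span_le.2 ?_)
  rintro w ⟨t, ht, q, v, ⟨hv, rfl⟩ | ⟨hv, rfl⟩⟩
  · have ok := Ok_succ hl ht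
    rw [show eps l t - eps l (t + 1) + cst l (2 * m) = eps l t - eps l (t + 1 - Nn l * m) by rw [sh]; abel] at hv
    obtain ⟨c, rfl⟩ := D.sp _ _ (ok.symm.sub_right m) _ _ hv
    rw [lie_smul]
    exact W.smul_mem _ (key _ _ (by omega) (by omega) (by omega) (by omega) ok q)
  · have ok := (Ok_succ hl ht).symm
    rw [show eps l (t + 1) - eps l t + cst l (2 * m) = eps l (t + 1) - eps l (t - Nn l * m) by rw [sh]; abel] at hv
    obtain ⟨c, rfl⟩ := D.sp _ _ (ok.symm.sub_right m) _ _ hv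
    rw [lie_smul]
    exact W.smul_mem _ (key _ _ (by omega) (by omega) (by omega) (by omega) ok q)

/-- the `l` standard vectors -/
def cv (i : Fin l) : L := D.C m z ((i : ℕ) + 1 : ℤ) 0 0

lemma span_w (h0 : ¬ (m = 0 ∧ z = 0)) (w : L) (h1 : D.De m z 2 0 ∈ Submodule.span ℂ {w})
    (h2 : D.De m z 0 1 ∈ Submodule.span ℂ {w}) (h3 : D.De m z 1 0 ∈ Submodule.span ℂ {w}) :
    D.Gr (cst l (2 * m)) z ≤ Submodule.span ℂ (Set.range (Fin.cons w (D.cv m z) : Fin (l + 1) → L)) := by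
  rw [Fin.range_cons, Submodule.span_insert]
  apply D.span_even m z _ _ _ h0
  · intro s n
    exact Submodule.mem_sup_left (D.De_mem m z _ h1 h2 h3 s n)
  · intro i hi hi'
    refine Submodule.mem_sup_right (Submodule.subset_span ⟨⟨(i - 1).toNat, by omega⟩, ?_⟩)
    unfold cv
    congr 1
    simp only []
    omega

lemma span_w0 (h0 : ¬ (m = 0 ∧ z = 0)) (h1 : D.De m z 2 0 = 0)
    (h2 : D.De m z 0 1 = 0) (h3 : D.De m z 1 0 = 0) :
    D.Gr (cst l (2 * m)) z ≤ Submodule.span ℂ (Set.range (D.cv m z)) := by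
  have := D.span_w m z h0 0 (by rw [h1]; exact Submodule.zero_mem _) (by rw [h2]; exact Submodule.zero_mem _) (by rw [h3]; exact Submodule.zero_mem _)
  rwa [Fin.range_cons, Submodule.span_insert, Submodule.span_zero_singleton, bot_sup_eq] at this

/-- membership in the null root space -/
lemma T_mem {i j : ℤ} (h : Ok l i j) (n : ℤ) : D.T m z i j n ∈ D.Gr (cst l (2 * m)) z := by
  have := D.mul _ _ _ _ _ _ (D.mem i j h n) (D.mem j _ (h.symm.sub_right m) (z - n))
  have e : eps l (i - Nn l * m) = eps l i - cst l (2 * m) := by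
    have := eps_shift (l := l) i (-m)
    rw [mul_neg, ← sub_eq_add_neg] at this
    rw [this, show 2 * -m = -(2 * m) by ring, cst_neg]; abel
  rw [e, add_sub_cancel] at this
  rwa [show eps l i - eps l j + (eps l j - (eps l i - cst l (2 * m))) = cst l (2 * m) by abel] at this

lemma C_mem {i : ℤ} (hi : Od l i) (s n : ℤ) : D.C m z i s n ∈ D.Gr (cst l (2 * m)) z :=
  D.T_mem m z (Ok_od hi (dvd_mul_right _ _)) n
lemma De_mem' (s n : ℤ) : D.De m z s n ∈ D.Gr (cst l (2 * m)) z :=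
  Submodule.sub_mem _ (D.C_mem m z (Od_one D.hl) s n) (D.C_mem m z (Od_one D.hl) 0 0)

end XS
end
end Ell

namespace Ell
noncomputable section
open LieAlgebra
variable {l : ℕ} {L : Type*} [LieRing L] [LieAlgebra ℂ L]
namespace XS

lemma Od.neg {i : ℤ} (h : Od l i) : Od l (-i) := by
  unfold Od at *; rwa [dvd_neg]

variable (D : XS l L) (p z : ℤ)

/-- column index -/
def cl (l : ℕ) (s : ℤ) : ℤ := ((l : ℤ) + 1) * s
lemma cl_dvd (s : ℤ) : (l : ℤ) + 1 ∣ cl l s := dvd_mul_right _ _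
lemma eps_cl (s : ℤ) : eps l (cl l s) = cst l s := eps_mul s

def J (i s n : ℤ) : L := ⁅D.X i (cl l s) n, D.X (cl l (s + p)) i (z - n)⁆

lemma J_ind0 (hp : Odd p) {i j : ℤ} (hi : Od l i) (hj : Od l j) (h : Ok l i j) (s n q : ℤ) :
    D.J p z i s n = D.J p z j s q := by
  unfold J
  have e1 := D.st i j (cl l s) h (Ok_od hj (cl_dvd s)) (Ok_od hi (cl_dvd s)) (n - q) q
  rw [sub_add_cancel] at e1
  have e2 := D.st (cl l (s + p)) i j (Ok_od hi (cl_dvd _)).symm h (Ok_od hj (cl_dvd _)).symm (z - n) (n - q)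
  rw [show z - n + (n - q) = z - q by ring] at e2
  have e3 : ⁅D.X j (cl l s) q, D.X (cl l (s + p)) i (z - n)⁆ = 0 := by
    have hm := D.mul _ _ _ _ _ _ (D.mem j (cl l s) (Ok_od hj (cl_dvd s)) q) (D.mem (cl l (s+p)) i (Ok_od hi (cl_dvd _)).symm (z - n))
    rw [eps_cl, eps_cl, cst_add, show eps l j - cst l s + (cst l s + cst l p - eps l i) = eps l j - eps l i + cst l p by abel,
      D.van j i h.symm hj hi p hp] at hm
    exact (Submodule.mem_bot ℂ).1 hm
  rw [← e1, lie_lie, e3, lie_zero, zero_sub, ← lie_neg, lie_skew]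
  rw [e2]

lemma J_ind (hp : Odd p) {i j : ℤ} (hi : Od l i) (hj : Od l j) (s n q : ℤ) :
    D.J p z i s n = D.J p z j s q := by
  by_cases h : Ok l i j
  · exact D.J_ind0 p z hp hi hj h s n q
  · obtain ⟨k, hk, h1, h2⟩ := exists_third D.hl hi hj h
    rw [D.J_ind0 p z hp hi hk h1 s n 0, D.J_ind0 p z hp hk hj h2 s 0 q]

lemma J_refl {i : ℤ} (hi : Od l i) (s n : ℤ) : D.J p z i s n = - D.J p z (-i) (-s - p) (z - n) := by
  unfold J
  have h1 := D.refl i (cl l s) (Ok_od hi (cl_dvd s)) n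
  have h2 := D.refl (cl l (s + p)) i (Ok_od hi (cl_dvd _)).symm (z - n)
  rw [show -cl l s = cl l (-s - p + p) by unfold cl; ring] at h1
  rw [show -cl l (s + p) = cl l (-s - p) by unfold cl; ring] at h2
  rw [h2, show z - (z - n) = n by ring, h1, lie_neg, neg_lie, neg_neg, lie_skew]

lemma J_shift {i : ℤ} (hi : Od l i) (s n : ℤ) : D.J p z (i + Nn l * 1) (s + 2) n = sn z • D.J p z i s n := by
  unfold J
  have h1 := D.shift i (cl l s) (Ok_od hi (cl_dvd s)) n 1
  have h2 := D.shift (cl l (s + p)) i (Ok_od hi (cl_dvd _)).symm (z - n) 1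
  rw [show cl l s + Nn l * 1 = cl l (s + 2) by unfold cl; rw [Nn_eq]; ring] at h1
  rw [show cl l (s + p) + Nn l * 1 = cl l (s + 2 + p) by unfold cl; rw [Nn_eq]; ring] at h2
  rw [h1, h2, smul_lie, lie_smul, smul_smul, ← sn_add]
  congr 2; ring

lemma J_mem_span (hp : Odd p) {i : ℤ} (hi : Od l i) (s n : ℤ) : D.J p z i s n ∈ Submodule.span ℂ {D.J p z 1 0 0} := by
  set W := Submodule.span ℂ {D.J p z 1 0 0}
  have o := Od_one D.hl
  have step : ∀ s, D.J p z 1 s 0 ∈ W ↔ D.J p z 1 (s + 2) 0 ∈ W := by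
    intro s
    rw [D.J_ind p z hp o (o.add 1) (s + 2) 0 0, D.J_shift p z o, Submodule.smul_mem_iff]
    exact fun h => by have := sn_sq z; rw [h] at this; norm_num at this
  have ev : ∀ s0 r : ℤ, D.J p z 1 s0 0 ∈ W ↔ D.J p z 1 (s0 + 2 * r) 0 ∈ W := by
    intro s0 r
    induction r using Int.induction_on with
    | zero => rw [mul_zero, add_zero]
    | succ n ih => rw [ih, step, show s0 + 2 * (n : ℤ) + 2 = s0 + 2 * (n + 1) by ring]
    | pred n ih => rw [ih, step (s0 + 2 * (-(n : ℤ) - 1)), show s0 + 2 * (-(n : ℤ) - 1) + 2 = s0 + 2 * -n by ring]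
  have z0 : D.J p z 1 0 0 ∈ W := Submodule.mem_span_singleton_self _
  rw [D.J_ind p z hp hi o s n 0]
  rcases Int.even_or_odd' s with ⟨r, hr | hr⟩
  · have := (ev 0 r).1 z0
    rwa [zero_add, ← hr] at this
  · obtain ⟨r', hr'⟩ := hp
    have hp : Odd p := ⟨r', hr'⟩
    rw [D.J_refl p z o, D.J_ind p z hp o.neg o _ _ 0]
    apply W.neg_mem
    have := (ev 0 (-r - r' - 1)).1 z0
    rwa [show 0 + 2 * (-r - r' - 1) = -s - p by omega] at this

lemma span_odd (hp : Odd p) : D.Gr (cst l p) z ≤ Submodule.span ℂ {D.J p z 1 0 0} := by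
  have hl := D.hl
  refine (D.gen p z (fun h => by rw [h.1] at hp; exact absurd hp (by decide))).trans (Submodule.span_le.2 ?_)
  have A : ∀ i s q v, Od l i → v ∈ D.Gr (eps l (cl l s) - eps l i + cst l p) (z - q) →
      ⁅D.X i (cl l s) q, v⁆ ∈ Submodule.span ℂ {D.J p z 1 0 0} := by
    intro i s q v hi hv
    rw [show eps l (cl l s) - eps l i + cst l p = eps l (cl l (s + p)) - eps l i by
      rw [eps_cl, eps_cl, cst_add]; abel] at hv
    obtain ⟨c, rfl⟩ := D.sp _ _ (Ok_od hi (cl_dvd _)).symm _ _ hv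
    rw [lie_smul]
    exact Submodule.smul_mem _ _ (D.J_mem_span p z hp hi s q)
  have B : ∀ i s q v, Od l i → v ∈ D.Gr (eps l i - eps l (cl l s) + cst l p) (z - q) →
      ⁅D.X (cl l s) i q, v⁆ ∈ Submodule.span ℂ {D.J p z 1 0 0} := by
    intro i s q v hi hv
    have h1 := D.refl _ _ (Ok_od hi (cl_dvd s)).symm q
    rw [show - cl l s = cl l (-s) by unfold cl; ring] at h1
    have := A (-i) (-s) q v hi.neg (by
      rw [show cl l (-s) = -cl l s by unfold cl; ring, eps_neg, eps_neg,
        show -eps l (cl l s) - -eps l i + cst l p = eps l i - eps l (cl l s) + cst l p by abel]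
      exact hv)
    rw [h1, neg_lie] at this
    exact (Submodule.neg_mem_iff _).1 this
  have c0 : (0 : ℤ) = cl l 0 := by unfold cl; ring
  have c1 : (l : ℤ) + 1 = cl l 1 := by unfold cl; ring
  rintro w ⟨t, ht, q, v, h⟩
  rcases Nat.eq_zero_or_pos t with rfl | ht0
  · rw [Nat.cast_zero, zero_add, c0] at h
    rcases h with ⟨hv, rfl⟩ | ⟨hv, rfl⟩
    · exact A 1 0 q v (Od_one hl) hv
    · exact B 1 0 q v (Od_one hl) hv
  · rcases eq_or_lt_of_le ht with rfl | htl
    · rw [c1] at h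
      have o : Od t t := Od_small (by omega) le_rfl
      rcases h with ⟨hv, rfl⟩ | ⟨hv, rfl⟩
      · exact B t 1 q v o hv
      · exact A t 1 q v o hv
    · have o1 : Od l t := Od_small (by omega) (by omega)
      have o2 : Od l (t + 1) := Od_small (by omega) (by omega)
      have ok := Ok_succ hl ht
      rcases h with ⟨hv, rfl⟩ | ⟨hv, rfl⟩
      · rw [D.van _ _ ok.symm o1 o2 p hp] at hv
        rw [(Submodule.mem_bot ℂ).1 hv, lie_zero]; exact Submodule.zero_mem _
      · rw [D.van _ _ ok o2 o1 p hp] at hv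
        rw [(Submodule.mem_bot ℂ).1 hv, lie_zero]; exact Submodule.zero_mem _

lemma J_mem {i : ℤ} (hi : Od l i) (s n : ℤ) : D.J p z i s n ∈ D.Gr (cst l p) z := by
  have := D.mul _ _ _ _ _ _ (D.mem i _ (Ok_od hi (cl_dvd s)) n) (D.mem _ i (Ok_od hi (cl_dvd (s + p))).symm (z - n))
  rw [eps_cl, eps_cl, cst_add, add_sub_cancel] at this
  rwa [show eps l i - cst l s + (cst l s + cst l p - eps l i) = cst l p by abel] at this

end XS
end
end Ell

namespace Ell
noncomputable section
open LieAlgebra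
variable {l : ℕ}

lemma mx_entry_ne {i k n j : ℤ} (h : ¬ Nn l ∣ i - j) (x : ZZ l) : mx l i k n (j : ZZ l) x = 0 := by
  unfold mx sg1
  rw [Matrix.add_apply, Matrix.smul_apply, Matrix.single_apply_of_row_ne, Matrix.single_apply_of_row_ne, smul_zero, add_zero]
  · rw [Ne, zz_eq]; intro hd; apply h
    have := dvd_sub ((dvd_mul_left _ _).trans hd) (dvd_refl (Nn l))
    rwa [show i + Nn l - j - Nn l = i - j by ring] at this
  · rw [Ne, zz_eq]; intro hd; exact h ((dvd_mul_left _ _).trans hd)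

lemma mx_entry_same (i k n : ℤ) : mx l i k n (i : ZZ l) (k : ZZ l) = 1 := by
  unfold mx sg1
  rw [Matrix.add_apply, Matrix.smul_apply, Matrix.single_apply_same, Matrix.single_apply_of_row_ne, smul_zero, add_zero]
  rw [Ne, zz_eq, add_sub_cancel_left]; exact two_nd

open XS in
/-- the bracket in the model -/
lemma model_T {P z i m : ℤ} (hi : Od l i) (s n : ℤ) :
    ⁅mb l P z i (cl l s) n, mb l P z (cl l s) (i - Nn l * m) (z - n)⁆ =
      ((ee l i (i - Nn l * m) z - ee l (Nn l * m - i) (-i) z + (sn ((z - n) * m) * sn (z * s) - sn (n * m)) • ee l (cl l s) (cl l s - Nn l * m) z,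
        chi P z (i - cl l s, n) * (tT P z (ee l i (i - Nn l * m) z) + sn ((z - n) * m) * sn (z * s) * tT P z (ee l (cl l s) (cl l s - Nn l * m) z))) : LM (ZZ l) × ℂ) := by
  have ok := Ok_od hi (cl_dvd (l := l) s)
  have hz1 : n + (z - n) = z := by ring
  have hz2 : z - n + n = z := by ring
  have k1 : ee l (-cl l s) (-cl l s - Nn l * m) z = sn (z * s) • ee l (cl l s) (cl l s - Nn l * m) z := by
    have := ee_shiftr (l := l) (cl l s) (cl l s - Nn l * m) z (-s)
    rw [mul_neg z s, sn_neg, show cl l s + Nn l * -s = -cl l s by unfold cl; rw [Nn_eq]; ring,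
      show cl l s - Nn l * m + Nn l * -s = -cl l s - Nn l * m by unfold cl; rw [Nn_eq]; ring] at this
    exact this
  have AB : me l i (cl l s) n * me l (cl l s) (i - Nn l * m) (z - n) =
      ee l i (i - Nn l * m) z + (sn ((z - n) * m) * sn (z * s)) • ee l (cl l s) (cl l s - Nn l * m) z := by
    unfold me
    have e : ee l (-(i - Nn l * m)) (-cl l s) (z - n) = sn ((z - n) * m) • ee l (-i) (-cl l s - Nn l * m) (z - n) := by
      rw [← ee_shiftr]; congr 1 <;> ring
    rw [sub_mul, mul_sub, mul_sub, ee_mul, hz1, ee_mul_ne, ee_mul_ne, e, mul_smul_comm, ee_mul, hz1, k1, smul_smul]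
    · module
    · intro hd; apply ok.2.1
      have := dvd_neg.2 hd
      rwa [show -(-i - cl l s) = i + cl l s by ring] at this
    · intro hd; apply ok.2.1
      have := dvd_add hd (dvd_mul_right (Nn l) m)
      rwa [show cl l s - -(i - Nn l * m) + Nn l * m = i + cl l s by ring] at this
  have BA : me l (cl l s) (i - Nn l * m) (z - n) * me l i (cl l s) n =
      sn (n * m) • ee l (cl l s) (cl l s - Nn l * m) z + ee l (Nn l * m - i) (-i) z := by
    unfold me
    have e : ee l i (cl l s) n = sn (n * m) • ee l (i - Nn l * m) (cl l s - Nn l * m) n := by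
      rw [← ee_shiftr]; congr 1 <;> ring
    rw [sub_mul, mul_sub, mul_sub, ee_mul, hz2, ee_mul_ne (j := i - Nn l * m) (j' := -cl l s), ee_mul_ne (j := -cl l s) (j' := i), e, mul_smul_comm, ee_mul, hz2, neg_sub]
    · module
    · intro hd; apply ok.2.1
      have := dvd_neg.2 hd
      rwa [show -(-cl l s - i) = i + cl l s by ring] at this
    · intro hd; apply ok.2.1
      have := dvd_add hd (dvd_mul_right (Nn l) m)
      rwa [show i - Nn l * m - -cl l s + Nn l * m = i + cl l s by ring] at this
  rw [Coc.lie_def]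
  refine Prod.ext ?_ ?_
  · change me l i (cl l s) n * me l (cl l s) (i - Nn l * m) (z - n) - me l (cl l s) (i - Nn l * m) (z - n) * me l i (cl l s) n = _
    rw [AB, BA]; module
  · change (cc l P z).psi (me l i (cl l s) n) (me l (cl l s) (i - Nn l * m) (z - n)) = _
    rw [psi_me, AB, map_add, map_smul, smul_eq_mul]

variable {L : Type*} [LieRing L] [LieAlgebra ℂ L] {S : Sys l L}

namespace Rep
open XS

/-- entry functional on the model -/
def ent (l : ℕ) (P z : ℤ) (j k : ℤ) : (cc l P z).Ext →ₗ[ℂ] ℂ where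
  toFun u := cf (j - k, z) (u : LM (ZZ l) × ℂ).1 (j : ZZ l) (k : ZZ l)
  map_add' u v := by
    change cf (j - k, z) ((u : LM (ZZ l) × ℂ).1 + (v : LM (ZZ l) × ℂ).1) (j : ZZ l) (k : ZZ l) = _
    rw [map_add]; rfl
  map_smul' c u := by
    change cf (j - k, z) (c • (u : LM (ZZ l) × ℂ).1) (j : ZZ l) (k : ZZ l) = _
    rw [map_smul]; rfl

def enl (l : ℕ) (z : ℤ) (j k : ℤ) : LM (ZZ l) →ₗ[ℂ] ℂ where
  toFun u := cf (j - k, z) u (j : ZZ l) (k : ZZ l)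
  map_add' u v := by rw [map_add]; rfl
  map_smul' c u := by rw [map_smul]; rfl

lemma ent_eq (P z j k : ℤ) (u : LM (ZZ l)) (c : ℂ) : ent l P z j k ((u, c) : LM (ZZ l) × ℂ) = enl l z j k u := rfl

lemma enl_ne {z j k i q : ℤ} (h : ¬ Nn l ∣ i - j) : enl l z j k (ee l i q z) = 0 := by
  change cf (j - k, z) (ee l i q z) (j : ZZ l) (k : ZZ l) = 0
  unfold ee
  rw [cf_mo]
  split_ifs
  · exact mx_entry_ne h _
  · rfl
lemma enl_same (z j k : ℤ) : enl l z j k (ee l j k z) = 1 := by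
  change cf (j - k, z) (ee l j k z) (j : ZZ l) (k : ZZ l) = 1
  unfold ee
  rw [cf_mo_same, mx_entry_same]

variable {m z : ℤ} {P : ℤ} (ρ : Rep S P z)

lemma C_map {i : ℤ} (hi : Od l i) (s n : ℤ) : ρ.φ (ρ.toXS.C m z i s n) =
      ((ee l i (i - Nn l * m) z - ee l (Nn l * m - i) (-i) z + (sn ((z - n) * m) * sn (z * s) - sn (n * m)) • ee l (cl l s) (cl l s - Nn l * m) z,
        chi P z (i - cl l s, n) * (tT P z (ee l i (i - Nn l * m) z) + sn ((z - n) * m) * sn (z * s) * tT P z (ee l (cl l s) (cl l s - Nn l * m) z))) : LM (ZZ l) × ℂ) := by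
  rw [← model_T hi]
  have ok := Ok_od hi (cl_dvd (l := l) s)
  change ρ.φ ⁅ρ.X i (cl l s) n, ρ.X (cl l s) (i - Nn l * m) (z - n)⁆ = _
  rw [LieHom.map_lie, ρ.X_map ok, ρ.X_map (ok.symm.sub_right m)]

/-- coordinates -/
def La (m : ℤ) : L →ₗ[ℂ] (Fin l → ℂ) :=
  LinearMap.pi (fun j => (ent l P z ((j : ℕ) + 1 : ℤ) ((j : ℕ) + 1 - Nn l * m)) ∘ₗ (ρ.φ : L →ₗ[ℂ] (cc l P z).Ext))

lemma La_apply (x : L) (j : Fin l) : ρ.La m x j = ent l P z ((j : ℕ) + 1 : ℤ) ((j : ℕ) + 1 - Nn l * m) (ρ.φ x) := rfl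

lemma La_C {i : ℤ} (h1 : 1 ≤ i) (h2 : i ≤ l) (s n : ℤ) (j : Fin l) :
    ρ.La m (ρ.toXS.C m z i s n) j = if i = (j : ℕ) + 1 then 1 else 0 := by
  have hj := j.2
  have hoj : Od l ((j : ℕ) + 1 : ℤ) := Od_small (by omega) (by omega)
  rw [La_apply, ρ.C_map (Od_small h1 h2), ent_eq, map_add, map_sub, map_smul]
  rw [enl_ne (i := Nn l * m - i), enl_ne (i := cl l s)]
  · split_ifs with h
    · rw [h, enl_same]; simp
    · rw [enl_ne]; simp
      apply ndvd
      have : i - ((j : ℕ) + 1) ≠ 0 := by omega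
      unfold Nn; omega
  · intro hd
    apply hoj
    have := dvd_sub (cl_dvd (l := l) s) ((half_dvd l).trans hd)
    rwa [sub_sub_cancel] at this
  · intro hd
    have := dvd_sub (dvd_mul_right (Nn l) m) hd
    rw [show Nn l * m - (Nn l * m - i - ((j : ℕ) + 1)) = i + ((j : ℕ) + 1) by ring] at this
    revert this
    apply ndvd; unfold Nn; omega

lemma La_De (s n : ℤ) : ρ.La m (ρ.toXS.De m z s n) = 0 := by
  have := S.hl
  ext j
  unfold XS.De
  rw [map_sub, Pi.sub_apply, ρ.La_C le_rfl (by omega), ρ.La_C le_rfl (by omega), sub_self]; rfl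

lemma La_cv : (ρ.La m : L → _) ∘ ρ.toXS.cv m z = Pi.basisFun ℂ (Fin l) := by
  funext i
  ext j
  rw [Function.comp_apply, Pi.basisFun_apply, Pi.single_apply]
  unfold XS.cv
  have := i.2
  rw [ρ.La_C (by omega) (by omega)]
  congr 1
  rw [eq_iff_iff, Fin.ext_iff]; omega

lemma li_cv : LinearIndependent ℂ (ρ.toXS.cv m z) := by
  apply LinearIndependent.of_comp (ρ.La m)
  rw [La_cv]; exact (Pi.basisFun ℂ (Fin l)).linearIndependent

lemma li_cons {w : L} (h1 : ρ.La m w = 0) (h2 : w ≠ 0) :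
    LinearIndependent ℂ (Fin.cons w (ρ.toXS.cv m z) : Fin (l + 1) → L) := by
  rw [linearIndependent_finCons]
  refine ⟨ρ.li_cv, fun hw => h2 ?_⟩
  obtain ⟨c, rfl⟩ := (Submodule.mem_span_range_iff_exists_fun ℂ).1 hw
  rw [map_sum] at h1
  have h3 : ∀ i, ρ.La m (c i • ρ.toXS.cv m z i) = c i • Pi.basisFun ℂ (Fin l) i := by
    intro i; rw [map_smul, ← ρ.La_cv (m := m)]; rfl
  rw [Finset.sum_congr rfl (fun i _ => h3 i)] at h1
  have h4 := Fintype.linearIndependent_iff.1 (Pi.basisFun ℂ (Fin l)).linearIndependent c h1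
  exact Finset.sum_eq_zero (fun i _ => by rw [h4 i, zero_smul])

lemma cv_mem (i : Fin l) : ρ.toXS.cv m z i ∈ S.Gr (cst l (2 * m)) z :=
  ρ.toXS.C_mem m z (Od_small (by omega) (by have := i.2; omega)) 0 0

lemma dim_w (h0 : ¬ (m = 0 ∧ z = 0)) {w : L} (hw : w ∈ S.Gr (cst l (2 * m)) z) (h1 : ρ.La m w = 0) (h2 : w ≠ 0)
    (g1 : ρ.toXS.De m z 2 0 ∈ Submodule.span ℂ {w})
    (g2 : ρ.toXS.De m z 0 1 ∈ Submodule.span ℂ {w}) (g3 : ρ.toXS.De m z 1 0 ∈ Submodule.span ℂ {w}) :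
    Module.finrank ℂ (S.Gr (cst l (2 * m)) z) = l + 1 := by
  have e : S.Gr (cst l (2 * m)) z = Submodule.span ℂ (Set.range (Fin.cons w (ρ.toXS.cv m z) : Fin (l + 1) → L)) := by
    apply le_antisymm (ρ.toXS.span_w m z h0 w g1 g2 g3)
    rw [Submodule.span_le]
    rintro _ ⟨i, rfl⟩
    induction i using Fin.cases with
    | zero => exact hw
    | succ i => exact ρ.cv_mem i
  rw [e, finrank_span_eq_card (ρ.li_cons h1 h2), Fintype.card_fin]

lemma dim_w0 (h0 : ¬ (m = 0 ∧ z = 0))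
    (g1 : ρ.toXS.De m z 2 0 = 0) (g2 : ρ.toXS.De m z 0 1 = 0) (g3 : ρ.toXS.De m z 1 0 = 0) :
    Module.finrank ℂ (S.Gr (cst l (2 * m)) z) = l := by
  have e : S.Gr (cst l (2 * m)) z = Submodule.span ℂ (Set.range (ρ.toXS.cv m z)) := by
    apply le_antisymm (ρ.toXS.span_w0 m z h0 g1 g2 g3)
    rw [Submodule.span_le]
    rintro _ ⟨i, rfl⟩
    exact ρ.cv_mem i
  rw [e, finrank_span_eq_card ρ.li_cv, Fintype.card_fin]


lemma w_oo (hm : Odd m) (hz : Odd z) : ρ.toXS.De m z 0 1 ≠ 0 := by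
  intro h
  have h2 := congrArg ρ.φ h
  have o := Od_one S.hl
  unfold XS.De at h2
  rw [map_sub, ρ.C_map o, ρ.C_map o, map_zero] at h2
  have h3 := congrArg Prod.fst h2
  change _ - _ = (0 : LM (ZZ l)) at h3
  rw [mul_zero, sn_zero, sub_mul, zero_mul, one_mul, sn_sub, sn_odd (hz.mul hm), sn_odd hm, sub_zero, sn_odd (hz.mul hm), sn_zero] at h3
  apply ee_ne (l := l) (cl l 0) (cl l 0 - Nn l * m) z
  linear_combination (norm := module) (1 / 4 : ℂ) • h3

lemma w_eo (hm : Even m) (hz : Odd z) : ρ.toXS.De m z 1 0 ≠ 0 := by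
  intro h
  have h2 := congrArg ρ.φ h
  have o := Od_one S.hl
  unfold XS.De at h2
  rw [map_sub, ρ.C_map o, ρ.C_map o, map_zero] at h2
  have h3 := congrArg Prod.fst h2
  change _ - _ = (0 : LM (ZZ l)) at h3
  rw [mul_zero, sn_zero, zero_mul, sub_zero, mul_one, sn_even (hm.mul_left z), sn_odd hz, sn_zero] at h3
  apply ee_ne (l := l) (cl l 1) (cl l 1 - Nn l * m) z
  linear_combination (norm := module) (-1 / 2 : ℂ) • h3

lemma tT_ev (hm : Even m) (hz : Even z) (i : ℤ) : tT (Nn l * m) z (ee l i (i - Nn l * m) z) = 2 := by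
  rw [t_ee, if_pos, if_pos, sn_even hz]; norm_num
  · obtain ⟨r, hr⟩ := hm; exact ⟨r, by rw [hr]; ring⟩
  · rw [sub_sub_cancel]

lemma cen_ee (hm : Even m) (hz : Even z) (hP : P = Nn l * m) {i : ℤ} (hi : Od l i) (s n : ℤ) :
    (ρ.φ (ρ.toXS.C m z i s n) : LM (ZZ l) × ℂ).2 = 4 * (z * (i - cl l s) - Nn l * m * n) := by
  rw [ρ.C_map hi]
  subst hP
  change chi _ _ _ * _ = _
  rw [tT_ev hm hz, tT_ev hm hz, sn_even (hm.mul_left _), sn_even (hz.mul_right _)]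
  unfold chi; push_cast; ring

lemma w_ee2 (hm : Even m) (hz : Even z) (hP : P = Nn l * m) (h0 : m ≠ 0) : ρ.toXS.De m z 0 1 ≠ 0 := by
  intro h
  have h2 := congrArg ρ.φ h
  have o := Od_one S.hl
  unfold XS.De at h2
  rw [map_sub, map_zero] at h2
  have h3 := congrArg Prod.snd h2
  change (ρ.φ (ρ.toXS.C m z 1 0 1) : LM (ZZ l) × ℂ).2 - (ρ.φ (ρ.toXS.C m z 1 0 0) : LM (ZZ l) × ℂ).2 = 0 at h3
  rw [ρ.cen_ee hm hz hP o, ρ.cen_ee hm hz hP o] at h3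
  have h4 : ((Nn l * m : ℤ) : ℂ) = 0 := by push_cast at h3 ⊢; linear_combination (-1 / 4 : ℂ) * h3
  rw [Int.cast_eq_zero, mul_eq_zero] at h4
  rcases h4 with h4 | h4
  · unfold Nn at h4; omega
  · exact h0 h4

lemma w_ee1 (hm : Even m) (hz : Even z) (hP : P = Nn l * m) (h0 : z ≠ 0) : ρ.toXS.De m z 2 0 ≠ 0 := by
  intro h
  have h2 := congrArg ρ.φ h
  have o := Od_one S.hl
  unfold XS.De at h2
  rw [map_sub, map_zero] at h2
  have h3 := congrArg Prod.snd h2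
  change (ρ.φ (ρ.toXS.C m z 1 2 0) : LM (ZZ l) × ℂ).2 - (ρ.φ (ρ.toXS.C m z 1 0 0) : LM (ZZ l) × ℂ).2 = 0 at h3
  rw [ρ.cen_ee hm hz hP o, ρ.cen_ee hm hz hP o] at h3
  have h4 : ((Nn l * z : ℤ) : ℂ) = 0 := by unfold cl at h3; push_cast at h3 ⊢; linear_combination (-1 / 4 : ℂ) * h3
  rw [Int.cast_eq_zero, mul_eq_zero] at h4
  rcases h4 with h4 | h4
  · unfold Nn at h4; omega
  · exact h0 h4

/-- even case, final dimensions -/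
theorem dim_even (ρ : Rep S P z) (h0 : ¬ (m = 0 ∧ z = 0)) (hP : P = Nn l * m) :
    Module.finrank ℂ (S.Gr (cst l (2 * m)) z) = if Odd m ∧ Even z then l else l + 1 := by
  have self : ∀ w : L, w ∈ Submodule.span ℂ {w} := Submodule.mem_span_singleton_self
  have zz : ∀ w : L, (0 : L) ∈ Submodule.span ℂ {w} := fun w => Submodule.zero_mem _
  rcases Int.even_or_odd m with hm | hm <;> rcases Int.even_or_odd z with hz | hz
  · rw [if_neg (fun h => (Int.not_even_iff_odd.2 h.1) hm)]
    obtain ⟨e1, e2⟩ := ρ.toXS.case_ee m z hm hz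
    by_cases hm0 : m = 0
    · have hz0 : z ≠ 0 := fun h => h0 ⟨hm0, h⟩
      refine ρ.dim_w h0 (ρ.toXS.De_mem' m z 2 0) (ρ.La_De 2 0) (ρ.w_ee1 hm hz hP hz0) (self _) ?_ ?_
      · have hzc : (z : ℂ) ≠ 0 := Int.cast_ne_zero.2 hz0
        have : ρ.toXS.De m z 0 1 = (z : ℂ)⁻¹ • (m : ℂ) • ρ.toXS.De m z 2 0 := by
          rw [e2, smul_smul, inv_mul_cancel₀ hzc, one_smul]
        rw [this]
        exact Submodule.smul_mem _ _ (Submodule.smul_mem _ _ (self _))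
      · rw [e1]; exact Submodule.smul_mem _ _ (self _)
    · have hzc : (m : ℂ) ≠ 0 := Int.cast_ne_zero.2 hm0
      have e3 : ρ.toXS.De m z 2 0 = (m : ℂ)⁻¹ • (z : ℂ) • ρ.toXS.De m z 0 1 := by
        rw [← e2, smul_smul, inv_mul_cancel₀ hzc, one_smul]
      have e4 : ρ.toXS.De m z 2 0 ∈ Submodule.span ℂ {ρ.toXS.De m z 0 1} := by
        rw [e3]
        exact Submodule.smul_mem _ _ (Submodule.smul_mem _ _ (self _))
      refine ρ.dim_w h0 (ρ.toXS.De_mem' m z 0 1) (ρ.La_De 0 1) (ρ.w_ee2 hm hz hP hm0) e4 (self _) ?_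
      rw [e1]; exact Submodule.smul_mem _ _ e4
  · rw [if_neg (fun h => (Int.not_even_iff_odd.2 h.1) hm)]
    obtain ⟨e1, e2⟩ := ρ.toXS.case_eo m z hm hz
    refine ρ.dim_w h0 (ρ.toXS.De_mem' m z 1 0) (ρ.La_De 1 0) (ρ.w_eo hm hz) ?_ ?_ (self _)
    · rw [e1]; exact zz _
    · rw [e2]; exact zz _
  · rw [if_pos ⟨hm, hz⟩]
    obtain ⟨e1, e2, e3⟩ := ρ.toXS.case_oe m z hm hz
    exact ρ.dim_w0 h0 e1 e2 e3
  · rw [if_neg (fun h => (Int.not_even_iff_odd.2 hz) h.2)]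
    obtain ⟨e1, e2⟩ := ρ.toXS.case_oo m z hm hz
    refine ρ.dim_w h0 (ρ.toXS.De_mem' m z 0 1) (ρ.La_De 0 1) (ρ.w_oo hm hz) ?_ (self _) ?_
    · rw [e1]; exact self _
    · rw [e2]; exact Submodule.smul_mem _ _ (self _)

theorem dim_odd (ρ : Rep S P z) {p : ℤ} (hp : Odd p) : Module.finrank ℂ (S.Gr (cst l p) z) = 1 := by
  have o := Od_one S.hl
  have hl := S.hl
  have hne : ρ.toXS.J p z 1 0 0 ≠ 0 := by
    intro h
    have h2 := congrArg ρ.φ h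
    have ok1 := Ok_od o (cl_dvd (l := l) 0)
    have ok2 := (Ok_od o (cl_dvd (l := l) (0 + p))).symm
    change ρ.φ ⁅ρ.X 1 (cl l 0) 0, ρ.X (cl l (0 + p)) 1 (z - 0)⁆ = _ at h2
    rw [LieHom.map_lie, ρ.X_map ok1, ρ.X_map ok2, map_zero] at h2
    have h3 := congrArg Prod.fst h2
    change me l 1 (cl l 0) 0 * me l (cl l (0 + p)) 1 (z - 0) - me l (cl l (0 + p)) 1 (z - 0) * me l 1 (cl l 0) 0 = 0 at h3
    have c0 : cl l 0 = 0 := by unfold cl; ring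
    have hnp : ¬ Nn l ∣ cl l p := by
      rintro ⟨r, hr⟩
      unfold cl at hr
      rw [Nn_eq] at hr
      have : p = 2 * r := by
        have : ((l : ℤ) + 1) * (p - 2 * r) = 0 := by linear_combination hr
        rcases mul_eq_zero.1 this with h | h <;> omega
      exact (Int.not_even_iff_odd.2 hp) ⟨r, by omega⟩
    have n1 : ¬ Nn l ∣ 1 - -1 := by apply ndvd; unfold Nn; omega
    have n2 : ¬ Nn l ∣ -1 - 1 := by apply ndvd; unfold Nn; omega
    rw [c0, zero_add, sub_zero] at h3
    unfold me at h3
    rw [neg_zero] at h3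
    rw [sub_mul, mul_sub, mul_sub, sub_mul, mul_sub, mul_sub,
      ee_mul_ne (j := 0) (j' := cl l p) (by rw [zero_sub, dvd_neg]; exact hnp),
      ee_mul_ne (j := 0) (j' := -1) (by apply ndvd; unfold Nn; omega),
      ee_mul_ne (j := -1) (j' := cl l p) (by
        intro hd
        have := (dvd_add ((half_dvd l).trans hd) (cl_dvd (l := l) p))
        rw [sub_add_cancel] at this
        exact o.neg this),
      ee_mul, ee_mul, ee_mul_ne (j := 1) (j' := 0) (by apply ndvd; unfold Nn; omega),
      ee_mul_ne (j := -cl l p) (j' := 1) (by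
        intro hd
        have := (dvd_add ((half_dvd l).trans hd) (cl_dvd (l := l) p))
        rw [show -cl l p - 1 + cl l p = -1 by ring] at this
        exact o.neg this),
      ee_mul_ne (j := -cl l p) (j' := 0) (by rw [sub_zero, dvd_neg]; exact hnp), zero_add, add_zero] at h3
    have h4 := congrArg (Rep.enl l z 0 (-cl l p)) h3
    rw [map_sub, map_zero] at h4
    have h5 : Rep.enl l z 0 (-cl l p) (ee l (cl l p) 0 z) = 0 := Rep.enl_ne (by rw [sub_zero]; exact hnp)
    simp only [map_sub, map_zero, h5, Rep.enl_same, sub_zero, zero_sub, sub_neg_eq_add, add_zero] at h4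
    have h6 := Rep.enl_same (l := l) z 0 (-cl l p)
    rw [zero_add] at h4
    exact one_ne_zero (h6.symm.trans h4)
  have e : S.Gr (cst l p) z = Submodule.span ℂ {ρ.toXS.J p z 1 0 0} := by
    apply le_antisymm (ρ.toXS.span_odd p z hp)
    rw [Submodule.span_singleton_le_iff_mem]
    exact ρ.toXS.J_mem p z o 0 0
  rw [e, finrank_span_singleton hne]

end Rep
end
end Ell

namespace Ell
noncomputable section
open LieAlgebra TensorProduct

/-- the Gram matrix of the nodes -/
def gm (l t u : ℕ) : ℤ :=
  (if u = t then (if t = 0 ∨ t = l then 1 else 2) else 0) + (if u + 1 = t then -1 else 0) +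
    (if u = t + 1 then -1 else 0)

/-- root data: nodes `b 0, …, b l` and the null vector `a` -/
structure RD {V : Type*} [AddCommGroup V] [Module ℝ V] (l : ℕ) (B : LinearMap.BilinForm ℝ V)
    (a : V) (b : ℕ → V) : Prop where
  hl : 2 ≤ l
  symm : ∀ u v, B u v = B v u
  ha : ∀ v, B a v = 0
  null : ∀ v, B v v = 0 → ∀ w, B w v = 0
  gram : ∀ t ≤ l, ∀ u ≤ l, B (b t) (b u) = (gm l t u : ℝ)
  indep : ∀ (n : ℕ → ℤ) (z : ℤ), ∑ t ∈ Finset.range (l + 1), n t • b t + z • a = 0 →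
    (∀ t ≤ l, n t = 0) ∧ z = 0

def toV {V : Type*} [AddCommGroup V] (l : ℕ) (a : V) (b : ℕ → V) (n : ℕ → ℤ) (z : ℤ) : V :=
  ∑ t ∈ Finset.range (l + 1), n t • b t + z • a

/-- sign -/
def sp (p : Bool) : ℤ := if p then 1 else -1
/-- degree of generators -/
def dv (l t : ℕ) (s p : Bool) : ℕ → ℤ := sg t (sp p * (if s then stc l t else 1))
def dz (s p : Bool) : ℤ := sp p * (if s then 1 else 0)
/-- the roots of the generators -/
def rt {V : Type*} [AddCommGroup V] (l : ℕ) (a : V) (b : ℕ → V) (t : ℕ) (s p : Bool) : V :=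
  sp p • (if s then stc l t • b t + a else b t)
/-- pairing with the coroot of a generator -/
def pq (l t : ℕ) (s p : Bool) (n : ℕ → ℤ) : ℤ := sp p * (if s then prs l t n else pr l t n)

lemma sp_neg (p : Bool) : sp (!p) = - sp p := by cases p <;> simp [sp]
lemma sp_sq (p : Bool) : sp p * sp p = 1 := by cases p <;> simp [sp]
lemma sp_eq {p q : Bool} (h : sp p = sp q) : p = q := by
  revert h; cases p <;> cases q <;> simp [sp]

section
variable {V : Type*} [AddCommGroup V] [Module ℝ V] {l : ℕ} {B : LinearMap.BilinForm ℝ V}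
    {a : V} {b : ℕ → V}

lemma toV_add (n m : ℕ → ℤ) (z y : ℤ) :
    toV l a b (n + m) (z + y) = toV l a b n z + toV l a b m y := by
  unfold toV
  simp only [Pi.add_apply, add_smul, Finset.sum_add_distrib]
  abel

lemma toV_zero : toV l a b 0 0 = 0 := by simp [toV]

lemma toV_neg (n : ℕ → ℤ) (z : ℤ) : toV l a b (-n) (-z) = - toV l a b n z := by
  unfold toV
  simp only [Pi.neg_apply, neg_smul, Finset.sum_neg_distrib]
  abel

lemma toV_sg {t : ℕ} (ht : t ≤ l) (m z : ℤ) : toV l a b (sg t m) z = m • b t + z • a := by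
  unfold toV
  congr 1
  rw [Finset.sum_eq_single t]
  · simp [sg]
  · intro u _ hu
    simp [sg, Pi.single_apply, hu]
  · intro h; exact absurd (Finset.mem_range.mpr (by omega)) h

lemma rt_toV {t : ℕ} (ht : t ≤ l) (s p : Bool) :
    rt l a b t s p = toV l a b (dv l t s p) (dz s p) := by
  unfold dv
  rw [toV_sg ht]
  unfold rt dz
  cases s
  · simp
  · simp only [if_true, smul_add, mul_smul, mul_one]

lemma rt_not (t : ℕ) (s p : Bool) : rt l a b t s (!p) = - rt l a b t s p := by
  unfold rt; rw [sp_neg, neg_smul]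


lemma RD.ha' (D : RD l B a b) (v : V) : B v a = 0 := by rw [D.symm, D.ha]

lemma RD.inj (D : RD l B a b) {n m : ℕ → ℤ} {z y : ℤ} (h : toV l a b n z = toV l a b m y) :
    (∀ t ≤ l, n t = m t) ∧ z = y := by
  have h1 : toV l a b (n - m) (z - y) = 0 := by
    rw [sub_eq_add_neg, sub_eq_add_neg, toV_add, toV_neg, h, add_neg_cancel]
  obtain ⟨h2, h3⟩ := D.indep _ _ h1
  refine ⟨fun t ht => ?_, by omega⟩
  have := h2 t ht
  simp only [Pi.sub_apply] at this
  omega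

lemma RD.B_toV (D : RD l B a b) {t : ℕ} (ht : t ≤ l) (n : ℕ → ℤ) (z : ℤ) :
    B (b t) (toV l a b n z) = ((∑ u ∈ Finset.range (l + 1), n u * gm l t u : ℤ) : ℝ) := by
  unfold toV
  rw [map_add, map_sum, map_zsmul, D.ha', smul_zero, add_zero]
  push_cast
  apply Finset.sum_congr rfl
  intro u hu
  rw [map_zsmul, D.gram t ht u (by simpa [Nat.lt_succ_iff] using hu), zsmul_eq_mul]

lemma gm_sum (hl : 2 ≤ l) {t : ℕ} (ht : t ≤ l) (n : ℕ → ℤ) :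
    (if t = 0 ∨ t = l then 2 else 1) * ∑ u ∈ Finset.range (l + 1), n u * gm l t u = pr l t n := by
  unfold gm
  simp only [mul_add, Finset.sum_add_distrib, mul_ite, mul_zero]
  have e1 : ∀ c : ℤ, ∑ u ∈ Finset.range (l + 1), (if u = t then n u * c else 0) = n t * c := by
    intro c
    rw [Finset.sum_ite_eq' (Finset.range (l+1)) t (fun u => n u * c), if_pos (Finset.mem_range.mpr (by omega))]
  have e2 : ∀ c : ℤ, ∑ u ∈ Finset.range (l + 1), (if u + 1 = t then n u * c else 0) = if t = 0 then 0 else n (t - 1) * c := by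
    intro c
    split_ifs with h
    · apply Finset.sum_eq_zero; intro u _; rw [if_neg (by omega)]
    · rw [Finset.sum_eq_single (t - 1)]
      · rw [if_pos (by omega)]
      · intro u _ hu; rw [if_neg (by omega)]
      · intro h'; exact absurd (Finset.mem_range.mpr (by omega)) h'
  have e3 : ∀ c : ℤ, ∑ u ∈ Finset.range (l + 1), (if u = t + 1 then n u * c else 0) = if t = l then 0 else n (t + 1) * c := by
    intro c
    split_ifs with h
    · apply Finset.sum_eq_zero; intro u hu; rw [if_neg]; have := Finset.mem_range.mp hu; omega
    · rw [Finset.sum_ite_eq' (Finset.range (l+1)) (t+1) (fun u => n u * c), if_pos (Finset.mem_range.mpr (by omega))]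
  unfold pr
  by_cases h0 : t = 0
  · subst h0
    have : (0 : ℕ) ≠ l := by omega
    simp only [true_or, if_true, e1, e2, e3, this, if_false]
    simp
    ring
  · by_cases h1 : t = l
    · subst h1
      simp only [or_true, if_true, e1, e2, e3, h0, if_false]
      simp
      ring
    · simp only [h0, h1, or_self, if_false, e1, e2, e3]
      ring

lemma RD.diag (D : RD l B a b) {t : ℕ} (ht : t ≤ l) : B (b t) (b t) = if t = 0 ∨ t = l then 1 else 2 := by
  rw [D.gram t ht t ht]
  unfold gm
  split_ifs <;> first | omega | norm_num

lemma RD.pair (D : RD l B a b) {t : ℕ} (ht : t ≤ l) (s p : Bool) (n : ℕ → ℤ) (z : ℤ) :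
    2 * B (rt l a b t s p) (toV l a b n z) / B (rt l a b t s p) (rt l a b t s p) = (pq l t s p n : ℝ) := by
  have h1 : ∀ c : ℤ, ∀ v, B (c • b t + a) v = c * B (b t) v := by
    intro c v
    rw [map_add, map_zsmul, LinearMap.add_apply, D.ha, add_zero, LinearMap.smul_apply, zsmul_eq_mul]
  have h1' : ∀ c : ℤ, ∀ v, B v (c • b t + a) = c * B v (b t) := by
    intro c v
    rw [D.symm, h1, D.symm]
  have hg := gm_sum D.hl ht n
  have hB := D.B_toV ht n z
  have hd := D.diag ht
  have hl := D.hl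
  have sq : ∀ v, B (sp p • v) (sp p • v) = B v v := by
    intro v
    rw [map_zsmul, map_zsmul, LinearMap.smul_apply, smul_smul, sp_sq, one_smul]
  unfold rt
  rw [sq, map_zsmul, LinearMap.smul_apply, zsmul_eq_mul]
  unfold pq
  rw [Int.cast_mul]
  rw [show ∀ x y : ℝ, 2 * ((sp p : ℝ) * x) / y = sp p * (2 * x / y) by intros; ring]
  congr 1
  set SS := ∑ u ∈ Finset.range (l + 1), n u * gm l t u
  cases s
  · simp only [Bool.false_eq_true, if_false]
    rw [hB, hd, ← hg]
    split_ifs <;> push_cast <;> ring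
  · simp only [if_true]
    rw [h1, h1, h1', hB, hd]
    by_cases ht' : t = l
    · subst ht'
      have h3 : prs t t n = SS := by
        have : pr t t n = 2 * prs t t n := by
          unfold prs pr
          rw [if_neg (by omega), if_pos rfl, if_pos rfl]; ring
        rw [this] at hg
        simp only [or_true, if_true] at hg
        omega
      rw [h3]
      simp only [stc, or_true, if_true]
      push_cast
      ring
    · have h3 : prs l t n = pr l t n := by unfold prs; rw [if_neg ht']
      rw [h3, ← hg]
      simp only [stc, ht', if_false]
      split_ifs <;> push_cast <;> ring

/-- injectivity of the root map -/
lemma RD.rt_inj (D : RD l B a b) {t u : ℕ} (ht : t ≤ l) (hu : u ≤ l) {s s' p p' : Bool}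
    (h : rt l a b t s p = rt l a b u s' p') : t = u ∧ s = s' ∧ p = p' := by
  rw [rt_toV ht, rt_toV hu] at h
  obtain ⟨h1, h2⟩ := D.inj h
  have hl := D.hl
  have h3 := h1 t ht
  unfold dv at h3
  have htu : t = u := by
    by_contra hne
    simp only [sg, Pi.single_eq_same, Pi.single_apply, hne, if_false] at h3
    revert h3
    unfold stc sp
    cases s <;> cases p <;> simp <;> split_ifs <;> simp
  subst htu
  simp only [sg, Pi.single_eq_same] at h3
  refine ⟨rfl, ?_⟩
  revert h2 h3
  unfold dz stc sp
  cases s <;> cases p <;> cases s' <;> cases p' <;> simp <;> split_ifs <;> norm_num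

end

end
end Ell

namespace Ell
noncomputable section
open LieAlgebra TensorProduct

variable {V : Type*} [AddCommGroup V] [Module ℝ V] {l : ℕ} {B : LinearMap.BilinForm ℝ V}
    {a : V} {b : ℕ → V}

/-- complexified form against a real vector -/
def bc (B : LinearMap.BilinForm ℝ V) (σ : ℂ ⊗[ℝ] V) (v : V) : ℂ :=
  LinearMap.BilinForm.baseChange ℂ B σ ((1 : ℂ) ⊗ₜ[ℝ] v)

lemma bc_add (σ : ℂ ⊗[ℝ] V) (v w : V) : bc B σ (v + w) = bc B σ v + bc B σ w := by
  unfold bc; rw [TensorProduct.tmul_add, map_add]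
lemma bc_neg (σ : ℂ ⊗[ℝ] V) (v : V) : bc B σ (-v) = - bc B σ v := by
  unfold bc; rw [TensorProduct.tmul_neg, map_neg]
lemma bc_zero (σ : ℂ ⊗[ℝ] V) : bc B σ 0 = 0 := by
  unfold bc; rw [TensorProduct.tmul_zero, map_zero]
lemma bc_one (w v : V) : bc B ((1 : ℂ) ⊗ₜ[ℝ] w) v = (B w v : ℂ) := by
  unfold bc; rw [LinearMap.BilinForm.baseChange_tmul]; simp
lemma bc_smul_left (c : ℂ) (σ : ℂ ⊗[ℝ] V) (v : V) : bc B (c • σ) v = c * bc B σ v := by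
  unfold bc; rw [map_smul]; rfl
lemma bc_add_left (σ τ : ℂ ⊗[ℝ] V) (v : V) : bc B (σ + τ) v = bc B σ v + bc B τ v := by
  unfold bc; rw [map_add]; rfl

/-- coroot -/
def cr (B : LinearMap.BilinForm ℝ V) (v : V) : V := (2 / B v v) • v

lemma RD.cr_pair (D : RD l B a b) {t : ℕ} (ht : t ≤ l) (s p : Bool) (n : ℕ → ℤ) (z : ℤ) :
    bc B ((1 : ℂ) ⊗ₜ[ℝ] cr B (rt l a b t s p)) (toV l a b n z) = (pq l t s p n : ℂ) := by
  rw [bc_one]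
  have h := D.pair ht s p n z
  unfold cr
  rw [map_smul, LinearMap.smul_apply, smul_eq_mul]
  rw [show 2 / B (rt l a b t s p) (rt l a b t s p) * B (rt l a b t s p) (toV l a b n z) = (pq l t s p n : ℝ) by
    rw [← h]; ring]
  simp

/-- the defining relations of the elliptic Lie algebra, indexed by nodes -/
structure IsPres (l : ℕ) (B : LinearMap.BilinForm ℝ V) (a : V) (b : ℕ → V) {L : Type*} [LieRing L]
    [LieAlgebra ℂ L] (H : ℂ ⊗[ℝ] V → L) (E : ℕ → Bool → Bool → L) : Prop where
  lin : ∀ (x y : ℂ) σ τ, x • H σ + y • H τ = H (x • σ + y • τ)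
  hh : ∀ σ τ, ⁅H σ, H τ⁆ = 0
  hE : ∀ σ, ∀ t ≤ l, ∀ s p, ⁅H σ, E t s p⁆ = bc B σ (rt l a b t s p) • E t s p
  ef : ∀ t ≤ l, ∀ s, ⁅E t s true, E t s false⁆ = H ((1 : ℂ) ⊗ₜ[ℝ] cr B (rt l a b t s true))
  sr5 : ∀ t ≤ l, ∀ u ≤ l, ∀ s s' p p', ¬ (t = u ∧ s = s') →
    (ad ℂ L (E t s p) ^ (1 + (- pq l t s p (dv l u s' p')).toNat)) (E u s' p') = 0
  sr6 : ∀ t < l, ∀ u < l, 1 ≤ u → (t + 1 = u ∨ u + 1 = t) → ∀ p,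
    ⁅E t true p, E u false p⁆ = ⁅E t false p, E u true p⁆
  sr6l : (2 : ℂ) • ⁅E l true true, E (l - 1) false true⁆ = ⁅E l false true, ⁅E l false true, E (l - 1) true true⁆⁆
  sr7l : (-2 : ℂ) • ⁅E l true false, E (l - 1) false false⁆ = ⁅E l false false, ⁅E l false false, E (l - 1) true false⁆⁆

namespace IsPres
variable {L : Type*} [LieRing L] [LieAlgebra ℂ L] {H : ℂ ⊗[ℝ] V → L} {E : ℕ → Bool → Bool → L}

lemma pr_sg_ne {t u : ℕ} (hl : 2 ≤ l) (ht : t ≤ l) (hu : u ≤ l) (h : t ≠ u) (m : ℤ) (hm : 0 ≤ m) :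
    pr l t (sg u m) ≤ 0 ∧ prs l t (sg u m) ≤ 0 := by
  unfold prs pr sg
  simp only [Pi.single_apply]
  split_ifs <;> omega

lemma pr_sg_far {t u : ℕ} (hl : 2 ≤ l) (ht : t ≤ l) (hu : u ≤ l) (h : t + 1 < u ∨ u + 1 < t) (m : ℤ) :
    pr l t (sg u m) = 0 ∧ prs l t (sg u m) = 0 := by
  unfold prs pr sg
  simp only [Pi.single_apply]
  split_ifs <;> omega

lemma pr_sg_same {t : ℕ} (hl : 2 ≤ l) (ht : t ≤ l) (m : ℤ) (hm : 0 ≤ m) :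
    0 ≤ pr l t (sg t m) ∧ 0 ≤ prs l t (sg t m) := by
  unfold prs pr sg
  simp only [Pi.single_apply]
  split_ifs <;> omega

lemma stc_nn (s : Bool) (l t : ℕ) : 0 ≤ (if s then stc l t else 1) := by
  unfold stc; split_ifs <;> norm_num

lemma sg_neg1 (t : ℕ) (m : ℤ) : sg t (-1 * m) = - sg t m := by
  rw [neg_one_mul]; funext u; simp only [sg, Pi.single_apply, Pi.neg_apply]; split_ifs <;> simp

lemma pq_opp {t u : ℕ} (hl : 2 ≤ l) (ht : t ≤ l) (hu : u ≤ l) (h : t ≠ u) (s s' p : Bool) :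
    0 ≤ pq l t s p (dv l u s' (!p)) := by
  have := pr_sg_ne hl ht hu h _ (stc_nn s' l u)
  unfold pq dv
  cases p
  · simp only [Bool.not_false, sp, if_true, Bool.false_eq_true, if_false, one_mul]
    split_ifs <;> simp_all
  · simp only [Bool.not_true, sp, if_true, Bool.false_eq_true, if_false, one_mul, sg_neg1, pr_neg, prs_neg]
    split_ifs <;> simp_all

lemma pq_far {t u : ℕ} (hl : 2 ≤ l) (ht : t ≤ l) (hu : u ≤ l) (h : t + 1 < u ∨ u + 1 < t) (s s' p p' : Bool) :
    0 ≤ pq l t s p (dv l u s' p') := by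
  unfold pq dv
  rw [(pr_sg_far hl ht hu h _).1, (pr_sg_far hl ht hu h _).2]
  simp

lemma pq_same {t : ℕ} (hl : 2 ≤ l) (ht : t ≤ l) (s s' p : Bool) :
    0 ≤ pq l t s p (dv l t s' p) := by
  have := pr_sg_same hl ht _ (stc_nn s' l t)
  unfold pq dv
  cases p
  · simp only [sp, if_true, Bool.false_eq_true, if_false, one_mul, sg_neg1, pr_neg, prs_neg]
    split_ifs <;> simp_all
  · simp only [sp, if_true, Bool.false_eq_true, if_false, one_mul]
    split_ifs <;> simp_all

lemma com (K : IsPres l B a b H E) {t u : ℕ} (ht : t ≤ l) (hu : u ≤ l) {s s' p p' : Bool} (h : ¬ (t = u ∧ s = s'))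
    (hp : 0 ≤ pq l t s p (dv l u s' p')) : ⁅E t s p, E u s' p'⁆ = 0 := by
  have := K.sr5 t ht u hu s s' p p' h
  rw [show (- pq l t s p (dv l u s' p')).toNat = 0 by omega, add_zero, pow_one, ad_apply] at this
  exact this

lemma EH (K : IsPres l B a b H E) (σ) {t : ℕ} (ht : t ≤ l) (s p) :
    ⁅E t s p, H σ⁆ = (- bc B σ (rt l a b t s p)) • E t s p := by
  rw [← lie_skew, K.hE σ t ht, neg_smul]

lemma nil (K : IsPres l B a b H E)
    (gen : ∀ A : LieSubalgebra ℂ L, (∀ σ, H σ ∈ A) → (∀ t ≤ l, ∀ s p, E t s p ∈ A) → A = ⊤)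
    {t : ℕ} (ht : t ≤ l) (s p : Bool) (v : L) : ∃ n, (ad ℂ L (E t s p) ^ n) v = 0 := by
  have h2 : ∀ σ, (ad ℂ L (E t s p) ^ 2) (H σ) = 0 := by
    intro σ
    rw [pow_two, Module.End.mul_apply, ad_apply, ad_apply, K.EH σ ht, lie_smul, lie_self, smul_zero]
  have h : LieSubalgebra.engel ℂ (E t s p) = ⊤ := by
    apply gen
    · intro σ
      rw [LieSubalgebra.mem_engel_iff]
      exact ⟨2, h2 σ⟩
    · intro u hu s' p'
      rw [LieSubalgebra.mem_engel_iff]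
      by_cases hc : t = u ∧ s = s'
      · obtain ⟨rfl, rfl⟩ := hc
        by_cases hp : p = p'
        · subst hp
          exact ⟨1, by rw [pow_one, ad_apply, lie_self]⟩
        · refine ⟨3, ?_⟩
          rw [show (3 : ℕ) = 2 + 1 from rfl, pow_succ, Module.End.mul_apply, ad_apply]
          cases p <;> cases p'
          · exact absurd rfl hp
          · rw [← lie_skew, K.ef t ht, map_neg, h2, neg_zero]
          · rw [K.ef t ht, h2]
          · exact absurd rfl hp
      · exact ⟨_, K.sr5 t ht u hu s s' p p' hc⟩
  have := LieSubalgebra.mem_top (R := ℂ) (L := L) v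
  rw [← h, LieSubalgebra.mem_engel_iff] at this
  exact this

/-- weight space -/
def wsp (B : LinearMap.BilinForm ℝ V) (H : ℂ ⊗[ℝ] V → L) (v : V) : Submodule ℂ L where
  carrier := {x | ∀ σ, ⁅H σ, x⁆ = bc B σ v • x}
  add_mem' := by
    intro x y hx hy σ
    rw [lie_add, hx σ, hy σ, smul_add]
  zero_mem' := by intro σ; rw [lie_zero, smul_zero]
  smul_mem' := by
    intro c x hx σ
    rw [lie_smul, hx σ, smul_comm]

open scoped Classical in
/-- the grading by coordinates -/
def GG (l : ℕ) (B : LinearMap.BilinForm ℝ V) (a : V) (b : ℕ → V) (H : ℂ ⊗[ℝ] V → L)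
    (gr : V → Submodule ℂ L) (n : ℕ → ℤ) (z : ℤ) : Submodule ℂ L :=
  if ∀ t, l < t → n t = 0 then gr (toV l a b n z) ⊓ wsp B H (toV l a b n z) else ⊥

structure Grd (l : ℕ) (a : V) (b : ℕ → V) (H : ℂ ⊗[ℝ] V → L) (E : ℕ → Bool → Bool → L)
    (gr : V → Submodule ℂ L) : Prop where
  ind : iSupIndep gr
  mul : ∀ σ τ : V, ∀ x ∈ gr σ, ∀ y ∈ gr τ, ⁅x, y⁆ ∈ gr (σ + τ)
  h0 : ∀ σ, H σ ∈ gr 0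
  hE : ∀ t ≤ l, ∀ s p, E t s p ∈ gr (rt l a b t s p)
  gen : ∀ A : LieSubalgebra ℂ L, (∀ σ, H σ ∈ A) → (∀ t ≤ l, ∀ s p, E t s p ∈ A) → A = ⊤

variable {gr : V → Submodule ℂ L}

lemma GG_pos {n : ℕ → ℤ} (hn : ∀ t, l < t → n t = 0) (z : ℤ) :
    GG l B a b H gr n z = gr (toV l a b n z) ⊓ wsp B H (toV l a b n z) := by
  unfold GG; rw [if_pos hn]

lemma GG_mem {n : ℕ → ℤ} {z : ℤ} {x : L} (hx : x ∈ GG l B a b H gr n z) :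
    x = 0 ∨ (∀ t, l < t → n t = 0) := by
  by_cases h : ∀ t, l < t → n t = 0
  · exact Or.inr h
  · left
    unfold GG at hx
    rw [if_neg h] at hx
    exact (Submodule.mem_bot ℂ).mp hx

lemma GG_wt {n : ℕ → ℤ} {z : ℤ} {x : L} (hx : x ∈ GG l B a b H gr n z) (σ) :
    ⁅H σ, x⁆ = bc B σ (toV l a b n z) • x := by
  rcases GG_mem hx with h | h
  · rw [h, lie_zero, smul_zero]
  · rw [GG_pos h] at hx
    exact hx.2 σ

lemma GG_mul (G : Grd l a b H E gr) {n m : ℕ → ℤ} {z y : ℤ} {x w : L} (hx : x ∈ GG l B a b H gr n z)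
    (hw : w ∈ GG l B a b H gr m y) : ⁅x, w⁆ ∈ GG l B a b H gr (n + m) (z + y) := by
  rcases GG_mem hx with h | h
  · rw [h, zero_lie]; exact Submodule.zero_mem _
  rcases GG_mem hw with h' | h'
  · rw [h', lie_zero]; exact Submodule.zero_mem _
  rw [GG_pos (by intro t ht; rw [Pi.add_apply, h t ht, h' t ht, add_zero]), toV_add]
  have w1 := fun σ => GG_wt hx σ
  have w2 := fun σ => GG_wt hw σ
  rw [GG_pos h] at hx
  rw [GG_pos h'] at hw
  refine ⟨G.mul _ _ _ hx.1 _ hw.1, fun σ => ?_⟩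
  rw [leibniz_lie (H σ) x w, w1 σ, w2 σ, smul_lie, lie_smul, bc_add, add_smul]

lemma disj (D : RD l B a b) (G : Grd l a b H E gr) (q : (ℕ → ℤ) × ℤ) (hq : ∀ t, l < t → q.1 t = 0) :
    Disjoint (gr (toV l a b q.1 q.2)) (⨆ j : (ℕ → ℤ) × ℤ, ⨆ (_ : j ≠ q), GG l B a b H gr j.1 j.2) := by
  refine Disjoint.mono_right ?_ (G.ind (toV l a b q.1 q.2))
  refine iSup₂_le fun j hj => ?_
  by_cases h : ∀ t, l < t → j.1 t = 0
  · rw [GG_pos h]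
    refine le_iSup₂_of_le (toV l a b j.1 j.2) ?_ inf_le_left
    intro he
    apply hj
    obtain ⟨h1, h2⟩ := D.inj he
    refine Prod.ext (funext fun t => ?_) h2
    by_cases ht : t ≤ l
    · exact h1 t ht
    · rw [h t (by omega), hq t (by omega)]
  · unfold GG; rw [if_neg h]; exact bot_le

lemma dv_supp {t : ℕ} (ht : t ≤ l) (s p : Bool) : ∀ u, l < u → dv l t s p u = 0 := by
  intro u hu
  unfold dv sg
  rw [Pi.single_apply, if_neg (by omega)]

lemma E_mem (K : IsPres l B a b H E) (G : Grd l a b H E gr) {t : ℕ} (ht : t ≤ l) (s p : Bool) :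
    E t s p ∈ GG l B a b H gr (dv l t s p) (dz s p) := by
  rw [GG_pos (dv_supp ht s p), ← rt_toV ht]
  exact ⟨G.hE t ht s p, fun σ => K.hE σ t ht s p⟩

lemma H_mem (K : IsPres l B a b H E) (G : Grd l a b H E gr) (σ) : H σ ∈ GG l B a b H gr 0 0 := by
  rw [GG_pos (by intro t _; rfl), toV_zero]
  exact ⟨G.h0 σ, fun τ => by rw [K.hh, bc_zero, zero_smul]⟩

lemma GG_top (K : IsPres l B a b H E) (G : Grd l a b H E gr) :
    ⨆ q : (ℕ → ℤ) × ℤ, GG l B a b H gr q.1 q.2 = ⊤ := by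
  let A : LieSubalgebra ℂ L :=
    { (⨆ q : (ℕ → ℤ) × ℤ, GG l B a b H gr q.1 q.2 : Submodule ℂ L) with
      lie_mem' := by
        intro x y hx hy
        change x ∈ (⨆ q : (ℕ → ℤ) × ℤ, GG l B a b H gr q.1 q.2 : Submodule ℂ L) at hx
        change y ∈ (⨆ q : (ℕ → ℤ) × ℤ, GG l B a b H gr q.1 q.2 : Submodule ℂ L) at hy
        change ⁅x, y⁆ ∈ (⨆ q : (ℕ → ℤ) × ℤ, GG l B a b H gr q.1 q.2 : Submodule ℂ L)
        induction hx using Submodule.iSup_induction' with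
        | mem q x hx =>
          induction hy using Submodule.iSup_induction' with
          | mem r y hy => exact Submodule.mem_iSup_of_mem (q + r) (GG_mul G hx hy)
          | zero => rw [lie_zero]; exact Submodule.zero_mem _
          | add y y' _ _ h1 h2 => rw [lie_add]; exact Submodule.add_mem _ h1 h2
        | zero => rw [zero_lie]; exact Submodule.zero_mem _
        | add y y' _ _ h1 h2 => rw [add_lie]; exact Submodule.add_mem _ h1 h2 }
  have hA : A = ⊤ := by
    apply G.gen
    · intro σ
      exact Submodule.mem_iSup_of_mem ((0, 0) : (ℕ → ℤ) × ℤ) (H_mem K G σ)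
    · intro t ht s p
      exact Submodule.mem_iSup_of_mem ((dv l t s p, dz s p) : (ℕ → ℤ) × ℤ) (E_mem K G ht s p)
  rw [eq_top_iff]
  intro x _
  have : x ∈ A := by rw [hA]; exact LieSubalgebra.mem_top x
  exact this

lemma GG_eq (D : RD l B a b) (K : IsPres l B a b H E) (G : Grd l a b H E gr) {n : ℕ → ℤ}
    (hn : ∀ t, l < t → n t = 0) (z : ℤ) : GG l B a b H gr n z = gr (toV l a b n z) := by
  have h1 := disj D G (n, z) hn
  have h2 := GG_top K G
  rw [iSup_split_single _ ((n, z) : (ℕ → ℤ) × ℤ)] at h2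
  have h3 : GG l B a b H gr n z ≤ gr (toV l a b n z) := by rw [GG_pos hn]; exact inf_le_left
  have h4 := sup_inf_assoc_of_le (⨆ j : (ℕ → ℤ) × ℤ, ⨆ (_ : j ≠ (n, z)), GG l B a b H gr j.1 j.2) h3
  rw [inf_comm (⨆ j : (ℕ → ℤ) × ℤ, ⨆ (_ : j ≠ (n, z)), GG l B a b H gr j.1 j.2)] at h4
  rw [h2, top_inf_eq, h1.eq_bot, sup_bot_eq] at h4
  exact h4.symm

/-- the presented algebra as an abstract system -/
def toSys (D : RD l B a b) (K : IsPres l B a b H E) (G : Grd l a b H E gr) : Sys l L where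
  hl := D.hl
  e t := E t false true
  f t := E t false false
  es t := E t true true
  fs t := E t true false
  h t := H ((1 : ℂ) ⊗ₜ[ℝ] cr B (rt l a b t false true))
  hs t := H ((1 : ℂ) ⊗ₜ[ℝ] cr B (rt l a b t true true))
  Hs := Set.range H
  Gr := GG l B a b H gr
  indep := by
    intro q
    beta_reduce
    by_cases h : ∀ t, l < t → q.1 t = 0
    · refine Disjoint.mono_left ?_ (disj D G q h)
      rw [GG_pos h]; exact inf_le_left
    · rw [show GG l B a b H gr q.1 q.2 = ⊥ by unfold GG; rw [if_neg h]]
      exact disjoint_bot_left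
  top := GG_top K G
  mul n z m y u v hu hv := GG_mul G hu hv
  he t ht := by have := E_mem K G ht false true; simpa [dv, dz, sp] using this
  hf t ht := by have := E_mem K G ht false false; simpa [dv, dz, sp] using this
  hes t ht := by have := E_mem K G ht true true; simpa [dv, dz, sp] using this
  hfs t ht := by have := E_mem K G ht true false; simpa [dv, dz, sp] using this
  wt t ht n z v hv := by
    rw [GG_wt hv, D.cr_pair ht]; simp [pq, sp]
  wts t ht n z v hv := by
    rw [GG_wt hv, D.cr_pair ht]; simp [pq, sp]
  wtH := by
    rintro _ ⟨σ, rfl⟩ n z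
    exact ⟨_, fun v hv => GG_wt hv σ⟩
  H0 := by rintro _ ⟨σ, rfl⟩; exact H_mem K G σ
  ef t ht := K.ef t ht false
  esfs t ht := K.ef t ht true
  ees t ht := K.com ht ht (by simp) (pq_same D.hl ht _ _ _)
  ffs t ht := K.com ht ht (by simp) (pq_same D.hl ht _ _ _)
  cross t ht u hu h := ⟨K.com ht hu (by simp [h]) (pq_opp D.hl ht hu h _ _ true),
    K.com ht hu (by simp [h]) (pq_opp D.hl ht hu h _ _ true),
    K.com ht hu (by simp [h]) (pq_opp D.hl ht hu h _ _ true),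
    K.com ht hu (by simp [h]) (pq_opp D.hl ht hu h _ _ true)⟩
  far t ht u hu h := by
    have hne : t ≠ u := by omega
    refine ⟨?_, ?_, ?_, ?_, ?_, ?_⟩ <;>
    exact K.com ht hu (by simp [hne]) (pq_far D.hl ht hu (Or.inl h) _ _ _ _)
  sr6 t ht := K.sr6 t (by omega) (t + 1) ht (by omega) (Or.inl rfl) true
  sr7 t ht := K.sr6 t (by omega) (t + 1) ht (by omega) (Or.inl rfl) false
  sr6l := K.sr6l
  sr7l := K.sr7l
  nile t ht v := K.nil G.gen ht _ _ v
  nilf t ht v := K.nil G.gen ht _ _ v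
  niles t ht v := K.nil G.gen ht _ _ v
  nilfs t ht v := K.nil G.gen ht _ _ v
  gen A h1 h2 := G.gen A (fun σ => h1 ⟨σ, rfl⟩) (by
    intro t ht s p
    obtain ⟨q1, q2, q3, q4⟩ := h2 t ht
    cases s <;> cases p <;> assumption)

end IsPres

end
end Ell

namespace Ell
noncomputable section
open LieAlgebra TensorProduct

variable {V : Type*} [AddCommGroup V] [Module ℝ V] {l : ℕ} {B : LinearMap.BilinForm ℝ V}
    {a : V} {b : ℕ → V}

lemma pr_cst {t : ℕ} (ht : t ≤ l) (hl : 2 ≤ l) (p : ℤ) : pr l t (cst l p) = 0 ∧ prs l t (cst l p) = 0 := by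
  unfold prs pr cst
  split_ifs <;> first | omega | (constructor <;> ring)

lemma dvd_small {x : ℤ} (h1 : -(Nn l) < x) (h2 : x < Nn l) : Nn l ∣ x ↔ x = 0 := by
  constructor
  · intro h
    exact Int.eq_zero_of_abs_lt_dvd h (abs_lt.mpr ⟨h1, h2⟩)
  · rintro rfl; exact dvd_zero _

lemma per_neg_shift {d : ℤ → ℂ} (h : Per l d) (k r : ℤ) : d (k + Nn l * r) = d k := h.mul k r

lemma dcor_per (t : ℕ) (s : Bool) : Per l (dcor l t s) := by
  intro k
  unfold dcor
  simp only [Pi.smul_apply, Pi.add_apply, Pi.sub_apply]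
  rw [per_ind, per_ind, per_ind, per_ind]

lemma ind_odd (i k : ℤ) : ind l i (-k) = ind l (-i) k := by
  unfold ind
  have : Nn l ∣ -k - i ↔ Nn l ∣ k - -i := by
    rw [show -k - i = -(k - -i) by ring, dvd_neg]
  simp only [this]

lemma dcor_odd (t : ℕ) (s : Bool) (k : ℤ) : dcor l t s (-k) = - dcor l t s k := by
  unfold dcor
  simp only [Pi.smul_apply, Pi.add_apply, Pi.sub_apply, ind_odd, neg_neg, smul_eq_mul]
  ring

lemma dcor_nat (hl : 2 ≤ l) {t k : ℕ} (ht : t ≤ l) (hk : k ≤ l + 1) (s : Bool) :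
    dcor l t s k = (pq l t s true (eps l k) : ℂ) := by
  have key : dcor l t s k = cs l t s * (((if k = t + 1 then 1 else 0) - (if k = t then 1 else 0) +
      (if k = 0 ∧ t = 0 then 1 else 0) - (if k = l + 1 ∧ t = l then 1 else 0) : ℤ) : ℂ) - 0 := by
    unfold dcor ind
    simp only [Pi.smul_apply, Pi.add_apply, Pi.sub_apply, smul_eq_mul]
    have h1 : Nn l ∣ (k : ℤ) - (t + 1) ↔ k = t + 1 := by
      rw [dvd_small (by unfold Nn; omega) (by unfold Nn; omega)]; omega
    have h2 : Nn l ∣ (k : ℤ) - t ↔ k = t := by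
      rw [dvd_small (by unfold Nn; omega) (by unfold Nn; omega)]; omega
    have h3 : Nn l ∣ (k : ℤ) - -t ↔ k = 0 ∧ t = 0 := by
      rw [dvd_small (by unfold Nn; omega) (by unfold Nn; omega)]; omega
    have h4 : Nn l ∣ (k : ℤ) - -(t + 1) ↔ k = l + 1 ∧ t = l := by
      rw [← dvd_sub_self_right, dvd_small (by unfold Nn; omega) (by unfold Nn; omega)]; unfold Nn; omega
    simp only [h1, h2, h3, h4]
    push_cast
    ring
  rw [key]
  unfold pq prs pr sp cs ct
  rw [eps_val hk (by omega : (0:ℕ) ≤ l), eps_val hk (by omega : (1:ℕ) ≤ l), eps_val hk (le_refl l), eps_val hk (by omega : l - 1 ≤ l),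
    eps_val hk ht, eps_val hk (by omega : t - 1 ≤ l)]
  by_cases h0 : t = 0
  · subst h0
    have : ¬ (0 : ℕ) = l := by omega
    simp only [this, false_and, if_false, if_true, and_false, true_or, and_true, ite_self]
    split_ifs <;> first | omega | norm_num
  · by_cases h1 : t = l
    · subst h1
      simp only [h0, false_and, if_false, if_true, and_false, or_true, and_true, true_and]
      cases s <;> simp only [if_true, Bool.false_eq_true, if_false] <;> split_ifs <;> first | omega | norm_num
    · rw [eps_val hk (by omega : t + 1 ≤ l)]
      simp only [h0, h1, false_and, if_false, if_true, and_false, or_self, ite_self]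
      split_ifs <;> first | omega | norm_num

lemma pq_add (t : ℕ) (s p : Bool) (n m : ℕ → ℤ) : pq l t s p (n + m) = pq l t s p n + pq l t s p m := by
  unfold pq; rw [pr_add, prs_add]; split_ifs <;> ring
lemma pq_neg (t : ℕ) (s p : Bool) (n : ℕ → ℤ) : pq l t s p (-n) = - pq l t s p n := by
  unfold pq; rw [pr_neg, prs_neg]; split_ifs <;> ring
lemma pq_cst {t : ℕ} (ht : t ≤ l) (hl : 2 ≤ l) (s p : Bool) (m : ℤ) : pq l t s p (cst l m) = 0 := by
  unfold pq; rw [(pr_cst ht hl m).1, (pr_cst ht hl m).2]; simp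

lemma dcor_eq (hl : 2 ≤ l) {t : ℕ} (ht : t ≤ l) (s : Bool) (k : ℤ) :
    dcor l t s k = (pq l t s true (eps l k) : ℂ) := by
  obtain ⟨m, hm, r, h | h⟩ := orbit_rep l k
  · rw [h, (dcor_per t s).mul, eps_shift, pq_add, pq_cst ht hl, add_zero, dcor_nat hl ht hm]
  · rw [h, (dcor_per t s).mul, eps_shift, pq_add, pq_cst ht hl, add_zero, eps_neg, pq_neg, dcor_odd, dcor_nat hl ht hm]
    push_cast; ring

lemma cst_null (D : RD l B a b) (p : ℤ) (σ : ℂ ⊗[ℝ] V) : bc B σ (toV l a b (cst l p) 0) = 0 := by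
  have h1 : ∀ t ≤ l, B (b t) (toV l a b (cst l p) 0) = 0 := by
    intro t ht
    have h := D.pair ht false true (cst l p) 0
    rw [pq_cst ht D.hl] at h
    have hr : rt l a b t false true = b t := by simp [rt, sp]
    rw [hr, D.diag ht] at h
    split_ifs at h <;> simp at h <;> linarith
  have h2 : B (toV l a b (cst l p) 0) (toV l a b (cst l p) 0) = 0 := by
    conv_lhs => arg 1; unfold toV
    rw [zero_smul, add_zero, map_sum, LinearMap.sum_apply]
    apply Finset.sum_eq_zero
    intro t ht
    rw [map_zsmul, LinearMap.smul_apply, h1 t (by have := Finset.mem_range.mp ht; omega), smul_zero]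
  have h3 := D.null _ h2
  induction σ using TensorProduct.induction_on with
  | zero => unfold bc; rw [map_zero]; rfl
  | tmul x y => unfold bc; rw [LinearMap.BilinForm.baseChange_tmul, h3, zero_smul]
  | add x y hx hy => rw [bc_add_left, hx, hy, add_zero]

/-- the model functional -/
def dm (l : ℕ) (B : LinearMap.BilinForm ℝ V) (a : V) (b : ℕ → V) (σ : ℂ ⊗[ℝ] V) : ℤ → ℂ :=
  fun k => bc B σ (toV l a b (eps l k) 0)

lemma dm_per (D : RD l B a b) (σ) : Per l (dm l B a b σ) := by
  intro k
  unfold dm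
  have := eps_shift (l := l) k 1
  rw [mul_one] at this
  rw [this, ← add_zero (0 : ℤ), toV_add, bc_add, cst_null D]
  simp

lemma dm_odd (σ) (k : ℤ) : dm l B a b σ (-k) = - dm l B a b σ k := by
  unfold dm
  rw [eps_neg, ← neg_zero, toV_neg, bc_neg, neg_zero]

lemma dm_sub (σ) (k j : ℤ) : dm l B a b σ k - dm l B a b σ j = bc B σ (toV l a b (eps l k - eps l j) 0) := by
  unfold dm
  rw [sub_eq_add_neg (eps l k), show (0 : ℤ) = 0 + -0 by simp, toV_add, bc_add, toV_neg, bc_neg]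
  simp [sub_eq_add_neg]

lemma bc_a (D : RD l B a b) (σ : ℂ ⊗[ℝ] V) : bc B σ a = 0 := by
  induction σ using TensorProduct.induction_on with
  | zero => unfold bc; rw [map_zero]; rfl
  | tmul x y => unfold bc; rw [LinearMap.BilinForm.baseChange_tmul, D.ha', zero_smul]
  | add x y hx hy => rw [bc_add_left, hx, hy, add_zero]

lemma bc_toV (D : RD l B a b) (σ : ℂ ⊗[ℝ] V) (n : ℕ → ℤ) (z : ℤ) :
    bc B σ (toV l a b n z) = bc B σ (toV l a b n 0) := by
  unfold toV
  rw [bc_add, bc_add, zero_smul, bc_zero]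
  congr 1
  let F : V →+ ℂ := { toFun := bc B σ, map_zero' := bc_zero σ, map_add' := bc_add σ }
  have : F (z • a) = z • F a := map_zsmul F z a
  have h2 : F a = 0 := bc_a D σ
  rw [h2, smul_zero] at this
  exact this

lemma eps_tp (hl : 2 ≤ l) {t : ℕ} (ht : t ≤ l) (s : Bool) : eps l (tp l t s) - eps l t = dv l t s true := by
  unfold dv
  rcases tp_cases l t s with ⟨h1, h2, h3⟩ | ⟨h1, h3⟩
  · rw [h3]
    subst h1 h2
    have : (t : ℤ) + 2 = -t + Nn t * 1 := by unfold Nn; ring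
    rw [this, eps_shift, eps_neg]
    funext u
    simp only [Pi.sub_apply, Pi.add_apply, Pi.neg_apply, sp, stc, if_true, sg, Pi.single_apply]
    by_cases hu : u ≤ t
    · rw [eps_val (by omega) hu]
      unfold cst
      split_ifs <;> omega
    · rw [eps_beyond _ hu]
      unfold cst
      split_ifs <;> omega
  · rw [h3, eps_succ ht]
    congr 1
    unfold sp stc
    split_ifs <;> first | rfl | simp_all

lemma model_wt (D : RD l B a b) (P z : ℤ) (σ) {t : ℕ} (ht : t ≤ l) (s p : Bool) :
    ⁅hb l P z (dm l B a b σ), gE l P z t s p⁆ = bc B σ (rt l a b t s p) • gE l P z t s p := by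
  rw [gE_wt (dm_per D σ) (dm_odd σ), dm_sub, eps_tp D.hl ht]
  congr 1
  have h : bc B σ (rt l a b t s true) = bc B σ (toV l a b (dv l t s true) 0) := by
    rw [rt_toV ht, bc_toV D]
  cases p
  · have := rt_not (l := l) (a := a) (b := b) t s true
    rw [Bool.not_true] at this
    rw [this, bc_neg, h]
    simp
  · rw [h]; simp

lemma model_ef (D : RD l B a b) {P z : ℤ} (h0 : ¬ (P = 0 ∧ z = 0)) {t : ℕ} (ht : t ≤ l) (s : Bool) :
    ⁅gE l P z t s true, gE l P z t s false⁆ =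
      hb l P z (dm l B a b ((1 : ℂ) ⊗ₜ[ℝ] cr B (rt l a b t s true))) := by
  rw [gE_sl2 h0 ht]
  congr 1
  funext k
  unfold dm
  rw [D.cr_pair ht, dcor_eq D.hl ht]

/-- commuting or extremal -/
lemma model_com (hl : 2 ≤ l) {P z : ℤ} {t u : ℕ} (ht : t ≤ l) (hu : u ≤ l) (s s' p p' : Bool)
    (h : ¬ (t = u ∧ s = s')) (hp : t = u → p = p') (hp' : t ≠ u → p' = !p) :
    ⁅gE l P z t s p, gE l P z u s' p'⁆ = 0 := by
  by_cases htu : t = u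
  · subst htu
    have := hp rfl; subst this
    have hs := gE_same hl (P := P) (z := z) ht p
    cases s <;> cases s'
    · simp at h
    · exact hs
    · rw [← lie_skew, hs, neg_zero]
    · simp at h
  · have := hp' htu; subst this
    cases p
    · rw [← lie_skew, Bool.not_false, gE_cross hl hu ht (Ne.symm htu), neg_zero]
    · rw [Bool.not_true, gE_cross hl ht hu htu]

lemma pq_flip (t u : ℕ) (s s' p p' : Bool) : pq l t s p (dv l u s' (!p')) = - pq l t s p (dv l u s' p') := by
  have : dv l u s' (!p') = - dv l u s' p' := by
    unfold dv
    rw [sp_neg, neg_mul]; funext w; simp only [sg, Pi.single_apply, Pi.neg_apply]; split_ifs <;> simp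
  rw [this, pq_neg]

lemma model_sr5 (D : RD l B a b) {P z : ℤ} (h0 : ¬ (P = 0 ∧ z = 0)) {t u : ℕ} (ht : t ≤ l) (hu : u ≤ l)
    (s s' p p' : Bool) (h : ¬ (t = u ∧ s = s')) :
    (ad ℂ _ (gE l P z t s p) ^ (1 + (- pq l t s p (dv l u s' p')).toNat)) (gE l P z u s' p') = 0 := by
  by_cases hc : (t = u → p = p') ∧ (t ≠ u → p' = !p)
  · rw [add_comm 1 (Int.toNat _), pow_succ, Module.End.mul_apply, ad_apply, model_com D.hl ht hu s s' p p' h hc.1 hc.2, map_zero]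
  · -- extremal case
    have hpp : (t = u → p' = !p) ∧ (t ≠ u → p = p') := by
      revert hc; by_cases htu : t = u <;> cases p <;> cases p' <;> simp [htu]
    have hcom : ⁅gE l P z t s (!p), gE l P z u s' p'⁆ = 0 := by
      apply model_com D.hl ht hu s s' _ _ h
      · intro e; rw [hpp.1 e]
      · intro e; rw [← hpp.2 e, Bool.not_not]
    have hle : pq l t s p (dv l u s' p') ≤ 0 := by
      by_cases htu : t = u
      · have := hpp.1 htu; subst this; subst htu
        have := IsPres.pq_same D.hl ht s s' p
        rw [pq_flip]; omega
      · have := hpp.2 htu; subst this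
        have := IsPres.pq_opp D.hl ht hu htu s s' p
        rw [pq_flip] at this; omega
    set c := pq l t s p (dv l u s' p') with hcdef
    have hwt : ∀ (v : ℕ) (hv : v ≤ l) (x y : Bool), ⁅hb l P z (dm l B a b ((1 : ℂ) ⊗ₜ[ℝ] cr B (rt l a b t s true))), gE l P z v x y⁆ =
        (pq l t s true (dv l v x y) : ℂ) • gE l P z v x y := by
      intro v hv x y
      rw [model_wt D P z _ hv, rt_toV hv, D.cr_pair ht]
    have hd : pq l t s true (dv l t s true) = 2 := by
      have hl := D.hl
      unfold pq dv prs pr sp stc sg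
      simp only [Pi.single_apply]
      split_ifs <;> omega
    set hh := hb l P z (dm l B a b ((1 : ℂ) ⊗ₜ[ℝ] cr B (rt l a b t s true))) with hhdef
    have hef := model_ef D h0 ht s
    rw [add_comm 1 (Int.toNat _)]
    cases p
    · -- f = negative root vector
      have hflip : pq l t s true (dv l u s' p') = - c := by
        rw [hcdef]; unfold pq; rw [show sp true = 1 from rfl, show sp false = -1 from rfl]; ring
      refine sl2_C hef ?_ _ ?_ hcom (gE_nil D.hl P z ht s false _)
      · rw [hwt t ht, show (false : Bool) = !true from rfl, pq_flip, hd]; norm_num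
      · rw [hwt u hu, hflip]
        congr 1
        have : ((- c).toNat : ℤ) = - c := Int.toNat_of_nonneg (by omega)
        rw [← Int.cast_natCast, this]
    · refine sl2_C (h := - hh) (e := gE l P z t s false) ?_ ?_ _ ?_ hcom (gE_nil D.hl P z ht s true _)
      · rw [← lie_skew, hef]
      · rw [neg_lie, hwt t ht, hd]; module
      · rw [neg_lie, hwt u hu, ← hcdef, ← neg_smul]
        congr 1
        have : ((- c).toNat : ℤ) = - c := Int.toNat_of_nonneg (by omega)
        rw [← Int.cast_natCast, this]; push_cast; ring

theorem model_pres (D : RD l B a b) {P z : ℤ} (h0 : ¬ (P = 0 ∧ z = 0)) :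
    IsPres l B a b (fun σ => hb l P z (dm l B a b σ)) (gE l P z) where
  lin x y σ τ := by
    rw [← hb_smul, ← hb_smul, ← hb_add]
    congr 1
    funext k
    simp only [Pi.add_apply, Pi.smul_apply, smul_eq_mul, dm, bc_add_left, bc_smul_left]
  hh σ τ := hb_hb _ _ _ _
  hE σ t ht s p := model_wt D P z σ ht s p
  ef t ht s := model_ef D h0 ht s
  sr5 t ht u hu s s' p p' h := model_sr5 D h0 ht hu s s' p p' h
  sr6 t ht u hu h1 htu p := by
    rcases htu with rfl | rfl
    · cases p
      · exact (gE_sr6 D.hl hu).2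
      · exact (gE_sr6 D.hl hu).1
    · have h := gE_sr6 D.hl (P := P) (z := z) ht
      cases p
      · rw [← lie_skew, ← h.2, lie_skew]
      · rw [← lie_skew, ← h.1, lie_skew]
  sr6l := gE_sr6l D.hl
  sr7l := gE_sr7l D.hl

end
end Ell

namespace Ell
noncomputable section
open LieAlgebra TensorProduct

/-- translation data between the frozen hypotheses and nodes -/
structure FR {V : Type*} [AddCommGroup V] [Module ℝ V] (l : ℕ) (B : LinearMap.BilinForm ℝ V)
    (P : Set V) (a : V) (k : V → ℕ) (g : V → Bool) (b : ℕ → V) : Prop where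
  D : RD l B a b
  hP : ∀ v, v ∈ P ↔ ∃ t ≤ l, v = b t
  hk : ∀ t ≤ l, k (b t) = 1
  hg : ∀ t ≤ l, g (b t) = decide (t = l)

lemma map_ad_pow {L L' : Type*} [LieRing L] [LieAlgebra ℂ L] [LieRing L'] [LieAlgebra ℂ L']
    (F : L →ₗ⁅ℂ⁆ L') (x y : L) (n : ℕ) : F ((ad ℂ L x ^ n) y) = (ad ℂ L' (F x) ^ n) (F y) := by
  induction n with
  | zero => rfl
  | succ n ih =>
    rw [pow_succ', pow_succ', Module.End.mul_apply, Module.End.mul_apply, ad_apply, ad_apply, LieHom.map_lie, ih]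

/-- the quotient morphism -/
def qm {L : Type*} [LieRing L] [LieAlgebra ℂ L] (I : LieIdeal ℂ L) : L →ₗ⁅ℂ⁆ L ⧸ I where
  toFun := LieSubmodule.Quotient.mk
  map_add' _ _ := rfl
  map_smul' _ _ := rfl
  map_lie' {x y} := LieSubmodule.Quotient.mk_bracket I x y

/-- morphisms from a quotient -/
lemma exists_lift {L L' : Type*} [LieRing L] [LieAlgebra ℂ L] [LieRing L'] [LieAlgebra ℂ L'] (I : LieIdeal ℂ L)
    (F : L →ₗ⁅ℂ⁆ L') (h : ∀ x ∈ I, F x = 0) : ∃ φ : (L ⧸ I) →ₗ⁅ℂ⁆ L', ∀ x, φ (qm I x) = F x := by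
  let φ₀ : (L ⧸ I) →ₗ[ℂ] L' := Submodule.liftQ I.toSubmodule (F : L →ₗ[ℂ] L') (fun x hx => LinearMap.mem_ker.mpr (h x hx))
  have h0 : ∀ x, φ₀ (qm I x) = F x := fun x => Submodule.liftQ_apply _ _ x
  have hs : ∀ y : L ⧸ I, ∃ x, qm I x = y := fun y => Submodule.Quotient.mk_surjective _ y
  refine ⟨{ φ₀ with map_lie' := ?_ }, h0⟩
  intro x y
  obtain ⟨x, rfl⟩ := hs x
  obtain ⟨y, rfl⟩ := hs y
  change φ₀ ⁅qm I x, qm I y⁆ = ⁅φ₀ (qm I x), φ₀ (qm I y)⁆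
  rw [← LieHom.map_lie, h0, h0, h0, LieHom.map_lie]

section
variable {V : Type*} [AddCommGroup V] [Module ℝ V] {l : ℕ} {B : LinearMap.BilinForm ℝ V}
    {P : Set V} {a : V} {k : V → ℕ} {g : V → Bool} {b : ℕ → V}

namespace FR

lemma c_eq (Q : FR l B P a k g b) {t : ℕ} (ht : t ≤ l) : cMap g (b t) = if t = l then 2 else 1 := by
  unfold cMap; rw [Q.hg t ht]; by_cases h : t = l <;> simp [h]

lemma rt_ft (t : ℕ) : rt l a b t false true = b t := by simp [rt, sp]
lemma rt_ff (t : ℕ) : rt l a b t false false = - b t := by simp [rt, sp]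

lemma star_eq (Q : FR l B P a k g b) {t : ℕ} (ht : t ≤ l) : starMap a k g (b t) = rt l a b t true true := by
  unfold starMap rt sp stc
  rw [Q.c_eq ht, Q.hk t ht]
  by_cases h : t = l <;> simp [h]

lemma star_neg (Q : FR l B P a k g b) {t : ℕ} (ht : t ≤ l) : - starMap a k g (b t) = rt l a b t true false := by
  rw [Q.star_eq ht, ← rt_not]; rfl

lemma bplus_iff (Q : FR l B P a k g b) (v : V) : v ∈ bplus a P k g ↔ ∃ t ≤ l, ∃ s, v = rt l a b t s true := by
  unfold bplus
  constructor
  · rintro (h | ⟨w, h, rfl⟩)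
    · obtain ⟨t, ht, rfl⟩ := (Q.hP v).mp h
      exact ⟨t, ht, false, (rt_ft t).symm⟩
    · obtain ⟨t, ht, rfl⟩ := (Q.hP w).mp h
      exact ⟨t, ht, true, Q.star_eq ht⟩
  · rintro ⟨t, ht, s, rfl⟩
    cases s
    · left; rw [rt_ft]; exact (Q.hP _).mpr ⟨t, ht, rfl⟩
    · right; exact ⟨b t, (Q.hP _).mpr ⟨t, ht, rfl⟩, Q.star_eq ht⟩

lemma bfull_iff (Q : FR l B P a k g b) (v : V) : v ∈ bfull a P k g ↔ ∃ t ≤ l, ∃ s p, v = rt l a b t s p := by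
  unfold bfull
  rw [Set.mem_union, Set.mem_neg, Q.bplus_iff, Q.bplus_iff]
  constructor
  · rintro (⟨t, ht, s, h⟩ | ⟨t, ht, s, h⟩)
    · exact ⟨t, ht, s, true, h⟩
    · refine ⟨t, ht, s, false, ?_⟩
      rw [show false = !true from rfl, rt_not, ← h, neg_neg]
  · rintro ⟨t, ht, s, p, h⟩
    cases p
    · right
      refine ⟨t, ht, s, ?_⟩
      rw [h, ← rt_not]; rfl
    · left; exact ⟨t, ht, s, h⟩

lemma mem_full (Q : FR l B P a k g b) {t : ℕ} (ht : t ≤ l) (s p : Bool) : rt l a b t s p ∈ bfull a P k g :=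
  (Q.bfull_iff _).mpr ⟨t, ht, s, p, rfl⟩

lemma xExp_eq (Q : FR l B P a k g b) {t u : ℕ} (ht : t ≤ l) (hu : u ≤ l) (s s' p p' : Bool) :
    xExp B (rt l a b t s p) (rt l a b u s' p') = 1 + (- pq l t s p (dv l u s' p')).toNat := by
  unfold xExp
  have := Q.D.pair ht s p (dv l u s' p') (dz s' p')
  rw [← rt_toV hu] at this
  rw [this, ← Int.cast_neg, Nat.ceil_intCast]

lemma adj_iff (Q : FR l B P a k g b) {t u : ℕ} (ht : t ≤ l) (hu : u ≤ l) :
    2 * B (b t) (b u) = -(B (b u) (b u)) ↔ (1 ≤ u ∧ u < l ∧ (t + 1 = u ∨ u + 1 = t)) := by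
  have hl := Q.D.hl
  rw [Q.D.gram t ht u hu, Q.D.gram u hu u hu]
  have : (2 * (gm l t u : ℝ) = - (gm l u u : ℝ)) ↔ 2 * gm l t u = - gm l u u := by
    constructor
    · intro h; exact_mod_cast h
    · intro h; exact_mod_cast h
  rw [this]
  unfold gm
  split_ifs <;> omega

lemma not_iff (Q : FR l B P a k g b) {t u : ℕ} (ht : t ≤ l) (hu : u ≤ l) (s s' p p' : Bool)  :
    (rt l a b t s p ≠ rt l a b u s' p' ∧ rt l a b u s' p' ≠ - rt l a b t s p) ↔ ¬ (t = u ∧ s = s') := by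
  constructor
  · rintro ⟨h1, h2⟩ ⟨rfl, rfl⟩
    by_cases hp : p = p'
    · subst hp; exact h1 rfl
    · apply h2
      rw [← rt_not]
      congr 1
      revert hp; cases p <;> cases p' <;> simp
  · intro h
    constructor
    · intro e
      obtain ⟨h1, h2, -⟩ := Q.D.rt_inj ht hu e
      exact h ⟨h1, h2⟩
    · intro e
      rw [← rt_not] at e
      obtain ⟨h1, h2, -⟩ := Q.D.rt_inj hu ht e
      exact h ⟨h1.symm, h2.symm⟩

variable (B P a k g) in
abbrev EL := EllipticLieAlg B a P k g (fun _ _ => (1 : ℂ))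

lemma rel0 {x : FreeLieAlgebra ℂ (EllGen a P k g)} (h : x ∈ ellRels B a P k g (fun _ _ => 1)) :
    qm (ellIdeal B a P k g (fun _ _ => (1 : ℂ))) x = 0 :=
  LieSubmodule.Quotient.mk_eq_zero'.mpr (LieSubmodule.subset_lieSpan h)

lemma cr_vee (v : V) : cr B v = vee B v := rfl

theorem pres (Q : FR l B P a k g b) :
    IsPres l B a b (L := EL B P a k g) (fun σ => hbar B a P k g (fun _ _ => 1) σ)
      (fun t s p => ebar B a P k g (fun _ _ => 1) (rt l a b t s p)) where
  lin x y σ τ := by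
    have := rel0 (B := B) (a := a) (P := P) (k := k) (g := g)
      (Or.inl (Or.inl (Or.inl (Or.inl (Or.inl (Or.inl (Or.inl (Or.inl ⟨x, y, σ, τ, rfl⟩))))))))
    rw [map_sub, sub_eq_zero, map_add, map_smul, map_smul] at this
    exact this
  hh σ τ := by
    have := rel0 (B := B) (a := a) (P := P) (k := k) (g := g)
      (Or.inl (Or.inl (Or.inl (Or.inl (Or.inl (Or.inl (Or.inl (Or.inr ⟨σ, τ, rfl⟩))))))))
    rw [LieHom.map_lie] at this
    exact this
  hE σ t ht s p := by
    have := rel0 (B := B) (a := a) (P := P) (k := k) (g := g)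
      (Or.inl (Or.inl (Or.inl (Or.inl (Or.inl (Or.inl (Or.inr ⟨σ, _, Q.mem_full ht s p, rfl⟩)))))))
    rw [map_sub, sub_eq_zero, LieHom.map_lie, map_smul] at this
    exact this
  ef t ht s := by
    have := rel0 (B := B) (a := a) (P := P) (k := k) (g := g)
      (Or.inl (Or.inl (Or.inl (Or.inl (Or.inl (Or.inr ⟨_, (Q.bplus_iff _).mpr ⟨t, ht, s, rfl⟩, rfl⟩))))))
    rw [map_sub, sub_eq_zero, LieHom.map_lie, ← rt_not] at this
    exact this
  sr5 t ht u hu s s' p p' h := by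
    have hn := (Q.not_iff ht hu s s' p p').mpr h
    have := rel0 (B := B) (a := a) (P := P) (k := k) (g := g)
      (Or.inl (Or.inl (Or.inl (Or.inl (Or.inr ⟨_, Q.mem_full ht s p, _, Q.mem_full hu s' p', hn.1, hn.2, rfl⟩)))))
    rw [map_ad_pow, Q.xExp_eq ht hu] at this
    exact this
  sr6 t ht u hu h1 htu p := by
    have ht' : t ≤ l := ht.le
    have hu' : u ≤ l := hu.le
    have hadj := (Q.adj_iff ht' hu').mpr ⟨h1, hu, htu⟩
    have mt := (Q.hP _).mpr ⟨t, ht', rfl⟩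
    have mu := (Q.hP _).mpr ⟨u, hu', rfl⟩
    cases p
    · have := rel0 (B := B) (a := a) (P := P) (k := k) (g := g)
        (Or.inl (Or.inl (Or.inr ⟨b t, mt, b u, mu, hadj, rfl⟩)))
      rw [map_sub, sub_eq_zero, map_smul, map_smul, map_ad_pow, map_ad_pow, Q.c_eq ht',
        Q.star_neg ht', Q.star_neg hu', Q.hk t ht', Q.hk u hu', if_neg ht.ne, ← rt_ff (l := l) (a := a) (b := b) t, ← rt_ff (l := l) (a := a) (b := b) u] at this
      norm_num at this
      exact this
    · have := rel0 (B := B) (a := a) (P := P) (k := k) (g := g)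
        (Or.inl (Or.inl (Or.inl (Or.inr ⟨b t, mt, b u, mu, hadj, rfl⟩))))
      rw [map_sub, sub_eq_zero, map_smul, map_smul, map_ad_pow, map_ad_pow, Q.c_eq ht',
        Q.star_eq ht', Q.star_eq hu', Q.hk t ht', Q.hk u hu', if_neg ht.ne, ← rt_ft (l := l) (a := a) (b := b) t, ← rt_ft (l := l) (a := a) (b := b) u] at this
      norm_num at this
      exact this
  sr6l := by
    have hl := Q.D.hl
    have ht' : l ≤ l := le_rfl
    have hu' : l - 1 ≤ l := by omega
    have hadj := (Q.adj_iff ht' hu').mpr ⟨by omega, by omega, by omega⟩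
    have mt := (Q.hP _).mpr ⟨l, ht', rfl⟩
    have mu := (Q.hP _).mpr ⟨l - 1, hu', rfl⟩
    have := rel0 (B := B) (a := a) (P := P) (k := k) (g := g)
      (Or.inl (Or.inl (Or.inl (Or.inr ⟨b l, mt, b (l - 1), mu, hadj, rfl⟩))))
    rw [map_sub, sub_eq_zero, map_smul, map_smul, map_ad_pow, map_ad_pow, Q.c_eq ht',
        Q.star_eq ht', Q.star_eq hu', Q.hk l ht', Q.hk (l - 1) hu', if_pos rfl, ← rt_ft (l := l) (a := a) (b := b) l, ← rt_ft (l := l) (a := a) (b := b) (l - 1)] at this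
    norm_num [pow_two] at this
    exact this
  sr7l := by
    have hl := Q.D.hl
    have ht' : l ≤ l := le_rfl
    have hu' : l - 1 ≤ l := by omega
    have hadj := (Q.adj_iff ht' hu').mpr ⟨by omega, by omega, by omega⟩
    have mt := (Q.hP _).mpr ⟨l, ht', rfl⟩
    have mu := (Q.hP _).mpr ⟨l - 1, hu', rfl⟩
    have := rel0 (B := B) (a := a) (P := P) (k := k) (g := g)
      (Or.inl (Or.inl (Or.inr ⟨b l, mt, b (l - 1), mu, hadj, rfl⟩)))
    rw [map_sub, sub_eq_zero, map_smul, map_smul, map_ad_pow, map_ad_pow, Q.c_eq ht',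
        Q.star_neg ht', Q.star_neg hu', Q.hk l ht', Q.hk (l - 1) hu', if_pos rfl, ← rt_ff (l := l) (a := a) (b := b) l, ← rt_ff (l := l) (a := a) (b := b) (l - 1)] at this
    norm_num [pow_two] at this
    exact (neg_smul _ _).trans this

end FR
end
end
end Ell

namespace Ell
noncomputable section
open LieAlgebra TensorProduct

section
variable {V : Type*} [AddCommGroup V] [Module ℝ V] {l : ℕ} {B : LinearMap.BilinForm ℝ V}
    {P : Set V} {a : V} {k : V → ℕ} {g : V → Bool} {b : ℕ → V}

namespace FR

lemma free_hom (Q : FR l B P a k g b) {L' : Type*} [LieRing L'] [LieAlgebra ℂ L'] (H' : ℂ ⊗[ℝ] V → L')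
    (E' : ℕ → Bool → Bool → L') : ∃ F : FreeLieAlgebra ℂ (EllGen a P k g) →ₗ⁅ℂ⁆ L',
    (∀ σ, F (hFree a P k g σ) = H' σ) ∧ ∀ t ≤ l, ∀ s p, F (eFree a P k g (rt l a b t s p)) = E' t s p := by
  choose t ht s p e using fun μ : bfull a P k g => (Q.bfull_iff μ.1).mp μ.2
  let f : EllGen a P k g → L' :=
    fun x => Sum.elim H' (fun μ : bfull a P k g => E' (t μ) (s μ) (p μ)) x
  refine ⟨FreeLieAlgebra.lift ℂ f, ?_, ?_⟩
  · intro σ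
    exact FreeLieAlgebra.lift_of_apply f _
  · intro t' ht' s' p'
    unfold eFree
    rw [dif_pos (Q.mem_full ht' s' p')]
    refine (FreeLieAlgebra.lift_of_apply f _).trans ?_
    change E' (t ⟨_, Q.mem_full ht' s' p'⟩) (s ⟨_, Q.mem_full ht' s' p'⟩) (p ⟨_, Q.mem_full ht' s' p'⟩) = _
    obtain ⟨h1, h2, h3⟩ := Q.D.rt_inj ht' (ht _) (e ⟨_, Q.mem_full ht' s' p'⟩)
    rw [← h1, ← h2, ← h3]

lemma kills (Q : FR l B P a k g b) {L' : Type*} [LieRing L'] [LieAlgebra ℂ L'] {H' : ℂ ⊗[ℝ] V → L'}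
    {E' : ℕ → Bool → Bool → L'} (K : IsPres l B a b H' E') (F : FreeLieAlgebra ℂ (EllGen a P k g) →ₗ⁅ℂ⁆ L')
    (hH : ∀ σ, F (hFree a P k g σ) = H' σ)
    (hE : ∀ t ≤ l, ∀ s p, F (eFree a P k g (rt l a b t s p)) = E' t s p)
    (x : FreeLieAlgebra ℂ (EllGen a P k g)) (hx : x ∈ ellRels B a P k g (fun _ _ => 1)) : F x = 0 := by
  have hl := Q.D.hl
  have hft : ∀ t ≤ l, F (eFree a P k g (b t)) = E' t false true := fun t ht => by
    have := hE t ht false true; rw [rt_ft] at this; exact this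
  have hff : ∀ t ≤ l, F (eFree a P k g (- b t)) = E' t false false := fun t ht => by
    have := hE t ht false false; rw [rt_ff] at this; exact this
  have hst : ∀ t ≤ l, F (eFree a P k g (starMap a k g (b t))) = E' t true true := fun t ht => by
    rw [Q.star_eq ht]; exact hE t ht _ _
  have hsf : ∀ t ≤ l, F (eFree a P k g (- starMap a k g (b t))) = E' t true false := fun t ht => by
    rw [Q.star_neg ht]; exact hE t ht _ _
  rcases hx with ((((((((h|h)|h)|h)|h)|h)|h)|h)|h)
  · obtain ⟨x, y, σ, τ, rfl⟩ := h
    rw [map_sub, map_add, map_smul, map_smul, hH, hH, hH, K.lin, sub_self]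
  · obtain ⟨σ, τ, rfl⟩ := h
    rw [LieHom.map_lie, hH, hH, K.hh]
  · obtain ⟨σ, μ, hμ, rfl⟩ := h
    obtain ⟨t, ht, s, p, rfl⟩ := (Q.bfull_iff μ).mp hμ
    rw [map_sub, map_smul, LieHom.map_lie, hH, hE t ht, K.hE σ t ht]
    exact sub_self _
  · obtain ⟨μ, hμ, rfl⟩ := h
    obtain ⟨t, ht, s, rfl⟩ := (Q.bplus_iff μ).mp hμ
    rw [map_sub, LieHom.map_lie, hH, ← rt_not, hE t ht, hE t ht]
    exact sub_eq_zero.mpr (K.ef t ht s)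
  · obtain ⟨μ, hμ, ν, hν, h1, h2, rfl⟩ := h
    obtain ⟨t, ht, s, p, rfl⟩ := (Q.bfull_iff μ).mp hμ
    obtain ⟨u, hu, s', p', rfl⟩ := (Q.bfull_iff ν).mp hν
    rw [map_ad_pow, hE t ht, hE u hu, Q.xExp_eq ht hu]
    exact K.sr5 t ht u hu s s' p p' ((Q.not_iff ht hu s s' p p').mp ⟨h1, h2⟩)
  · obtain ⟨α, hα, β, hβ, hab, rfl⟩ := h
    obtain ⟨t, ht, rfl⟩ := (Q.hP α).mp hα
    obtain ⟨u, hu, rfl⟩ := (Q.hP β).mp hβ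
    obtain ⟨u1, u2, htu⟩ := (Q.adj_iff ht hu).mp hab
    rw [map_sub, map_smul, map_smul, map_ad_pow, map_ad_pow, hst t ht, hft u hu, hft t ht, hst u hu,
      Q.c_eq ht, Q.hk t ht, Q.hk u hu, sub_eq_zero]
    by_cases h : t = l
    · subst h
      obtain rfl : u = t - 1 := by omega
      have := K.sr6l
      rw [if_pos rfl]
      norm_num [pow_two]
      exact this
    · have := K.sr6 t (by omega) u u2 u1 htu true
      rw [if_neg h]
      norm_num
      exact this
  · obtain ⟨α, hα, β, hβ, hab, rfl⟩ := h
    obtain ⟨t, ht, rfl⟩ := (Q.hP α).mp hα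
    obtain ⟨u, hu, rfl⟩ := (Q.hP β).mp hβ
    obtain ⟨u1, u2, htu⟩ := (Q.adj_iff ht hu).mp hab
    rw [map_sub, map_smul, map_smul, map_ad_pow, map_ad_pow, hsf t ht, hff u hu, hff t ht, hsf u hu,
      Q.c_eq ht, Q.hk t ht, Q.hk u hu, sub_eq_zero]
    by_cases h : t = l
    · subst h
      obtain rfl : u = t - 1 := by omega
      have := K.sr7l
      rw [if_pos rfl]
      norm_num [pow_two]
      exact (neg_smul _ _).symm.trans this
    · have := K.sr6 t (by omega) u u2 u1 htu false
      rw [if_neg h]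
      norm_num
      exact this
  · obtain ⟨α, hα, β, hβ, hab, i, i1, i2, -⟩ := h
    obtain ⟨t, ht, rfl⟩ := (Q.hP α).mp hα
    obtain ⟨u, hu, rfl⟩ := (Q.hP β).mp hβ
    rw [Q.hk t ht, Q.hk u hu] at i2
    omega
  · obtain ⟨α, hα, β, hβ, hab, i, i1, i2, -⟩ := h
    obtain ⟨t, ht, rfl⟩ := (Q.hP α).mp hα
    obtain ⟨u, hu, rfl⟩ := (Q.hP β).mp hβ
    rw [Q.hk t ht, Q.hk u hu] at i2
    omega

theorem univ (Q : FR l B P a k g b) {L' : Type*} [LieRing L'] [LieAlgebra ℂ L'] {H' : ℂ ⊗[ℝ] V → L'}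
    {E' : ℕ → Bool → Bool → L'} (K : IsPres l B a b H' E') :
    ∃ φ : EL B P a k g →ₗ⁅ℂ⁆ L', ∀ t ≤ l, ∀ s p,
      φ (ebar B a P k g (fun _ _ => 1) (rt l a b t s p)) = E' t s p := by
  obtain ⟨F, hH, hE⟩ := Q.free_hom H' E'
  have hle : ellIdeal B a P k g (fun _ _ => (1 : ℂ)) ≤ F.ker :=
    LieSubmodule.lieSpan_le.mpr fun x hx => LieHom.mem_ker.mpr (Q.kills K F hH hE x hx)
  obtain ⟨φ, hφ⟩ := exists_lift (ellIdeal B a P k g (fun _ _ => (1 : ℂ))) F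
    (fun x hx => LieHom.mem_ker.mp (hle hx))
  exact ⟨φ, fun t ht s p => (hφ _).trans (hE t ht s p)⟩

theorem gen (Q : FR l B P a k g b) (A : LieSubalgebra ℂ (EL B P a k g))
    (hH : ∀ σ, hbar B a P k g (fun _ _ => 1) σ ∈ A)
    (hE : ∀ t ≤ l, ∀ s p, ebar B a P k g (fun _ _ => 1) (rt l a b t s p) ∈ A) : A = ⊤ := by
  obtain ⟨F, h1, h2⟩ : ∃ F : FreeLieAlgebra ℂ (EllGen a P k g) →ₗ⁅ℂ⁆ A,
      (∀ σ, ((F (hFree a P k g σ) : A) : EL B P a k g) = hbar B a P k g (fun _ _ => 1) σ) ∧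
      ∀ μ ∈ bfull a P k g, ((F (eFree a P k g μ) : A) : EL B P a k g) = ebar B a P k g (fun _ _ => 1) μ := by
    have hE' : ∀ μ ∈ bfull a P k g, ebar B a P k g (fun _ _ => 1) μ ∈ A := by
      intro μ hμ
      obtain ⟨t, ht, s, p, rfl⟩ := (Q.bfull_iff μ).mp hμ
      exact hE t ht s p
    let f : EllGen a P k g → A :=
      fun x => Sum.elim (fun σ => (⟨_, hH σ⟩ : A)) (fun μ : bfull a P k g => ⟨_, hE' μ.1 μ.2⟩) x
    refine ⟨FreeLieAlgebra.lift ℂ f, ?_, ?_⟩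
    · intro σ
      exact congrArg Subtype.val (FreeLieAlgebra.lift_of_apply f _)
    · intro μ hμ
      rw [eFree, dif_pos hμ]
      exact congrArg Subtype.val (FreeLieAlgebra.lift_of_apply f _)
  have key : A.incl.comp F = qm (ellIdeal B a P k g (fun _ _ => (1 : ℂ))) := by
    apply FreeLieAlgebra.hom_ext
    rintro (σ | μ)
    · exact h1 σ
    · have := h2 μ.1 μ.2
      rw [eFree, dif_pos μ.2, ebar, eFree, dif_pos μ.2] at this
      exact this
  rw [eq_top_iff]
  intro y _
  obtain ⟨x, rfl⟩ : ∃ x, qm (ellIdeal B a P k g (fun _ _ => (1 : ℂ))) x = y :=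
    Submodule.Quotient.mk_surjective _ y
  rw [← key]
  exact (F x).2

theorem grd (Q : FR l B P a k g b) {R : Set V}
    {gr : V → Submodule ℂ (EL B P a k g)} (hgr : IsEllGrading B R a P k g (fun _ _ => (1 : ℂ)) gr) :
    IsPres.Grd l a b (L := EL B P a k g) (fun σ => hbar B a P k g (fun _ _ => 1) σ)
      (fun t s p => ebar B a P k g (fun _ _ => 1) (rt l a b t s p)) gr where
  ind := by classical exact hgr.1.submodule_iSupIndep
  mul := hgr.2.1
  h0 := hgr.2.2.2.1
  hE t ht s p := hgr.2.2.2.2 _ (Q.mem_full ht s p)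
  gen := Q.gen

end FR
end
end
end Ell

namespace Ell
noncomputable section
open LieAlgebra TensorProduct

/-- the nodes in linear order -/
def nb {V : Type*} (l : ℕ) (αf : Fin (l + 1) → V) (t : ℕ) : V :=
  if h : t < l then αf ⟨t + 1, by omega⟩ else αf 0

section
variable {V : Type*} [AddCommGroup V] [Module ℝ V] {l : ℕ} {B : LinearMap.BilinForm ℝ V}
    {R P : Set V} {a : V} {k : V → ℕ} {g : V → Bool} {αf : Fin (l + 1) → V}

lemma nat_pair {x y u v : ℕ} (h : ({x, y} : Finset ℕ) = {u, v}) : (x = u ∧ y = v) ∨ (x = v ∧ y = u) := by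
  have h' : ({x, y} : Set ℕ) = {u, v} := by
    have := congrArg (fun s : Finset ℕ => (s : Set ℕ)) h
    simpa using this
  exact Set.pair_eq_pair_iff.mp h'

lemma nb_lt {t : ℕ} (h : t < l) : nb l αf t = αf ⟨t + 1, by omega⟩ := dif_pos h
lemma nb_last : nb l αf l = αf 0 := dif_neg (lt_irrefl l)

lemma nb_inj (hi : Function.Injective αf) {t u : ℕ} (ht : t ≤ l) (hu : u ≤ l) (h : nb l αf t = nb l αf u) : t = u := by
  rcases ht.lt_or_eq with h1 | rfl <;> rcases hu.lt_or_eq with h2 | rfl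
  · rw [nb_lt h1, nb_lt h2] at h
    have := congrArg Fin.val (hi h)
    simpa using this
  · rw [nb_lt h1, nb_last] at h
    have := congrArg Fin.val (hi h)
    simp at this
  · rw [nb_lt h2, nb_last] at h
    have := congrArg Fin.val (hi h)
    simp at this
  · rfl

lemma nb_mem (hr : Set.range αf = P) (v : V) : v ∈ P ↔ ∃ t ≤ l, v = nb l αf t := by
  rw [← hr]
  constructor
  · rintro ⟨⟨i, hi⟩, rfl⟩
    rcases i with _ | i
    · exact ⟨l, le_rfl, nb_last.symm⟩
    · exact ⟨i, by omega, (nb_lt (by omega)).symm⟩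
  · rintro ⟨t, ht, rfl⟩
    rcases ht.lt_or_eq with h1 | rfl
    · rw [nb_lt h1]; exact ⟨_, rfl⟩
    · rw [nb_last]; exact ⟨_, rfl⟩

lemma nb_gram_lt (hl : 2 ≤ l) (hs : ∀ u v, B u v = B v u) (hD : IsTypeDTwo B P l αf) {t u : ℕ} (hu : u ≤ l) (h : t < u) :
    B (nb l αf t) (nb l αf u) = if u = t + 1 then -1 else 0 := by
  obtain ⟨hi, hr, h00, h11, hjj, h12, hj, hl0, hz⟩ := hD
  rw [nb_lt (show t < l by omega)]
  have e1 : (1 : Fin (l + 1)) = ⟨1, by omega⟩ := by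
    apply Fin.ext
    exact Nat.mod_eq_of_lt (show 1 < l + 1 by omega)
  have e2 : (2 : Fin (l + 1)) = ⟨2, by omega⟩ := by
    apply Fin.ext
    exact Nat.mod_eq_of_lt (show 2 < l + 1 by omega)
  rcases hu.lt_or_eq with h1 | rfl
  · rw [nb_lt h1]
    split_ifs with e
    · subst e
      rcases t with _ | t
      · rw [e1, e2] at h12; exact h12
      · exact hj (t + 2) (by omega) (by omega)
    · apply hz
      · intro q; have := congrArg Fin.val q; simp at this; omega
      · rintro (q | ⟨m, m1, m2, q⟩ | q)
        · have := nat_pair q; simp only [] at this; omega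
        · have := nat_pair q; simp only [] at this; omega
        · have := nat_pair q; simp only [] at this; omega
  · rw [nb_last]
    split_ifs with e
    · have : (⟨t + 1, by omega⟩ : Fin (u + 1)) = Fin.last u := Fin.ext e.symm
      rw [this]; exact hl0
    · apply hz
      · intro q; have := congrArg Fin.val q; simp at this
      · rintro (q | ⟨m, m1, m2, q⟩ | q)
        · have := nat_pair q; simp only [Fin.val_zero] at this; omega
        · have := nat_pair q; simp only [Fin.val_zero] at this; omega
        · have := nat_pair q; simp only [Fin.val_zero] at this; omega

lemma nb_gram_eq (hl : 2 ≤ l) (hD : IsTypeDTwo B P l αf) {t : ℕ} (ht : t ≤ l) :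
    B (nb l αf t) (nb l αf t) = if t = 0 ∨ t = l then 1 else 2 := by
  obtain ⟨hi, hr, h00, h11, hjj, h12, hj, hl0, hz⟩ := hD
  have e1 : (1 : Fin (l + 1)) = ⟨1, by omega⟩ := by
    apply Fin.ext
    exact Nat.mod_eq_of_lt (show 1 < l + 1 by omega)
  rcases ht.lt_or_eq with h1 | rfl
  · rw [nb_lt h1]
    split_ifs with e
    · obtain rfl : t = 0 := by omega
      rw [e1] at h11; exact h11
    · exact hjj _ (by simp only []; omega)
  · rw [nb_last, h00, if_pos (Or.inr rfl)]

lemma mkRD (hl : 2 ≤ l) (hE : IsEARS B R l 2) (hfs : IsFundamentalSet B R l P a) (hD : IsTypeDTwo B P l αf) :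
    RD l B a (nb l αf) where
  hl := hl
  symm := hE.symm
  ha v := by
    have : a ∈ nullSet B := hfs.2.1
    rw [hE.null_eq] at this
    have h2 : B a = 0 := LinearMap.mem_ker.mp this
    rw [h2]; rfl
  null v hv w := by
    have : v ∈ nullSet B := hv
    rw [hE.null_eq] at this
    have h2 : B v = 0 := LinearMap.mem_ker.mp this
    rw [hE.symm, h2]; rfl
  gram t ht u hu := by
    rcases lt_trichotomy t u with h | rfl | h
    · rw [nb_gram_lt hl hE.symm hD hu h]
      unfold gm
      rw [if_neg (show ¬ u = t by omega), if_neg (show ¬ u + 1 = t by omega)]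
      split_ifs <;> norm_num
    · rw [nb_gram_eq hl hD ht]
      unfold gm
      rw [if_pos rfl, if_neg (show ¬ t + 1 = t by omega), if_neg (show ¬ t = t + 1 by omega)]
      split_ifs <;> norm_num
    · rw [hE.symm, nb_gram_lt hl hE.symm hD ht h]
      unfold gm
      rw [if_neg (show ¬ u = t by omega), if_neg (show ¬ u = t + 1 by omega)]
      by_cases e : t = u + 1
      · rw [if_pos e, if_pos e.symm]; norm_num
      · rw [if_neg e, if_neg (fun h => e h.symm)]; norm_num
  indep n z h := by
    obtain ⟨-, -, ⟨c, -, -, -, hc⟩, -, hfin, hcard, -, -, hcard', hli, -⟩ := hfs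
    obtain ⟨hi, hr, -⟩ := hD
    have hinj : Set.InjOn (Submodule.span ℝ {a}).mkQ P :=
      Set.injOn_of_ncard_image_eq (hcard'.trans hcard.symm) hfin
    have hmem : ∀ i : Fin (l + 1), nb l αf i ∈ P := fun i => (nb_mem hr _).mpr ⟨i, by omega, rfl⟩
    let w : Fin (l + 1) → ↥((Submodule.span ℝ {a}).mkQ '' P) := fun i => ⟨_, Set.mem_image_of_mem _ (hmem i)⟩
    have hw : Function.Injective w := by
      intro i j hij
      exact Fin.ext (nb_inj hi (by omega) (by omega) (hinj (hmem i) (hmem j) (congrArg Subtype.val hij)))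
    have hli' := Fintype.linearIndependent_iff.mp (hli.comp w hw) (fun i => (n i : ℝ))
    have hn : ∀ i : Fin (l + 1), (n i : ℝ) = 0 := by
      apply hli'
      have h2 := congrArg (Submodule.span ℝ {a}).mkQ h
      rw [map_add, map_sum, map_zsmul, Finset.sum_range, map_zero] at h2
      have ha : (Submodule.span ℝ {a}).mkQ a = 0 :=
        (Submodule.Quotient.mk_eq_zero _).mpr (Submodule.mem_span_singleton_self a)
      rw [ha, smul_zero, add_zero] at h2
      rw [← h2]
      refine Finset.sum_congr rfl fun i _ => ?_
      rw [map_zsmul, Int.cast_smul_eq_zsmul]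
      rfl
    have hn' : ∀ t ≤ l, n t = 0 := fun t ht => by exact_mod_cast hn ⟨t, by omega⟩
    refine ⟨hn', ?_⟩
    rw [Finset.sum_eq_zero (fun t ht => by rw [hn' t (by have := Finset.mem_range.mp ht; omega), zero_smul]), zero_add] at h
    exact (hc z 0 (by rw [h, zero_smul, add_zero])).1

lemma mkFR (hl : 2 ≤ l) (hE : IsEARS B R l 2) (hfs : IsFundamentalSet B R l P a) (hD : IsTypeDTwo B P l αf)
    (hk1 : ∀ α ∈ P, k α = 1)
    (hg0 : g (αf 0) = true) (hgi : ∀ i : Fin (l + 1), i ≠ 0 → g (αf i) = false) :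
    FR l B P a k g (nb l αf) where
  D := mkRD hl hE hfs hD
  hP := nb_mem hD.2.1
  hk t ht := hk1 _ ((nb_mem hD.2.1 _).mpr ⟨t, ht, rfl⟩)
  hg t ht := by
    rcases ht.lt_or_eq with h1 | rfl
    · rw [nb_lt h1, hgi _ (by intro q; have := congrArg Fin.val q; simp at this), decide_eq_false h1.ne]
    · rw [nb_last, hg0, decide_eq_true rfl]

lemma toV_cst (b : ℕ → V) (p z : ℤ) : toV l a b (cst l p) z = p • ∑ t ∈ Finset.range (l + 1), b t + z • a := by
  unfold toV
  rw [Finset.smul_sum]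
  congr 1
  refine Finset.sum_congr rfl fun t ht => ?_
  rw [cst, if_pos (by have := Finset.mem_range.mp ht; omega)]

lemma delta_eq {b : ℕ → V} (Q : FR l B P a k g b) {δ : V} (hδ : IsDelta B P δ) :
    δ = ∑ t ∈ Finset.range (l + 1), b t := by
  classical
  obtain ⟨⟨s, hs, c, hc, hd⟩, hcl⟩ := hδ
  have D := Q.D
  have hl := D.hl
  have hinj : ∀ t ≤ l, ∀ u ≤ l, b t = b u → t = u := by
    intro t ht u hu h
    have h' : rt l a b t false true = rt l a b u false true := by rw [FR.rt_ft, FR.rt_ft, h]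
    exact (D.rt_inj ht hu h').1
  have hs' : s = (Finset.range (l + 1)).image b := by
    ext v
    rw [← Finset.mem_coe, hs, Q.hP, Finset.mem_image]
    constructor
    · rintro ⟨t, ht, rfl⟩; exact ⟨t, Finset.mem_range.mpr (by omega), rfl⟩
    · rintro ⟨t, ht, rfl⟩; exact ⟨t, by have := Finset.mem_range.mp ht; omega, rfl⟩
  have hd' : δ = ∑ t ∈ Finset.range (l + 1), (c (b t) : ℤ) • b t := by
    rw [hd, hs', Finset.sum_image]
    intro t ht u hu h
    have h1 := Finset.mem_range.mp (Finset.mem_coe.mp ht)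
    have h2 := Finset.mem_range.mp (Finset.mem_coe.mp hu)
    exact hinj t (by omega) u (by omega) h
  set d := ∑ t ∈ Finset.range (l + 1), b t with hdd
  have hdv : toV l a b (cst l 1) 0 = d := by rw [toV_cst, one_smul, zero_smul, add_zero]
  have h0 : ∀ t ≤ l, B (b t) d = 0 := by
    intro t ht
    have h1 := D.pair ht false true (cst l 1) 0
    rw [pq_cst ht hl, hdv, FR.rt_ft, D.gram t ht t ht] at h1
    have hne : (gm l t t : ℝ) ≠ 0 := by
      have : gm l t t ≠ 0 := by unfold gm; split_ifs <;> omega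
      exact_mod_cast this
    rw [Int.cast_zero, div_eq_zero_iff] at h1
    rcases h1 with h1 | h1
    · linarith
    · exact absurd h1 hne
  have hdd0 : B d d = 0 := by
    conv_lhs => rw [hdd]
    rw [map_sum]
    refine Finset.sum_eq_zero fun t ht => ?_
    rw [← hdd, D.symm]
    exact h0 t (by have := Finset.mem_range.mp ht; omega)
  have hdm : d ∈ AddSubgroup.closure ({δ} : Set V) := by
    have : d ∈ (AddSubgroup.closure P : Set V) ∩ nullSet B := by
      refine ⟨?_, hdd0⟩
      refine AddSubgroup.sum_mem _ fun t ht => AddSubgroup.subset_closure ?_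
      exact (Q.hP _).mpr ⟨t, by have := Finset.mem_range.mp ht; omega, rfl⟩
    rw [← hcl] at this
    exact this
  obtain ⟨m, hm⟩ := AddSubgroup.mem_closure_singleton.mp hdm
  have hrel := D.indep (fun t => m * (c (b t) : ℤ) - 1) 0 (by
    simp only [sub_smul, mul_smul, one_smul, Finset.sum_sub_distrib, zero_smul, add_zero]
    rw [← Finset.smul_sum, ← hd', hm, hdd, sub_self])
  have h1 : m * (c (b 0) : ℤ) - 1 = 0 := hrel.1 0 (by omega)
  have hm1 : m = 1 := by
    have hpos : 0 < c (b 0) := by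
      apply hc
      rw [← Finset.mem_coe, hs]
      exact (Q.hP _).mpr ⟨0, by omega, rfl⟩
    have hu : IsUnit m := IsUnit.of_mul_eq_one (c (b 0) : ℤ) (by linarith)
    rcases Int.isUnit_iff.mp hu with h | h
    · exact h
    · rw [h] at h1; omega
  rw [← hm, hm1, one_smul]

theorem final {b : ℕ → V} (Q : FR l B P a k g b) {δ : V} (hδ : IsDelta B P δ)
    {gr : V → Submodule ℂ (FR.EL B P a k g)} (hgr : IsEllGrading B R a P k g (fun _ _ => (1 : ℂ)) gr) (z : ℤ) :
    (∀ m : ℤ, ¬ (m = 0 ∧ z = 0) → Module.finrank ℂ (gr ((2 * m) • δ + z • a)) = if Odd m ∧ Even z then l else l + 1) ∧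
    (∀ p : ℤ, Odd p → Module.finrank ℂ (gr (p • δ + z • a)) = 1) := by
  have hgrp : ∀ p : ℤ, ((IsPres.toSys Q.D Q.pres (Q.grd hgr)).Gr (cst l p) z) = gr (p • δ + z • a) := by
    intro p
    have := IsPres.GG_eq Q.D Q.pres (Q.grd hgr) (n := cst l p) (fun t ht => if_neg (by omega)) z
    rw [toV_cst, ← delta_eq Q hδ] at this
    exact this
  have hrep : ∀ P' : ℤ, ¬ (P' = 0 ∧ z = 0) → Nonempty (Rep (IsPres.toSys Q.D Q.pres (Q.grd hgr)) P' z) := by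
    intro P' h
    obtain ⟨φ, hφ⟩ := Q.univ (model_pres Q.D h)
    exact ⟨⟨φ, fun t ht => hφ t ht _ _, fun t ht => hφ t ht _ _, fun t ht => hφ t ht _ _, fun t ht => hφ t ht _ _⟩⟩
  constructor
  · intro m hm
    obtain ⟨ρ⟩ := hrep (Nn l * m) (by
      rintro ⟨h1, h2⟩
      apply hm
      refine ⟨?_, h2⟩
      rcases mul_eq_zero.mp h1 with h | h
      · unfold Nn at h; omega
      · exact h)
    rw [← hgrp]
    exact ρ.dim_even hm rfl
  · intro p hp
    obtain ⟨ρ⟩ := hrep 1 (by simp)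
    rw [← hgrp]
    exact ρ.dim_odd hp
end
end
end Ell

/-- Isotropic root multiplicities of the elliptic Lie algebra of type
`D_{l+1}^{(2)}` with `k ≡ 1`, `g(α₀) = 2ℤ+1`, `g(α) = ∅` otherwise, and trivial tuning:
`dim 𝔤_{pδ+za} = l+1` if `p ≡ 0 (4)` and `(p,z) ≠ (0,0)`; `= 1` if `p` is odd;
`= l` if `p ≡ 2 (4)` and `z` is even; `= l+1` if `p ≡ 2 (4)` and `z` is odd. -/
theorem stmt18 {V : Type*} [AddCommGroup V] [Module ℝ V]
    (B : LinearMap.BilinForm ℝ V) (R : Set V) (l : ℕ) (hl : 2 ≤ l)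
    (hE : IsEARS B R l 2) (hred : IsReducedRS R)
    (P : Set V) (a : V) (hfs : IsFundamentalSet B R l P a)
    (k : V → ℕ) (g : V → Bool) (hkg : IsKG R a P k g)
    (αf : Fin (l + 1) → V) (hD : IsTypeDTwo B P l αf)
    (hk1 : ∀ α ∈ P, k α = 1)
    (hg0 : g (αf 0) = true) (hgi : ∀ i : Fin (l + 1), i ≠ 0 → g (αf i) = false)
    (δ : V) (hδ : IsDelta B P δ)
    (gr : V → Submodule ℂ (EllipticLieAlg B a P k g (fun _ _ => (1 : ℂ))))
    (hgr : IsEllGrading B R a P k g (fun _ _ => (1 : ℂ)) gr) :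
    ∀ p z : ℤ,
      ((p % 4 = 0 ∧ ¬(p = 0 ∧ z = 0)) →
        Module.finrank ℂ (gr (p • δ + z • a)) = l + 1) ∧
      (Odd p → Module.finrank ℂ (gr (p • δ + z • a)) = 1) ∧
      ((p % 4 = 2 ∧ Even z) → Module.finrank ℂ (gr (p • δ + z • a)) = l) ∧
      ((p % 4 = 2 ∧ Odd z) → Module.finrank ℂ (gr (p • δ + z • a)) = l + 1) := by
  intro p z
  obtain ⟨h1, h2⟩ := Ell.final (Ell.mkFR hl hE hfs hD hk1 hg0 hgi) hδ hgr z
  have h1' := h1 (p / 2)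
  refine ⟨?_, h2 p, ?_, ?_⟩
  · rintro ⟨h3, h4⟩
    rw [show 2 * (p / 2) = p by omega] at h1'
    rw [h1' (by omega), if_neg]
    rintro ⟨h5, -⟩
    rw [Int.odd_iff] at h5
    omega
  · rintro ⟨h3, h4⟩
    rw [show 2 * (p / 2) = p by omega] at h1'
    rw [h1' (by omega), if_pos]
    exact ⟨by rw [Int.odd_iff]; omega, h4⟩
  · rintro ⟨h3, h4⟩
    rw [show 2 * (p / 2) = p by omega] at h1'
    rw [h1' (by omega), if_neg]
    rintro ⟨-, h5⟩
    exact (Int.not_even_iff_odd.mpr h4) h5
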